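/- Let n ≥ 5 and let φ : A[B_n] → A[B_n] be a group endomorphism. Then there exists x ∈ A[B_n] such that conj_x ∘ φ is an endomorphism of type (1), of type (2a), of type (2b), or of type (3). -/

import Mathlib

/-- The defining relators of the Artin group of type `Bₙ`, as elements of the free
group on `n` generators (0-indexed: generator `i` corresponds to `r_{i+1}`). -/
def BnRels (n : ℕ) : Set (FreeGroup (Fin n)) :=
  {w | (∃ i j : Fin n, (i : ℕ) + 1 = (j : ℕ) ∧ (j : ℕ) + 1 < n ∧
          w = FreeGroup.of i * FreeGroup.of j * FreeGroup.of i *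
              (FreeGroup.of j * FreeGroup.of i * FreeGroup.of j)⁻¹) ∨
       (∃ i j : Fin n, (i : ℕ) + 2 = n ∧ (j : ℕ) + 1 = n ∧
          w = FreeGroup.of i * FreeGroup.of j * FreeGroup.of i * FreeGroup.of j *
              (FreeGroup.of j * FreeGroup.of i * FreeGroup.of j * FreeGroup.of i)⁻¹) ∨
       (∃ i j : Fin n, (i : ℕ) + 2 ≤ (j : ℕ) ∧
          w = FreeGroup.of i * FreeGroup.of j * (FreeGroup.of j * FreeGroup.of i)⁻¹)}

/-- The Artin group `A[Bₙ]` of type `Bₙ`. -/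
abbrev ArtinB (n : ℕ) := PresentedGroup (BnRels n)

/-- The standard generator `r_i` (1-indexed, `1 ≤ i ≤ n`). -/
def rB (n i : ℕ) : ArtinB n :=
  if h : i - 1 < n then PresentedGroup.of ⟨i - 1, h⟩ else 1

/-- `ρ_B = r_1 r_2 ⋯ r_n`. -/
def ρB (n : ℕ) : ArtinB n := ((List.range n).map fun i => rB n (i + 1)).prod

/-- `Δ_B = ρ_B ^ n`, the generator of the center. -/
def ΔB (n : ℕ) : ArtinB n := ρB n ^ n

/-- `t_i` for `i` read modulo `n`: `t_i = r_i` for `1 ≤ i ≤ n-1`,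
and `t_0 = ρ_B r_{n-1} ρ_B⁻¹`. -/
def tB (n i : ℕ) : ArtinB n :=
  if i % n = 0 then ρB n * rB n (n - 1) * (ρB n)⁻¹ else rB n (i % n)

/-- `Δ_Y = (t_1⋯t_{n-1})(t_1⋯t_{n-2})⋯(t_1t_2)t_1`, the Garside element of the
parabolic subgroup of type `A_{n-1}`. -/
def ΔY (n : ℕ) : ArtinB n :=
  ((List.range (n - 1)).map fun k =>
    ((List.range (n - 1 - k)).map fun i => rB n (i + 1)).prod).prod

/-- `ρ_0 = t_1 t_2 ⋯ t_{n-1}`. -/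
def ρ₀B (n : ℕ) : ArtinB n := ((List.range (n - 1)).map fun i => rB n (i + 1)).prod

/-- `ρ_1 = t_1⁻¹ t_2⁻¹ ⋯ t_{n-1}⁻¹`. -/
def ρ₁B (n : ℕ) : ArtinB n := ((List.range (n - 1)).map fun i => (rB n (i + 1))⁻¹).prod

/-- `ρ_k` for `k ∈ {0,1}`. -/
def ρkB (n k : ℕ) : ArtinB n := if k = 0 then ρ₀B n else ρ₁B n

/-- `v_k = ρ_k t_{n-1} ρ_k⁻¹` for `k ∈ {0,1}`. -/
def vB (n k : ℕ) : ArtinB n := ρkB n k * rB n (n - 1) * (ρkB n k)⁻¹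

/-- `δ = r_{n-1} r_{n-2} ⋯ r_2 r_1² r_2 ⋯ r_{n-2} r_{n-1}`. -/
def δB (n : ℕ) : ArtinB n :=
  ((List.range (n - 2)).map fun i => rB n (n - 1 - i)).prod * rB n 1 ^ 2 *
  ((List.range (n - 2)).map fun i => rB n (i + 2)).prod

/-- The quotient `Ā = A[Bₙ]/Z(A[Bₙ])`. -/
abbrev AbarB (n : ℕ) := ArtinB n ⧸ Subgroup.center (ArtinB n)

/-- The canonical projection `π : A[Bₙ] → Ā`. -/
def πB (n : ℕ) : ArtinB n →* AbarB n := QuotientGroup.mk' (Subgroup.center (ArtinB n))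

/-- `t̄_i = π(t_i)`. -/
def tbar (n i : ℕ) : AbarB n := πB n (tB n i)

/-- `ρ̄_B = π(ρ_B)`. -/
def ρbar (n : ℕ) : AbarB n := πB n (ρB n)

/-- The composition `conj_x ∘ φ` of an endomorphism with an inner automorphism. -/
def conjComp {G : Type*} [Group G] (x : G) (φ : G →* G) : G →* G :=
  (MulAut.conj x).toMonoidHom.comp φ

/-- Type (1): there are commuting `g, h` with `φ(t_i) = g` for all `0 ≤ i ≤ n-1`
and `φ(ρ_B) = h`. -/
def IsType1 (n : ℕ) (φ : ArtinB n →* ArtinB n) : Prop :=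
  ∃ g h : ArtinB n, g * h = h * g ∧ (∀ i < n, φ (tB n i) = g) ∧ φ (ρB n) = h

/-- Type (2a) with parameters `ε ∈ {1,-1}`, `p q : ℤ`. -/
def IsType2a (n : ℕ) (ε p q : ℤ) (φ : ArtinB n →* ArtinB n) : Prop :=
  (ε = 1 ∨ ε = -1) ∧ (∀ i < n, φ (tB n i) = tB n i ^ ε * ΔB n ^ p) ∧
    φ (ρB n) = ρB n * ΔB n ^ q

/-- Type (2b) with parameters `ε ∈ {1,-1}`, `p q : ℤ`. -/
def IsType2b (n : ℕ) (ε p q : ℤ) (φ : ArtinB n →* ArtinB n) : Prop :=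
  (ε = 1 ∨ ε = -1) ∧ (∀ i < n, φ (tB n i) = tB n (n - i) ^ ε * ΔB n ^ p) ∧
    φ (ρB n) = (ρB n)⁻¹ * ΔB n ^ q

/-- Type (3) with parameters `ε ∈ {1,-1}`, `k ∈ {0,1}`, `p q r s : ℤ`. -/
def IsType3 (n : ℕ) (ε : ℤ) (k : ℕ) (p q r s : ℤ) (φ : ArtinB n →* ArtinB n) : Prop :=
  (ε = 1 ∨ ε = -1) ∧ (k = 0 ∨ k = 1) ∧
    (∀ i, 1 ≤ i → i ≤ n - 1 → φ (tB n i) = tB n i ^ ε * ΔY n ^ (2 * p) * ΔB n ^ q) ∧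
    φ (tB n 0) = vB n k ^ ε * ΔY n ^ (2 * p) * ΔB n ^ q ∧
    φ (ρB n) = ρkB n k * ΔY n ^ (2 * r) * ΔB n ^ s

namespace Braid

open Equiv.Perm (mul_apply one_apply)
open Multiplicative (ofAdd toAdd)
open SemidirectProduct (mul_right right_inr right_inl inl_injective rightHom rightHom_eq_right
  inv_right inl_left_mul_inr_right)
open List (isChain_append isChain_cons_cons isChain_singleton isChain_pair isChain_nil cons_append
  exists_cons_of_ne_nil eq_nil_or_concat concat_eq_append IsChain.cons_cons)
open DFunLike (congr_fun)
open Function (Injective)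
open MonoidHom (comp_apply id_apply)
open _root_.FreeGroup (lift_apply_of)
open Subgroup (zpowers mem_comap mem_zpowers_iff mem_centralizer_singleton_iff coe_mul)
open MulAction (stabilizer)

section

open FreeGroup in
/-- The relators of the braid group on `m` strands, on generators indexed by `ℕ`;
the generators with index at least `m - 1` are killed. -/
def relators (m : ℕ) : Set (FreeGroup ℕ) :=
  {w | (∃ i, i + 2 < m ∧ w = of i * of (i + 1) * of i * (of (i + 1) * of i * of (i + 1))⁻¹) ∨
       (∃ i j, i + 2 ≤ j ∧ j + 1 < m ∧ w = of i * of j * (of j * of i)⁻¹) ∨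
       (∃ i, m ≤ i + 1 ∧ w = of i)}

/-- The braid group on `m` strands. -/
abbrev Br (m : ℕ) := PresentedGroup (relators m)

/-- The standard generators of the braid group (trivial for `m ≤ i + 1`). -/
def σ (m i : ℕ) : Br m := PresentedGroup.of i

lemma σ_eq_one {m i : ℕ} (h : m ≤ i + 1 := by omega) : σ m i = 1 :=
  PresentedGroup.one_of_mem (Or.inr (Or.inr ⟨i, h, rfl⟩))

lemma σ_braid {m i : ℕ} (h : i + 2 < m := by omega) :
    σ m i * σ m (i + 1) * σ m i = σ m (i + 1) * σ m i * σ m (i + 1) :=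
  PresentedGroup.mk_eq_mk_of_mul_inv_mem (Or.inl ⟨i, h, rfl⟩)

lemma σ_comm {m i j : ℕ} (h : i + 2 ≤ j := by omega) : Commute (σ m i) (σ m j) := by
  by_cases hj : j + 1 < m
  · exact PresentedGroup.mk_eq_mk_of_mul_inv_mem (Or.inr (Or.inl ⟨i, j, h, hj, rfl⟩))
  · rw [σ_eq_one (i := j)]
    exact Commute.one_right _

section lift
variable {G : Type*} [Group G] {m : ℕ} (s : ℕ → G)
  (hb : ∀ i, i + 2 < m → s i * s (i + 1) * s i = s (i + 1) * s i * s (i + 1))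
  (hc : ∀ i j, i + 2 ≤ j → j + 1 < m → s i * s j = s j * s i)

/-- The universal property of the braid group. -/
def Br.lift : Br m →* G :=
  PresentedGroup.toGroup (f := fun i => if i + 1 < m then s i else 1) (by
    rintro r (⟨i, hi, rfl⟩ | ⟨i, j, hij, hj, rfl⟩ | ⟨i, hi, rfl⟩)
    · simp only [map_mul, map_inv, lift_apply_of]
      rw [if_pos (by omega), if_pos (by omega), hb i hi, mul_inv_cancel]
    · simp only [map_mul, map_inv, lift_apply_of]
      rw [if_pos (by omega), if_pos (by omega), hc i j hij hj, mul_inv_cancel]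
    · simp only [lift_apply_of]
      rw [if_neg (by omega)])

lemma Br.lift_σ {i : ℕ} (h : i + 1 < m := by omega) : Br.lift s hb hc (σ m i) = s i :=
  (PresentedGroup.toGroup.of _).trans (if_pos h)

end lift

lemma Br.mem_of_gens {m : ℕ} (K : Subgroup (Br m)) (h : ∀ i, i + 1 < m → σ m i ∈ K)
    (b : Br m) : b ∈ K := by
  have : Subgroup.closure (Set.range PresentedGroup.of) ≤ K := by
    rw [Subgroup.closure_le]
    rintro _ ⟨i, rfl⟩
    by_cases hi : i + 1 < m
    · exact h i hi
    · have := σ_eq_one (m := m) (i := i)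
      rw [σ] at this
      rw [this]
      exact K.one_mem
  rw [PresentedGroup.closure_range_of] at this
  exact this trivial

/-- Equivariance with respect to the generators implies equivariance. -/
lemma Br.equivariant {m : ℕ} {X Y : Type*} (A : Br m →* Equiv.Perm X) (E : Br m → Y → Y) (f : X → Y)
    {p : X → Prop} (hp : ∀ b {u}, p u → p (A b u))
    (h : ∀ i, i + 1 < m → ∀ u, p u → f (A (σ m i) u) = E (σ m i) (f u)) (b : Br m) {u : X}
    (hu : p u) (E1 : ∀ u, E 1 u = u := by simp)
    (E2 : ∀ a b u, E (a * b) u = E a (E b u) := by simp [mul_assoc]) :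
    f (A b u) = E b (f u) :=
  Br.mem_of_gens
    { carrier := {b | ∀ u, p u → f (A b u) = E b (f u)}
      one_mem' := fun u _ => by rw [map_one, E1]; rfl
      mul_mem' := fun {a b} ha hb u hu => by
        rw [map_mul, mul_apply, ha _ (hp _ hu), hb _ hu, E2]
      inv_mem' := fun {a} ha u hu => by
        rw [← E1 (f (A a⁻¹ u)), ← inv_mul_cancel a, E2, ← ha _ (hp _ hu), ← mul_apply, ← map_mul,
          mul_inv_cancel, map_one]; rfl } h b u hu

lemma Br.aut_equivariant {m : ℕ} {N Y : Type*} [Group N] (A : Br m →* MulAut N) (E : Br m → Y → Y)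
    (f : N → Y) (h : ∀ i, i + 1 < m → ∀ u, f (A (σ m i) u) = E (σ m i) (f u)) (b : Br m) (u : N)
    (E1 : ∀ u, E 1 u = u := by simp)
    (E2 : ∀ a b u, E (a * b) u = E a (E b u) := by simp [mul_assoc]) : f (A b u) = E b (f u) :=
  Br.equivariant ((MulAut.toPerm N).comp A) E f (p := fun _ => True) (fun _ _ _ => trivial)
    (fun i hi u _ => h i hi u) b trivial E1 E2

lemma Br.hom_ext {M : Type*} [Group M] {m : ℕ} {f g : Br m →* M}
    (h : ∀ i, i + 1 < m → f (σ m i) = g (σ m i)) : f = g :=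
  MonoidHom.ext fun b => Br.mem_of_gens (f.eqLocus g) h b

lemma Br.commute_of_gens {m : ℕ} {G : Type*} [Group G] (f : Br m →* G) (x : G)
    (h : ∀ i, i + 1 < m → Commute (f (σ m i)) x) (b : Br m) : Commute (f b) x := by
  have := Br.mem_of_gens ((Subgroup.centralizer {x}).comap f) (fun i hi => by
    rw [mem_comap, mem_centralizer_singleton_iff]
    exact (h i hi)) b
  rw [mem_comap, mem_centralizer_singleton_iff] at this
  exact this

/-! ### The underlying permutation -/

open Equiv in
lemma swap_braid (i : ℕ) : swap i (i + 1) * swap (i + 1) (i + 1 + 1) * swap i (i + 1) =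
    swap (i + 1) (i + 1 + 1) * swap i (i + 1) * swap (i + 1) (i + 1 + 1) := by
  ext k
  simp only [Perm.coe_mul, Function.comp_apply, swap_apply_def]
  grind

open Equiv in
lemma swap_comm_of_le {i j : ℕ} (h : i + 2 ≤ j) :
    swap i (i + 1) * swap j (j + 1) = swap j (j + 1) * swap i (i + 1) := by
  ext k
  simp only [Perm.coe_mul, Function.comp_apply, swap_apply_def]
  grind

/-- The permutation of a braid. -/
def perm (m : ℕ) : Br m →* Equiv.Perm ℕ :=
  Br.lift (fun i => Equiv.swap i (i + 1)) (fun i _ => swap_braid i)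
    (fun _ _ h _ => swap_comm_of_le h)

lemma perm_σ {m i : ℕ} (h : i + 1 < m := by omega) : perm m (σ m i) = Equiv.swap i (i + 1) :=
  Br.lift_σ _ _ _ h

lemma perm_of_le {m p : ℕ} (hp : m ≤ p) (b : Br m) : perm m b p = p := by
  have := Br.mem_of_gens ((stabilizer (Equiv.Perm ℕ) p).comap (perm m))
    (fun i hi => by
      rw [mem_comap, perm_σ hi, MulAction.mem_stabilizer_iff]
      exact Equiv.swap_apply_of_ne_of_ne (by omega) (by omega)) b
  exact this

lemma perm_lt {m p : ℕ} (hp : p < m) (b : Br m) : perm m b p < m := by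
  by_contra h
  have h1 := perm_of_le (not_lt.1 h) b
  have := (perm m b).injective h1
  omega

/-! ### Free groups and the Artin action -/

/-- The free group of rank `m`. -/
abbrev F (m : ℕ) := FreeGroup (Fin m)

/-- The generators of the free group (trivial for `m ≤ i`). -/
def x (m i : ℕ) : F m := if h : i < m then FreeGroup.of ⟨i, h⟩ else 1

lemma x_of_lt {m i : ℕ} (h : i < m) : x m i = FreeGroup.of ⟨i, h⟩ := dif_pos h

lemma x_eq_one {m i : ℕ} (h : m ≤ i := by omega) : x m i = 1 := dif_neg (by omega)

/-- The universal property of the free group. -/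
def F.lift {G : Type*} [Group G] (m : ℕ) (s : ℕ → G) : F m →* G :=
  FreeGroup.lift fun i => s i

lemma F.lift_x {G : Type*} [Group G] {m i : ℕ} (s : ℕ → G) (h : i < m := by omega) :
    F.lift m s (x m i) = s i := by
  rw [x_of_lt h]; exact lift_apply_of

lemma F.mem_of_gens {m : ℕ} (K : Subgroup (F m)) (h : ∀ i, i < m → x m i ∈ K)
    (b : F m) : b ∈ K := by
  have : Subgroup.closure (Set.range FreeGroup.of) ≤ K := by
    rw [Subgroup.closure_le]
    rintro _ ⟨i, rfl⟩
    have := h i i.2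
    rwa [x_of_lt i.2] at this
  rw [FreeGroup.closure_range_of] at this
  exact this trivial

lemma F.hom_ext {M : Type*} [Group M] {m : ℕ} {f g : F m →* M}
    (h : ∀ i, i < m → f (x m i) = g (x m i)) : f = g :=
  MonoidHom.ext fun b => F.mem_of_gens (f.eqLocus g) h b

/-- The endomorphism of the free group attached to `σ i`. -/
def actFun (m i : ℕ) : F m →* F m :=
  F.lift m fun j => if j = i then (x m i)⁻¹ * x m (i + 1) * x m i else
    if j = i + 1 then x m i else x m j

/-- The inverse of `actFun`. -/
def actInv (m i : ℕ) : F m →* F m :=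
  F.lift m fun j => if j = i then x m (i + 1) else
    if j = i + 1 then x m (i + 1) * x m i * (x m (i + 1))⁻¹ else x m j

section
variable {m i j : ℕ}

lemma actFun_self (h : i + 1 < m) : actFun m i (x m i) = (x m i)⁻¹ * x m (i + 1) * x m i := by
  rw [actFun, F.lift_x _, if_pos rfl]

lemma actFun_succ (h : i + 1 < m) : actFun m i (x m (i + 1)) = x m i := by
  rw [actFun, F.lift_x _, if_neg (by omega), if_pos rfl]

lemma actFun_of_ne (h : j ≠ i) (h' : j ≠ i + 1) : actFun m i (x m j) = x m j := by
  by_cases hj : j < m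
  · rw [actFun, F.lift_x _, if_neg (by omega), if_neg (by omega)]
  · rw [x_eq_one, map_one]

lemma actInv_self (h : i + 1 < m) : actInv m i (x m i) = x m (i + 1) := by
  rw [actInv, F.lift_x _, if_pos rfl]

lemma actInv_succ (h : i + 1 < m) :
    actInv m i (x m (i + 1)) = x m (i + 1) * x m i * (x m (i + 1))⁻¹ := by
  rw [actInv, F.lift_x _, if_neg (by omega), if_pos rfl]

lemma actInv_of_ne (h : j ≠ i) (h' : j ≠ i + 1) : actInv m i (x m j) = x m j := by
  by_cases hj : j < m
  · rw [actInv, F.lift_x _, if_neg (by omega), if_neg (by omega)]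
  · rw [x_eq_one, map_one]

end

/-- The automorphism of the free group attached to `σ i`. -/
def actAut (m i : ℕ) (h : i + 1 < m) : MulAut (F m) :=
  MonoidHom.toMulEquiv (actFun m i) (actInv m i)
    (F.hom_ext fun j _ => by
      rw [comp_apply, id_apply]
      obtain rfl | rfl | h1 : j = i ∨ j = i + 1 ∨ (j ≠ i ∧ j ≠ i + 1) := by omega
      · simp only [actFun_self h, map_mul, map_inv, actInv_self h, actInv_succ h]
        group
      · rw [actFun_succ h, actInv_self h]
      · rw [actFun_of_ne h1.1 h1.2, actInv_of_ne h1.1 h1.2])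
    (F.hom_ext fun j _ => by
      rw [comp_apply, id_apply]
      obtain rfl | rfl | h1 : j = i ∨ j = i + 1 ∨ (j ≠ i ∧ j ≠ i + 1) := by omega
      · rw [actInv_self h, actFun_succ h]
      · simp only [actInv_succ h, map_mul, map_inv, actFun_self h, actFun_succ h]
        group
      · rw [actInv_of_ne h1.1 h1.2, actFun_of_ne h1.1 h1.2])

lemma mulAut_ext {m : ℕ} {f g : MulAut (F m)} (h : ∀ i, i < m → f (x m i) = g (x m i)) :
    f = g := by
  have := F.hom_ext (f := f.toMonoidHom) (g := g.toMonoidHom) h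
  ext a
  exact congr_fun this a

/-- The Artin action of the braid group on the free group. -/
def act (m : ℕ) : Br m →* MulAut (F m) :=
  Br.lift (fun i => if h : i + 1 < m then actAut m i h else 1)
    (fun i hi => by
      rw [dif_pos (by omega), dif_pos (by omega)]
      refine mulAut_ext fun j _ => ?_
      change actFun m i (actFun m (i + 1) (actFun m i (x m j))) =
        actFun m (i + 1) (actFun m i (actFun m (i + 1) (x m j)))
      obtain h | h : j = i ∨ j ≠ i := by omega
      · simp (disch := omega) only [h, actFun_self, actFun_succ, actFun_of_ne, map_mul, map_inv]
        group
      obtain rfl | rfl | h' : j = i + 1 ∨ j = i + 1 + 1 ∨ (j ≠ i + 1 ∧ j ≠ i + 1 + 1) := by omega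
      all_goals simp (disch := omega) only [actFun_self, actFun_succ, actFun_of_ne, map_mul, map_inv])
    (fun i j hij hj => by
      rw [dif_pos (by omega), dif_pos (by omega)]
      refine mulAut_ext fun k _ => ?_
      change actFun m i (actFun m j (x m k)) = actFun m j (actFun m i (x m k))
      obtain rfl | rfl | rfl | rfl | h :
        k = i ∨ k = i + 1 ∨ k = j ∨ k = j + 1 ∨ (k ≠ i ∧ k ≠ i + 1 ∧ k ≠ j ∧ k ≠ j + 1) := by omega
      all_goals simp (disch := omega) only [actFun_self, actFun_succ, actFun_of_ne, map_mul, map_inv])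

section
variable {m i j : ℕ}

lemma act_σ (h : i + 1 < m) (v : F m) : act m (σ m i) v = actFun m i v := by
  rw [act, Br.lift_σ _ _ _ h, dif_pos h]; rfl

lemma act_σ_self (h : i + 1 < m := by omega) :
    act m (σ m i) (x m i) = (x m i)⁻¹ * x m (i + 1) * x m i := by
  rw [act_σ h, actFun_self h]

lemma act_σ_succ (h : i + 1 < m := by omega) : act m (σ m i) (x m (i + 1)) = x m i := by
  rw [act_σ h, actFun_succ h]

lemma act_σ_of_ne (h : j ≠ i := by omega) (h' : j ≠ i + 1 := by omega) : act m (σ m i) (x m j) = x m j := by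
  by_cases hi : i + 1 < m
  · rw [act_σ hi, actFun_of_ne h h']
  · rw [σ_eq_one, map_one]; rfl

end

/-- The semidirect product of the free group and the braid group. -/
abbrev AG (m : ℕ) := F m ⋊[act m] Br m

/-- The inclusion of the free group. -/
abbrev fr {m : ℕ} : F m →* AG m := SemidirectProduct.inl

/-- The inclusion of the braid group. -/
abbrev br {m : ℕ} : Br m →* AG m := SemidirectProduct.inr

lemma br_conj {m : ℕ} (b : Br m) (v : F m) : br b * fr v * (br b)⁻¹ = fr (act m b v) := by
  rw [← map_inv]; exact (SemidirectProduct.inl_aut b v).symm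

lemma br_mul_fr {m : ℕ} (b : Br m) (v : F m) : br b * fr v = fr (act m b v) * br b := by
  rw [← br_conj, inv_mul_cancel_right]

/-! ### The universal property of `AG m` -/

section lift
variable {Γ : Type*} [Group Γ] (m : ℕ) (s : ℕ → Γ) (q : Γ)

/-- The product `s j * s (j+1) * ⋯ * s (m - 2)`. -/
def tailProd (j : ℕ) : Γ := ((List.range' j (m - 1 - j)).map s).prod

/-- The images of the free generators. -/
def xImg (j : ℕ) : Γ := tailProd m s j * q * (tailProd m s j)⁻¹

lemma tailProd_of_lt {j : ℕ} (h : j + 1 < m) :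
    tailProd m s j = s j * tailProd m s (j + 1) := by
  rw [tailProd, tailProd, show m - 1 - j = (m - 1 - (j + 1)) + 1 by omega, List.range'_succ]
  simp

lemma tailProd_of_le {j : ℕ} (h : m ≤ j + 1) : tailProd m s j = 1 := by
  rw [tailProd, show m - 1 - j = 0 by omega]
  simp

lemma xImg_of_lt {j : ℕ} (h : j + 1 < m := by omega) :
    xImg m s q j = s j * xImg m s q (j + 1) * (s j)⁻¹ := by
  rw [xImg, xImg, tailProd_of_lt m s h]; group

lemma xImg_of_le {j : ℕ} (h : m ≤ j + 1 := by omega) : xImg m s q j = q := by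
  rw [xImg, tailProd_of_le m s h]; group

variable {m s q}
variable (hb : ∀ i, i + 2 < m → s i * s (i + 1) * s i = s (i + 1) * s i * s (i + 1))
  (hc : ∀ i j, i + 2 ≤ j → j + 1 < m → s i * s j = s j * s i)
  (hq : ∀ i, i + 2 < m → s i * q = q * s i)
  (hsq : 2 ≤ m → s (m - 2) * q * s (m - 2) * q = q * s (m - 2) * q * s (m - 2))

include hc hq in
lemma commute_s_xImg_of_lt {i : ℕ} (k j : ℕ) (h : i + 2 ≤ j := by omega) (hjk : m ≤ j + k + 1 := by omega)
    (hj : j < m := by omega) : Commute (s i) (xImg m s q j) := by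
  induction k generalizing j with
  | zero =>
    rw [xImg_of_le m s q]
    exact hq i (by omega)
  | succ k ih =>
    by_cases hjm : j + 1 < m
    · rw [xImg_of_lt m s q hjm]
      have h1 : Commute (s i) (s j) := hc i j h hjm
      exact (h1.mul_right (ih (j + 1) (by omega) (by omega) (by omega))).mul_right h1.inv_right
    · rw [xImg_of_le m s q]
      exact hq i (by omega)

include hb hc hq in
lemma commute_s_xImg_of_gt {i : ℕ} (k j : ℕ) (h : j + k + 1 = i) (hi : i + 1 < m) :
    Commute (s i) (xImg m s q j) := by
  induction k generalizing j with
  | zero =>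
    obtain rfl : i = j + 1 := by omega
    rw [xImg_of_lt m s q (j := j), xImg_of_lt m s q]
    have h1 : Commute (s j) (xImg m s q (j + 1 + 1)) :=
      commute_s_xImg_of_lt hc hq m _
    have h2 := hb j (by omega)
    have e : s j * (s (j + 1) * xImg m s q (j + 1 + 1) * (s (j + 1))⁻¹) * (s j)⁻¹ =
      (s j * s (j + 1)) * xImg m s q (j + 1 + 1) * (s j * s (j + 1))⁻¹ := by group
    rw [e]
    have h3 : SemiconjBy (s j * s (j + 1)) (s j) (s (j + 1)) := by
      rw [SemiconjBy, h2, mul_assoc]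
    have h4 := h1.map (MulAut.conj (s j * s (j + 1)))
    simpa only [MulAut.conj_apply, h3.eq, mul_inv_cancel_right] using h4
  | succ k ih =>
    rw [xImg_of_lt m s q]
    have h1 : Commute (s i) (s j) := (hc j i (by omega) hi).symm
    exact (h1.mul_right (ih (j + 1) (by omega))).mul_right h1.inv_right

lemma artin_conj (g : Γ) {y a : Γ} (h : y * a * y * a = a * y * a * y) :
    (g * y * g⁻¹) * (g * a * g⁻¹) * (g * y * g⁻¹) * (g * a * g⁻¹) =
      (g * a * g⁻¹) * (g * y * g⁻¹) * (g * a * g⁻¹) * (g * y * g⁻¹) := by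
  have : g * (y * a * y * a) * g⁻¹ = g * (a * y * a * y) * g⁻¹ := by rw [h]
  simpa [mul_assoc] using this

include hb hc hq hsq in
lemma xImg_artin (k i : ℕ) (h : i + k + 2 = m) :
    xImg m s q (i + 1) * s i * xImg m s q (i + 1) * s i =
      s i * xImg m s q (i + 1) * s i * xImg m s q (i + 1) := by
  induction k generalizing i with
  | zero =>
    rw [xImg_of_le m s q]
    obtain rfl : i = m - 2 := by omega
    exact (hsq (by omega)).symm
  | succ k ih =>
    rw [xImg_of_lt m s q]
    have h1 := ih (i + 1) (by omega)
    have h2 : Commute (s i) (xImg m s q (i + 1 + 1)) :=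
      commute_s_xImg_of_lt hc hq m _
    have h3 : (s (i + 1) * s i) * s (i + 1) * (s (i + 1) * s i)⁻¹ = s i := by
      rw [mul_inv_eq_iff_eq_mul, ← mul_assoc, hb i (by omega)]
    have h4 : s (i + 1) * xImg m s q (i + 1 + 1) * (s (i + 1))⁻¹ =
        (s (i + 1) * s i) * xImg m s q (i + 1 + 1) * (s (i + 1) * s i)⁻¹ := by
      rw [mul_assoc (s (i + 1)) (s i), h2.eq]; group
    have := artin_conj (s (i + 1) * s i) h1
    rwa [h3, ← h4] at this

include hb hc hq hsq in
lemma xImg_act {i j : ℕ} (hi : i + 1 < m) (hj : j < m) :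
    F.lift m (xImg m s q) (act m (σ m i) (x m j)) = s i * xImg m s q j * (s i)⁻¹ := by
  by_cases h1 : j = i
  · subst h1
    rw [act_σ_self hi]
    simp only [map_mul, map_inv, F.lift_x _ hj, F.lift_x _ hi]
    have := xImg_artin hb hc hq hsq (m - j - 2) j (by omega)
    rw [xImg_of_lt m s q hi]
    generalize xImg m s q (j + 1) = y at *
    generalize s j = a at *
    have h4 : (a * y * a⁻¹)⁻¹ * y * (a * y * a⁻¹) = (a * y⁻¹ * a⁻¹) * (y * a * y * a) * a⁻¹ * a⁻¹ := by
      group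
    rw [h4, this]; group
  by_cases h2 : j = i + 1
  · subst h2
    rw [act_σ_succ hi, F.lift_x _, xImg_of_lt m s q hi]
  · rw [act_σ_of_ne h1 h2, F.lift_x _ hj, eq_mul_inv_iff_mul_eq]
    by_cases h3 : j < i
    · exact (commute_s_xImg_of_gt hb hc hq (i - j - 1) j (by omega) hi).symm
    · exact (commute_s_xImg_of_lt hc hq m j (by omega) (by omega) hj).symm

/-- The universal property of `AG m`, an Artin group of type `B`. -/
def AG.lift : AG m →* Γ :=
  SemidirectProduct.lift (F.lift m (xImg m s q)) (Br.lift s hb hc) (by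
    intro b
    have hT (v) := Br.aut_equivariant (act m)
      (fun b g => Br.lift s hb hc b * g * (Br.lift s hb hc b)⁻¹) (F.lift m (xImg m s q)) (fun i hi v => by
        rw [Br.lift_σ _ _ _ hi]
        exact congr_fun (F.hom_ext (f := (F.lift m (xImg m s q)).comp (act m (σ m i)).toMonoidHom)
          (g := (MulAut.conj (s i)).toMonoidHom.comp (F.lift m (xImg m s q))) fun j hj => by
            change F.lift m (xImg m s q) (act m (σ m i) (x m j)) =
              s i * F.lift m (xImg m s q) (x m j) * (s i)⁻¹
            rw [xImg_act hb hc hq hsq hi hj, F.lift_x _ hj]) v)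
      b v
    ext1 v
    exact hT (FreeGroup.of v))

lemma AG.lift_br {i : ℕ} (h : i + 1 < m) : AG.lift hb hc hq hsq (br (σ m i)) = s i := by
  rw [AG.lift, SemidirectProduct.lift_inr, Br.lift_σ _ _ _ h]

lemma AG.lift_fr {j : ℕ} (h : j < m) :
    AG.lift hb hc hq hsq (fr (x m j)) = xImg m s q j := by
  rw [AG.lift, SemidirectProduct.lift_inl, F.lift_x _ h]

end lift

lemma AG.conj_x {m i : ℕ} (h : i + 1 < m) :
    (fr (x m i) : AG m) = br (σ m i) * fr (x m (i + 1)) * (br (σ m i))⁻¹ := by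
  rw [br_conj, act_σ_succ h]

lemma AG.mem_of_gens {m : ℕ} (K : Subgroup (AG m)) (h1 : fr (x m (m - 1)) ∈ K)
    (h2 : ∀ i, i + 1 < m → br (σ m i) ∈ K) (g : AG m) : g ∈ K := by
  have h3 : ∀ b, br b ∈ K := fun b => Br.mem_of_gens (K.comap br) h2 b
  have key : ∀ k i, i + k + 1 = m → fr (x m i) ∈ K := by
    intro k
    induction k with
    | zero => intro i hi; obtain rfl : i = m - 1 := by omega
              exact h1
    | succ k ih =>
      intro i hi
      rw [AG.conj_x (by omega)]
      exact K.mul_mem (K.mul_mem (h3 _) (ih (i + 1) (by omega))) (K.inv_mem (h3 _))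
  have h4 : ∀ v, fr v ∈ K := fun v =>
    F.mem_of_gens (K.comap fr) (fun i hi => key (m - 1 - i) i (by omega)) v
  rw [← inl_left_mul_inr_right g]
  exact K.mul_mem (h4 _) (h3 _)

/-- A homomorphism out of `AG m` is determined by its values on the standard generators. -/
lemma AG.hom_ext' {M : Type*} [Group M] {m : ℕ} {f g : AG m →* M}
    (h1 : f (fr (x m (m - 1))) = g (fr (x m (m - 1))))
    (h2 : ∀ i, i + 1 < m → f (br (σ m i)) = g (br (σ m i))) : f = g :=
  MonoidHom.ext fun b => AG.mem_of_gens (f.eqLocus g) h1 h2 b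

end

/-! ### The rotation element and the centre of the braid group -/

/-- The product `σ 0 * ⋯ * σ (k - 1)`. -/
def dl (m : ℕ) : ℕ → Br m
  | 0 => 1
  | k + 1 => dl m k * σ m k

/-- The rotation `σ 0 * ⋯ * σ (m - 2)`. -/
def δ (m : ℕ) : Br m := dl m (m - 1)

/-- The full twist. -/
def ζ (m : ℕ) : Br m := δ m ^ m

lemma dl_commute {m k i : ℕ} (h : k + 1 ≤ i) : Commute (dl m k) (σ m i) := by
  induction k with
  | zero => exact Commute.one_left _
  | succ k ih => exact (ih (by omega)).mul_left (σ_comm)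

lemma dl_σ {m k i : ℕ} (h : i + 2 ≤ k) (hk : k < m) :
    dl m k * σ m i = σ m (i + 1) * dl m k := by
  induction k, h using Nat.le_induction with
  | base =>
    change dl m i * σ m i * σ m (i + 1) * σ m i = σ m (i + 1) * (dl m i * σ m i * σ m (i + 1))
    rw [mul_assoc (dl m i), mul_assoc (dl m i), σ_braid, ← mul_assoc, ← mul_assoc,
      (dl_commute (by omega)).eq]
    simp only [mul_assoc]
  | succ k hk' ih =>
    change dl m k * σ m k * σ m i = σ m (i + 1) * (dl m k * σ m k)
    rw [mul_assoc, ← (σ_comm (m := m) (i := i) (j := k)).eq, ← mul_assoc,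
      ih (by omega), mul_assoc]

lemma δ_σ {m i : ℕ} (h : i + 2 < m := by omega) : δ m * σ m i = σ m (i + 1) * δ m :=
  dl_σ (by omega) (by omega)

lemma δ_dl {m k : ℕ} (h : k + 1 < m) : σ m 0 * (δ m * dl m k) = dl m (k + 1) * δ m := by
  induction k with
  | zero => simp [dl]
  | succ k ih =>
    change σ m 0 * (δ m * (dl m k * σ m k)) = dl m (k + 1) * σ m (k + 1) * δ m
    rw [mul_assoc (dl m (k + 1)), ← δ_σ, ← mul_assoc (dl m (k + 1)), ← ih (by omega)]
    simp only [mul_assoc]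

lemma δ_sq_σ_last {m : ℕ} (h : 2 ≤ m := by omega) : δ m ^ 2 * σ m (m - 2) = σ m 0 * δ m ^ 2 := by
  obtain ⟨k, rfl⟩ : ∃ k, m = k + 2 := ⟨m - 2, by omega⟩
  have h1 := δ_dl (m := k + 2) (k := k) (by omega)
  have h2 : δ (k + 2) = dl (k + 2) k * σ (k + 2) k := rfl
  have h3 : δ (k + 2) * δ (k + 2) = σ (k + 2) 0 * (δ (k + 2) * dl (k + 2) k) := by
    rw [h1]; rfl
  rw [pow_two, show k + 2 - 2 = k by omega]
  nth_rewrite 1 [h3]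
  rw [mul_assoc, mul_assoc, ← h2]

lemma δ_pow_σ {m i j : ℕ} (h : i + j + 1 < m := by omega) : δ m ^ j * σ m i = σ m (i + j) * δ m ^ j := by
  induction j with
  | zero => simp
  | succ j ih =>
    rw [pow_succ', mul_assoc, ih (by omega), ← mul_assoc, δ_σ, mul_assoc]
    rfl

lemma δ_pow_conj {m i j : ℕ} (h : i + j + 1 < m := by omega) :
    δ m ^ j * σ m i * (δ m ^ j)⁻¹ = σ m (i + j) := by
  rw [δ_pow_σ h, mul_inv_cancel_right]

lemma ζ_commute_σ (m i : ℕ) : Commute (ζ m) (σ m i) := by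
  by_cases h : i + 1 < m
  · have h1 : ζ m = δ m ^ i * δ m ^ 2 * δ m ^ (m - 2 - i) := by
      rw [← pow_add, ← pow_add, ζ]; congr 1; omega
    have h2 := δ_pow_σ (m := m) (i := i) (j := m - 2 - i)
    have h3 := δ_sq_σ_last (m := m)
    have h4 := δ_pow_σ (m := m) (i := 0) (j := i)
    rw [show i + (m - 2 - i) = m - 2 by omega] at h2
    rw [Nat.zero_add] at h4
    rw [Commute, SemiconjBy, h1, mul_assoc, h2, ← mul_assoc, mul_assoc (δ m ^ i), h3,
      ← mul_assoc, h4]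
    simp only [mul_assoc]
  · rw [σ_eq_one]; exact Commute.one_right _

lemma ζ_commute (m : ℕ) (b : Br m) : Commute (ζ m) b :=
  (Br.commute_of_gens (MonoidHom.id _) (ζ m) (fun i _ => (ζ_commute_σ m i).symm) b).symm

/-! ### Action on the free group -/

/-- The product `x (k - 1) * ⋯ * x 0`. -/
def zl (m : ℕ) : ℕ → F m
  | 0 => 1
  | k + 1 => x m k * zl m k

/-- The boundary word. -/
def z (m : ℕ) : F m := zl m m

lemma act_dl_gt {m k j : ℕ} (h : k < j) : act m (dl m k) (x m j) = x m j := by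
  induction k with
  | zero => simp [dl]
  | succ k ih =>
    change act m (dl m k * σ m k) _ = _
    rw [map_mul, MulAut.mul_apply, act_σ_of_ne, ih (by omega)]

lemma act_dl_self {m k : ℕ} (h : k < m) : act m (dl m k) (x m k) = x m 0 := by
  induction k with
  | zero => simp [dl]
  | succ k ih =>
    change act m (dl m k * σ m k) _ = _
    rw [map_mul, MulAut.mul_apply, act_σ_succ, ih (by omega)]

lemma act_dl_lt {m k j : ℕ} (h : j < k) (hk : k < m) :
    act m (dl m k) (x m j) = (x m 0)⁻¹ * x m (j + 1) * x m 0 := by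
  induction k, h using Nat.le_induction with
  | base =>
    change act m (dl m j * σ m j) _ = _
    rw [map_mul, MulAut.mul_apply, act_σ_self, map_mul, map_mul, map_inv,
      act_dl_self (by omega), act_dl_gt (by omega)]
  | succ k hk' ih =>
    change act m (dl m k * σ m k) _ = _
    rw [map_mul, MulAut.mul_apply, act_σ_of_ne, ih (by omega)]

lemma act_δ_last {m : ℕ} (h : 0 < m) : act m (δ m) (x m (m - 1)) = x m 0 :=
  act_dl_self (by omega)

lemma act_δ {m j : ℕ} (h : j + 1 < m) :
    act m (δ m) (x m j) = (x m 0)⁻¹ * x m (j + 1) * x m 0 :=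
  act_dl_lt (by omega) (by omega)

lemma act_σ_zl_le {m i k : ℕ} (h : k ≤ i) : act m (σ m i) (zl m k) = zl m k := by
  induction k with
  | zero => simp [zl]
  | succ k ih => rw [zl, map_mul, act_σ_of_ne, ih (by omega)]

lemma act_σ_mul {m i : ℕ} (h : i + 1 < m) :
    act m (σ m i) (x m (i + 1) * x m i) = x m (i + 1) * x m i := by
  rw [map_mul, act_σ_self h, act_σ_succ h]; group

lemma act_σ_zl_ge {m i k : ℕ} (h : i + 2 ≤ k) : act m (σ m i) (zl m k) = zl m k := by
  by_cases hi : i + 1 < m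
  · induction k, h using Nat.le_induction with
    | base =>
      rw [zl, zl, ← mul_assoc, map_mul, act_σ_mul hi, act_σ_zl_le le_rfl]
    | succ k hk ih =>
      rw [zl, map_mul, act_σ_of_ne, ih]
  · rw [σ_eq_one, map_one, MulAut.one_apply]

lemma act_σ_z (m i : ℕ) : act m (σ m i) (z m) = z m := by
  by_cases hi : i + 1 < m
  · exact act_σ_zl_ge (by omega)
  · rw [σ_eq_one, map_one, MulAut.one_apply]

/-- Fixed points of all generators are fixed by the group they generate. -/
lemma act_eq_of_gens {m : ℕ} (v : F m) (h : ∀ i, i + 1 < m → act m (σ m i) v = v) (b : Br m) :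
    act m b v = v := by
  have := Br.mem_of_gens ((stabilizer (MulAut (F m)) v).comap (act m)) h b
  exact this

lemma act_z (m : ℕ) (b : Br m) : act m b (z m) = z m :=
  act_eq_of_gens _ (fun i _ => act_σ_z m i) b

/-- The element `ρ` of `AG m`. -/
def ρ (m : ℕ) : AG m := fr (x m 0) * br (δ m)

/-- The generator of the centre of `AG m`. -/
def Δ (m : ℕ) : AG m := fr (z m) * br (ζ m)

lemma ρ_eq {m : ℕ} (h : 0 < m := by omega) : ρ m = br (δ m) * fr (x m (m - 1)) := by
  rw [br_mul_fr, act_δ_last h, ρ]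

lemma ρ_conj {m j : ℕ} (h : j + 1 < m) : ρ m * fr (x m j) = fr (x m (j + 1)) * ρ m := by
  rw [ρ, mul_assoc, br_mul_fr, act_δ h, ← mul_assoc, ← map_mul, ← mul_assoc (fr (x m (j + 1))),
    ← map_mul]
  congr 2; group

lemma ρ_conj_last {m : ℕ} (h : 0 < m) : ρ m * fr (x m (m - 1)) = fr (x m 0) * ρ m := by
  rw [ρ, mul_assoc, br_mul_fr, act_δ_last h]

lemma ρ_zl {m k : ℕ} (h : k < m) : ρ m * fr (zl m k) = fr (zl m (k + 1)) * br (δ m) := by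
  induction k with
  | zero => simp [zl, ρ]
  | succ k ih =>
    rw [zl, map_mul, ← mul_assoc, ρ_conj h, mul_assoc, ih (by omega), ← mul_assoc, ← map_mul]
    rfl

lemma ρ_pow {m k : ℕ} (h : k ≤ m) : ρ m ^ k = fr (zl m k) * br (δ m) ^ k := by
  induction k with
  | zero => simp [zl]
  | succ k ih => rw [pow_succ', ih (by omega), ← mul_assoc, ρ_zl h, mul_assoc, ← pow_succ']

lemma ρ_pow_self (m : ℕ) : ρ m ^ m = Δ m := by
  rw [ρ_pow le_rfl, Δ, ζ, map_pow]; rfl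

lemma ρ_pow_conj {m i j : ℕ} (h : i + j < m) :
    ρ m ^ j * fr (x m i) = fr (x m (i + j)) * ρ m ^ j := by
  induction j with
  | zero => simp
  | succ j ih =>
    rw [pow_succ', mul_assoc, ih (by omega), ← mul_assoc, ρ_conj (by omega), mul_assoc]
    rfl

lemma Δ_commute_fr (m : ℕ) (v : F m) : Commute (Δ m) (fr v) := by
  have := F.mem_of_gens ((Subgroup.centralizer {Δ m}).comap fr) (fun i hi => by
    rw [mem_comap, mem_centralizer_singleton_iff]
    have h1 : ρ m ^ m = ρ m ^ i * ρ m * ρ m ^ (m - 1 - i) := by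
      rw [← pow_succ, ← pow_add]; congr 1; omega
    have h2 := ρ_pow_conj (m := m) (i := i) (j := m - 1 - i) (by omega)
    have h3 := ρ_conj_last (m := m) (by omega)
    have h4 := ρ_pow_conj (m := m) (i := 0) (j := i) (by omega)
    rw [show i + (m - 1 - i) = m - 1 by omega] at h2
    rw [Nat.zero_add] at h4
    symm
    rw [← ρ_pow_self, h1, mul_assoc, h2, ← mul_assoc, mul_assoc (ρ m ^ i), h3, ← mul_assoc, h4]
    simp only [mul_assoc]) v
  rw [mem_comap, mem_centralizer_singleton_iff] at this
  exact this.symm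

lemma Δ_commute (m : ℕ) (g : AG m) : Commute (Δ m) g := by
  have h1 : Commute (Δ m) (br g.right) := by
    rw [Δ]
    refine Commute.mul_left ?_ ((ζ_commute m _).map br)
    change _ = _
    rw [br_mul_fr, act_z]
  rw [← inl_left_mul_inr_right g]
  exact (Δ_commute_fr m _).mul_right h1

lemma act_ζ (m : ℕ) (v : F m) : act m (ζ m) v = (z m)⁻¹ * v * z m := by
  have h := (Δ_commute_fr m v).eq
  rw [Δ, mul_assoc, br_mul_fr, ← mul_assoc, ← mul_assoc, ← map_mul, ← map_mul] at h
  have := inl_injective (mul_right_cancel h)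
  rw [mul_assoc, ← this]; group

lemma act_σ_sq_self {m i : ℕ} (h : i + 1 < m) : act m (σ m i ^ 2) (x m i) =
    (x m (i + 1) * x m i)⁻¹ * x m i * (x m (i + 1) * x m i) := by
  rw [pow_two, map_mul, MulAut.mul_apply, act_σ_self h]
  simp only [map_mul, map_inv, act_σ_self h, act_σ_succ h]; group

lemma act_σ_sq_succ {m i : ℕ} (h : i + 1 < m) : act m (σ m i ^ 2) (x m (i + 1)) =
    (x m (i + 1) * x m i)⁻¹ * x m (i + 1) * (x m (i + 1) * x m i) := by
  rw [pow_two, map_mul, MulAut.mul_apply, act_σ_succ h, act_σ_self h]; group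

lemma act_σ_sq_of_ne {m i j : ℕ} (h : j ≠ i) (h' : j ≠ i + 1) :
    act m (σ m i ^ 2) (x m j) = x m j := by
  rw [pow_two, map_mul, MulAut.mul_apply, act_σ_of_ne h h', act_σ_of_ne h h']

/-! ### The embedding into the next braid group -/

/-- The homomorphism `AG m → Br (m + 1)` onto the stabiliser of the last strand. -/
def ι (m : ℕ) : AG m →* Br (m + 1) :=
  AG.lift (s := σ (m + 1)) (q := σ (m + 1) (m - 1) ^ 2) (fun i hi => σ_braid)
    (fun i j h hj => (σ_comm h).eq)
    (fun i hi => ((σ_comm (i := i) (j := m - 1)).pow_right 2).eq)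
    (fun hm => by
      obtain ⟨k, rfl⟩ : ∃ k, m = k + 2 := ⟨m - 2, by omega⟩
      have h := σ_braid (m := k + 2 + 1) (i := k)
      rw [show k + 2 - 2 = k by omega, show k + 2 - 1 = k + 1 by omega]
      generalize σ (k + 2 + 1) k = a at *
      generalize σ (k + 2 + 1) (k + 1) = b at *
      calc a * b ^ 2 * a * b ^ 2 = a * b * (b * a * b) * b := by simp only [pow_two, mul_assoc]
        _ = (a * b * a) * (b * a * b) := by
          conv_lhs => rw [← h]
          simp only [mul_assoc]
        _ = (b * a * b) * (a * b * a) := by rw [h]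
        _ = b * (b * a * b) * b * a := by
          conv_rhs => rw [← h]
          simp only [mul_assoc]
        _ = _ := by simp only [pow_two, mul_assoc])

lemma ι_br_σ {m i : ℕ} (h : i + 1 < m := by omega) : ι m (br (σ m i)) = σ (m + 1) i :=
  AG.lift_br _ _ _ _ h

lemma ι_x_last {m : ℕ} (h : 0 < m := by omega) : ι m (fr (x m (m - 1))) = σ (m + 1) (m - 1) ^ 2 := by
  rw [ι, AG.lift_fr _ _ _ _ (by omega), xImg_of_le _ _ _]

lemma ι_x {m i : ℕ} (h : i + 1 < m) : ι m (fr (x m i)) =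
    σ (m + 1) i * ι m (fr (x m (i + 1))) * (σ (m + 1) i)⁻¹ := by
  rw [AG.conj_x h, map_mul, map_mul, map_inv, ι_br_σ h]

lemma ι_br_dl {m k : ℕ} (h : k < m) : ι m (br (dl m k)) = dl (m + 1) k := by
  induction k with
  | zero => simp [dl]
  | succ k ih => rw [dl, dl, map_mul, map_mul, ih (by omega), ι_br_σ]

lemma δ_σ_pow_aux {m k : ℕ} (h : k + 1 < m) :
    (σ m 1 * δ m) ^ k = (σ m 0)⁻¹ * dl m (k + 1) * δ m ^ k := by
  induction k with
  | zero => simp [dl]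
  | succ k ih =>
    have h1 := δ_pow_σ (m := m) (i := 1) (j := k)
    rw [pow_succ, ih (by omega), mul_assoc, ← mul_assoc (δ m ^ k), h1, Nat.add_comm 1 k,
      mul_assoc _ (δ m ^ k), ← pow_succ, ← mul_assoc, mul_assoc _ (dl m (k + 1))]
    rfl

lemma σ_δ_pow {m : ℕ} (h : 2 ≤ m) : (σ (m + 1) 1 * δ (m + 1)) ^ m = ζ (m + 1) := by
  obtain ⟨k, rfl⟩ : ∃ k, m = k + 1 := ⟨m - 1, by omega⟩
  have h1 := δ_σ (m := k + 1 + 1) (i := 0)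
  have h2 : dl (k + 1 + 1) (k + 1) = δ (k + 1 + 1) := rfl
  rw [pow_succ, δ_σ_pow_aux (by omega), ← h1, h2, mul_assoc (σ _ 0)⁻¹, ← pow_succ',
    mul_assoc, ← mul_assoc (δ _ ^ (k + 1)), ← pow_succ,
    show (δ (k + 1 + 1)) ^ (k + 1 + 1) = ζ (k + 1 + 1) from rfl,
    (ζ_commute_σ (k + 1 + 1) 0).eq, inv_mul_cancel_left]

lemma ι_Δ {m : ℕ} (h : 1 ≤ m := by omega) : ι m (Δ m) = ζ (m + 1) := by
  rw [← ρ_pow_self, map_pow, ρ_eq h, map_mul, ι_x_last h, δ, ι_br_dl (by omega)]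
  have h1 : dl (m + 1) (m - 1) * σ (m + 1) (m - 1) ^ 2 = δ (m + 1) * σ (m + 1) (m - 1) := by
    obtain ⟨k, rfl⟩ : ∃ k, m = k + 1 := ⟨m - 1, by omega⟩
    change dl _ k * σ _ k ^ 2 = dl _ k * σ _ k * σ _ k
    rw [pow_two, mul_assoc]
  have h2 := δ_pow_σ (m := m + 1) (i := 0) (j := m - 1)
  rw [Nat.zero_add] at h2
  have h3 : δ (m + 1) * σ (m + 1) (m - 1) =
      δ (m + 1) ^ (m - 1) * (δ (m + 1) * σ (m + 1) 0) * (δ (m + 1) ^ (m - 1))⁻¹ := by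
    rw [eq_mul_inv_iff_mul_eq, mul_assoc, ← h2, ← mul_assoc, ← mul_assoc, ← pow_succ', ← pow_succ]
  rw [h1, h3, conj_pow]
  by_cases hm : m = 1
  · subst hm
    simp [ζ, δ, dl, pow_two]
  · rw [δ_σ, σ_δ_pow (by omega), mul_inv_eq_iff_eq_mul]
    exact (ζ_commute _ _).symm

/-! ### Exponent sums -/

/-- The exponent sum of a braid. -/
def expo (m : ℕ) : Br m →* Multiplicative ℤ :=
  Br.lift (fun _ => ofAdd 1) (fun _ _ => rfl) (fun _ _ _ _ => rfl)

lemma expo_σ {m i : ℕ} (h : i + 1 < m := by omega) : expo m (σ m i) = ofAdd 1 :=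
  Br.lift_σ _ _ _ h

lemma expo_dl {m k : ℕ} (h : k < m) : expo m (dl m k) = ofAdd (k : ℤ) := by
  induction k with
  | zero => simp [dl]
  | succ k ih =>
    rw [dl, map_mul, ih (by omega), expo_σ, ← ofAdd_add]; simp

lemma expo_ζ {m : ℕ} (h : 1 ≤ m := by omega) :
    expo m (ζ m) = ofAdd ((m : ℤ) * (m - 1)) := by
  rw [ζ, map_pow, δ, expo_dl (by omega), ← ofAdd_nsmul, nsmul_eq_mul]
  push_cast [h]; rfl

/-- The exponent sum in a free group. -/
def chi (m : ℕ) : F m →* Multiplicative ℤ := F.lift m fun _ => ofAdd 1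

lemma chi_x {m i : ℕ} (h : i < m) : chi m (x m i) = ofAdd 1 := F.lift_x _ h

lemma chi_zl {m k : ℕ} (h : k ≤ m) : chi m (zl m k) = ofAdd (k : ℤ) := by
  induction k with
  | zero => simp [zl]
  | succ k ih =>
    rw [zl, map_mul, ih (by omega), chi_x (by omega), ← ofAdd_add]
    congr 1; push_cast; ring

lemma chi_z (m : ℕ) : chi m (z m) = ofAdd (m : ℤ) := chi_zl le_rfl

/-- The wreath product of a group `V` with the permutations of `X`. -/
@[ext] structure Wr (X V : Type*) where
  fn : X → V
  pm : Equiv.Perm X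

namespace Wr
variable {X V : Type*} [Group V]

instance : Mul (Wr X V) := ⟨fun a b => ⟨fun p => a.fn (b.pm p) * b.fn p, a.pm * b.pm⟩⟩
instance : One (Wr X V) := ⟨⟨fun _ => 1, 1⟩⟩
instance : Inv (Wr X V) := ⟨fun a => ⟨fun p => (a.fn (a.pm⁻¹ p))⁻¹, a.pm⁻¹⟩⟩

@[simp] lemma mul_fn (a b : Wr X V) (p : X) : (a * b).fn p = a.fn (b.pm p) * b.fn p := rfl
@[simp] lemma mul_pm (a b : Wr X V) : (a * b).pm = a.pm * b.pm := rfl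
@[simp] lemma one_fn (p : X) : (1 : Wr X V).fn p = 1 := rfl
@[simp] lemma one_pm : (1 : Wr X V).pm = 1 := rfl
@[simp] lemma inv_fn (a : Wr X V) (p : X) : a⁻¹.fn p = (a.fn (a.pm⁻¹ p))⁻¹ := rfl
@[simp] lemma inv_pm (a : Wr X V) : a⁻¹.pm = a.pm⁻¹ := rfl

instance : Group (Wr X V) :=
  Group.ofLeftAxioms
    (fun a b c => by ext p <;> simp [mul_assoc])
    (fun a => by ext p <;> simp)
    (fun a => by ext p <;> simp)

/-- The permutation part. -/
def pmHom : Wr X V →* Equiv.Perm X where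
  toFun := pm
  map_one' := rfl
  map_mul' _ _ := rfl

end Wr

/-! ### The cocycle of the last strand -/

/-- The value of the cocycle on the generator `σ i` at the position `p`. -/
def val (m i p : ℕ) : AG m :=
  if m < p then 1 else if i + 1 < p then br (σ m i) else if p = i + 1 then 1 else
    if p = i then fr (x m i) else br (σ m (i - 1))

section
variable {m i p : ℕ}

lemma val_out (h : m < p) : val m i p = 1 := if_pos h

lemma val_gt (h : i + 1 < p) (hp : p ≤ m) : val m i p = br (σ m i) := by
  rw [val, if_neg (by omega), if_pos h]

lemma val_succ : val m i (i + 1) = 1 := by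
  rw [val]; split_ifs <;> first | rfl | omega

lemma val_self : val m i i = fr (x m i) := by
  rw [val]; split_ifs <;> first | rfl | omega | skip
  rw [x_eq_one, map_one]

lemma val_lt (h : p < i) (hp : p ≤ m) : val m i p = br (σ m (i - 1)) := by
  rw [val, if_neg (by omega), if_neg (by omega), if_neg (by omega), if_neg (by omega)]

end

open Equiv in
/-- The cocycle of strands of a braid with `m + 1` strands, with values in `AG m`. -/
def c1 (m : ℕ) : Br (m + 1) →* Wr ℕ (AG m) :=
  Br.lift (fun i => ⟨val m i, swap i (i + 1)⟩)
    (fun i hi => by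
      refine Wr.ext (funext fun p => ?_) (swap_braid i)
      simp only [Wr.mul_fn, Wr.mul_pm, mul_apply]
      by_cases hp : m < p
      · simp (disch := omega) only [swap_apply_of_ne_of_ne, val_out]
      rcases lt_trichotomy p i with h | rfl | h
      · obtain ⟨k, rfl⟩ : ∃ k, i = k + 1 := ⟨i - 1, by omega⟩
        simp (disch := omega) only [swap_apply_of_ne_of_ne, val_lt, ← map_mul]
        exact congrArg br (σ_braid)
      · simp (disch := omega) only [swap_apply_left, swap_apply_of_ne_of_ne, val_self, val_gt, val_lt]
        rw [mul_assoc, ← map_mul, br_mul_fr, act_σ_mul (by omega), map_mul]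
        rfl
      obtain rfl | rfl | h : p = i + 1 ∨ p = i + 1 + 1 ∨ i + 1 + 1 < p := by omega
      · simp (disch := omega) only [swap_apply_left, swap_apply_right, swap_apply_of_ne_of_ne,
          val_self, val_succ, val_gt, val_lt, mul_one, one_mul]
        rw [br_mul_fr, act_σ_succ]
        rfl
      · simp (disch := omega) only [swap_apply_right, swap_apply_of_ne_of_ne, val_succ, val_gt,
          val_lt, mul_one, one_mul]
        rfl
      · simp (disch := omega) only [swap_apply_of_ne_of_ne, val_gt, ← map_mul]
        exact congrArg br (σ_braid))
    (fun i j hij hj => by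
      refine Wr.ext (funext fun p => ?_) (swap_comm_of_le hij)
      simp only [Wr.mul_fn, Wr.mul_pm, mul_apply]
      by_cases hp : m < p
      · simp (disch := omega) only [swap_apply_of_ne_of_ne, val_out]
      obtain h | rfl | rfl | h : p < i ∨ p = i ∨ p = i + 1 ∨ i + 1 < p := by omega
      · simp (disch := omega) only [swap_apply_of_ne_of_ne, val_lt]
        exact ((σ_comm).map br).eq
      · simp (disch := omega) only [swap_apply_of_ne_of_ne, swap_apply_left, val_self, val_lt]
        rw [br_mul_fr, act_σ_of_ne]
      · simp (disch := omega) only [swap_apply_of_ne_of_ne, swap_apply_right, val_succ, val_lt,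
          mul_one, one_mul]
      obtain h | rfl | rfl | h : p < j ∨ p = j ∨ p = j + 1 ∨ j + 1 < p := by omega
      · simp (disch := omega) only [swap_apply_of_ne_of_ne, val_gt, val_lt]
        exact ((σ_comm).map br).eq
      · simp (disch := omega) only [swap_apply_of_ne_of_ne, swap_apply_left, val_self, val_gt]
        rw [br_mul_fr, act_σ_of_ne]
      · simp (disch := omega) only [swap_apply_of_ne_of_ne, swap_apply_right, val_succ, val_gt,
          mul_one, one_mul]
      · simp (disch := omega) only [swap_apply_of_ne_of_ne, val_gt]
        exact ((σ_comm).map br).eq)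

lemma c1_σ {m i : ℕ} (h : i + 1 < m + 1) :
    c1 m (σ (m + 1) i) = ⟨val m i, Equiv.swap i (i + 1)⟩ := Br.lift_σ _ _ _ h

lemma c1_pm (m : ℕ) (b : Br (m + 1)) : (c1 m b).pm = perm (m + 1) b := by
  have : (Wr.pmHom.comp (c1 m)) = perm (m + 1) := Br.hom_ext fun i hi => by
    rw [comp_apply, c1_σ hi, perm_σ hi]; rfl
  exact congr_fun this b

/-- The braid moving the last strand to the position `p`. -/
def τ (m p : ℕ) : Br (m + 1) := tailProd (m + 1) (σ (m + 1)) p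

lemma τ_of_lt {m p : ℕ} (h : p < m := by omega) : τ m p = σ (m + 1) p * τ m (p + 1) :=
  tailProd_of_lt _ _ (by omega)

lemma τ_of_le {m p : ℕ} (h : m ≤ p) : τ m p = 1 := tailProd_of_le _ _ (by omega)

lemma τ_commute {m i : ℕ} (k p : ℕ) (hk : p + k = m) (h : i + 1 < p) :
    Commute (σ (m + 1) i) (τ m p) := by
  induction k generalizing p with
  | zero => rw [τ_of_le (by omega)]; exact Commute.one_right _
  | succ k ih =>
    rw [τ_of_lt]
    exact (σ_comm).mul_right (ih (p + 1) (by omega) (by omega))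

lemma σ_mul_τ_gt {m i : ℕ} (k p : ℕ) (hk : p + k + 1 = i) (h : i < m) :
    σ (m + 1) i * τ m p = τ m p * σ (m + 1) (i - 1) := by
  induction k generalizing p with
  | zero =>
    obtain rfl : i = p + 1 := by omega
    rw [τ_of_lt (p := p), τ_of_lt (p := p + 1), ← mul_assoc, ← mul_assoc,
      ← σ_braid, mul_assoc, (τ_commute (m := m) (i := p) (m - (p + 1 + 1)) (p + 1 + 1)
        (by omega) (by omega)).eq]
    simp only [mul_assoc]
    rfl
  | succ k ih =>
    rw [τ_of_lt, ← mul_assoc, ← (σ_comm (m := m + 1) (i := p) (j := i)).eq,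
      mul_assoc, ih (p + 1) (by omega), mul_assoc]

lemma σ_sq_conj {m i : ℕ} (h : i + 2 < m) : σ m i * σ m (i + 1) ^ 2 * (σ m i)⁻¹ =
    (σ m (i + 1))⁻¹ * σ m i ^ 2 * σ m (i + 1) := by
  have h1 := σ_braid h
  have h2 : σ m i * σ m (i + 1) * (σ m i)⁻¹ = (σ m (i + 1))⁻¹ * σ m i * σ m (i + 1) := by
    rw [mul_inv_eq_iff_eq_mul, mul_assoc, mul_assoc, eq_inv_mul_iff_mul_eq, ← mul_assoc,
      ← mul_assoc, h1]
  have h3 : (σ m i * σ m (i + 1) * (σ m i)⁻¹) ^ 2 = ((σ m (i + 1))⁻¹ * σ m i * σ m (i + 1)) ^ 2 := by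
    rw [h2]
  rw [conj_pow] at h3
  rw [h3]
  have := conj_pow (i := 2) (a := (σ m (i + 1))⁻¹) (b := σ m i)
  rwa [inv_inv] at this

lemma σ_sq_mul_τ {m : ℕ} (k p : ℕ) (hk : p + k + 1 = m) :
    σ (m + 1) p ^ 2 * τ m (p + 1) = τ m (p + 1) * ι m (fr (x m p)) := by
  induction k generalizing p with
  | zero =>
    obtain rfl : p = m - 1 := by omega
    rw [τ_of_le (by omega), ι_x_last, mul_one, one_mul]
  | succ k ih =>
    have h1 := σ_sq_conj (m := m + 1) (i := p) (by omega)
    have h2 := (τ_commute (m := m) (i := p) (m - (p + 1 + 1)) (p + 1 + 1) (by omega) (by omega)).eq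
    have h3 := ih (p + 1) (by omega)
    rw [ι_x (by omega), τ_of_lt, ← mul_assoc, mul_assoc _ (τ m (p + 1 + 1)),
      ← mul_assoc (τ m (p + 1 + 1)), ← mul_assoc (τ m (p + 1 + 1)), ← h2, mul_assoc (σ _ p),
      ← h3]
    have h4 : τ m (p + 1 + 1) * (σ (m + 1) p)⁻¹ = (σ (m + 1) p)⁻¹ * τ m (p + 1 + 1) := by
      rw [eq_inv_mul_iff_mul_eq, ← mul_assoc, h2, mul_inv_cancel_right]
    rw [mul_assoc (σ (m + 1) p), mul_assoc (σ _ (p + 1) ^ 2), h4, ← mul_assoc (σ _ (p + 1) ^ 2),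
      ← mul_assoc (σ _ p), ← mul_assoc (σ _ p), h1]
    group

lemma perm_le {m p : ℕ} (hp : p ≤ m) (b : Br (m + 1)) : perm (m + 1) b p ≤ m :=
  Nat.lt_succ_iff.1 (perm_lt (Nat.lt_succ_iff.2 hp) b)

lemma mul_τ (m : ℕ) (b : Br (m + 1)) (p : ℕ) (hp : p ≤ m) :
    b * τ m p = τ m (perm (m + 1) b p) * ι m ((c1 m b).fn p) := by
  let T : Subgroup (Br (m + 1)) :=
    { carrier := {b | ∀ p ≤ m, b * τ m p = τ m (perm (m + 1) b p) * ι m ((c1 m b).fn p)}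
      one_mem' := fun p _ => by simp
      mul_mem' := fun {a b} ha hb p hp => by
        rw [mul_assoc, hb p hp, ← mul_assoc, ha _ (perm_le hp b), map_mul, map_mul, Wr.mul_fn, map_mul, c1_pm, mul_assoc]
        rfl
      inv_mem' := fun {a} ha p hp => by
        have := ha (perm (m + 1) a⁻¹ p) (perm_le hp a⁻¹)
        rw [← mul_apply, ← map_mul, mul_inv_cancel, map_one, one_apply]
          at this
        rw [map_inv (c1 m), Wr.inv_fn, map_inv (ι m), ← Wr.inv_pm, ← map_inv (c1 m), c1_pm,
          eq_mul_inv_iff_mul_eq, mul_assoc, ← this, inv_mul_cancel_left] }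
  refine Br.mem_of_gens T (fun i hi p hp => ?_) b p hp
  rw [c1_σ hi, perm_σ hi]
  dsimp only
  rcases lt_trichotomy p i with h | rfl | h
  · rw [Equiv.swap_apply_of_ne_of_ne (by omega) (by omega), val_lt h hp, ι_br_σ,
      σ_mul_τ_gt (i - p - 1) p (by omega) (by omega)]
  · rw [Equiv.swap_apply_left, val_self, ← σ_sq_mul_τ (m - p - 1) p (by omega),
      τ_of_lt, pow_two, mul_assoc]
  rcases Nat.lt_or_ge (i + 1) p with h1 | h1
  · rw [Equiv.swap_apply_of_ne_of_ne (by omega) (by omega), val_gt h1 hp, ι_br_σ,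
      (τ_commute (m := m) (i := i) (m - p) p (by omega) h1).eq]
  · obtain rfl : p = i + 1 := by omega
    rw [Equiv.swap_apply_right, val_succ, map_one, mul_one, ← τ_of_lt]

/-- The element of `AG m` given by a braid fixing the last strand. -/
def fg (m : ℕ) (b : Br (m + 1)) : AG m := (c1 m b).fn m

lemma fg_mul {m : ℕ} (a : Br (m + 1)) {b : Br (m + 1)} (hb : perm (m + 1) b m = m) :
    fg m (a * b) = fg m a * fg m b := by
  rw [fg, map_mul, Wr.mul_fn, c1_pm, hb]; rfl

lemma ι_fg {m : ℕ} {b : Br (m + 1)} (hb : perm (m + 1) b m = m) : ι m (fg m b) = b := by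
  have := mul_τ m b m le_rfl
  rw [hb, τ_of_le le_rfl, mul_one, one_mul] at this
  exact this.symm

lemma perm_ι (m : ℕ) (g : AG m) : perm (m + 1) (ι m g) = perm m g.right := by
  have : (perm (m + 1)).comp (ι m) = (perm m).comp rightHom :=
    AG.hom_ext' (by
      by_cases hm : 0 < m
      · rw [comp_apply, ι_x_last hm, map_pow, perm_σ, pow_two,
          Equiv.swap_mul_self]
        simp
      · obtain rfl : m = 0 := by omega
        simp [x_eq_one]) (fun i hi => by
      rw [comp_apply, ι_br_σ hi, perm_σ, comp_apply,
        SemidirectProduct.rightHom_inr, perm_σ hi])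
  exact congr_fun this g

lemma perm_ι_last (m : ℕ) (g : AG m) : perm (m + 1) (ι m g) m = m := by
  rw [perm_ι]; exact perm_of_le le_rfl _

lemma fg_ι {m : ℕ} (g : AG m) : fg m (ι m g) = g := by
  let T : Subgroup (AG m) :=
    { carrier := {g | fg m (ι m g) = g}
      one_mem' := by simp [fg]
      mul_mem' := fun {a b} ha hb => by
        change fg m _ = _
        rw [map_mul, fg_mul _ (perm_ι_last m b), ha, hb]
      inv_mem' := fun {a} ha => by
        change fg m _ = _
        rw [eq_inv_iff_mul_eq_one]
        nth_rewrite 2 [← ha]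
        rw [← fg_mul _ (perm_ι_last m a), ← map_mul]
        simp [fg] }
  refine AG.mem_of_gens T ?_ (fun i hi => ?_) g
  · change fg m _ = _
    by_cases hm : 0 < m
    · rw [ι_x_last hm, pow_two, fg, map_mul, c1_σ (by omega), Wr.mul_fn]
      obtain ⟨k, rfl⟩ : ∃ k, m = k + 1 := ⟨m - 1, by omega⟩
      rw [show k + 1 - 1 = k from rfl]
      dsimp only
      rw [Equiv.swap_apply_right, val_self, val_succ, mul_one]
    · obtain rfl : m = 0 := by omega
      simp [x_eq_one, fg]
  · change fg m _ = _
    rw [ι_br_σ hi, fg, c1_σ (by omega)]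
    exact val_gt hi le_rfl

lemma ι_injective (m : ℕ) : Injective (ι m) := fun a b h => by
  rw [← fg_ι a, ← fg_ι b, h]

lemma FreeGroup.subsingleton_of_central {X : Type*} {a : FreeGroup X} (ha : a ≠ 1)
    (h : ∀ g, Commute g a) : ∃ p : X, ∀ y : X, y = p := by
  classical
  have hw : a.toWord ≠ [] := fun h => ha (FreeGroup.toWord_eq_nil_iff.1 h)
  obtain ⟨⟨p, b⟩, L, hL⟩ := exists_cons_of_ne_nil hw
  refine ⟨p, fun y => ?_⟩
  by_contra hy
  have hr : FreeGroup.IsReduced ((y, true) :: a.toWord) := by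
    have := FreeGroup.isReduced_toWord (x := a)
    rw [hL] at this ⊢
    exact IsChain.cons_cons (fun h => absurd h hy) this
  have h1 : (FreeGroup.of y * a).toWord = (y, true) :: a.toWord := by
    conv_lhs => rw [← FreeGroup.mk_toWord (x := a), FreeGroup.of, FreeGroup.mul_mk,
      FreeGroup.toWord_mk]
    exact hr.reduce_eq
  have h2 : FreeGroup.Red (a.toWord ++ [(y, true)]) (a * FreeGroup.of y).toWord := by
    conv_rhs => rw [← FreeGroup.mk_toWord (x := a), FreeGroup.of, FreeGroup.mul_mk,
      FreeGroup.toWord_mk]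
    exact FreeGroup.reduce.red
  rw [← (h (FreeGroup.of y)).eq, h1] at h2
  have h3 := h2.sublist.eq_of_length (by simp)
  rw [hL] at h3
  simp at h3
  exact hy h3.1.1

lemma FreeGroup.centralizer_cyclic {α : Type} {a : FreeGroup α} (ha : a ≠ 1) :
    ∃ r, ∀ g, Commute g a → g ∈ zpowers r := by
  let C : Subgroup (FreeGroup α) := Subgroup.centralizer {a}
  let e := IsFreeGroup.toFreeGroup C
  have hC : ∀ g, g ∈ C ↔ Commute g a := fun g => by
    rw [mem_centralizer_singleton_iff]; exact ⟨fun h => h, fun h => h⟩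
  let a' : C := ⟨a, (hC a).2 rfl⟩
  obtain ⟨p, hp⟩ := FreeGroup.subsingleton_of_central (a := e a')
    (by rw [Ne, map_eq_one_iff _ e.injective]; exact fun h => ha (congrArg Subtype.val h))
    (fun g => by
      obtain ⟨g, rfl⟩ := e.surjective g
      exact (show Commute g a' from Subtype.ext ((hC _).1 g.2).eq).map e)
  have key : ∀ g, g ∈ zpowers (FreeGroup.of p) := fun g => by
    induction g using FreeGroup.induction_on with
    | C1 => exact one_mem _
    | of y => rw [hp y]; exact Subgroup.mem_zpowers _
    | inv_of y h => exact inv_mem h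
    | mul a b h1 h2 => exact mul_mem h1 h2
  refine ⟨e.symm (FreeGroup.of p), fun g hg => ?_⟩
  obtain ⟨k, hk⟩ := key (e ⟨g, (hC g).2 hg⟩)
  refine ⟨k, ?_⟩
  have := congrArg e.symm hk
  simp only [map_zpow, MulEquiv.symm_apply_apply] at this
  exact congrArg Subtype.val this

/-- An element of exponent `±1` generates the centralizers of its powers. -/
lemma mem_zpowers_of_commute {α : Type} {w : FreeGroup α}
    (χ : FreeGroup α →* Multiplicative ℤ) (hw : IsUnit (χ w).toAdd) {N : ℤ} (hN : N ≠ 0)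
    {h : FreeGroup α} (hc : Commute h (w ^ N)) : h ∈ zpowers w := by
  have hw1 : w ^ N ≠ 1 := fun h => by
    have := congrArg (fun g => (χ g).toAdd) h
    simp [hN] at this
    simp [this] at hw
  obtain ⟨r, hr⟩ := FreeGroup.centralizer_cyclic hw1
  obtain ⟨k, hk⟩ := hr w ((Commute.refl w).zpow_right N)
  obtain ⟨l, rfl⟩ := hr h hc
  have : IsUnit k := by
    rw [← hk] at hw
    simp at hw
    exact hw.1
  obtain rfl | rfl := Int.isUnit_iff.1 this
  · rw [← hk]; simp [mem_zpowers_iff]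
  · rw [← hk]; simp [mem_zpowers_iff]

/-- The free product of `H` with an infinite cyclic group. -/
abbrev FP (H : Type*) [Group H] := HNNExtension H ⊥ ⊥ (MulEquiv.refl (⊥ : Subgroup H))

namespace FP
variable {H : Type*} [Group H]

/-- The inclusion of the first factor. -/
abbrev inc : H →* FP H := HNNExtension.of

variable (H) in
/-- The generator of the second factor. -/
abbrev t : FP H := HNNExtension.t

/-- The homomorphism given by a homomorphism on `H` and the image of `t`. -/
def lift {G : Type*} [Group G] (f : H →* G) (g : G) : FP H →* G :=
  HNNExtension.lift f g fun a => by
    obtain ⟨a, ha⟩ := a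
    rw [Subgroup.mem_bot] at ha
    subst ha
    simp [show (⟨1, ha⟩ : (⊥ : Subgroup H)) = 1 from rfl]

@[simp] lemma lift_t {G : Type*} [Group G] (f : H →* G) (g : G) : lift f g (t H) = g :=
  HNNExtension.lift_t ..

@[simp] lemma lift_inc {G : Type*} [Group G] (f : H →* G) (g : G) (h : H) :
    lift f g (inc h) = f h := HNNExtension.lift_of ..

lemma hom_ext {G : Type*} [Group G] {f g : FP H →* G} (h1 : f.comp inc = g.comp inc)
    (h2 : f (t H) = g (t H)) : f = g := HNNExtension.hom_ext h1 h2

lemma inc_injective : Injective (inc : H →* FP H) := HNNExtension.of_injective _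

/-- The value of a letter `t ^ e * h`. -/
def L (a : ℤˣ × H) : FP H := t H ^ (a.1 : ℤ) * inc a.2

/-- The product of a list of letters. -/
def P (l : List (ℤˣ × H)) : FP H := (l.map L).prod

@[simp] lemma P_nil : P ([] : List (ℤˣ × H)) = 1 := rfl
@[simp] lemma P_cons (a : ℤˣ × H) (l) : P (a :: l) = L a * P l := rfl
@[simp] lemma P_append (k l : List (ℤˣ × H)) : P (k ++ l) = P k * P l := by
  rw [P, List.map_append, List.prod_append]; rfl

/-- The relation between consecutive letters of a reduced word. -/
def Rel (a b : ℤˣ × H) : Prop := a.2 = 1 → a.1 = b.1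

/-- Reduced words. -/
abbrev Red (l : List (ℤˣ × H)) : Prop := l.IsChain Rel

lemma toSubgroup_eq (u : ℤˣ) : HNNExtension.toSubgroup (⊥ : Subgroup H) ⊥ u = ⊥ := by
  unfold HNNExtension.toSubgroup; split_ifs <;> rfl

/-- The reduced word of Mathlib given by a head and a reduced list. -/
def toRW (h : H) (l : List (ℤˣ × H)) (hl : Red l) :
    HNNExtension.NormalWord.ReducedWord H ⊥ ⊥ where
  head := h
  toList := l
  chain := hl.imp fun a b hab h => hab (by rwa [toSubgroup_eq, Subgroup.mem_bot] at h)

lemma unique {l l' : List (ℤˣ × H)} (hl : Red l) (hl' : Red l') {h h' : H}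
    (heq : inc h * P l = inc h' * P l') : h = h' ∧ l = l' := by
  induction l generalizing l' h h' with
  | nil =>
    have := (HNNExtension.ReducedWord.map_fst_eq_and_of_prod_eq _
      (w₁ := toRW h [] hl) (w₂ := toRW h' l' hl') heq).1
    obtain rfl : l' = [] := by simpa [toRW] using this.symm
    exact ⟨inc_injective (by simpa using heq), rfl⟩
  | cons a l ih =>
    have := HNNExtension.ReducedWord.map_fst_eq_and_of_prod_eq _
      (w₁ := toRW h _ hl) (w₂ := toRW h' l' hl') heq
    cases l' with
    | nil => simp [toRW] at this
    | cons b l' =>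
      simp only [toRW, List.map_cons, List.cons.injEq, List.head?_cons, Option.map_some,
        toSubgroup_eq, Subgroup.mem_bot] at this
      obtain rfl : h = h' := inv_mul_eq_one.1 (this.2 _ rfl)
      obtain ⟨a1, a2⟩ := a
      obtain ⟨b1, b2⟩ := b
      obtain rfl : a1 = b1 := this.1.1
      have h3 : inc a2 * P l = inc b2 * P l' := by
        simpa [L, mul_assoc] using heq
      obtain ⟨rfl, rfl⟩ := ih hl.of_cons hl'.of_cons h3
      exact ⟨rfl, rfl⟩

lemma exists_normal (g : FP H) : ∃ h l, Red l ∧ g = inc h * P l := by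
  have key : ∀ (u : ℤˣ) (h : H) l, Red l →
      ∃ h' l', Red l' ∧ t H ^ (u : ℤ) * (inc h * P l) = inc h' * P l' := fun u h l hl => by
    by_cases hr : ∃ a l', l = a :: l' ∧ h = 1 ∧ a.1 = -u
    · obtain ⟨⟨a1, a2⟩, l', rfl, rfl, rfl⟩ := hr
      refine ⟨a2, l', hl.of_cons, ?_⟩
      simp [L, mul_assoc]
    · refine ⟨1, (u, h) :: l, ?_, by simp [L, mul_assoc]⟩
      cases l with
      | nil => exact isChain_singleton _
      | cons a l =>
        refine IsChain.cons_cons (fun h1 => ?_) hl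
        by_contra h2
        refine hr ⟨a, l, rfl, h1, ?_⟩
        change u ≠ a.1 at h2
        rcases Int.units_eq_one_or u with rfl | rfl <;>
          rcases Int.units_eq_one_or a.1 with h3 | h3 <;> simp_all
  let Q : FP H → Prop := fun g =>
    ∀ h l, Red l → ∃ h' l', Red l' ∧ g * (inc h * P l) = inc h' * P l'
  have hQ : ∀ {a b}, Q a → Q b → Q (a * b) := fun {a b} ha hb h l hl => by
    obtain ⟨h1, l1, hl1, e1⟩ := hb h l hl
    obtain ⟨h2, l2, hl2, e2⟩ := ha h1 l1 hl1
    exact ⟨h2, l2, hl2, by rw [mul_assoc, e1, e2]⟩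
  have all : ∀ g, Q g ∧ Q g⁻¹ := fun g => by
    induction g using HNNExtension.induction_on with
    | of h =>
      exact ⟨fun h1 l hl => ⟨h * h1, l, hl, by simp [mul_assoc]⟩,
        fun h1 l hl => ⟨h⁻¹ * h1, l, hl, by simp [mul_assoc]⟩⟩
    | t => exact ⟨by simpa using key 1, by simpa using key (-1)⟩
    | mul a b ha hb => exact ⟨hQ ha.1 hb.1, by rw [mul_inv_rev]; exact hQ hb.2 ha.2⟩
    | inv a ha => exact ⟨ha.2, by rw [inv_inv]; exact ha.1⟩
  obtain ⟨h, l, hl, e⟩ := (all g).1 1 [] isChain_nil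
  exact ⟨h, l, hl, by simpa using e⟩

end FP

namespace FP
variable {H : Type*} [Group H]

/-- Cyclically reduced words. -/
def CycRed (l : List (ℤˣ × H)) : Prop := Cycle.Chain Rel (l : Cycle (ℤˣ × H))

lemma CycRed.rotated {l l' : List (ℤˣ × H)} (h : CycRed l) (hr : l ~r l') : CycRed l' := by
  unfold CycRed at *
  rwa [← Cycle.coe_eq_coe.2 hr]

lemma CycRed.red {l : List (ℤˣ × H)} (h : CycRed l) : Red l := by
  cases l with
  | nil => exact isChain_nil
  | cons a l =>
    have := (Cycle.chain_coe_cons Rel a l).1 h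
    rw [← cons_append] at this
    exact (isChain_append.1 this).1

lemma red_concat {m : List (ℤˣ × H)} {e : ℤˣ} {h : H} (hm : Red (m ++ [(e, h)])) (h' : H) :
    Red (m ++ [(e, h')]) := by
  rw [Red, isChain_append] at hm ⊢
  refine ⟨hm.1, isChain_singleton _, fun x hx y hy => ?_⟩
  obtain rfl : (e, h') = y := by simpa using hy
  exact hm.2.2 x hx (e, h) (by simp)

lemma L_mul_inc (e : ℤˣ) (h h' : H) : L (e, h) * inc h' = L (e, h * h') := by
  simp [L, mul_assoc]

lemma L_cancel {e f : ℤˣ} (h : e = -f) (g : H) : L (e, 1) * L (f, g) = inc g := by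
  subst h; simp [L, mul_assoc]

lemma units_eq_neg {e f : ℤˣ} (h : e ≠ f) : e = -f := by
  rcases Int.units_eq_one_or e with rfl | rfl <;> rcases Int.units_eq_one_or f with rfl | rfl <;>
    simp_all

lemma isRotated_of_append {α : Type*} {l l' : List α} (n : ℕ) (k : List α) (hn : k.length ≤ n)
    (h : k ++ l = l' ++ k) : l ~r l' := by
  induction n generalizing k with
  | zero =>
    obtain rfl : k = [] := List.length_eq_zero_iff.1 (by omega)
    rw [List.nil_append, List.append_nil] at h
    rw [h]
  | succ n ih =>
    obtain ⟨m, h1, h2⟩ | ⟨m, h1, h2⟩ := List.append_eq_append_iff.1 h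
    · subst h1; subst h2; exact List.isRotated_append
    · by_cases hl : l' = []
      · subst hl
        have : l = [] := by
          have := congrArg List.length h
          simp at this; exact this
        rw [this]
      · refine ih m ?_ (by rw [← h1, h2])
        have := congrArg List.length h1
        have h3 := List.length_pos_iff.2 hl
        simp at this; omega

/-- Conjugate cyclically reduced words are rotations of one another. -/
lemma isRotated_of_conj (n : ℕ) {h0 : H} {k l l' : List (ℤˣ × H)} (hn : k.length ≤ n)
    (hk : Red k) (hl : CycRed l) (hl' : CycRed l') (h1 : l ≠ []) (h2 : l' ≠ [])
    (heq : inc h0 * P k * P l = P l' * (inc h0 * P k)) : l ~r l' := by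
  induction n generalizing h0 k l l' with
  | zero =>
    obtain rfl : k = [] := List.length_eq_zero_iff.1 (by omega)
    obtain rfl | ⟨m, ⟨e, h⟩, rfl⟩ := eq_nil_or_concat l'
    · exact absurd rfl h2
    rw [concat_eq_append] at *
    have h3 : inc h0 * P l = inc 1 * P (m ++ [(e, h * h0)]) := by
      simpa [mul_assoc, L_mul_inc] using heq
    obtain ⟨rfl, rfl⟩ := unique hl.red (red_concat hl'.red _) h3
    rw [mul_one]
  | succ n ih =>
    obtain rfl | ⟨m, ⟨e, h⟩, rfl⟩ := eq_nil_or_concat l'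
    · exact absurd rfl h2
    obtain ⟨b, l2, rfl⟩ := exists_cons_of_ne_nil h1
    rw [concat_eq_append] at *
    by_cases hk0 : k = []
    · subst hk0
      exact ih (k := []) (by simp) hk hl hl' h1 h2 heq
    by_cases hj1 : ∃ k0 e1, k = k0 ++ [(e1, 1)] ∧ e1 = - b.1
    · obtain ⟨k0, e1, rfl, rfl⟩ := hj1
      obtain ⟨b1, b2⟩ := b
      have hrot : ((b1, b2) :: l2) ~r (l2 ++ [(b1, b2)]) :=
        ⟨1, by simp⟩
      refine hrot.trans ?_
      have h3 : ∀ w, L (-b1, 1) * (L (b1, b2) * w) = inc b2 * w := fun w => by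
        rw [← mul_assoc, L_cancel rfl]
      obtain rfl | ⟨k1, ⟨e2, g2⟩, rfl⟩ := eq_nil_or_concat k0
      · refine ih (k := []) (h0 := h0 * b2) (by simp) isChain_nil (hl.rotated hrot) hl'
          (by simp) (by simp) ?_
        have := congrArg (· * L (b1, b2)) heq
        simp only [P_append, P_cons, P_nil, List.nil_append, mul_assoc, mul_one, map_mul, h3,
          L_cancel rfl] at this ⊢
        exact this
      · rw [concat_eq_append] at *
        refine ih (k := k1 ++ [(e2, g2 * b2)]) (h0 := h0) (by simp at hn ⊢; omega)
          (red_concat (isChain_append.1 hk).1 _) (hl.rotated hrot) hl' (by simp) (by simp) ?_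
        have := congrArg (· * L (b1, b2)) heq
        simp only [P_append, P_cons, P_nil, List.nil_append, mul_assoc, mul_one, map_mul, h3,
          L_cancel rfl, ← L_mul_inc] at this ⊢
        exact this
    by_cases hj2 : h * h0 = 1 ∧ ∃ f g k', k = (f, g) :: k' ∧ e = -f
    · obtain ⟨hh, f, g, k', rfl, rfl⟩ := hj2
      have hrot : (m ++ [(-f, h)]) ~r ((-f, h) :: m) := by
        have := List.isRotated_append (l := m) (l' := [(-f, h)])
        exact this
      refine List.IsRotated.trans ?_ hrot.symm
      refine ih (k := k') (h0 := g) (by simp at hn; omega) hk.of_cons hl (hl'.rotated hrot)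
        (by simp) (by simp) ?_
      have h3 : L (-f, h) * (inc h0 * (L (f, g) * P k')) = inc g * P k' := by
        rw [← mul_assoc, L_mul_inc, hh, ← mul_assoc, L_cancel rfl]
      calc inc g * P k' * P (b :: l2)
          = L (-f, h) * (inc h0 * P ((f, g) :: k') * P (b :: l2)) := by
            rw [← h3]; simp [mul_assoc]
        _ = L (-f, h) * (P (m ++ [(-f, h)]) * (inc h0 * P ((f, g) :: k'))) := by rw [heq]
        _ = P ((-f, h) :: m) * (inc g * P k') := by rw [← h3]; simp [mul_assoc]
    · have r1 : Red (k ++ b :: l2) := by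
        refine isChain_append.2 ⟨hk, hl.red, fun x hx y hy => ?_⟩
        obtain rfl : b = y := by simpa using hy
        intro hx1
        by_contra hne
        obtain rfl | ⟨k0, x', rfl⟩ := eq_nil_or_concat k
        · exact hk0 rfl
        rw [concat_eq_append] at *
        obtain rfl : x' = x := by simpa using hx
        obtain ⟨x1, x2⟩ := x'
        simp only at hx1
        subst hx1
        exact hj1 ⟨k0, x1, rfl, units_eq_neg hne⟩
      have r2 : Red ((m ++ [(e, h * h0)]) ++ k) := by
        refine isChain_append.2 ⟨red_concat hl'.red _, hk, fun x hx y hy => ?_⟩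
        obtain rfl : (e, h * h0) = x := by simpa using hx
        intro hx1
        by_contra hne
        cases k with
        | nil => exact hk0 rfl
        | cons y' k' =>
          obtain rfl : y' = y := by simpa using hy
          exact hj2 ⟨hx1, y'.1, y'.2, k', rfl, units_eq_neg hne⟩
      have h3 : inc h0 * P (k ++ b :: l2) = inc 1 * P ((m ++ [(e, h * h0)]) ++ k) := by
        simpa [mul_assoc, ← L_mul_inc] using heq
      obtain ⟨rfl, h4⟩ := unique r1 r2 h3
      rw [mul_one] at h4
      exact isRotated_of_append _ _ le_rfl h4

lemma isRotated_of_isConj {l l' : List (ℤˣ × H)} (hl : CycRed l) (hl' : CycRed l')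
    (h1 : l ≠ []) (h2 : l' ≠ []) (h : IsConj (P l) (P l')) : l ~r l' := by
  obtain ⟨c, hc⟩ := isConj_iff.1 h
  obtain ⟨h0, k, hk, rfl⟩ := exists_normal c
  exact isRotated_of_conj (h0 := h0) _ le_rfl hk hl hl' h1 h2 (by rw [← hc, inv_mul_cancel_right])

/-- Every element is conjugate to an element of `H` or to a cyclically reduced word. -/
lemma exists_cycRed (g : FP H) :
    (∃ h, IsConj g (inc h)) ∨ ∃ l, l ≠ [] ∧ CycRed l ∧ IsConj g (P l) := by
  obtain ⟨h, l, hl, rfl⟩ := exists_normal g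
  obtain ⟨n, hn⟩ : ∃ n, l.length ≤ n := ⟨_, le_rfl⟩
  induction n generalizing h l with
  | zero =>
    obtain rfl : l = [] := List.length_eq_zero_iff.1 (by omega)
    exact Or.inl ⟨h, by rw [P_nil, mul_one]⟩
  | succ n ih =>
    obtain rfl | ⟨m, ⟨e, g⟩, rfl⟩ := eq_nil_or_concat l
    · exact ih _ _ hl (by simp)
    rw [concat_eq_append] at *
    have hc : IsConj (inc h * P (m ++ [(e, g)])) (P (m ++ [(e, g * h)])) :=
      isConj_iff.2 ⟨(inc h)⁻¹, by simp [mul_assoc, L_mul_inc]⟩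
    have hr := red_concat hl (g * h)
    by_cases hcr : CycRed (m ++ [(e, g * h)])
    · exact Or.inr ⟨_, by simp, hcr, hc⟩
    cases m with
    | nil => exact absurd ((Cycle.chain_singleton _ _).2 fun _ => rfl) hcr
    | cons a m =>
      have hnr : ¬ Rel (e, g * h) a := fun hrel => hcr <| by
        rw [cons_append] at hr ⊢
        refine (Cycle.chain_coe_cons Rel a _).2 ?_
        rw [← cons_append]
        refine isChain_append.2 ⟨hr, isChain_singleton _, fun x hx y hy => ?_⟩
        obtain rfl : a = y := by simpa using hy
        obtain rfl : (e, g * h) = x := by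
          rw [← cons_append, List.getLast?_concat] at hx; simpa using hx
        exact hrel
      obtain ⟨a1, a2⟩ := a
      simp only [Rel, Classical.not_imp] at hnr
      have hc2 : IsConj (P (((a1, a2) :: m) ++ [(e, g * h)])) (inc a2 * P m) :=
        isConj_iff.2 ⟨L (e, 1), by
          have : L (e, 1) * (L (a1, a2) * P m) = inc a2 * P m := by
            rw [← mul_assoc, L_cancel (units_eq_neg hnr.2)]
          simp [mul_assoc, hnr.1, this]⟩
      have hm : Red m := (isChain_append.1 hl).1.of_cons
      rcases ih a2 m hm (by simp at hn; omega) with ⟨h', hh⟩ | ⟨l, h1, h2, h3⟩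
      · exact Or.inl ⟨h', (hc.trans hc2).trans hh⟩
      · exact Or.inr ⟨l, h1, h2, (hc.trans hc2).trans h3⟩

/-- Functoriality. -/
def map {K : Type*} [Group K] (f : H →* K) : FP H →* FP K := lift (inc.comp f) (t K)

lemma map_P {K : Type*} [Group K] (f : H →* K) (l : List (ℤˣ × H)) :
    map f (P l) = P (l.map fun a => (a.1, f a.2)) := by
  induction l with
  | nil => simp
  | cons a l ih => rw [P_cons, map_mul, ih, List.map_cons, P_cons]; simp [L, map]

lemma map_inc {K : Type*} [Group K] (f : H →* K) (h : H) : map f (inc h) = inc (f h) := by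
  simp [map]

lemma Red.map {K : Type*} [Group K] {f : H →* K} (hf : Injective f)
    {l : List (ℤˣ × H)} (h : Red l) : Red (l.map fun a => (a.1, f a.2)) :=
  (List.isChain_map _).2 (h.imp fun _ _ hab h1 => hab ((map_eq_one_iff f hf).1 h1))

lemma CycRed.map {K : Type*} [Group K] {f : H →* K} (hf : Injective f)
    {l : List (ℤˣ × H)} (h : CycRed l) : CycRed (l.map fun a => (a.1, f a.2)) := by
  unfold CycRed at *
  have := (Cycle.chain_map (r := Rel) (fun a : ℤˣ × H => (a.1, f a.2)) (s := (l : Cycle _))).2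
    (h.imp fun _ _ hab h1 => hab ((map_eq_one_iff f hf).1 h1))
  exact this

end FP

namespace FP
variable {H : Type*} [Group H]

lemma P_mem {K : Subgroup (FP H)} (ht : t H ∈ K) {l : List (ℤˣ × H)}
    (hl : ∀ a ∈ l, inc a.2 ∈ K) : P l ∈ K := by
  induction l with
  | nil => exact one_mem _
  | cons a l ih =>
    rw [P_cons]
    exact mul_mem (mul_mem (zpow_mem ht _) (hl a (by simp)))
      (ih fun b hb => hl b (List.mem_cons_of_mem _ hb))

/-- The endomorphism fixing `t` and conjugating `H` by `w`. -/
abbrev cmap (w : H) : FP H →* FP H := map (MulAut.conj w).toMonoidHom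

lemma conj_injective (w : H) : Injective (MulAut.conj w).toMonoidHom :=
  (MulAut.conj w).injective

/-- The list version of `cmap`. -/
def cl (w : H) (l : List (ℤˣ × H)) : List (ℤˣ × H) :=
  l.map fun a => (a.1, (MulAut.conj w).toMonoidHom a.2)

lemma cl_rotate (w : H) (l : List (ℤˣ × H)) (n : ℕ) :
    cl w (l.rotate n) = (cl w l).rotate n := List.map_rotate _ _ _

lemma commute_of_isRotated {w : H} {l : List (ℤˣ × H)} (h1 : l ≠ []) (h : cl w l ~r l) :
    ∃ N : ℤ, N ≠ 0 ∧ ∀ a ∈ l, Commute a.2 (w ^ N) := by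
  obtain ⟨n, hn⟩ := h.symm
  have key : ∀ k : ℕ, cl (w ^ k) l = l.rotate (n * k) := fun k => by
    induction k with
    | zero => simp [cl]
    | succ k ih =>
      rw [mul_add, mul_one, ← List.rotate_rotate, ← ih, ← cl_rotate, hn]
      simp [cl, pow_succ, mul_assoc]
  refine ⟨l.length, by exact_mod_cast (List.length_pos_iff.2 h1).ne', fun a ha => ?_⟩
  have h2 := key l.length
  rw [mul_comm, List.rotate_length_mul] at h2
  have h3 : (fun a : ℤˣ × H => (a.1, (MulAut.conj (w ^ l.length)).toMonoidHom a.2)) a = id a :=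
    List.map_inj_left.1 (h2.trans (List.map_id l).symm) a ha
  have h4 := congrArg Prod.snd h3
  simp only [MulEquiv.toMonoidHom_eq_coe, MonoidHom.coe_coe, MulAut.conj_apply, id] at h4
  rw [zpow_natCast]
  exact (mul_inv_eq_iff_eq_mul.1 h4).symm

/-- Elements whose conjugacy class is invariant under `cmap w`. -/
lemma twist {K : Type*} [Group K] {f : K →* H} (hf : Injective f) {w : H} {v : FP K}
    (h : IsConj (cmap w (map f v)) (map f v)) :
    (∃ k, IsConj v (inc k)) ∨ ∃ l, l ≠ [] ∧ CycRed l ∧ IsConj v (P l) ∧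
      ∃ N : ℤ, N ≠ 0 ∧ ∀ a ∈ l, Commute (f a.2) (w ^ N) := by
  refine (exists_cycRed v).imp id ?_
  rintro ⟨l, h1, h2, h3⟩
  refine ⟨l, h1, h2, h3, ?_⟩
  have h4 := map_P f l
  set l' := l.map fun a => (a.1, f a.2) with hl'
  have h5 : CycRed l' := h2.map hf
  have h6 : IsConj (map f v) (P l') := h4 ▸ (map f).map_isConj h3
  have h7 : IsConj (cmap w (map f v)) (P (cl w l')) := by
    have := (cmap w).map_isConj h6
    rwa [map_P] at this
  have h8 : l' ≠ [] := by simpa [hl'] using h1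
  have h9 : cl w l' ~r l' := isRotated_of_isConj (h5.map (conj_injective w)) h5
    (by simpa [cl] using h8) h8 ((h7.symm.trans h).trans h6)
  obtain ⟨N, hN, h10⟩ := commute_of_isRotated h8 h9
  exact ⟨N, hN, fun a ha => h10 (a.1, f a.2) (List.mem_map.2 ⟨a, ha, rfl⟩)⟩

/-- Fixed elements of `cmap w`, up to an inner automorphism. -/
lemma fixed {w g : H} {u : FP H} (h : cmap w u = inc g * u * (inc g)⁻¹) :
    (∃ k, u = inc k ∧ w * k * w⁻¹ = g * k * g⁻¹) ∨
      ∃ k l, l ≠ [] ∧ u = inc k * P l ∧ w * k * w⁻¹ = g * k := by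
  obtain ⟨k, l, hl, rfl⟩ := exists_normal u
  rw [map_mul, map_P, map_inc] at h
  obtain rfl | ⟨m, ⟨e, b⟩, rfl⟩ := eq_nil_or_concat l
  · refine Or.inl ⟨k, by simp, inc_injective ?_⟩
    simpa using h
  · rw [concat_eq_append] at *
    refine Or.inr ⟨k, _, by simp, rfl, ?_⟩
    have h2 : inc ((MulAut.conj w).toMonoidHom k) * P (cl w (m ++ [(e, b)])) =
        inc (g * k) * P (m ++ [(e, b * g⁻¹)]) := by
      rw [cl, h]
      simp [mul_assoc, ← L_mul_inc]
    have := (unique (hl.map (conj_injective w)) (red_concat hl _) h2).1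
    simpa using this

lemma fixed_mem {w : H} {u : FP H} (h : cmap w u = u)
    (hw : ∀ k, Commute k w → k ∈ zpowers w) :
    u ∈ Subgroup.closure {t H, inc w} := by
  obtain ⟨k, l, hl, rfl⟩ := exists_normal u
  rw [map_mul, map_P, map_inc] at h
  obtain ⟨h1, h2⟩ := unique (hl.map (conj_injective w)) hl h
  have h3 : ∀ k, (MulAut.conj w).toMonoidHom k = k →
      inc k ∈ Subgroup.closure {t H, inc w} := fun k hk => by
    obtain ⟨n, rfl⟩ := hw k (by
      simp only [MulEquiv.toMonoidHom_eq_coe, MonoidHom.coe_coe, MulAut.conj_apply] at hk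
      exact (mul_inv_eq_iff_eq_mul.1 hk).symm)
    simp only [map_zpow]
    exact zpow_mem (Subgroup.subset_closure (by simp)) _
  refine mul_mem (h3 k h1) (P_mem (Subgroup.subset_closure (by simp)) fun a ha => h3 _ ?_)
  have h4 : (fun a : ℤˣ × H => (a.1, (MulAut.conj w).toMonoidHom a.2)) a = id a :=
    List.map_inj_left.1 (h2.trans (List.map_id l).symm) a ha
  exact congrArg Prod.snd h4

end FP

namespace FP

/-- The free group of rank two. -/
abbrev W := FP (Multiplicative ℤ)

/-- The second generator of `W`. -/
def X : W := inc (ofAdd 1)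

abbrev Lt := ℤˣ × Multiplicative ℤ

/-- The first sign of a word followed by a letter of sign `s`. -/
def hd (l : List Lt) (s : ℤˣ) : ℤˣ := match l with
  | [] => s
  | a :: _ => a.1

@[simp] lemma hd_nil (s : ℤˣ) : hd [] s = s := rfl
@[simp] lemma hd_cons (a : Lt) (l : List Lt) (s : ℤˣ) : hd (a :: l) s = a.1 := rfl
@[simp] lemma hd_append (l k : List Lt) (s : ℤˣ) : hd (l ++ k) s = hd l (hd k s) := by
  cases l <;> rfl

/-- The effect of the twist on a word followed by a letter of sign `s`. -/
def tw : List Lt → ℤˣ → List Lt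
  | [], _ => []
  | a :: l, s => (a.1, a.2 * ofAdd (if a.1 = hd l s then (a.1 : ℤ) else 0)) :: tw l s

/-- The sum of the signed exponents at the places where the sign does not change. -/
def sm : List Lt → ℤˣ → ℤ
  | [], _ => 0
  | a :: l, s => (if a.1 = hd l s then (a.1 : ℤ) * a.2.toAdd else 0) + sm l s

/-- The number of places where the sign does not change. -/
def ct : List Lt → ℤˣ → ℕ
  | [], _ => 0
  | a :: l, s => (if a.1 = hd l s then 1 else 0) + ct l s

/-- Consecutive letters have opposite signs. -/
def Alt (a b : Lt) : Prop := a.1 ≠ b.1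

lemma hd_tw (l : List Lt) (s : ℤˣ) (r : ℤˣ) : hd (tw l s) r = hd l r := by
  cases l <;> rfl

lemma sm_tw (l : List Lt) (s : ℤˣ) : sm (tw l s) s = sm l s + ct l s := by
  induction l with
  | nil => simp [tw, sm, ct]
  | cons a l ih =>
    simp only [tw, sm, ct, ih, hd_tw]
    rcases Int.units_eq_one_or a.1 with h | h <;> simp only [h] <;> split_ifs <;> simp <;> ring

lemma sm_append (l k : List Lt) (s : ℤˣ) : sm (l ++ k) s = sm l (hd k s) + sm k s := by
  induction l with
  | nil => simp [sm]
  | cons a l ih => simp only [cons_append, sm, ih, hd_append]; ring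

lemma sm_rotated {l l' : List Lt} (h : l ~r l') : sm l (hd l 1) = sm l' (hd l' 1) := by
  obtain ⟨n, rfl⟩ := h
  induction n with
  | zero => simp
  | succ n ih =>
    rw [ih, ← List.rotate_rotate]
    cases l.rotate n with
    | nil => simp
    | cons a m =>
      simp only [List.rotate_cons_succ, List.rotate_zero, sm_append, hd_append, hd_cons, hd_nil, sm, add_zero]
      exact add_comm _ _

lemma alt_of_ct {l : List Lt} {s : ℤˣ} (h : ct l s = 0) (b : Multiplicative ℤ) :
    (l ++ [(s, b)]).IsChain Alt := by
  induction l with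
  | nil => exact isChain_singleton _
  | cons a l ih =>
    simp only [ct, Nat.add_eq_zero_iff, ite_eq_right_iff, one_ne_zero, imp_false] at h
    cases l with
    | nil => exact isChain_pair.2 h.1
    | cons b l => exact IsChain.cons_cons h.1 (ih h.2)

lemma red_tw {l : List Lt} {s : ℤˣ} {b : Multiplicative ℤ} (b' : Multiplicative ℤ)
    (h : Red (l ++ [(s, b)])) : Red (tw l s ++ [(s, b')]) := by
  induction l with
  | nil => exact isChain_singleton _
  | cons a l ih =>
    have h1 := ih h.of_cons
    have key (c d : Lt) (hc : c.1 = hd l s) (hd' : d.1 = hd l s) (hr : Rel a d) : Rel (a.1, a.2 *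
        ofAdd (if a.1 = hd l s then (a.1 : ℤ) else 0)) c := fun h2 => by
      by_contra h3
      rw [hc] at h3
      exact h3 ((hr (by simpa [h3] using h2)).trans hd')
    cases l with
    | nil => exact isChain_pair.2 (key _ _ rfl rfl (isChain_pair.1 h))
    | cons a' l => exact IsChain.cons_cons (key _ _ rfl rfl (isChain_cons_cons.1 h).1) h1

/-- The twist `t ↦ t x`. -/
def T : W →* W := lift inc (t _ * X)

@[simp] lemma T_t : T (t _) = t _ * X := lift_t _ _
@[simp] lemma T_X : T X = X := lift_inc _ _ _

/-- The correction term. -/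
def cr (s : ℤˣ) : W := if s = 1 then 1 else X⁻¹

lemma inc_ofAdd (n : ℤ) : (inc (ofAdd n) : W) = X ^ n := by
  rw [X, ← map_zpow, ← ofAdd_zsmul]; simp

lemma inc_eq (a : Multiplicative ℤ) : (inc a : W) = X ^ a.toAdd := by
  rw [← inc_ofAdd]; rfl

lemma T_P (l : List Lt) (s : ℤˣ) : T (P l) * cr s = cr (hd l s) * P (tw l s) := by
  induction l with
  | nil => simp [tw]
  | cons a l ih =>
    rw [P_cons, map_mul, mul_assoc, ih, tw, P_cons, ← mul_assoc, ← mul_assoc]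
    congr 1
    obtain ⟨e, a⟩ := a
    generalize hd l s = r
    simp only [L, map_mul, map_zpow, T_t, T_X, inc_eq, cr, hd_cons, toAdd_mul,
      toAdd_ofAdd]
    rcases Int.units_eq_one_or e with rfl | rfl <;> rcases Int.units_eq_one_or r with rfl | rfl <;>
      simp [zpow_add, mul_assoc, (by decide : (1 : ℤˣ) ≠ -1), (by decide : (-1 : ℤˣ) ≠ 1)] <;> group

/-- A cyclic word invariant under the twist is alternating. -/
lemma alternating {l : List Lt} (h0 : l ≠ []) (hl : CycRed l) (h : IsConj (T (P l)) (P l)) :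
    Cycle.Chain Alt (l : Cycle Lt) := by
  obtain ⟨a, m, rfl⟩ := exists_cons_of_ne_nil h0
  have h1 : CycRed (tw (a :: m) a.1) := (Cycle.chain_coe_cons Rel _ _).2
    (red_tw (l := a :: m) (s := a.1) (b := a.2) _ ((Cycle.chain_coe_cons Rel _ _).1 hl))
  have h2 : IsConj (T (P (a :: m))) (P (tw (a :: m) a.1)) := isConj_iff.2 ⟨(cr a.1)⁻¹, by
    rw [inv_inv, mul_assoc, T_P, hd_cons, inv_mul_cancel_left]⟩
  have h4 := sm_rotated (isRotated_of_isConj h1 hl (by simp [tw]) h0 (h2.symm.trans h))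
  rw [hd_tw, hd_cons, sm_tw] at h4
  exact alt_of_ct (l := a :: m) (s := a.1) (by simpa using h4) a.2

/-- The automorphism exchanging the two generators. -/
def sw : W →* W := lift (zpowersHom W (t _)) X

@[simp] lemma sw_t : sw (t _) = X := lift_t _ _
@[simp] lemma sw_X : sw X = t _ := by rw [sw, X, lift_inc]; simp

lemma W_hom_ext {G : Type*} [Group G] {f g : W →* G} (h1 : f (t _) = g (t _))
    (h2 : f X = g X) : f = g :=
  hom_ext (MonoidHom.ext_mint h2) h1

/-- The other twist `x ↦ x t`. -/
def T' : W →* W := lift (zpowersHom W (X * t _)) (t _)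

@[simp] lemma T'_t : T' (t _) = t _ := lift_t _ _
@[simp] lemma T'_X : T' X = X * t _ := by rw [T', X, lift_inc]; simp [X]

lemma sw_T' (u : W) : sw (T' u) = T (sw u) := by
  have : sw.comp T' = T.comp sw := W_hom_ext (by simp) (by simp)
  exact congr_fun this u

/-- The sign of an exponent. -/
def sg (a : Multiplicative ℤ) : ℤˣ := if 0 < a.toAdd then 1 else -1

/-- The word for `x ^ a * t ^ (-e)` with the roles of the generators exchanged. -/
def blk (a : Lt) : List Lt :=
  List.replicate (a.2.toAdd.natAbs - 1) (sg a.2, 1) ++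
    [(sg a.2, ofAdd (-(a.1 : ℤ)))]

lemma P_replicate (n : ℕ) (e : ℤˣ) :
    P (List.replicate n ((e, 1) : Lt)) = t _ ^ ((e : ℤ) * n) := by
  induction n with
  | zero => simp
  | succ n ih =>
    rw [List.replicate_succ, P_cons, ih, L]
    simp only [map_one, mul_one, ← zpow_add]
    congr 1; push_cast; ring

lemma sg_mul (a : Multiplicative ℤ) (n : ℕ) (h : a.toAdd.natAbs = n + 1) :
    (sg a : ℤ) * n + sg a = a.toAdd := by
  unfold sg; split_ifs <;> simp <;> omega

lemma P_blk (a : Lt) (ha : a.2 ≠ 1) : P (blk a) = t _ ^ a.2.toAdd * X ^ (-(a.1 : ℤ)) := by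
  obtain ⟨n, hn⟩ : ∃ n, a.2.toAdd.natAbs = n + 1 := ⟨a.2.toAdd.natAbs - 1, by
    have : a.2.toAdd ≠ 0 := ha
    omega⟩
  rw [blk, hn, P_append, Nat.add_sub_cancel, P_replicate, P_cons, P_nil, mul_one, L, inc_ofAdd,
    ← mul_assoc, ← zpow_add, sg_mul _ _ hn]

lemma red_blk (a b : Lt) : Red (blk a ++ [b]) := by
  rw [blk, List.append_assoc]
  have h0 : Rel (sg a.2, ofAdd (-(a.1 : ℤ))) b := fun h => by
    have h1 : -(a.1 : ℤ) = 0 := h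
    simp at h1
  induction a.2.toAdd.natAbs - 1 with
  | zero => exact isChain_pair.2 h0
  | succ n ih =>
    rw [List.replicate_succ, cons_append]
    cases n <;> exact IsChain.cons_cons (fun _ => rfl) ih

lemma red_flatMap (l : List Lt) (b : Lt) : Red (l.flatMap blk ++ [b]) := by
  induction l with
  | nil => exact isChain_singleton _
  | cons a l ih =>
    rw [List.flatMap_cons, List.append_assoc]
    cases h : l.flatMap blk ++ [b] with
    | nil => simp at h
    | cons c m =>
      rw [h] at ih
      have := red_blk a c
      rw [show blk a ++ c :: m = (blk a ++ [c]) ++ m by simp]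
      rw [Red, isChain_append] at this ⊢
      refine ⟨isChain_append.2 this, ih.of_cons, fun x hx y hy => ?_⟩
      rw [List.getLast?_concat] at hx
      obtain rfl : c = x := by simpa using hx
      cases m with
      | nil => simp at hy
      | cons d m =>
        obtain rfl : d = y := by simpa using hy
        exact (isChain_cons_cons.1 ih).1

lemma sw_P (l : List Lt) (s : ℤˣ) (b : Multiplicative ℤ) (h1 : ∀ a ∈ l, a.2 ≠ 1)
    (h2 : (l ++ [(s, b)]).IsChain Alt) :
    sw (P l) * X ^ (s : ℤ) = X ^ (hd l s : ℤ) * P (l.flatMap blk) := by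
  induction l with
  | nil => simp
  | cons a l ih =>
    rw [P_cons, map_mul, mul_assoc, ih (fun c hc => h1 c (List.mem_cons_of_mem _ hc)) h2.of_cons,
      List.flatMap_cons, P_append, P_blk a (h1 a (by simp)), hd_cons, L]
    have : hd l s = - a.1 := by
      refine (neg_eq_iff_eq_neg.2 (units_eq_neg ?_)).symm
      cases l with
      | nil => exact (isChain_pair.1 h2 : Alt _ _)
      | cons c l => exact (isChain_cons_cons.1 h2).1
    rw [this]
    simp only [map_mul, map_zpow, sw_t, inc_eq, sw_X, Units.val_neg, mul_assoc]

/-- The successor of a letter in a power of the commutator. -/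
def nx (a : Lt) : Lt := (-a.1, a.2⁻¹)

lemma nx_nx (a : Lt) : nx (nx a) = a := by simp [nx]
lemma nx_ne (a : Lt) : nx a ≠ a := fun h => by
  have : -a.1 = a.1 := congrArg Prod.fst h
  simp at this

lemma periodic (n : ℕ) (a : Lt) (l : List Lt) (hn : l.length ≤ n)
    (h : (a :: (l ++ [a])).IsChain (fun p q => q = nx p)) :
    ∃ k : ℕ, P (a :: l) = (L a * L (nx a)) ^ k := by
  induction n using Nat.strong_induction_on generalizing l with
  | _ n ih =>
    match l with
    | [] => exact absurd (isChain_pair.1 h).symm (nx_ne a)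
    | [q] =>
      obtain rfl := (isChain_cons_cons.1 h).1
      exact ⟨1, by simp⟩
    | q :: r :: l =>
      simp only [cons_append, isChain_cons_cons] at h
      obtain ⟨rfl, rfl, h⟩ := h
      rw [nx_nx] at h
      obtain ⟨k, hk⟩ := ih (n - 1) (by simp at hn; omega) l (by simp at hn; omega) h
      refine ⟨k + 1, ?_⟩
      rw [P_cons, P_cons, nx_nx, hk, pow_succ', mul_assoc]

lemma conj_cases (a : Lt) (h : a.2.toAdd.natAbs = 1) :
    IsConj (L a * L (nx a)) (t _ * X * (t _)⁻¹ * X⁻¹) ∨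
      IsConj (L a * L (nx a)) (t _ * X * (t _)⁻¹ * X⁻¹)⁻¹ := by
  obtain ⟨e, a⟩ := a
  simp only [L, nx, inc_eq, toAdd_inv]
  simp only at h
  rcases Int.natAbs_eq_iff.1 h with h | h <;> rw [h] <;>
    rcases Int.units_eq_one_or e with rfl | rfl
  · exact Or.inl (isConj_iff.2 ⟨1, by simp [mul_assoc]⟩)
  · exact Or.inr (isConj_iff.2 ⟨t _, by simp [mul_assoc]⟩)
  · exact Or.inr (isConj_iff.2 ⟨X, by simp [mul_assoc]⟩)
  · exact Or.inl (isConj_iff.2 ⟨X * t _, by simp [mul_assoc]⟩)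

/-- The exponent of `t`. -/
def chT : W →* Multiplicative ℤ := lift 1 (ofAdd 1)

lemma chT_X : chT X = 1 := by simp [chT, X]
lemma chT_t : chT (t _) = ofAdd 1 := by simp [chT]

/-- Elements of the free group of rank two whose conjugacy class is invariant under both twists. -/
lemma classification {u : W} (h1 : IsConj (T u) u) (h2 : IsConj (T' u) u) :
    ∃ k : ℤ, IsConj u ((t _ * X * (t _)⁻¹ * X⁻¹) ^ k) := by
  rcases exists_cycRed u with ⟨h, hh⟩ | ⟨l, l0, lr, lu⟩
  · refine ⟨0, ?_⟩
    rw [inc_eq] at hh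
    have e1 := (chT.map_isConj hh)
    have e2 := (chT.map_isConj ((T'.map_isConj hh).symm.trans (h2.trans hh)))
    rw [isConj_iff_eq] at e1 e2
    have e3 : h.toAdd = 0 := by
      have := congrArg toAdd e2
      simpa [T'_X, chT_X, chT_t] using this
    rw [e3] at hh
    simpa using hh
  have a1 := alternating l0 lr (((T.map_isConj lu).symm.trans h1).trans lu)
  obtain ⟨p, m, rfl⟩ := exists_cons_of_ne_nil l0
  set l := p :: m with hl
  have a2 : (l ++ [(p.1, p.2)]).IsChain Alt := (Cycle.chain_coe_cons _ _ _).1 a1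
  have r2 : (l ++ [(p.1, p.2)]).IsChain Rel := (Cycle.chain_coe_cons _ _ _).1 lr
  have hne : ∀ a ∈ l, a.2 ≠ 1 := fun a ha h => by
    obtain ⟨i, hi, rfl⟩ := List.getElem_of_mem ha
    have h1 := List.isChain_iff_getElem.1 a2 i (by simpa)
    have h2 := List.isChain_iff_getElem.1 r2 i (by simpa)
    rw [List.getElem_append_left hi] at h1 h2
    exact h1 (h2 h)
  have c1 : IsConj (sw (P l)) (P (l.flatMap blk)) := by
    have := sw_P l p.1 p.2 hne a2
    refine isConj_iff.2 ⟨(X ^ (p.1 : ℤ))⁻¹, ?_⟩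
    rw [inv_inv, mul_assoc, this, hl, hd_cons, inv_mul_cancel_left]
  have f0 : l.flatMap blk ≠ [] := by simp [hl, blk]
  have fr : CycRed (l.flatMap blk) := by
    obtain ⟨c, k, hc⟩ := exists_cons_of_ne_nil f0
    rw [hc]
    refine (Cycle.chain_coe_cons _ _ _).2 ?_
    have := red_flatMap l c
    rwa [hc] at this
  have c2 : IsConj (sw u) (P (l.flatMap blk)) := (sw.map_isConj lu).trans c1
  have c3 : IsConj (T (sw u)) (sw u) := by rw [← sw_T']; exact sw.map_isConj h2
  have a3 := alternating f0 fr (((T.map_isConj c2).symm.trans c3).trans c2)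
  have a4 : (l.flatMap blk).IsChain Alt := by
    obtain ⟨c, k, hc⟩ := exists_cons_of_ne_nil f0
    rw [hc] at a3 ⊢
    have := (Cycle.chain_coe_cons _ _ _).1 a3
    rw [← cons_append] at this
    exact (isChain_append.1 this).1
  have n1 : ∀ a ∈ l, a.2.toAdd.natAbs = 1 := fun a ha => by
    have h0 : a.2.toAdd ≠ 0 := hne a ha
    by_contra h1
    obtain ⟨l1, l2, h2⟩ := List.append_of_mem ha
    rw [h2, List.flatMap_append, List.flatMap_cons] at a4
    have := List.isChain_iff_getElem.1
      (isChain_append.1 (isChain_append.1 a4).2.1).1 0 (by simp [blk]; omega)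
    grind [blk, Alt]
  have b1 : ∀ a ∈ l, blk a = [(sg a.2, ofAdd (-(a.1 : ℤ)))] := fun a ha => by
    simp [blk, n1 a ha]
  have b2 : l.flatMap blk = l.map fun a => (sg a.2, ofAdd (-(a.1 : ℤ))) := by
    rw [List.map_eq_flatMap, List.flatMap_congr b1]
  rw [b2] at a3
  have a6 : Cycle.Chain (fun a b => sg a.2 ≠ sg b.2) (l : Cycle Lt) :=
    (Cycle.chain_map (r := Alt) (fun a : Lt => ((sg a.2, ofAdd (-(a.1 : ℤ))) : Lt))).1 a3
  have a7 : (l ++ [p]).IsChain (fun p q => q = nx p) := by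
    have a6' : (l ++ [p]).IsChain (fun a b => sg a.2 ≠ sg b.2) :=
      (Cycle.chain_coe_cons _ _ _).1 a6
    have hm : ∀ a ∈ l ++ [p], a.2.toAdd.natAbs = 1 := fun a ha => n1 a (by simp_all; tauto)
    refine List.isChain_iff_getElem.2 fun i hi => ?_
    have i1 := List.isChain_iff_getElem.1 a2 i hi
    have i2 := List.isChain_iff_getElem.1 a6' i hi
    have i3 := hm _ (List.getElem_mem (by omega : i < (l ++ [p]).length))
    have i4 := hm _ (List.getElem_mem hi)
    refine Prod.ext (by rw [nx, units_eq_neg i1, neg_neg]) (toAdd.injective ?_)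
    simp only [nx, toAdd_inv]
    unfold sg at i2
    split_ifs at i2 <;> first | omega | exact absurd rfl i2
  obtain ⟨k, hk⟩ := periodic _ p m le_rfl a7
  rw [← hl] at hk
  rw [hk] at lu
  have pw : ∀ {a b : W} (_ : IsConj a b) (n : ℕ), IsConj (a ^ n) (b ^ n) := fun {a b} h n => by
    obtain ⟨c, rfl⟩ := isConj_iff.1 h
    exact isConj_iff.2 ⟨c, by rw [conj_pow]⟩
  rcases conj_cases p (n1 p (by simp [hl])) with h | h
  · exact ⟨k, lu.trans (by rw [zpow_natCast]; exact pw h k)⟩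
  · exact ⟨-k, lu.trans (by rw [zpow_neg, zpow_natCast, ← inv_pow]; exact pw h k)⟩

end FP

namespace FP
variable {H : Type*} [Group H]

/-- Cancellation must occur in a product of reduced words lying in `H`. -/
lemma cancel {m k : List (ℤˣ × H)} {a b : ℤˣ × H} {g g0 h : H} (h1 : Red (m ++ [a]))
    (h2 : Red (b :: k)) (h3 : inc h * P (m ++ [a]) * inc g * P (b :: k) = inc g0) :
    a.1 = -b.1 ∧ a.2 * g = 1 := by
  obtain ⟨e, c⟩ := a
  by_contra h4
  have h5 : Red (m ++ [(e, c * g)] ++ b :: k) := by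
    rw [Red, isChain_append]
    refine ⟨red_concat h1 _, h2, fun x hx y hy => ?_⟩
    obtain rfl : (e, c * g) = x := by simpa using hx
    obtain rfl : b = y := by simpa using hy
    intro h6
    by_contra h7
    exact h4 ⟨units_eq_neg h7, h6⟩
  have h6 : inc h * P (m ++ [(e, c * g)] ++ b :: k) = inc g0 * P [] := by
    rw [P_nil, mul_one, ← h3]
    simp [mul_assoc, ← L_mul_inc]
  have := (unique h5 isChain_nil h6).2
  simp at this

variable (z w : H)

/-- The entry contributed by the left of a letter. -/
def pre (w : H) (s : ℤˣ) : H := if s = 1 then w else 1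
/-- The entry contributed by the right of a letter. -/
def post (w : H) (s : ℤˣ) : H := if s = 1 then 1 else w⁻¹

/-- Letters of the image of a word under `t ↦ w * t⁻¹`, followed by `g`. -/
def flipW : List Lt → H → List (ℤˣ × H)
  | [], _ => []
  | (e, a) :: l, g =>
    (-e, post w e * z ^ a.toAdd * (match l with | [] => g | c :: _ => pre w c.1)) :: flipW l g

/-- The head of the image of a word. -/
def flipH (w : H) (l : List Lt) (g : H) : H := match l with | [] => g | c :: _ => pre w c.1

lemma flipW_cons (e : ℤˣ) (a : Multiplicative ℤ) (l : List Lt) (g : H) :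
    flipW z w ((e, a) :: l) g = (-e, post w e * z ^ a.toAdd * flipH w l g) :: flipW z w l g := rfl

/-- The homomorphism `X ↦ z`, `t ↦ w * t⁻¹`. -/
def flip : W →* FP H := lift ((inc).comp (zpowersHom H z)) (inc w * (t H)⁻¹)

lemma flip_L (a : Lt) :
    flip z w (L a) = inc (pre w a.1) * t H ^ (-a.1 : ℤ) * inc (post w a.1 * z ^ a.2.toAdd) := by
  obtain ⟨e, a⟩ := a
  rcases Int.units_eq_one_or e with rfl | rfl <;> simp [flip, L, pre, post, mul_assoc]

lemma flip_P (l : List Lt) (g : H) :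
    flip z w (P l) * inc g = inc (flipH w l g) * P (flipW z w l g) := by
  induction l with
  | nil => simp [flipH, flipW]
  | cons c l ih =>
    obtain ⟨e, a⟩ := c
    rw [P_cons, map_mul, mul_assoc, ih, flipW_cons, P_cons, flip_L]
    simp [L, flipH, mul_assoc]

variable {z w}

lemma red_flipW (hz2 : ∀ i j : ℤ, w⁻¹ * z ^ i * w = z ^ j → i = 0) {l : List Lt} (hl : Red l) (g : H) :
    Red (flipW z w l g) := by
  induction l with
  | nil => exact isChain_nil
  | cons c l ih =>
    obtain ⟨e, a⟩ := c
    cases l with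
    | nil => exact isChain_singleton _
    | cons d l =>
      obtain ⟨f, b⟩ := d
      have h1 := isChain_cons_cons.1 hl
      refine IsChain.cons_cons ?_ (ih h1.2)
      intro h2
      change -e = -f
      by_contra h3
      have h4 : e ≠ f := fun h => h3 (by rw [h])
      have h5 : a ≠ 1 := fun h => h4 (h1.1 h)
      change post w e * z ^ a.toAdd * pre w f = 1 at h2
      have h0 : z ^ a.toAdd = 1 := by
        rcases Int.units_eq_one_or e with rfl | rfl <;>
          rcases Int.units_eq_one_or f with rfl | rfl
        · exact absurd rfl h4
        · simpa [pre, post] using h2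
        · rw [pre, post, if_pos rfl, if_neg (by decide)] at h2
          have := mul_eq_one_iff_eq_inv.1 h2
          rwa [inv_mul_eq_iff_eq_mul, mul_inv_cancel] at this
        · exact absurd rfl h4
      exact h5 (hz2 a.toAdd 0 (by rw [h0]; simp))

lemma flipW_append (l : List Lt) (c : Lt) (k : List Lt) (g : H) :
    flipW z w (l ++ c :: k) g = flipW z w l (pre w c.1) ++ flipW z w (c :: k) g := by
  induction l with
  | nil => rfl
  | cons d l ih =>
    obtain ⟨e, a⟩ := d
    rw [cons_append, flipW_cons, flipW_cons, ih, cons_append]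
    cases l <;> rfl

lemma post_eq (hz : ∀ i j : ℤ, z ^ i * w * z ^ j ≠ 1) {e : ℤˣ} {i j : ℤ}
    (h : post w e * z ^ i * z ^ j = 1) : e = 1 ∧ z ^ (i + j) = 1 := by
  rcases Int.units_eq_one_or e with rfl | rfl
  · exact ⟨rfl, by simpa [post, zpow_add] using h⟩
  · rw [post, if_neg (by decide), mul_assoc, inv_mul_eq_one] at h
    exact absurd (by rw [h, mul_assoc, ← zpow_add, ← zpow_add]; ring_nf; simp) (hz 0 (-j-i))

lemma flip_classification (hz : ∀ i j : ℤ, z ^ i * w * z ^ j ≠ 1)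
    (hz2 : ∀ i j : ℤ, w⁻¹ * z ^ i * w = z ^ j → i = 0) {h : W} {g0 : H}
    (hh : flip z w h * map (zpowersHom H z) h = inc g0) :
    ∃ i : ℤ, h = X ^ i ∨ h = X ^ i * t _ * (X ^ i)⁻¹ := by
  have hinj : Injective (zpowersHom H z) := by
    rw [injective_iff_map_eq_one]
    intro a ha
    exact hz2 a.toAdd 0 (by rw [show z ^ a.toAdd = 1 from ha]; simp)
  obtain ⟨a0, l, hl, rfl⟩ := exists_normal h
  have hfi : ∀ a, flip z w (inc a) = inc (z ^ a.toAdd) := fun a => by simp [flip]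
  rw [map_mul, map_mul, map_inc, map_P, hfi] at hh
  have hfP := fun l => flip_P z w l 1
  simp only [map_one, mul_one] at hfP
  obtain rfl | ⟨m, ⟨e, b⟩, rfl⟩ := eq_nil_or_concat l
  · exact ⟨a0.toAdd, Or.inl (by rw [P_nil, mul_one, inc_eq])⟩
  rw [concat_eq_append] at *
  have r1 := red_flipW hz2 hl 1
  have r2 := hl.map hinj
  rw [hfP] at hh
  rw [flipW_append] at hh r1
  have key : ∀ c k, m ++ [(e, b)] = c :: k → c.1 = 1 ∧ e = 1 ∧ b = a0⁻¹ := fun c k hc => by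
    rw [hc, List.map_cons] at hh r2
    have h1 : inc (z ^ a0.toAdd * flipH w (c :: k) 1) *
        P (flipW z w m (pre w e) ++ flipW z w [(e, b)] 1) * inc (z ^ a0.toAdd) *
        P ((c.1, zpowersHom H z c.2) :: k.map fun a => (a.1, zpowersHom H z a.2)) = inc g0 := by
      rw [← hh, map_mul]
      simp only [mul_assoc]
      rfl
    have h2 := cancel r1 r2 h1
    have h3 : post w e * z ^ b.toAdd * z ^ a0.toAdd = 1 := by
      have := h2.2
      simpa [flipH] using this
    obtain ⟨rfl, h4⟩ := post_eq hz h3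
    have h5 : b * a0 = 1 := hinj (by rw [map_one]; exact h4)
    exact ⟨(neg_injective h2.1).symm, rfl, eq_inv_of_mul_eq_one_left h5⟩
  obtain ⟨c, k, hc⟩ := exists_cons_of_ne_nil (show m ++ [(e, b)] ≠ [] by simp)
  obtain ⟨hc1, rfl, rfl⟩ := key c k hc
  clear key
  cases m with
  | nil =>
    refine ⟨a0.toAdd, Or.inr ?_⟩
    simp [L, inc_eq, mul_assoc]
  | cons d m =>
    exfalso
    obtain ⟨d1, a1⟩ := d
    obtain ⟨rfl, rfl⟩ : (d1, a1) = c ∧ m ++ [(1, a0⁻¹)] = k := by simpa using hc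
    obtain rfl : d1 = 1 := hc1
    obtain ⟨m', ⟨f, a'⟩, hm⟩ :=
      (eq_nil_or_concat ((1, a1) :: m : List Lt)).resolve_left (by simp)
    rw [concat_eq_append] at hm
    obtain ⟨⟨f', a''⟩, k, hk⟩ := exists_cons_of_ne_nil (show m ++ [(1, a0⁻¹)] ≠ [] by simp)
    have hlm : Red ((1, a1) :: m) := (isChain_append.1 hl).1
    have q1 := red_flipW hz2 hlm w
    have q2 : Red (m ++ [(1, a0⁻¹)]) := by rw [cons_append] at hl; exact hl.of_cons
    have q3 := q2.map hinj
    have e1 : pre w 1 = w := rfl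
    rw [e1, hm, flipW_append] at hh
    rw [hm, flipW_append] at q1
    rw [hk, List.map_cons] at q3
    have h1 : inc (z ^ a0.toAdd * w) *
        P (flipW z w m' (pre w f) ++ flipW z w [(f, a')] w) * inc (z ^ a1.toAdd) *
        P ((f', zpowersHom H z a'') :: k.map fun a => (a.1, zpowersHom H z a.2)) = inc g0 := by
      rw [← hh]
      rw [← hm, cons_append, hk]
      simp only [flipH, pre, flipW, post, P_append, P_cons, P_nil, List.map_cons, L]
      simp [mul_assoc, map_mul]
    have h2 := cancel q1 q3 h1
    have h3 : post w f * z ^ a'.toAdd * w * z ^ a1.toAdd = 1 := by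
      have := h2.2
      simpa [flipH] using this
    rcases Int.units_eq_one_or f with rfl | rfl
    · exact hz a'.toAdd a1.toAdd (by simpa [post] using h3)
    · rw [post, if_neg (by decide)] at h3
      have h4 := hz2 a'.toAdd (-a1.toAdd) (by rw [zpow_neg]; exact eq_inv_of_mul_eq_one_left h3)
      rw [hm, List.append_assoc] at hl
      have h5 : Rel ((-1, a') : Lt) (1, a0⁻¹) :=
        (isChain_cons_cons.1 (isChain_append.1 hl).2.1).1
      have h6 : (-1 : ℤˣ) = 1 := h5 h4
      exact absurd h6 (by decide)

end FP

section

open Braid.FP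

/-! ### Inclusions -/

/-- The inclusion of free groups. -/
def inF (k : ℕ) : F k →* F (k + 1) := F.lift k (x (k + 1))

lemma inF_x {k i : ℕ} (h : i < k) : inF k (x k i) = x (k + 1) i := F.lift_x _ h

lemma inF_zl {k j : ℕ} (h : j ≤ k) : inF k (zl k j) = zl (k + 1) j := by
  induction j with
  | zero => simp [zl]
  | succ j ih => rw [zl, zl, map_mul, ih (by omega), inF_x (by omega)]

lemma z_succ (k : ℕ) : z (k + 1) = x (k + 1) k * inF k (z k) := by
  rw [z, zl, z, inF_zl le_rfl]

/-- The inclusion of braid groups. -/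
abbrev inB (k : ℕ) : Br k →* Br (k + 1) := (ι k).comp br

lemma inB_σ {k i : ℕ} (h : i + 1 < k := by omega) : inB k (σ k i) = σ (k + 1) i := ι_br_σ h

lemma act_inB_inF (k : ℕ) (b : Br k) (v : F k) :
    act (k + 1) (inB k b) (inF k v) = inF k (act k b v) := by
  refine Br.aut_equivariant (act k) (fun b => act (k + 1) (inB k b)) (inF k) (fun i hi v => .symm ?_)
    b v |>.symm
  rw [inB_σ hi]
  have := F.hom_ext (f := (act (k + 1) (σ (k + 1) i)).toMonoidHom.comp (inF k))
    (g := (inF k).comp (act k (σ k i)).toMonoidHom) (fun j hj => by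
      change act (k + 1) (σ (k + 1) i) (inF k (x k j)) = inF k (act k (σ k i) (x k j))
      rw [inF_x hj]
      by_cases h1 : j = i
      · subst h1
        rw [act_σ_self, act_σ_self, map_mul, map_mul, map_inv, inF_x hj,
          inF_x hi]
      · by_cases h2 : j = i + 1
        · subst h2
          rw [act_σ_succ, act_σ_succ, inF_x (by omega)]
        · rw [act_σ_of_ne h1 h2, act_σ_of_ne h1 h2, inF_x hj])
  exact congr_fun this v

lemma act_inB_last (k : ℕ) (b : Br k) : act (k + 1) (inB k b) (x (k + 1) k) = x (k + 1) k := by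
  refine Br.mem_of_gens ((stabilizer (MulAut (F (k + 1))) (x (k + 1) k)).comap
    ((act (k + 1)).comp (inB k))) (fun i hi => ?_) b
  change act (k + 1) (inB k (σ k i)) _ = _
  rw [inB_σ hi, act_σ_of_ne]

/-! ### Free product decompositions of the free group -/

/-- Splitting off the last generator. -/
def fpA (k : ℕ) : F (k + 1) →* FP (F k) :=
  F.lift (k + 1) fun i => if i < k then inc (x k i) else t _

/-- The inverse of `fpA`. -/
def fpA' (k : ℕ) : FP (F k) →* F (k + 1) := lift (inF k) (x (k + 1) k)

lemma fpA_x {k i : ℕ} (h : i < k) : fpA k (x (k + 1) i) = inc (x k i) := by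
  rw [fpA, F.lift_x _, if_pos h]

lemma fpA_last (k : ℕ) : fpA k (x (k + 1) k) = t _ := by
  rw [fpA, F.lift_x _, if_neg (by omega)]

lemma fpA_inF (k : ℕ) (v : F k) : fpA k (inF k v) = inc v := by
  have := F.hom_ext (f := (fpA k).comp (inF k)) (g := inc) fun i hi => by
    rw [comp_apply, inF_x hi, fpA_x hi]
  exact congr_fun this v

lemma fpA'_fpA (k : ℕ) (v : F (k + 1)) : fpA' k (fpA k v) = v := by
  have := F.hom_ext (f := (fpA' k).comp (fpA k)) (g := MonoidHom.id _) fun i hi => by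
    by_cases h : i < k
    · rw [comp_apply, fpA_x h, fpA', lift_inc, inF_x h]; rfl
    · obtain rfl : i = k := by omega
      rw [comp_apply, fpA_last, fpA', lift_t]; rfl
  exact congr_fun this v

lemma fpA_act_inB_ζ (k : ℕ) (v : F (k + 1)) :
    fpA k (act (k + 1) (inB k (ζ k)) v) = cmap (z k)⁻¹ (fpA k v) := by
  have := F.hom_ext (f := (fpA k).comp (act (k + 1) (inB k (ζ k))).toMonoidHom)
    (g := (cmap (z k)⁻¹).comp (fpA k)) fun i hi => by
    change fpA k (act (k + 1) (inB k (ζ k)) _) = cmap (z k)⁻¹ (fpA k _)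
    by_cases h : i < k
    · rw [← inF_x h, act_inB_inF, fpA_inF, fpA_inF, act_ζ, map_inc]
      simp
    · obtain rfl : i = k := by omega
      rw [act_inB_last, fpA_last]
      simp [FP.map]
  exact congr_fun this v

/-- A decomposition in which the product of the last two generators lies in the first factor. -/
def fpB (k : ℕ) : F (k + 2) →* FP (F (k + 1)) :=
  F.lift (k + 2) fun i => if i < k then inc (x (k + 1) i) else
    if i = k then (t _)⁻¹ * inc (x (k + 1) k) else t _

/-- The inverse of `fpB`. -/
def fpB' (k : ℕ) : FP (F (k + 1)) →* F (k + 2) :=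
  lift (F.lift (k + 1) fun i => if i < k then x (k + 2) i else x (k + 2) (k + 1) * x (k + 2) k)
    (x (k + 2) (k + 1))

lemma fpB_x {k i : ℕ} (h : i < k) : fpB k (x (k + 2) i) = inc (x (k + 1) i) := by
  rw [fpB, F.lift_x _, if_pos h]

lemma fpB_mid (k : ℕ) : fpB k (x (k + 2) k) = (t _)⁻¹ * inc (x (k + 1) k) := by
  rw [fpB, F.lift_x _, if_neg (by omega), if_pos rfl]

lemma fpB_last (k : ℕ) : fpB k (x (k + 2) (k + 1)) = t _ := by
  rw [fpB, F.lift_x _, if_neg (by omega), if_neg (by omega)]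

lemma fpB'_fpB (k : ℕ) (v : F (k + 2)) : fpB' k (fpB k v) = v := by
  have := F.hom_ext (f := (fpB' k).comp (fpB k)) (g := MonoidHom.id _) fun i hi => by
    rw [comp_apply]
    by_cases h : i < k
    · rw [fpB_x h, fpB', lift_inc, F.lift_x _, if_pos h]; rfl
    · by_cases h1 : i = k
      · subst h1
        rw [fpB_mid, fpB', map_mul, map_inv, lift_inc, F.lift_x _, if_neg h, lift_t]
        simp
      · obtain rfl : i = k + 1 := by omega
        rw [fpB_last, fpB', lift_t]; rfl
  exact congr_fun this v

lemma fpB_zl {k j : ℕ} (h : j ≤ k) : fpB k (zl (k + 2) j) = inc (zl (k + 1) j) := by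
  induction j with
  | zero => simp [zl]
  | succ j ih => rw [zl, zl, map_mul, map_mul, ih (by omega), fpB_x (by omega)]

lemma fpB_mul (k : ℕ) :
    fpB k (x (k + 2) (k + 1) * x (k + 2) k) = inc (x (k + 1) k) := by
  rw [map_mul, fpB_mid, fpB_last, mul_inv_cancel_left]

lemma fpB_z (k : ℕ) : fpB k (z (k + 2)) = inc (z (k + 1)) := by
  rw [z, zl, zl, ← mul_assoc, map_mul, fpB_mul, fpB_zl le_rfl, z, zl, map_mul]

lemma fpB_act_σ_sq (k : ℕ) (v : F (k + 2)) :
    fpB k (x (k + 2) (k + 1) * x (k + 2) k * act (k + 2) (σ (k + 2) k ^ 2) v *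
      (x (k + 2) (k + 1) * x (k + 2) k)⁻¹) = cmap (x (k + 1) k) (fpB k v) := by
  have := F.hom_ext (f := (fpB k).comp ((MulAut.conj (x (k + 2) (k + 1) * x (k + 2) k)).toMonoidHom.comp
      (act (k + 2) (σ (k + 2) k ^ 2)).toMonoidHom))
    (g := (cmap (x (k + 1) k)).comp (fpB k)) fun i hi => by
    change fpB k (x (k + 2) (k + 1) * x (k + 2) k * act (k + 2) (σ (k + 2) k ^ 2) _ *
      (x (k + 2) (k + 1) * x (k + 2) k)⁻¹) = cmap (x (k + 1) k) (fpB k _)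
    by_cases h : i < k
    · rw [act_σ_sq_of_ne (by omega) (by omega), map_mul, map_mul, map_inv, fpB_mul, fpB_x h,
        map_inc]
      simp
    · by_cases h1 : i = k
      · subst h1
        rw [act_σ_sq_self (by omega), fpB_mid]
        simp only [map_mul, map_inv, fpB_mid, fpB_last]
        simp [FP.map, mul_assoc]
      · obtain rfl : i = k + 1 := by omega
        rw [act_σ_sq_succ (by omega), fpB_last]
        simp only [map_mul, map_inv, fpB_mid, fpB_last]
        simp [FP.map, mul_assoc]
  exact congr_fun this v

/-! ### Exponents -/

/-- The exponent of a single generator. -/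
def chij (m j : ℕ) : F m →* Multiplicative ℤ :=
  F.lift m fun i => if i = j then ofAdd 1 else 1

lemma chij_x {m i j : ℕ} (h : i < m) :
    chij m j (x m i) = if i = j then ofAdd 1 else 1 := F.lift_x _ h

lemma chij_self {m i : ℕ} (h : i < m := by omega) : chij m i (x m i) = ofAdd 1 := by
  rw [chij_x h, if_pos rfl]

lemma chij_ne {m i j : ℕ} (h : i ≠ j := by omega) : chij m j (x m i) = 1 := by
  by_cases hi : i < m
  · rw [chij_x hi, if_neg h]
  · rw [x_eq_one, map_one]

lemma chij_zl {m k j : ℕ} (h : k ≤ m) :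
    chij m j (zl m k) = if j < k then ofAdd 1 else 1 := by
  induction k with
  | zero => simp [zl]
  | succ k ih =>
    rw [zl, map_mul, ih (by omega), chij_x (by omega)]
    by_cases h1 : k = j
    · subst h1; simp
    · rw [if_neg h1, one_mul]
      congr 1
      simp only [eq_iff_iff]; omega

lemma chij_z {m j : ℕ} (h : j < m := by omega) : chij m j (z m) = ofAdd 1 := by
  rw [z, chij_zl le_rfl, if_pos h]

lemma chi_eq (m : ℕ) (v : F m) : chi m v = ∏ j ∈ Finset.range m, chij m j v := by
  have := F.hom_ext (f := chi m) (g := ∏ j ∈ Finset.range m, chij m j) fun i hi => by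
    rw [MonoidHom.finsetProd_apply, chi_x hi, Finset.prod_eq_single i, chij_self hi]
    · intro j _ hj
      exact chij_ne (Ne.symm hj)
    · intro h
      exact absurd (Finset.mem_range.2 hi) h
  rw [this, MonoidHom.finsetProd_apply]

lemma chij_act_σ {m i : ℕ} (h : i + 1 < m) (v : F m) :
    chij m i (act m (σ m i) v) = chij m (i + 1) v := by
  have := F.hom_ext (f := (chij m i).comp (act m (σ m i)).toMonoidHom) (g := chij m (i + 1))
    fun j hj => by
    change chij m i (act m (σ m i) (x m j)) = _
    by_cases h1 : j = i
    · subst h1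
      rw [act_σ_self h, map_mul, map_mul, map_inv, chij_self, chij_ne (i := j + 1),
        chij_ne]
      simp
    · by_cases h2 : j = i + 1
      · subst h2
        rw [act_σ_succ h, chij_self, chij_self]
      · rw [act_σ_of_ne h1 h2, chij_ne h1, chij_ne h2]
  exact congr_fun this v

lemma chij_eq {m : ℕ} {v : F m} (h : ∀ b, IsConj (act m b v) v) {j : ℕ} (hj : j < m) :
    chij m j v = chij m 0 v := by
  induction j with
  | zero => rfl
  | succ j ih =>
    rw [← ih (by omega), ← chij_act_σ hj]
    exact isConj_iff_eq.1 ((chij m j).map_isConj (h (σ m j)))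

lemma chi_eq_pow {m : ℕ} {v : F m} (h : ∀ b, IsConj (act m b v) v) :
    chi m v = chij m 0 v ^ m := by
  rw [chi_eq, Finset.prod_congr rfl (fun j hj => chij_eq h (Finset.mem_range.1 hj)),
    Finset.prod_const, Finset.card_range]

end

section

open Braid.FP

/-- The subgroup generated by `z` and the last generator. -/
def jB (k : ℕ) : W →* F (k + 1) := lift (zpowersHom _ (z (k + 1))) (x (k + 1) k)

lemma jB_t (k : ℕ) : jB k (t _) = x (k + 1) k := by simp [jB]
lemma jB_X (k : ℕ) : jB k X = z (k + 1) := by simp [jB, X]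
lemma jB_inc (k : ℕ) (a) : jB k (inc a) = z (k + 1) ^ a.toAdd := by simp [jB]

lemma fpB_jB (k : ℕ) (v : W) :
    fpB k (jB (k + 1) v) = map (zpowersHom _ (z (k + 1))) v := by
  have := W_hom_ext (f := (fpB k).comp (jB (k + 1))) (g := map (zpowersHom _ (z (k + 1))))
    (by simp [jB_t, fpB_last, FP.map])
    (by
      rw [comp_apply, jB_X, fpB_z, X, map_inc]
      simp)
  exact congr_fun this v

lemma zpowers_z_injective {k : ℕ} (h : 1 ≤ k) :
    Injective (zpowersHom (F k) (z k)) := by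
  rw [injective_iff_map_eq_one]
  intro a ha
  have h1 := congrArg (chij k 0) ha
  rw [zpowersHom_apply, map_zpow, chij_z h, map_one (chij k 0)] at h1
  have h2 := congrArg toAdd h1
  simp only [toAdd_zpow, toAdd_ofAdd, smul_eq_mul, mul_one, toAdd_one] at h2
  exact h2

lemma mem_range_jB_aux (k : ℕ) {l : List (ℤˣ × F k)}
    (h : ∀ a ∈ l, a.2 ∈ zpowers (z k)) : fpA' k (P l) ∈ (jB k).range := by
  refine P_mem (K := (jB k).range.comap (fpA' k)) ⟨t _, by simp [jB_t, fpA']⟩ fun a ha => ?_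
  obtain ⟨n, hn⟩ := h a ha
  refine ⟨((t _)⁻¹ * X) ^ n, ?_⟩
  rw [← hn, fpA', lift_inc, map_zpow, map_zpow, map_mul, map_inv, jB_t, jB_X, z_succ]
  simp

lemma chij_inF (k : ℕ) (v : F k) : chij (k + 1) k (inF k v) = 1 := by
  have := F.hom_ext (f := (chij (k + 1) k).comp (inF k)) (g := 1) fun i hi => by
    rw [comp_apply, inF_x hi, chij_ne]; rfl
  exact congr_fun this v

/-- A conjugacy class of the free group invariant under the braid group, and of nonzero exponents,
consists of conjugates of a power of `z`. -/
lemma isConj_zpow {k : ℕ} (hk : 1 ≤ k) {u : F (k + 2)} (h : ∀ b, IsConj (act _ b u) u)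
    (hu : chij (k + 2) 0 u ≠ 1) : ∃ l : ℤ, l ≠ 0 ∧ IsConj u (z (k + 2) ^ l) := by
  have h0 : ∀ {v}, IsConj u v → ∀ j, j < k + 2 → chij (k + 2) j v ≠ 1 := fun {v} hv j hj h1 => by
    apply hu
    rw [← chij_eq h hj, ← h1]
    exact isConj_iff_eq.1 ((chij _ j).map_isConj hv)
  obtain ⟨v, hv⟩ : ∃ v, IsConj u (jB (k + 1) v) := by
    have h1 : IsConj (cmap (z (k + 1))⁻¹ (fpA (k + 1) u)) (fpA (k + 1) u) := by
      rw [← fpA_act_inB_ζ]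
      exact (fpA (k + 1)).map_isConj (h _)
    have hid : ∀ v : FP (F (k + 1)), FP.map (MonoidHom.id (F (k + 1))) v = v := fun v =>
      congr_fun (FP.hom_ext (f := FP.map (MonoidHom.id (F (k + 1))))
        (g := MonoidHom.id _) (MonoidHom.ext fun v => by simp [FP.map]) (by simp [FP.map])) v
    rcases twist (f := MonoidHom.id (F (k + 1))) Function.injective_id
      (w := (z (k + 1))⁻¹) (v := fpA (k + 1) u) (by rwa [hid]) with ⟨c, hc⟩ | ⟨l, _, _, hl, N, hN, ha⟩
    · exfalso
      have h2 := (fpA' (k + 1)).map_isConj hc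
      rw [fpA'_fpA, fpA', lift_inc] at h2
      exact h0 h2 (k + 1) (by omega) (chij_inF _ _)
    · have h2 := (fpA' (k + 1)).map_isConj hl
      rw [fpA'_fpA] at h2
      obtain ⟨v, hv⟩ := mem_range_jB_aux (k + 1) (l := l) fun a ha' =>
        mem_zpowers_of_commute (chij (k + 1) 0)
          (by rw [chij_z]; simp) (neg_ne_zero.2 hN)
          (by simpa using ha a ha')
      exact ⟨v, by rwa [hv]⟩
  have h1 : IsConj (cmap (x (k + 1) k) (map (zpowersHom _ (z (k + 1))) v))
      (map (zpowersHom _ (z (k + 1))) v) := by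
    rw [← fpB_jB, ← fpB_act_σ_sq]
    refine (fpB k).map_isConj (IsConj.trans (isConj_iff.2 ⟨_, rfl⟩).symm ?_)
    exact (((act _ (σ _ k ^ 2)).toMonoidHom.map_isConj hv).symm.trans (h _)).trans hv
  rcases twist (zpowers_z_injective (by omega)) h1 with ⟨c, hc⟩ | ⟨l, _, _, hl, N, hN, ha⟩
  · have h2 := hv.trans ((jB (k + 1)).map_isConj hc)
    rw [jB_inc] at h2
    refine ⟨c.toAdd, fun h3 => ?_, h2⟩
    rw [h3] at h2
    exact h0 h2 0 (by omega) (by simp)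
  · exfalso
    have h2 := hv.trans ((jB (k + 1)).map_isConj hl)
    refine h0 h2 0 (by omega) ?_
    refine P_mem (K := ((chij (k + 2) 0).comp (jB (k + 1))).ker) ?_ fun a ha' => ?_
    · rw [MonoidHom.mem_ker, comp_apply, jB_t, chij_ne]
    · obtain ⟨n, hn⟩ := mem_zpowers_of_commute (chij (k + 1) k)
        (by rw [chij_self]; simp) hN (ha a ha')
      have h3 := congrArg (chij (k + 1) 0) hn
      simp only [zpowersHom_apply, map_zpow] at h3
      rw [chij_z, chij_ne, one_zpow, ← ofAdd_zsmul] at h3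
      have h4 : a.2.toAdd = 0 := by
        have := congrArg toAdd h3.symm
        simpa using this
      rw [MonoidHom.mem_ker, comp_apply, jB_inc, h4]
      simp

lemma AG.fr_right (m : ℕ) (g : AG m) : g = fr g.left * br g.right :=
  (inl_left_mul_inr_right g).symm

/-- The total exponent of the free part. -/
def chiAG (m : ℕ) : AG m →* Multiplicative ℤ :=
  SemidirectProduct.lift (chi m) 1 fun b => by
    suffices key : (chi m).comp (act m b).toMonoidHom = chi m by
      rw [key]; ext; simp
    refine MonoidHom.ext <| Br.aut_equivariant (act m) (fun _ v => v) (chi m) (fun i hi v => ?_) b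
    suffices key : (chi m).comp (act m (σ m i)).toMonoidHom = chi m from congr_fun key v
    refine F.hom_ext fun j hj => ?_
    change chi m (act m (σ m i) (x m j)) = chi m (x m j)
    by_cases h1 : j = i
    · subst h1
      rw [act_σ_self hi, map_mul, map_mul, map_inv, chi_x hi, chi_x hj]; simp
    · by_cases h2 : j = i + 1
      · subst h2
        rw [act_σ_succ hi, chi_x hj, chi_x (by omega)]
      · rw [act_σ_of_ne h1 h2]

lemma chiAG_fr {m : ℕ} (v : F m) : chiAG m (fr v) = chi m v :=
  SemidirectProduct.lift_inl ..

lemma chiAG_br {m : ℕ} (b : Br m) : chiAG m (br b) = 1 :=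
  SemidirectProduct.lift_inr ..

lemma σ_eq_image {m : ℕ} {G : Type*} [CommGroup G] (f : Br m →* G) (b : Br m) :
    f b = f (σ m 0) ^ (expo m b).toAdd := by
  have h : f = (zpowersHom G (f (σ m 0))).comp (expo m) := Br.hom_ext fun i hi => by
    rw [comp_apply, expo_σ hi, zpowersHom_apply, toAdd_ofAdd, zpow_one]
    induction i with
    | zero => rfl
    | succ i ih =>
      rw [← ih (by omega)]
      have := congrArg f (σ_braid (m := m) (i := i) hi)
      simp only [map_mul] at this
      rw [mul_comm (f (σ m i)) (f (σ m (i + 1)))] at this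
      exact (mul_left_cancel this).symm
  exact congr_fun h b

lemma commute_z_pow {m : ℕ} (hm : 1 ≤ m) {v : F m} {l : ℤ} (hl : l ≠ 0)
    (h : Commute v (z m ^ l)) : v ∈ zpowers (z m) :=
  mem_zpowers_of_commute (chij m 0) (by rw [chij_z]; simp) hl h

/-- Sections of the projection of `AG m` to the braid group. -/
lemma section_classification {m : ℕ} (hm : 3 ≤ m) (f : Br m →* AG m)
    (hf : ∀ b, (f b).right = b) :
    ∃ (v : F m) (k : ℤ), ∀ i, i + 1 < m →
      f (σ m i) = fr v * (fr (z m ^ k) * br (σ m i)) * (fr v)⁻¹ := by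
  obtain ⟨k, rfl⟩ : ∃ k, m = k + 2 := ⟨m - 2, by omega⟩
  have hfb : ∀ b, f b = fr (f b).left * br b := fun b => by
    conv_lhs => rw [AG.fr_right _ (f b), hf]
  obtain ⟨u, hu⟩ : ∃ u : F (k + 2), u = (f (ζ _)).left * (z _)⁻¹ := ⟨_, rfl⟩
  have hfz : f (ζ (k + 2)) = fr u * Δ (k + 2) := by
    rw [hfb, hu, Δ, map_mul, map_inv]; group
  have hcomm : ∀ b, Commute (f b) (fr u) := fun b => by
    have h1 : Commute (f b) (f (ζ _)) := ((ζ_commute _ b).symm).map f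
    have h2 : fr u = f (ζ _) * (Δ _)⁻¹ := by rw [hfz, mul_inv_cancel_right]
    rw [h2]
    exact h1.mul_right (Δ_commute _ _).symm.inv_right
  have hact : ∀ b, (f b).left * act _ b u * (f b).left⁻¹ = u := fun b => by
    have h1 := (hcomm b).eq
    rw [hfb b, mul_assoc, br_mul_fr, ← mul_assoc, ← mul_assoc, ← map_mul, ← map_mul] at h1
    exact mul_inv_eq_of_eq_mul (inl_injective (mul_right_cancel h1))
  have hcls : ∀ b, IsConj (act _ b u) u := fun b => isConj_iff.2 ⟨_, hact b⟩
  have hchi : chij (k + 2) 0 u ≠ 1 := fun h0 => by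
    have h1 := chi_eq_pow hcls
    rw [h0, one_pow] at h1
    have h2 := σ_eq_image ((chiAG (k + 2)).comp f) (ζ (k + 2))
    rw [comp_apply, hfz, map_mul, Δ, map_mul, chiAG_fr, chiAG_fr, chiAG_br, h1, one_mul,
      mul_one, expo_ζ, chi_z] at h2
    have h3 := congrArg toAdd h2
    simp only [toAdd_ofAdd, toAdd_zpow, smul_eq_mul] at h3
    push_cast at h3
    have h4 : ((k : ℤ) + 2) * (1 - (k + 2 - 1) * toAdd
      (((chiAG (k + 2)).comp f) (σ (k + 2) 0))) = 0 := by linear_combination h3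
    rcases mul_eq_zero.1 h4 with h5 | h5
    · omega
    · have h6 : ((k : ℤ) + 1) ∣ 1 := ⟨toAdd
        (((chiAG (k + 2)).comp f) (σ (k + 2) 0)), by linear_combination h5⟩
      have := Int.le_of_dvd (by norm_num) h6
      omega
  obtain ⟨l, hl, hul⟩ := isConj_zpow (by omega) hcls hchi
  obtain ⟨v, hv⟩ := isConj_iff.1 hul.symm
  have key : ∀ i, ∃ c : ℤ, f (σ _ i) = fr v * (fr (z _ ^ c) * br (σ _ i)) * (fr v)⁻¹ := fun i => by
    have h1 := hact (σ _ i)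
    set a := (f (σ (k + 2) i)).left with ha
    have h2 : Commute (v⁻¹ * a * act _ (σ _ i) v) (z (k + 2) ^ l) := by
      rw [← hv, map_mul, map_mul, map_inv, map_zpow, act_z] at h1
      change _ * _ = _ * _
      have h4 : v⁻¹ * (a * (act _ (σ _ i) v * z (k + 2) ^ l * (act _ (σ _ i) v)⁻¹) * a⁻¹) * v =
        z (k + 2) ^ l := by
        rw [h1, ← mul_assoc, ← mul_assoc, inv_mul_cancel, one_mul, inv_mul_cancel_right]
      calc _ = v⁻¹ * (a * (act _ (σ _ i) v * z (k + 2) ^ l * (act _ (σ _ i) v)⁻¹) * a⁻¹) * v *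
              (v⁻¹ * a * act _ (σ _ i) v) := by group
        _ = _ := by rw [h4]
    obtain ⟨c, hc⟩ := commute_z_pow (by omega) hl h2
    refine ⟨c, ?_⟩
    simp only at hc
    rw [hc, map_mul, ← br_conj, hfb, ← ha]
    simp only [map_mul, map_inv]
    group
  choose c hc using key
  refine ⟨v, c 0, fun i hi => ?_⟩
  have h1 := σ_eq_image ((chiAG (k + 2)).comp f) (σ (k + 2) i)
  rw [expo_σ hi, toAdd_ofAdd, zpow_one, comp_apply, comp_apply, hc, hc] at h1
  simp only [map_mul, map_inv, map_zpow, chiAG_fr, chiAG_br, mul_one, chi_z,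
    mul_inv_cancel_comm] at h1
  have h2 := congrArg toAdd h1
  simp only [toAdd_zpow, toAdd_ofAdd, smul_eq_mul] at h2
  have h3 : c i = c 0 := mul_right_cancel₀ (by push_cast; omega) h2
  rw [hc, h3]

end

lemma Br.eq_one_of_le {m : ℕ} (h : m ≤ 1) (b : Br m) : b = 1 :=
  Br.mem_of_gens ⊥ (fun i hi => by omega) b

lemma commute_inl {m : ℕ} {g : AG m} {b : Br m} (h : Commute g (br b)) :
    Commute g.right b ∧ act m b g.left = g.left := by
  have h1 := congrArg SemidirectProduct.right h.eq
  have h2 := congrArg SemidirectProduct.left h.eq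
  simp only [mul_right, right_inr, SemidirectProduct.mul_left,
    SemidirectProduct.left_inr, map_one, mul_one, one_mul] at h1 h2
  exact ⟨h1, h2.symm⟩

lemma act_fixed {m : ℕ} {v : F m} (h : act m (ζ m) v = v) : v ∈ zpowers (z m) := by
  rcases Nat.eq_zero_or_pos m with rfl | hm
  · have : v = 1 := Subsingleton.elim _ _
    rw [this]; exact one_mem _
  · rw [act_ζ] at h
    refine commute_z_pow (l := 1) hm one_ne_zero ?_
    rw [zpow_one]
    have h1 : (z m)⁻¹ * v = v * (z m)⁻¹ := eq_mul_inv_of_mul_eq h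
    change v * z m = z m * v
    calc v * z m = z m * ((z m)⁻¹ * v) * z m := by group
      _ = _ := by rw [h1]; group

lemma center_aux {k : ℕ} (hC : ∀ b : Br k, perm k b = 1 → (∀ c, Commute b c) →
    b ∈ zpowers (ζ k)) {Y : Br (k + 1)} (hp : perm (k + 1) Y = 1)
    (h : ∀ i, i + 1 < k → Commute Y (σ (k + 1) i)) :
    ∃ a b : ℤ, Y = ι k (fr (z k ^ a)) * ζ (k + 1) ^ b := by
  have hY : ι k (fg k Y) = Y := ι_fg (by rw [hp]; rfl)
  set g := fg k Y
  have h1 : ∀ c, Commute g (br c) := fun c => by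
    refine Br.commute_of_gens br g (fun i hi => ?_) c |>.symm
    refine Commute.of_map (ι_injective k) ?_
    rw [ι_br_σ hi, hY]
    exact (h i hi).symm
  obtain ⟨c, hc⟩ := hC g.right (by rw [← perm_ι, hY, hp]) fun c => (commute_inl (h1 c)).1
  obtain ⟨a, ha⟩ := act_fixed (commute_inl (h1 (ζ k))).2
  rcases Nat.eq_zero_or_pos k with rfl | hk
  · exact ⟨0, 0, by rw [Br.eq_one_of_le (by omega) Y]; simp⟩
  · refine ⟨a - c, c, ?_⟩
    rw [← ι_Δ hk, ← map_zpow, ← map_mul, ← hY, AG.fr_right k g]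
    simp only at ha hc
    congr 1
    have h2 : Commute (fr (z k)) (br (ζ k)) := by
      change _ = _
      rw [br_mul_fr, act_z]
    rw [← ha, ← hc, Δ, h2.mul_zpow, ← mul_assoc, ← map_zpow, ← map_zpow, ← map_mul, ← zpow_add,
      sub_add_cancel]

/-- A pure central braid is a power of the full twist. -/
lemma center (m : ℕ) : ∀ b : Br m, perm m b = 1 → (∀ c, Commute b c) →
    b ∈ zpowers (ζ m) := by
  induction m with
  | zero => exact fun b _ _ => by rw [Br.eq_one_of_le (by omega) b]; exact one_mem _
  | succ k ih =>
    intro Y hp h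
    obtain ⟨a, b, hab⟩ := center_aux ih hp fun i _ => h _
    rcases Nat.lt_or_ge k 2 with hk | hk
    · have hz : fr (z k) = Δ k := by rw [Δ, Br.eq_one_of_le (by omega) (ζ k)]; simp
      rcases Nat.eq_zero_or_pos k with rfl | hk'
      · rw [Br.eq_one_of_le (by omega) Y]; exact one_mem _
      · rw [map_zpow, hz, map_zpow, ι_Δ hk'] at hab
        exact ⟨a + b, by rw [hab]; exact zpow_add _ _ _⟩
    · have h1 : Commute (z k ^ a) (x k (k - 1)) := by
        refine Commute.of_map (f := (ι k).comp fr) ((ι_injective k).comp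
          inl_injective) ?_
        have h2 : ι k (fr (z k ^ a)) = Y * (ζ (k + 1) ^ b)⁻¹ := by rw [hab]; group
        rw [comp_apply, h2]
        exact (h _).mul_left ((ζ_commute _ _).zpow_left b).inv_left
      have h2 : a = 0 := by
        obtain ⟨n, hn⟩ := mem_zpowers_of_commute (N := 1) (h := z k ^ a)
          (w := x k (k - 1)) (chij k (k - 1)) (by rw [chij_self]; simp) one_ne_zero
          (by rwa [zpow_one])
        have h3 := congrArg toAdd (congrArg (chij k 0) hn)
        simp only [map_zpow] at h3
        rw [chij_z, chij_ne, one_zpow, toAdd_zpow] at h3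
        simpa using h3.symm
      rw [h2] at hab
      exact ⟨b, by rw [hab]; simp⟩

/-- Pure braids commuting with the generators of the braid group on one strand less. -/
lemma centralizer_inB {k : ℕ} {Y : Br (k + 1)} (hp : perm (k + 1) Y = 1)
    (h : ∀ i, i + 1 < k → Commute Y (σ (k + 1) i)) :
    ∃ a b : ℤ, Y = ι k (fr (z k ^ a)) * ζ (k + 1) ^ b :=
  center_aux (center k) hp h

/-- The modular group `SL₂(ℤ)`. -/
abbrev SLZ := Matrix.SpecialLinearGroup (Fin 2) ℤ

namespace SLZ

lemma det_eq (A : SLZ) : A.1 0 0 * A.1 1 1 - A.1 0 1 * A.1 1 0 = 1 := by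
  rw [← Matrix.det_fin_two]; exact A.2

lemma ext_iff' {A B : SLZ} : A = B ↔ A.1 0 0 = B.1 0 0 ∧ A.1 0 1 = B.1 0 1 ∧
    A.1 1 0 = B.1 1 0 ∧ A.1 1 1 = B.1 1 1 := by
  refine ⟨fun h => by simp [h], fun ⟨h1, h2, h3, h4⟩ => ?_⟩
  ext i j
  fin_cases i <;> fin_cases j <;> assumption

lemma mul_entry (A B : SLZ) (i j) : (A * B).1 i j = A.1 i 0 * B.1 0 j + A.1 i 1 * B.1 1 j := by
  simp [Matrix.mul_apply, Fin.sum_univ_two]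

lemma mul_ext_iff {A B C D : SLZ} : A * B = C * D ↔
    A.1 0 0 * B.1 0 0 + A.1 0 1 * B.1 1 0 = C.1 0 0 * D.1 0 0 + C.1 0 1 * D.1 1 0 ∧
    A.1 0 0 * B.1 0 1 + A.1 0 1 * B.1 1 1 = C.1 0 0 * D.1 0 1 + C.1 0 1 * D.1 1 1 ∧
    A.1 1 0 * B.1 0 0 + A.1 1 1 * B.1 1 0 = C.1 1 0 * D.1 0 0 + C.1 1 1 * D.1 1 0 ∧
    A.1 1 0 * B.1 0 1 + A.1 1 1 * B.1 1 1 = C.1 1 0 * D.1 0 1 + C.1 1 1 * D.1 1 1 := by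
  simp only [ext_iff', mul_entry]

lemma commute_iff {A B : SLZ} : Commute A B ↔ A.1 0 1 * B.1 1 0 = B.1 0 1 * A.1 1 0 ∧
    (A.1 0 0 - A.1 1 1) * B.1 0 1 = (B.1 0 0 - B.1 1 1) * A.1 0 1 ∧
    (A.1 0 0 - A.1 1 1) * B.1 1 0 = (B.1 0 0 - B.1 1 1) * A.1 1 0 := by
  rw [commute_iff_eq, mul_ext_iff]
  refine ⟨fun ⟨h1, h2, h3, h4⟩ => ⟨?_, ?_, ?_⟩, fun ⟨h1, h2, h3⟩ => ⟨?_, ?_, ?_, ?_⟩⟩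
  · linear_combination h1
  · linear_combination h2
  · linear_combination -h3
  · linear_combination h1
  · linear_combination h2
  · linear_combination -h3
  · linear_combination -h1

lemma eq_one_or_neg_one {A : SLZ} (h1 : A.1 0 1 = 0) (h2 : A.1 1 0 = 0)
    (h3 : A.1 0 0 - A.1 1 1 = 0) : A = 1 ∨ A = -1 := by
  have h := det_eq A
  have h4 : A.1 1 1 = A.1 0 0 := by omega
  rw [h1, h4, zero_mul, sub_zero] at h
  rcases mul_self_eq_one_iff.1 h with h5 | h5
  · left; rw [ext_iff', h1, h2, h4, h5]; simp
  · right; rw [ext_iff', h1, h2, h4, h5]; simp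

lemma commute_neg_one (A : SLZ) : Commute A (-1) := by
  rw [commute_iff_eq]; simp

/-- Centralizers of noncentral elements are commutative. -/
lemma commute_trans {A B X : SLZ} (h1 : X ≠ 1) (h2 : X ≠ -1) (hA : Commute A X)
    (hB : Commute B X) : Commute A B := by
  have h : ¬(X.1 0 1 = 0 ∧ X.1 1 0 = 0 ∧ X.1 0 0 - X.1 1 1 = 0) := fun ⟨h3, h4, h5⟩ =>
    (eq_one_or_neg_one h3 h4 h5).elim h1 h2
  rw [commute_iff] at hA hB ⊢
  obtain ⟨a1, a2, a3⟩ := hA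
  obtain ⟨b1, b2, b3⟩ := hB
  generalize X.1 0 0 - X.1 1 1 = p at *
  generalize X.1 0 1 = q at *
  generalize X.1 1 0 = r at *
  generalize A.1 0 0 - A.1 1 1 = p' at *
  generalize A.1 0 1 = q' at *
  generalize A.1 1 0 = r' at *
  generalize B.1 0 0 - B.1 1 1 = p'' at *
  generalize B.1 0 1 = q'' at *
  generalize B.1 1 0 = r'' at *
  by_cases hp : p = 0
  · by_cases hq : q = 0
    · have hr : r ≠ 0 := fun hr => h ⟨hq, hr, hp⟩
      refine ⟨?_, ?_, ?_⟩ <;> refine mul_left_cancel₀ hr ?_ <;> grind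
    · refine ⟨?_, ?_, ?_⟩ <;> refine mul_left_cancel₀ hq ?_ <;> grind
  · refine ⟨?_, ?_, ?_⟩ <;> refine mul_left_cancel₀ hp ?_ <;> grind

lemma eq_of_braid_of_commute {G : Type*} [Group G] {P R : G} (h : P * R * P = R * P * R)
    (hc : Commute P R) : P = R := by
  rw [← hc.eq, mul_assoc, mul_assoc, mul_left_cancel_iff, ← hc.eq] at h
  exact mul_right_cancel h

/-- The trace of an element. -/
def tr (A : SLZ) : ℤ := A.1 0 0 + A.1 1 1

lemma tr_mul_comm (A B : SLZ) : tr (A * B) = tr (B * A) := by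
  simp only [tr, mul_entry]; ring

lemma tr_conj (A B : SLZ) : tr (A * B * A⁻¹) = tr B := by
  rw [tr_mul_comm, inv_mul_cancel_left]

lemma neg_one_entries : ((-1 : SLZ).1 0 0 = -1 ∧ (-1 : SLZ).1 0 1 = 0) ∧
    (-1 : SLZ).1 1 0 = 0 ∧ (-1 : SLZ).1 1 1 = -1 := by simp

lemma one_entries : ((1 : SLZ).1 0 0 = 1 ∧ (1 : SLZ).1 0 1 = 0) ∧
    (1 : SLZ).1 1 0 = 0 ∧ (1 : SLZ).1 1 1 = 1 := by simp

lemma cube_add_one {D : SLZ} (h : D * D * D = -1) : D = -1 ∨ tr D = 1 := by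
  have hd := det_eq D
  obtain ⟨⟨n1, n2⟩, n3, n4⟩ := neg_one_entries
  simp only [ext_iff', mul_entry, n1, n2, n3, n4] at h
  obtain ⟨h1, h2, h3, h4⟩ := h
  by_cases ht : tr D = 1
  · exact Or.inr ht
  left
  rw [tr] at ht
  rw [ext_iff', n1, n2, n3, n4]
  generalize D.1 0 0 = a at *
  generalize D.1 0 1 = b at *
  generalize D.1 1 0 = c at *
  generalize D.1 1 1 = d at *
  have e2 : ((a + d) ^ 2 - 1) * b = 0 := by linear_combination h2 + b * hd
  have e3 : ((a + d) ^ 2 - 1) * c = 0 := by linear_combination h3 + c * hd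
  have e1 : ((a + d) ^ 2 - 1) * a - (a + d) = -1 := by
    linear_combination h1 + (2 * a + d) * hd
  have e4 : ((a + d) ^ 2 - 1) * d - (a + d) = -1 := by
    linear_combination h4 + (2 * d + a) * hd
  have ht1 : (a + d) ^ 2 - 1 ≠ 0 := fun h5 => by
    rw [h5] at e1; omega
  have hb := (mul_eq_zero.1 e2).resolve_left ht1
  have hc := (mul_eq_zero.1 e3).resolve_left ht1
  have had : a = d := mul_left_cancel₀ ht1 (by linear_combination e1 - e4)
  subst had hb hc
  have h5 : a * a = 1 := by linear_combination hd
  rcases mul_self_eq_one_iff.1 h5 with h6 | h6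
  · subst h6; norm_num at h1
  · exact ⟨h6, rfl, rfl, h6⟩

lemma sq_eq_one {E : SLZ} (h : E * E = 1) : E = 1 ∨ E = -1 := by
  have hd := det_eq E
  obtain ⟨⟨n1, n2⟩, n3, n4⟩ := one_entries
  simp only [ext_iff', mul_entry, n1, n2, n3, n4] at h
  obtain ⟨h1, h2, h3, h4⟩ := h
  have ht : tr E ≠ 0 := fun h5 => by
    rw [tr] at h5
    have : E.1 1 1 = - E.1 0 0 := by omega
    rw [this] at hd
    nlinarith
  rw [tr] at ht
  apply eq_one_or_neg_one
  · exact mul_left_cancel₀ ht (by linear_combination h2)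
  · exact mul_left_cancel₀ ht (by linear_combination h3)
  · exact mul_left_cancel₀ ht (by linear_combination h1 - h4)

lemma tr_eq_one_of_braid {P R : SLZ} (h : P * R * P = R * P * R) (hne : P ≠ R) :
    tr (P * R) = 1 := by
  have hnc : ¬ Commute P R := fun hc => hne (eq_of_braid_of_commute h hc)
  have h1 : P * R * P * P = R * (P * R * P) := by
    calc P * R * P * P = R * P * R * P := by rw [h]
      _ = _ := by group
  have h2 : P * R * P * R = P * (P * R * P) := by
    calc P * R * P * R = P * (R * P * R) := by group
      _ = _ := by rw [h]
  have hP : Commute P (P * R * P * (P * R * P)) := by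
    change _ = _
    rw [mul_assoc (P * R * P) (P * R * P) P, h1, ← mul_assoc (P * R * P) R, h2]
    group
  have hR : Commute R (P * R * P * (P * R * P)) := by
    change _ = _
    rw [mul_assoc (P * R * P) (P * R * P) R, h2, ← mul_assoc (P * R * P) P, h1]
    group
  by_cases e1 : P * R * P * (P * R * P) = 1
  · exfalso
    rcases sq_eq_one e1 with e | e
    · rw [e] at h1
      exact hne (by simpa using h1)
    · rw [e] at h1
      exact hne (by simpa using h1)
  by_cases e2 : P * R * P * (P * R * P) = -1
  · nth_rewrite 2 [h] at e2
    rcases cube_add_one (D := P * R) (by rw [← e2]; group) with e | e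
    · exfalso
      have : R = P⁻¹ * (-1) := by rw [← e]; group
      apply hnc
      rw [this]
      exact (Commute.refl P).inv_right.mul_right (commute_neg_one P)
    · exact e
  exact absurd (commute_trans e1 e2 hP hR) hnc

/-- Three elements of the modular group satisfying the relations of the braid group on four
strands. -/
lemma eq_of_braid {P R Q : SLZ} (h1 : P * R * P = R * P * R) (h2 : R * Q * R = Q * R * Q)
    (hc : Commute P Q) (hne : P ≠ R) : Q = P := by
  have hne2 : R ≠ Q := fun h => hne (eq_of_braid_of_commute h1 (h ▸ hc))
  have t1 := tr_eq_one_of_braid h1 hne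
  have t2 := tr_eq_one_of_braid h2 hne2
  have t3 : tr P = tr R := by
    rw [← tr_conj (P * R) P, h1]; congr 1; group
  have t4 : tr R = tr Q := by
    rw [← tr_conj (R * Q) R, h2]; congr 1; group
  obtain ⟨k1, k2, k3⟩ := commute_iff.1 hc
  rw [ext_iff']
  simp only [tr, mul_entry] at t1 t2 t3 t4
  generalize P.1 0 0 = a at *
  generalize P.1 0 1 = b at *
  generalize P.1 1 0 = c at *
  generalize P.1 1 1 = d at *
  generalize Q.1 0 0 = a2 at *
  generalize Q.1 0 1 = b2 at *
  generalize Q.1 1 0 = c2 at *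
  generalize Q.1 1 1 = d2 at *
  generalize R.1 0 0 = a1 at *
  generalize R.1 0 1 = b1 at *
  generalize R.1 1 0 = c1 at *
  generalize R.1 1 1 = d1 at *
  have hb : (a - d) * (a1 - d1) + 2 * (b * c1 + c * b1) = 2 - (a + d) ^ 2 := by
    linear_combination 2 * t1 + (a + d) * t3
  have hb2 : (a2 - d2) * (a1 - d1) + 2 * (b2 * c1 + c2 * b1) = 2 - (a + d) ^ 2 := by
    linear_combination 2 * t2 + (a + d) * t3 + (a1 + d1) * (t3 + t4)
  have hne3 : 2 - (a + d) ^ 2 ≠ 0 := fun h => by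
    have h5 : (a + d) ^ 2 = 2 := by omega
    have h6 : (a + d) ≤ 1 := by nlinarith
    have h7 : -1 ≤ (a + d) := by nlinarith
    generalize a + d = t at *
    interval_cases t <;> omega
  have x1 : (a2 - d2) = (a - d) := mul_left_cancel₀ hne3 (by
    nth_rewrite 1 [← hb]; rw [← hb2]; grind)
  have x2 : b2 = b := mul_left_cancel₀ hne3 (by
    nth_rewrite 1 [← hb]; rw [← hb2]; grind)
  have x3 : c2 = c := mul_left_cancel₀ hne3 (by
    nth_rewrite 1 [← hb]; rw [← hb2]; grind)
  exact ⟨by omega, x2, x3, by omega⟩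

lemma central_of_commute {P R A : SLZ} (h : P * R * P = R * P * R) (hne : P ≠ R)
    (h1 : Commute P A) (h2 : Commute A (R * A * R⁻¹)) : A = 1 ∨ A = -1 := by
  by_contra! hA
  have h3 := commute_trans hA.1 hA.2 h1 h2.symm
  have hA' : R * A * R⁻¹ ≠ 1 := fun e => hA.1 (by
    have := congrArg (fun x => R⁻¹ * x * R) e
    simpa [mul_assoc] using this)
  have hA'' : R * A * R⁻¹ ≠ -1 := fun e => hA.2 (by
    have : R * A = -1 * R := mul_inv_eq_iff_eq_mul.1 e
    rw [← (commute_neg_one R).eq] at this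
    exact mul_left_cancel this)
  have h4 : Commute (R * P * R⁻¹) (R * A * R⁻¹) := by
    change _ = _
    calc _ = R * (P * A) * R⁻¹ := by group
      _ = _ := by rw [h1.eq]; group
  have h5 := commute_trans hA' hA'' h3 h4
  have h6 : R * P * R⁻¹ = P⁻¹ * R * P := by
    rw [mul_inv_eq_iff_eq_mul, mul_assoc, mul_assoc, ← mul_assoc R P R, ← h]; group
  rw [h6] at h5
  apply hne
  apply eq_of_braid_of_commute h
  change _ = _
  calc P * R = P * (P * (P⁻¹ * R * P)) * P⁻¹ := by group
    _ = _ := by rw [h5.eq]; group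

lemma not_inverted {ω τ : SLZ} (h3 : ω * ω * ω = 1) (h1 : ω ≠ 1) (h : τ * ω = ω⁻¹ * τ) :
    False := by
  have e : tr ω = -1 := by
    have h4 : (-ω) * (-ω) * (-ω) = -1 := by rw [← h3]; simp
    rcases cube_add_one h4 with h5 | h5
    · exact absurd (neg_injective h5) h1
    · simp only [tr] at h5 ⊢
      simp at h5
      omega
  have d1 := det_eq ω
  have d2 := det_eq τ
  rw [tr] at e
  rw [mul_ext_iff] at h
  simp only [Matrix.SpecialLinearGroup.coe_inv, Matrix.adjugate_fin_two, Matrix.of_apply,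
    Matrix.cons_val] at h
  obtain ⟨e1, e2, e3, e4⟩ := h
  generalize ω.1 0 0 = a at *
  generalize ω.1 0 1 = b at *
  generalize ω.1 1 0 = c at *
  generalize ω.1 1 1 = d at *
  obtain rfl : d = -1 - a := by omega
  generalize τ.1 0 0 = p at *
  generalize τ.1 0 1 = q at *
  generalize τ.1 1 0 = r at *
  generalize τ.1 1 1 = s at *
  have hbc : 4 * (b * c) = -3 - (2 * a + 1) ^ 2 := by linear_combination (-4) * d1
  have hb0 : b ≠ 0 := fun hb => by rw [hb] at hbc; nlinarith
  have hs : s = -p := by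
    have : b * (p + s) = 0 := by linear_combination e2
    have := (mul_eq_zero.1 this).resolve_left hb0
    omega
  subst hs
  have e5 : p * (2 * a + 1) + q * c + r * b = 0 := by linear_combination e1
  have hqr : q * r = -1 - p ^ 2 := by linear_combination -d2
  have h6 : 4 * ((q * c) * (r * b)) = (1 + p ^ 2) * (3 + (2 * a + 1) ^ 2) := by
    calc _ = (q * r) * (4 * (b * c)) := by ring
      _ = _ := by rw [hqr, hbc]; ring
  have h7 : (q * c + r * b) ^ 2 = (p * (2 * a + 1)) ^ 2 := by
    have : q * c + r * b = -(p * (2 * a + 1)) := by linear_combination e5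
    rw [this]; ring
  nlinarith [sq_nonneg (q * c - r * b), sq_nonneg (2 * a + 1), sq_nonneg p]

end SLZ

def sm0 : SLZ := ⟨!![1, -1; 0, 1], by simp⟩
def sm1 : SLZ := ⟨!![1, 0; 1, 1], by simp⟩
def smz : SLZ := ⟨!![-1, -2; 0, -1], by simp⟩

lemma sm0_entries : sm0.1 0 0 = 1 ∧ sm0.1 0 1 = -1 ∧ sm0.1 1 0 = 0 ∧ sm0.1 1 1 = 1 :=
  ⟨rfl, rfl, rfl, rfl⟩
lemma sm1_entries : sm1.1 0 0 = 1 ∧ sm1.1 0 1 = 0 ∧ sm1.1 1 0 = 1 ∧ sm1.1 1 1 = 1 :=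
  ⟨rfl, rfl, rfl, rfl⟩
lemma smz_entries : smz.1 0 0 = -1 ∧ smz.1 0 1 = -2 ∧ smz.1 1 0 = 0 ∧ smz.1 1 1 = -1 :=
  ⟨rfl, rfl, rfl, rfl⟩

lemma sm_braid : sm0 * sm1 * sm0 = sm1 * sm0 * sm1 := by
  rw [SLZ.ext_iff']
  simp [SLZ.mul_entry, sm0_entries, sm1_entries]

/-- The map from the braid group on three strands to the modular group. -/
def SL : Br 3 →* SLZ :=
  Br.lift (fun i => if i = 0 then sm0 else sm1)
    (fun i hi => by
      obtain rfl : i = 0 := by omega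
      exact sm_braid)
    (fun i j h hj => by omega)

lemma SL_σ0 : SL (σ 3 0) = sm0 := Br.lift_σ _ _ _
lemma SL_σ1 : SL (σ 3 1) = sm1 := Br.lift_σ _ _ _

lemma SL_ζ : SL (ζ 3) = -1 := by
  have : ζ 3 = (σ 3 0 * σ 3 1) ^ 3 := by simp [ζ, δ, dl]
  rw [this, map_pow, map_mul, SL_σ0, SL_σ1, pow_three, SLZ.ext_iff']
  simp [SLZ.mul_entry, sm0_entries, sm1_entries, smz_entries]

/-! ### Reduction modulo two -/

def actv (A : SLZ) (v : ZMod 2 × ZMod 2) : ZMod 2 × ZMod 2 :=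
  ((A.1 0 0 : ZMod 2) * v.1 + (A.1 0 1 : ZMod 2) * v.2,
    (A.1 1 0 : ZMod 2) * v.1 + (A.1 1 1 : ZMod 2) * v.2)

lemma actv_mul (A B : SLZ) (v) : actv (A * B) v = actv A (actv B v) := by
  simp only [actv, SLZ.mul_entry]
  push_cast
  ext <;> simp only <;> ring

lemma actv_one (v) : actv 1 v = v := by simp [actv]

def vec (i : ℕ) : ZMod 2 × ZMod 2 := if i = 0 then (0, 1) else if i = 1 then (1, 1) else (1, 0)

lemma vec_injective {i j : ℕ} (hi : i < 3) (hj : j < 3) (h : vec i = vec j) : i = j := by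
  interval_cases i <;> interval_cases j <;> first | rfl | (revert h; simp [vec])

lemma actv_SL (b : Br 3) {i : ℕ} (hi : i < 3) : actv (SL b) (vec i) = vec (perm 3 b i) :=
  .symm <| Br.equivariant (perm 3) (fun b => actv (SL b)) vec (p := (· < 3))
    (fun b _ h => perm_lt h b) (fun i hi j hj => .symm <| by
      rw [perm_σ hi]
      obtain rfl | rfl : i = 0 ∨ i = 1 := by omega
      · rw [SL_σ0]; interval_cases j <;> decide
      · rw [SL_σ1]; interval_cases j <;> decide) b hi (by simp [actv_one]) (by simp [actv_mul])

lemma perm_eq_of_SL {b b' : Br 3}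
    (h : ∀ i j, ((SL b).1 i j : ZMod 2) = ((SL b').1 i j : ZMod 2)) : perm 3 b = perm 3 b' := by
  ext i
  rcases Nat.lt_or_ge i 3 with hi | hi
  · apply vec_injective (perm_lt hi b) (perm_lt hi b')
    rw [← actv_SL b hi, ← actv_SL b' hi, actv, actv, h, h, h, h]
  · rw [perm_of_le hi, perm_of_le hi]

/-! ### Faithfulness -/

def ppGen : Fin 2 → SLZ := ![SL (ι 2 (fr (z 2))), SL (ι 2 (fr (x 2 1)))]

lemma SL_x1 : SL (ι 2 (fr (x 2 1))) = sm1 ^ 2 := by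
  have := ι_x_last (m := 2)
  simp only [Nat.reduceSub, Nat.reduceAdd] at this
  rw [this, map_pow, SL_σ1]

lemma SL_z : SL (ι 2 (fr (z 2))) * sm0 ^ 2 = -1 := by
  rw [← SL_ζ, ← ι_Δ (m := 2), Δ, map_mul, map_mul, ← SL_σ0, ← map_pow]
  have : ζ 2 = σ 2 0 ^ 2 := by simp [ζ, δ, dl]
  rw [this, map_pow, map_pow, map_pow, ι_br_σ, map_pow]

lemma SL_z' : SL (ι 2 (fr (z 2))) = smz := by
  rw [← mul_left_inj (sm0 ^ 2), SL_z, SLZ.ext_iff', pow_two]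
  simp [SLZ.mul_entry, sm0_entries, sm1_entries, smz_entries]

def ppX : Fin 2 → Set SLZ :=
  ![{g | g.1 1 0 * g.1 1 0 ≤ g.1 0 0 * g.1 1 0},
    {g | g.1 0 0 = 0 ∨ g.1 0 0 * g.1 0 0 < g.1 0 0 * g.1 1 0}]
def ppY : Fin 2 → Set SLZ :=
  ![{g | g.1 0 0 * g.1 1 0 < -(g.1 1 0 * g.1 1 0)},
    {g | g.1 0 0 ≠ 0 ∧ g.1 0 0 * g.1 1 0 ≤ -(g.1 0 0 * g.1 0 0)}]

lemma ppGen_zero_smul (g : SLZ) : (ppGen 0 • g).1 0 0 = -g.1 0 0 - 2 * g.1 1 0 ∧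
    (ppGen 0 • g).1 1 0 = -g.1 1 0 := by
  have : ppGen 0 = smz := SL_z'
  rw [smul_eq_mul, this]
  simp only [SLZ.mul_entry, smz_entries]
  constructor <;> ring

lemma ppGen_one_smul (g : SLZ) : (ppGen 1 • g).1 0 0 = g.1 0 0 ∧
    (ppGen 1 • g).1 1 0 = 2 * g.1 0 0 + g.1 1 0 := by
  have : ppGen 1 = sm1 ^ 2 := SL_x1
  rw [smul_eq_mul, this, pow_two]
  simp only [SLZ.mul_entry, sm1_entries]
  constructor <;> ring

lemma lift_ppGen_injective : Injective (FreeGroup.lift ppGen) := by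
  have hd (g : SLZ) : ¬ (g.1 0 0 = 0 ∧ g.1 1 0 = 0) := fun h => by
    have := SLZ.det_eq g
    simp [h.1, h.2] at this
  have hX0 (g : SLZ) : g ∈ ppX 0 ↔ g.1 1 0 * g.1 1 0 ≤ g.1 0 0 * g.1 1 0 := Iff.rfl
  have hX1 (g : SLZ) : g ∈ ppX 1 ↔ g.1 0 0 = 0 ∨ g.1 0 0 * g.1 0 0 < g.1 0 0 * g.1 1 0 := Iff.rfl
  have hY0 (g : SLZ) : g ∈ ppY 0 ↔ g.1 0 0 * g.1 1 0 < -(g.1 1 0 * g.1 1 0) := Iff.rfl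
  have hY1 (g : SLZ) : g ∈ ppY 1 ↔ g.1 0 0 ≠ 0 ∧ g.1 0 0 * g.1 1 0 ≤ -(g.1 0 0 * g.1 0 0) :=
    Iff.rfl
  have dXX : Disjoint (ppX 0) (ppX 1) := Set.disjoint_left.2 fun g h0 h1 => by
    rw [hX0] at h0
    rw [hX1] at h1
    rcases h1 with h1 | h1
    · refine hd g ⟨h1, ?_⟩
      rw [h1] at h0
      nlinarith
    · nlinarith [sq_nonneg (g.1 0 0 - g.1 1 0)]
  have dYY : Disjoint (ppY 0) (ppY 1) := Set.disjoint_left.2 fun g h0 h1 => by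
    rw [hY0] at h0
    rw [hY1] at h1
    nlinarith [sq_nonneg (g.1 0 0 + g.1 1 0)]
  have dXY : ∀ i j, Disjoint (ppX i) (ppY j) := fun i j => Set.disjoint_left.2 fun g h0 h1 => by
    fin_cases i <;> fin_cases j <;> simp only [Fin.zero_eta, Fin.mk_one, Fin.isValue] at h0 h1
    · rw [hX0] at h0; rw [hY0] at h1; nlinarith
    · rw [hX0] at h0; rw [hY1] at h1
      have := mul_self_pos.2 h1.1
      nlinarith
    · rw [hX1] at h0; rw [hY0] at h1
      rcases h0 with h0 | h0
      · rw [h0] at h1; nlinarith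
      · nlinarith
    · rw [hX1] at h0; rw [hY1] at h1
      rcases h0 with h0 | h0
      · exact h1.1 h0
      · nlinarith
  refine FreeGroup.injective_lift_of_ping_pong ppGen ppX ppY ?_ ?_ ?_ dXY ?_ ?_
  · intro i
    fin_cases i
    · exact ⟨1, (hX0 1).2 (by simp)⟩
    · exact ⟨sm1 * sm1, (hX1 _).2 (by simp [SLZ.mul_entry, sm1_entries])⟩
  · intro i j hij
    fin_cases i <;> fin_cases j <;> first | exact absurd rfl hij | exact dXX | exact dXX.symm
  · intro i j hij
    fin_cases i <;> fin_cases j <;> first | exact absurd rfl hij | exact dYY | exact dYY.symm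
  · rintro i _ ⟨g, hg, rfl⟩
    rw [Set.mem_compl_iff] at hg
    fin_cases i <;> simp only [Fin.zero_eta, Fin.mk_one, Fin.isValue] at hg ⊢
    · rw [hY0] at hg
      rw [hX0, (ppGen_zero_smul g).1, (ppGen_zero_smul g).2]
      nlinarith
    · rw [hY1] at hg
      rw [hX1, (ppGen_one_smul g).1, (ppGen_one_smul g).2]
      by_contra! h
      exact hg ⟨h.1, by nlinarith⟩
  · rintro i _ ⟨g, hg, rfl⟩
    obtain ⟨g', rfl⟩ : ∃ g', g = ppGen i • g' := ⟨(ppGen i)⁻¹ • g, by simp⟩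
    change (ppGen i)⁻¹ • ppGen i • g' ∈ _
    rw [inv_smul_smul]
    rw [Set.mem_compl_iff] at hg
    fin_cases i <;> simp only [Fin.zero_eta, Fin.mk_one, Fin.isValue] at hg ⊢
    · rw [hX0, (ppGen_zero_smul g').1, (ppGen_zero_smul g').2] at hg
      rw [hY0]
      nlinarith
    · rw [hX1, (ppGen_one_smul g').1, (ppGen_one_smul g').2] at hg
      push Not at hg
      exact (hY1 _).2 ⟨hg.1, by nlinarith⟩

lemma SL_fr_injective : Injective fun u : F 2 => SL (ι 2 (fr u)) := by
  set f := (SL.comp (ι 2)).comp fr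
  change Injective f
  let e : F 2 →* F 2 := F.lift 2 fun i => if i = 0 then z 2 else x 2 1
  have h1 : f.comp e = FreeGroup.lift ppGen := F.hom_ext fun i hi => by
    rw [comp_apply, F.lift_x _ hi, x_of_lt hi, lift_apply_of]
    obtain rfl | rfl : i = 0 ∨ i = 1 := by omega
    · rfl
    · rfl
  have h2 : Function.Surjective e := fun u => by
    refine F.mem_of_gens e.range (fun i hi => ?_) u
    have h3 : e (x 2 1) = x 2 1 := by rw [F.lift_x _]; simp
    obtain rfl | rfl : i = 0 ∨ i = 1 := by omega
    · refine ⟨(x 2 1)⁻¹ * x 2 0, ?_⟩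
      rw [map_mul, map_inv, h3, F.lift_x _]
      simp [z, zl]
    · exact ⟨_, h3⟩
  intro u u' h
  obtain ⟨w, rfl⟩ := h2 u
  obtain ⟨w', rfl⟩ := h2 u'
  have : FreeGroup.lift ppGen w = FreeGroup.lift ppGen w' := by rw [← h1]; exact h
  rw [lift_ppGen_injective this]

section

/-! ### Forgetting all but three strands -/

/-- The number of elements of `S` below `i`. -/
def cnt (S : Finset ℕ) (i : ℕ) : ℕ := (S.filter (· < i)).card

/-- The action of permutations on finite sets. -/
def fsp : Equiv.Perm ℕ →* Equiv.Perm (Finset ℕ) where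
  toFun g := Equiv.finsetCongr g
  map_one' := by ext S i; change i ∈ S.map _ ↔ i ∈ S; rw [Finset.mem_map_equiv]; rfl
  map_mul' f g := by
    ext S i
    change i ∈ S.map _ ↔ i ∈ (S.map g.toEmbedding).map f.toEmbedding
    rw [Finset.mem_map_equiv, Finset.mem_map_equiv, Finset.mem_map_equiv]; rfl

lemma mem_fsp {g : Equiv.Perm ℕ} {S : Finset ℕ} {i : ℕ} : i ∈ fsp g S ↔ g⁻¹ i ∈ S := by
  change i ∈ S.map g.toEmbedding ↔ _
  rw [Finset.mem_map_equiv]; rfl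

lemma apply_mem_fsp {g : Equiv.Perm ℕ} {S : Finset ℕ} {i : ℕ} : g i ∈ fsp g S ↔ i ∈ S := by
  rw [mem_fsp, ← mul_apply, inv_mul_cancel, one_apply]

lemma card_fsp (g : Equiv.Perm ℕ) (S : Finset ℕ) : (fsp g S).card = S.card :=
  Finset.card_map _

lemma fsp_eq (g : Equiv.Perm ℕ) (S : Finset ℕ) : fsp g S = S.image g := by
  ext i
  rw [mem_fsp, Finset.mem_image]
  constructor
  · exact fun h => ⟨_, h, by simp⟩
  · rintro ⟨a, h, rfl⟩; simpa using h

open Equiv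

lemma mem_fsp_swap {S : Finset ℕ} {i j : ℕ} :
    j ∈ fsp (swap i (i + 1)) S ↔ swap i (i + 1) j ∈ S := by
  rw [mem_fsp, swap_inv]

lemma cnt_succ (S : Finset ℕ) (i : ℕ) : cnt S (i + 1) = cnt S i + if i ∈ S then 1 else 0 := by
  have : S.filter (· < i + 1) = S.filter (· < i) ∪ S.filter (· = i) := by
    ext; simp only [Finset.mem_filter, Finset.mem_union]; grind
  rw [cnt, this, Finset.card_union_of_disjoint
    (Finset.disjoint_filter.2 fun a _ h => by omega), cnt, Finset.filter_eq']
  split_ifs <;> simp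

lemma cnt_le_card (S : Finset ℕ) (i : ℕ) : cnt S i ≤ S.card :=
  Finset.card_le_card (Finset.filter_subset _ _)

lemma cnt_mono (S : Finset ℕ) {i j : ℕ} (h : i ≤ j) : cnt S i ≤ cnt S j :=
  Finset.card_le_card fun a ha => by
    rw [Finset.mem_filter] at ha ⊢
    exact ⟨ha.1, by omega⟩

lemma cnt_fsp_swap_le {S : Finset ℕ} {i j : ℕ} (h : i ≤ j) :
    cnt (fsp (swap j (j + 1)) S) i = cnt S i := by
  rw [cnt, cnt]
  congr 1
  ext a
  simp only [Finset.mem_filter, mem_fsp_swap]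
  refine and_congr_left fun ha => ?_
  rw [swap_apply_of_ne_of_ne (by omega) (by omega)]

lemma cnt_fsp_swap_ge {S : Finset ℕ} {i j : ℕ} (h : j + 2 ≤ i) :
    cnt (fsp (swap j (j + 1)) S) i = cnt S i := by
  induction i, h using Nat.le_induction with
  | base =>
    rw [cnt_succ, cnt_succ, cnt_succ, cnt_succ, cnt_fsp_swap_le le_rfl]
    simp only [mem_fsp_swap, swap_apply_left, swap_apply_right]
    omega
  | succ i hi ih =>
    simp only [cnt_succ, ih, mem_fsp_swap]
    rw [swap_apply_of_ne_of_ne (by omega) (by omega)]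

/-- The value of the cocycle on a generator. -/
def csv (i : ℕ) (S : Finset ℕ) : Br 3 :=
  if S.card = 3 ∧ i ∈ S ∧ i + 1 ∈ S then σ 3 (cnt S i) else 1

lemma csv_of_not {i : ℕ} {S : Finset ℕ} (h : i ∈ S → i + 1 ∉ S) : csv i S = 1 :=
  if_neg fun h' => h h'.2.1 h'.2.2

lemma csv_braid (i : ℕ) (S : Finset ℕ) :
    csv i (fsp (swap (i + 1) (i + 1 + 1)) (fsp (swap i (i + 1)) S)) *
      csv (i + 1) (fsp (swap i (i + 1)) S) * csv i S =
    csv (i + 1) (fsp (swap i (i + 1)) (fsp (swap (i + 1) (i + 1 + 1)) S)) *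
      csv i (fsp (swap (i + 1) (i + 1 + 1)) S) * csv (i + 1) S := by
  have e1 : swap (i + 1) (i + 1 + 1) i = i := swap_apply_of_ne_of_ne (by omega) (by omega)
  have e2 : swap i (i + 1) (i + 1 + 1) = i + 1 + 1 :=
    swap_apply_of_ne_of_ne (by omega) (by omega)
  have c1 := cnt_succ S i
  have c2 := cnt_succ S (i + 1)
  have c3 := cnt_succ S (i + 1 + 1)
  have c4 := cnt_le_card S (i + 1 + 1 + 1)
  simp only [csv, card_fsp, mem_fsp_swap, swap_apply_left, swap_apply_right, e1, e2, cnt_succ,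
    cnt_fsp_swap_le le_rfl, cnt_fsp_swap_le (Nat.le_succ i)]
  by_cases h : S.card = 3
  · by_cases h1 : i ∈ S <;> by_cases h2 : i + 1 ∈ S <;> by_cases h3 : i + 1 + 1 ∈ S <;>
      simp only [h, h1, h2, h3, and_true, and_false, if_true, if_false, mul_one, one_mul,
        add_zero, true_and, false_and] at c1 c2 c3 c4 ⊢
    have : cnt S i = 0 := by omega
    rw [this]
    exact σ_braid
  · simp [h]

lemma csv_comm {i j : ℕ} (h : i + 2 ≤ j) (S : Finset ℕ) :
    csv i (fsp (swap j (j + 1)) S) * csv j S = csv j (fsp (swap i (i + 1)) S) * csv i S := by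
  have e1 : csv i (fsp (swap j (j + 1)) S) = csv i S := by
    simp only [csv, card_fsp, mem_fsp_swap, cnt_fsp_swap_le (show i ≤ j by omega)]
    rw [swap_apply_of_ne_of_ne (by omega) (by omega), swap_apply_of_ne_of_ne (by omega) (by omega)]
  have e2 : csv j (fsp (swap i (i + 1)) S) = csv j S := by
    simp only [csv, card_fsp, mem_fsp_swap, cnt_fsp_swap_ge h]
    rw [swap_apply_of_ne_of_ne (by omega) (by omega), swap_apply_of_ne_of_ne (by omega) (by omega)]
  rw [e1, e2]
  by_cases h1 : i ∈ S ∧ i + 1 ∈ S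
  · by_cases h2 : j ∈ S ∧ j + 1 ∈ S
    · have h3 : S.card ≠ 3 := fun h3 => by
        have c1 := cnt_succ S i
        have c2 := cnt_succ S (i + 1)
        have c3 := cnt_succ S j
        have c4 := cnt_succ S (j + 1)
        have c5 := cnt_le_card S (j + 1 + 1)
        have c6 : cnt S (i + 1 + 1) ≤ cnt S j := cnt_mono S h
        simp only [h1, h2, if_true] at *
        omega
      simp [csv, h3]
    · simp [csv, h2]
  · simp [csv, h1]

/-- The cocycle with values in the braid group on three strands. -/
def cs (n : ℕ) : Br n →* Wr (Finset ℕ) (Br 3) :=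
  Br.lift (fun i => ⟨csv i, fsp (swap i (i + 1))⟩)
    (fun i hi => by
      refine Wr.ext (funext fun S => csv_braid i S) ?_
      simp only [Wr.mul_pm, ← map_mul, swap_braid])
    (fun i j h hj => by
      refine Wr.ext (funext fun S => csv_comm h S) ?_
      simp only [Wr.mul_pm, ← map_mul, swap_comm_of_le h])

variable {n : ℕ}

lemma cs_σ_fn {i : ℕ} (h : i + 1 < n) (S : Finset ℕ) : (cs n (σ n i)).fn S = csv i S := by
  rw [cs, Br.lift_σ _ _ _ h]

lemma cs_pm (b : Br n) : (cs n b).pm = fsp (perm n b) := by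
  have : Wr.pmHom.comp (cs n) = fsp.comp (perm n) := Br.hom_ext fun i hi => by
    rw [comp_apply, comp_apply, perm_σ hi, cs, Br.lift_σ _ _ _ hi]; rfl
  exact congr_fun this b

/-- The cocycle at the set `S`. -/
def C (n : ℕ) (S : Finset ℕ) (b : Br n) : Br 3 := (cs n b).fn S

lemma C_σ {i : ℕ} (h : i + 1 < n) (S : Finset ℕ) : C n S (σ n i) = csv i S := cs_σ_fn h S

lemma C_one (S : Finset ℕ) : C n S 1 = 1 := by rw [C, map_one]; rfl

lemma C_mul (S : Finset ℕ) (a b : Br n) : C n S (a * b) = C n (fsp (perm n b) S) a * C n S b := by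
  rw [C, map_mul, Wr.mul_fn, cs_pm]; rfl

lemma C_inv (S : Finset ℕ) (a : Br n) : C n S a⁻¹ = (C n (fsp (perm n a)⁻¹ S) a)⁻¹ := by
  rw [C, map_inv, Wr.inv_fn, cs_pm, map_inv]; rfl

/-- The cocycle restricted to the stabilizer. -/
lemma C_mul_of_fix {S : Finset ℕ} {a b : Br n} (h : fsp (perm n b) S = S) :
    C n S (a * b) = C n S a * C n S b := by rw [C_mul, h]

lemma C_inv_of_fix {S : Finset ℕ} {a : Br n} (h : fsp (perm n a) S = S) :
    C n S a⁻¹ = (C n S a)⁻¹ := by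
  rw [C_inv, map_inv]
  congr 2
  rw [Equiv.Perm.inv_eq_iff_eq, h]

/-- The cocycle as a homomorphism on the stabilizer. -/
def CH (n : ℕ) (S : Finset ℕ) : (stabilizer (Perm (Finset ℕ)) S).comap
    (fsp.comp (perm n)) →* Br 3 where
  toFun b := C n S b.1
  map_one' := C_one S
  map_mul' _ b := C_mul_of_fix b.2

lemma C_conj (S : Finset ℕ) (a b : Br n) (hb : fsp (perm n b) S = S) :
    C n (fsp (perm n a) S) (a * b * a⁻¹) = C n S a * C n S b * (C n S a)⁻¹ := by
  rw [C_mul, C_inv, C_mul]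
  have h : fsp (perm n a)⁻¹ (fsp (perm n a) S) = S := by
    rw [← mul_apply, ← map_mul, inv_mul_cancel, map_one, one_apply]
  rw [h, map_inv, h, hb]

lemma C_perm {S : Finset ℕ} (hS : S.card = 3) (b : Br n) : ∀ s ∈ S,
    perm 3 (C n S b) (cnt S s) = cnt (fsp (perm n b) S) (perm n b s) := by
  have := Br.mem_of_gens
    { carrier := {b | ∀ S : Finset ℕ, S.card = 3 → ∀ s ∈ S,
        perm 3 (C n S b) (cnt S s) = cnt (fsp (perm n b) S) (perm n b s)}
      one_mem' := fun S hS s hs => by simp [C_one]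
      mul_mem' := fun {a b} ha hb S hS s hs => by
        rw [C_mul, map_mul, map_mul, mul_apply, hb S hS s hs,
          ha _ (by rwa [card_fsp]) _ (apply_mem_fsp.2 hs), map_mul]; rfl
      inv_mem' := fun {a} ha S hS s hs => by
        have := ha (fsp (perm n a)⁻¹ S) (by rwa [card_fsp]) ((perm n a)⁻¹ s) (apply_mem_fsp.2 hs)
        rw [C_inv, map_inv, map_inv, Perm.inv_eq_iff_eq, ← map_inv fsp, map_inv (perm n), this, ← mul_apply, ← mul_apply,
          ← map_mul, mul_inv_cancel, map_one]
        rfl }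
    (fun i hi S hS s hs => by
      rw [C_σ hi, perm_σ hi]
      have c1 := cnt_succ S i
      have c2 := cnt_succ S (i + 1)
      have c5 := cnt_le_card S (i + 1 + 1)
      rcases lt_or_ge s i with h | h
      · rw [swap_apply_of_ne_of_ne (by omega) (by omega), cnt_fsp_swap_le (by omega)]
        rw [csv]
        split_ifs with h1
        · simp only [h1, if_true] at c1 c2
          have c6 := cnt_mono S (show s + 1 ≤ i by omega)
          rw [cnt_succ, if_pos hs] at c6
          rw [perm_σ, swap_apply_of_ne_of_ne (by omega) (by omega)]
        · rw [map_one]; rfl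
      rcases lt_or_ge (i + 1) s with h | h
      · rw [swap_apply_of_ne_of_ne (by omega) (by omega), cnt_fsp_swap_ge (by omega)]
        rw [csv]
        split_ifs with h1
        · simp only [h1, if_true] at c1 c2
          have c6 := cnt_mono S (show i + 1 + 1 ≤ s by omega)
          rw [perm_σ, swap_apply_of_ne_of_ne (by omega) (by omega)]
        · rw [map_one]; rfl
      obtain rfl | rfl : s = i ∨ s = i + 1 := by omega
      · rw [swap_apply_left, cnt_succ, cnt_fsp_swap_le le_rfl, csv]
        simp only [hS, hs, true_and, mem_fsp_swap, swap_apply_left]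
        split_ifs with h1
        · simp only [hs, h1, if_true] at c1 c2
          rw [perm_σ, swap_apply_left]
        · rw [map_one]; rfl
      · rw [swap_apply_right, cnt_fsp_swap_le le_rfl, csv, c1]
        simp only [hS, hs, true_and, and_true]
        split_ifs with h1
        · simp only [hs, h1, if_true] at c1 c2
          rw [perm_σ, swap_apply_right]
        · rw [map_one]; rfl) b
  exact this S hS

end

section

open Equiv

variable {n : ℕ}

lemma C_zpow {S : Finset ℕ} {a : Br n} (h : fsp (perm n a) S = S) (k : ℤ) :
    C n S (a ^ k) = C n S a ^ k := by
  have h' : a ∈ (stabilizer (Perm (Finset ℕ)) S).comap (fsp.comp (perm n)) := h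
  have := map_zpow (CH n S) ⟨a, h'⟩ k
  exact this

lemma C_pow {S : Finset ℕ} {a : Br n} (h : fsp (perm n a) S = S) (k : ℕ) :
    C n S (a ^ k) = C n S a ^ k := by
  rw [← zpow_natCast, C_zpow h, zpow_natCast]

lemma fsp_perm_sq {i : ℕ} (h : i + 1 < n) (S : Finset ℕ) :
    fsp (perm n (σ n i ^ 2)) S = S := by
  rw [map_pow, perm_σ h, pow_two, swap_mul_self, map_one]; rfl

lemma perm_sq_eq_one {i : ℕ} (h : i + 1 < n := by omega) : perm n (σ n i ^ 2) = 1 := by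
  rw [map_pow, perm_σ h, pow_two, swap_mul_self]

lemma C_σ_sq_of_not {i : ℕ} (h : i + 1 < n) {S : Finset ℕ} (hS : i ∈ S → i + 1 ∉ S) :
    C n S (σ n i ^ 2) = 1 := by
  rw [pow_two, C_mul, C_σ h, C_σ h, perm_σ h, csv_of_not hS, csv_of_not, mul_one]
  rw [mem_fsp_swap, mem_fsp_swap, swap_apply_left, swap_apply_right]
  exact fun h1 h2 => hS h2 h1

lemma perm_ι_fr (m : ℕ) (v : F m) : perm (m + 1) (ι m (fr v)) = 1 := by
  rw [perm_ι]
  exact map_one (perm m)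

lemma C_fr_mul (m : ℕ) (S : Finset ℕ) (v w : F m) :
    C (m + 1) S (ι m (fr (v * w))) = C (m + 1) S (ι m (fr v)) * C (m + 1) S (ι m (fr w)) := by
  rw [map_mul, map_mul, C_mul, perm_ι_fr, map_one]; rfl

/-- The restriction of the cocycle to the free group. -/
def CF (m : ℕ) (S : Finset ℕ) : F m →* Br 3 where
  toFun v := C (m + 1) S (ι m (fr v))
  map_one' := by rw [map_one, map_one, C_one]
  map_mul' := C_fr_mul m S

lemma CF_apply (m : ℕ) (S : Finset ℕ) (v : F m) : C (m + 1) S (ι m (fr v)) = CF m S v := rfl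

lemma CF_x_step {m i : ℕ} (h : i + 1 < m) (S : Finset ℕ) :
    CF m S (x m i) = csv i (fsp (swap i (i + 1)) S) *
      CF m (fsp (swap i (i + 1)) S) (x m (i + 1)) *
      (csv i (fsp (swap i (i + 1)) S))⁻¹ := by
  rw [← CF_apply, ← CF_apply, ι_x h, ← C_σ (n := m + 1) (by omega), ← C_conj _ _ _ (by rw [perm_ι_fr, map_one]; rfl),
    perm_σ, ← mul_apply, ← map_mul, swap_mul_self, map_one]
  rfl

lemma CF_x_of_not_mem {m i : ℕ} (hi : i < m) : ∀ {S : Finset ℕ}, i ∉ S → CF m S (x m i) = 1 := by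
  obtain ⟨k, hk⟩ : ∃ k, i + k + 1 = m := ⟨m - 1 - i, by omega⟩
  induction k generalizing i with
  | zero =>
    intro S hS
    obtain rfl : i = m - 1 := by omega
    rw [← CF_apply, ι_x_last, C_σ_sq_of_not (by omega)]
    exact fun h => absurd h hS
  | succ k ih =>
    intro S hS
    rw [CF_x_step (by omega), ih (i := i + 1) (by omega) (by omega)]
    · rw [mul_one, mul_inv_cancel]
    · rwa [mem_fsp_swap, swap_apply_right]

lemma CF_of_not_mem {m : ℕ} {S : Finset ℕ} (h : m ∉ S) (v : F m) : CF m S v = 1 := by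
  have hx : ∀ k i, i + k + 1 = m → ∀ S : Finset ℕ, m ∉ S → CF m S (x m i) = 1 := by
    intro k
    induction k with
    | zero =>
      intro i hi S hS
      obtain rfl : i = m - 1 := by omega
      rw [← CF_apply, ι_x_last, C_σ_sq_of_not (by omega)]
      intro _
      rwa [Nat.sub_add_cancel (by omega)]
    | succ k ih =>
      intro i hi S hS
      rw [CF_x_step (by omega), ih (i + 1) (by omega), mul_one, mul_inv_cancel]
      rwa [mem_fsp_swap, swap_apply_of_ne_of_ne (by omega) (by omega)]
  exact F.mem_of_gens (CF m S).ker (fun i hi => hx (m - 1 - i) i (by omega) S h) v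

lemma C_ι_br {m : ℕ} (S : Finset ℕ) (b : Br m) : C (m + 1) S (ι m (br b)) = C m S b := by
  have : (cs (m + 1)).comp ((ι m).comp br) = cs m := Br.hom_ext fun i hi => by
    rw [comp_apply, comp_apply, ι_br_σ hi, cs, cs, Br.lift_σ _ _ _,
      Br.lift_σ _ _ _ hi]
  rw [C, C, ← this]; rfl

lemma C_ι {m : ℕ} {S : Finset ℕ} (h : m ∉ S) (g : AG m) : C (m + 1) S (ι m g) = C m S g.right := by
  rw [AG.fr_right m g, map_mul, C_mul, C_ι_br, CF_apply, CF_of_not_mem, one_mul]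
  · simp
  · rw [mem_fsp]
    have := perm_ι_last m (br g.right)
    rwa [Perm.inv_eq_iff_eq.2 this.symm]

/-- The set `{k, k + 1, k + 2}`. -/
def tri (k : ℕ) : Finset ℕ := {k, k + 1, k + 2}

lemma mem_tri {k i : ℕ} : i ∈ tri k ↔ k ≤ i ∧ i < k + 3 := by
  simp only [tri, Finset.mem_insert, Finset.mem_singleton]; omega

lemma card_tri (k : ℕ) : (tri k).card = 3 := by simp [tri]

lemma cnt_tri (k : ℕ) : cnt (tri k) k = 0 ∧ cnt (tri k) (k + 1) = 1 ∧ cnt (tri k) (k + 2) = 2 := by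
  have h0 : cnt (tri k) k = 0 := Finset.card_eq_zero.2 (Finset.filter_eq_empty_iff.2
    fun i hi => by rw [mem_tri] at hi; omega)
  have h1 := cnt_succ (tri k) k
  have h2 := cnt_succ (tri k) (k + 1)
  rw [if_pos (mem_tri.2 (by omega))] at h1 h2
  exact ⟨h0, by omega, by show cnt _ (k + 1 + 1) = 2; omega⟩

lemma csv_tri_0 (k : ℕ) : csv k (tri k) = σ 3 0 := by
  rw [csv, if_pos ⟨card_tri k, mem_tri.2 (by omega), mem_tri.2 (by omega)⟩, (cnt_tri k).1]
lemma csv_tri_1 (k : ℕ) : csv (k + 1) (tri k) = σ 3 1 := by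
  rw [csv, if_pos ⟨card_tri k, mem_tri.2 (by omega), mem_tri.2 (by omega)⟩, (cnt_tri k).2.1]

lemma fsp_swap_of_mem {S : Finset ℕ} {i : ℕ} (h1 : i ∈ S) (h2 : i + 1 ∈ S) :
    fsp (swap i (i + 1)) S = S := by
  ext j
  rw [mem_fsp_swap, swap_apply_def]
  split_ifs with h h <;> simp_all

lemma C_tri_mul {k : ℕ} {i : ℕ} (hi : i + 1 < n) (h1 : i ∈ tri k) (h2 : i + 1 ∈ tri k) (b : Br n)  :
    C n (tri k) (b * σ n i) = C n (tri k) b * csv i (tri k) := by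
  rw [C_mul, C_σ hi, perm_σ hi, fsp_swap_of_mem h1 h2]

lemma C_self (b : Br 3) : C 3 (tri 0) b = b := by
  have h : ∀ c : Br 3, fsp (perm 3 c) (tri 0) = tri 0 := fun c => by
    ext i
    rw [mem_fsp, mem_tri, mem_tri, ← map_inv]
    have h1 : i < 3 ↔ perm 3 c⁻¹ i < 3 := by
      refine ⟨fun h => perm_lt h _, fun h => ?_⟩
      by_contra h'
      rw [perm_of_le (by omega)] at h
      omega
    omega
  let f : Br 3 →* Br 3 :=
    { toFun := C 3 (tri 0), map_one' := C_one _, map_mul' := fun a b => C_mul_of_fix (h b) }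
  have : f = MonoidHom.id _ := Br.hom_ext fun i hi => by
    change C 3 (tri 0) (σ 3 i) = σ 3 i
    rw [C_σ hi]
    obtain rfl | rfl : i = 0 ∨ i = 1 := by omega
    · exact csv_tri_0 0
    · exact csv_tri_1 0
  exact congr_fun this b

lemma C_ζ (hn : 3 ≤ n) : C n (tri 0) (ζ n) = ζ 3 := by
  induction n, hn using Nat.le_induction with
  | base => exact C_self _
  | succ m hm ih =>
    rw [← ι_Δ, C_ι (by rw [mem_tri]; omega), ← ih]
    simp [Δ]

lemma perm_dl {k i : ℕ} (hk : k < n) : (i < k → perm n (dl n k) i = i + 1) ∧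
    (k < i → perm n (dl n k) i = i) := by
  induction k generalizing i with
  | zero => exact ⟨fun h => by omega, fun _ => by simp [dl]⟩
  | succ k ih =>
    constructor
    · intro h
      rw [dl, map_mul, mul_apply, perm_σ hk]
      rcases eq_or_ne i k with rfl | h'
      · rw [swap_apply_left, (ih (by omega)).2 (by omega)]
      · rw [swap_apply_of_ne_of_ne h' (by omega), (ih (by omega)).1 (by omega)]
    · intro h
      rw [dl, map_mul, mul_apply, perm_σ hk, swap_apply_of_ne_of_ne (by omega) (by omega),
        (ih (by omega)).2 (by omega)]

lemma perm_δ {i : ℕ} (h : i + 1 < n) : perm n (δ n) i = i + 1 :=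
  (perm_dl (by omega)).1 (by omega)

lemma perm_δ_pow {i k : ℕ} (h : i + k < n := by omega) : perm n (δ n ^ k) i = i + k := by
  induction k with
  | zero => simp
  | succ k ih => rw [pow_succ', map_mul, mul_apply, ih (by omega), perm_δ (by omega)]; omega

lemma fsp_δ_pow {k : ℕ} (h : k + 2 < n) : fsp (perm n (δ n ^ k)) (tri 0) = tri k := by
  rw [fsp_eq]
  simp only [tri, Finset.image_insert, Finset.image_singleton]
  rw [perm_δ_pow, perm_δ_pow, perm_δ_pow]
  simp only [zero_add, add_comm k]

lemma C_conj_of_pure (S : Finset ℕ) (a b : Br n) (hb : perm n b = 1) :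
    C n (fsp (perm n a) S) (a * b * a⁻¹) = C n S a * C n S b * (C n S a)⁻¹ :=
  C_conj S a b (by rw [hb, map_one]; rfl)

lemma perm_eq_one_of_commute {g : Perm ℕ} {k : ℕ} (hk : 3 ≤ k) (hg : ∀ i, k ≤ i → g i = i)
    (h : ∀ i, i + 1 < k → Commute g (swap i (i + 1))) : g = 1 := by
  have key : ∀ i, i + 1 < k → (g i = i ∧ g (i + 1) = i + 1) ∨ (g i = i + 1 ∧ g (i + 1) = i) := by
    intro i hi
    have h1 : swap (g i) (g (i + 1)) = swap i (i + 1) := by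
      rw [swap_apply_apply, (h i hi).eq, mul_inv_cancel_right]
    have h2 := congrArg (fun f => f (g i)) h1
    simp only [swap_apply_left] at h2
    have h3 : g (i + 1) ≠ g i := fun h => by have := g.injective h; omega
    rw [swap_apply_def] at h2
    split_ifs at h2 with ha hb
    · exact Or.inl ⟨ha, h2⟩
    · exact Or.inr ⟨hb, h2⟩
    · exact absurd h2 h3
  have key2 : ∀ i, i + 2 < k → g i = i ∧ g (i + 1) = i + 1 ∧ g (i + 2) = i + 2 := fun i hi => by
    have h1 := key i (by omega)
    have h2 := key (i + 1) (by omega)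
    simp only [add_assoc, Nat.reduceAdd] at h2
    omega
  ext i
  rw [one_apply]
  rcases lt_or_ge i k with hi | hi
  · rcases lt_or_ge (i + 2) k with h' | h'
    · exact (key2 i h').1
    · obtain ⟨j, rfl⟩ : ∃ j, k = j + 3 := ⟨k - 3, by omega⟩
      have := key2 j (by omega)
      obtain rfl | rfl : i = j + 1 ∨ i = j + 2 := by omega
      · exact this.2.1
      · exact this.2.2
  · exact hg i hi

lemma perm_ζ (hn : 3 ≤ n := by omega) : perm n (ζ n) = 1 :=
  perm_eq_one_of_commute hn (fun i hi => perm_of_le hi _) fun i hi => by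
    rw [← perm_σ hi]
    exact (ζ_commute n _).map (perm n)

lemma C_tri_ζ {k : ℕ} (h : k + 2 < n) : C n (tri k) (ζ n) = ζ 3 := by
  have h1 := C_conj_of_pure (tri 0) (δ n ^ k) (ζ n) (perm_ζ)
  rw [fsp_δ_pow h, C_ζ (by omega), ← (ζ_commute n (δ n ^ k)).eq, mul_inv_cancel_right] at h1
  rw [h1, ← (ζ_commute 3 _).eq, mul_inv_cancel_right]

lemma CF_x_last {m : ℕ} : CF (m + 2) (tri m) (x (m + 2) (m + 1)) = ι 2 (fr (x 2 1)) := by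
  have h1 := ι_x_last (m := m + 2)
  have h2 := ι_x_last (m := 2)
  rw [show m + 2 - 1 = m + 1 by omega] at h1
  simp only [Nat.reduceSub, Nat.reduceAdd] at h2
  rw [← CF_apply, h1, h2, pow_two, C_tri_mul (by omega) (mem_tri.2 (by omega)) (mem_tri.2 (by omega)),
    C_σ (by omega), csv_tri_1, pow_two]

lemma CF_x_prev {m : ℕ} : CF (m + 2) (tri m) (x (m + 2) m) = ι 2 (fr (x 2 0)) := by
  rw [CF_x_step (by omega), fsp_swap_of_mem (mem_tri.2 (by omega)) (mem_tri.2 (by omega)), CF_x_last,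
    csv_tri_0, ι_x (m := 2) (i := 0) (by omega)]

lemma CF_zl {m : ℕ} {k : ℕ} (h : k ≤ m) : CF (m + 2) (tri m) (zl (m + 2) k) = 1 := by
  induction k with
  | zero => rw [zl, map_one]
  | succ k ih => rw [zl, map_mul, ih (by omega), mul_one,
                   CF_x_of_not_mem (by omega) (by rw [mem_tri]; omega)]

lemma CF_p {m : ℕ} : CF (m + 2) (tri m) (zl (m + 2) (m + 1)) = ι 2 (fr (x 2 0)) := by
  rw [zl, map_mul, CF_zl le_rfl, mul_one, CF_x_prev]

lemma CF_z {m : ℕ} : CF (m + 2) (tri m) (z (m + 2)) = ι 2 (fr (z 2)) := by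
  rw [z, zl, map_mul, CF_p, CF_x_last, ← map_mul, ← map_mul]
  simp [z, zl]

end

section

open Equiv

variable {n : ℕ}

lemma cnt_tri_zero {s : ℕ} (h : s < 3) : cnt (tri 0) s = s := by
  have := cnt_tri 0
  interval_cases s
  · exact this.1
  · exact this.2.1
  · exact this.2.2

lemma perm_C_tri {b : Br n} (h : fsp (perm n b) (tri 0) = tri 0) {s : ℕ} (hs : s < 3) :
    perm 3 (C n (tri 0) b) s = perm n b s := by
  have h1 := C_perm (card_tri 0) b s (mem_tri.2 (by omega))
  have h2 : perm n b s ∈ tri 0 := by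
    rw [← h, apply_mem_fsp, mem_tri]; omega
  rw [mem_tri] at h2
  rwa [cnt_tri_zero hs, h, cnt_tri_zero (by omega)] at h1

lemma fsp_tri_of_fix {g : Perm ℕ} (h : ∀ i < 3, g i = i) : fsp g (tri 0) = tri 0 := by
  rw [fsp_eq]
  simp only [tri, Finset.image_insert, Finset.image_singleton]
  rw [h _ (by omega), h _ (by omega), h _ (by omega)]

/-- The composition of `φ` with the modular image of the first three strands. -/
def tripleHom (φ : Br n →* Br n) (hφ : ∀ b, perm n (φ b) = perm n b) :
    (stabilizer (Perm (Finset ℕ)) (tri 0)).comap (fsp.comp (perm n)) →* SLZ where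
  toFun b := SL (C n (tri 0) (φ b.1))
  map_one' := by
    change SL (C n (tri 0) (φ 1)) = 1
    rw [map_one, C_one, map_one]
  map_mul' a b := by
    change SL (C n (tri 0) (φ (a.1 * b.1))) = _
    rw [map_mul, C_mul_of_fix (by rw [hφ]; exact b.2), map_mul]

lemma triple_scalar (hn : 5 ≤ n) (φ : Br n →* Br n) (hφ : ∀ b, perm n (φ b) = perm n b) :
    SL (C n (tri 0) (φ (σ n 2 ^ 2))) = 1 ∨ SL (C n (tri 0) (φ (σ n 2 ^ 2))) = -1 := by
  have m0 : fsp (perm n (σ n 0)) (tri 0) = tri 0 := by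
    rw [perm_σ, fsp_swap_of_mem (mem_tri.2 (by omega)) (mem_tri.2 (by omega))]
  have m1 : fsp (perm n (σ n 1)) (tri 0) = tri 0 := by
    rw [perm_σ, fsp_swap_of_mem (mem_tri.2 (by omega)) (mem_tri.2 (by omega))]
  have m3 : fsp (perm n (σ n 3)) (tri 0) = tri 0 := by
    rw [perm_σ]
    exact fsp_tri_of_fix fun i hi => swap_apply_of_ne_of_ne (by omega) (by omega)
  obtain ⟨g0, h0⟩ : ∃ g : (stabilizer (Perm (Finset ℕ)) (tri 0)).comap
    (fsp.comp (perm n)), g.1 = σ n 0 := ⟨⟨_, m0⟩, rfl⟩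
  obtain ⟨g1, h1⟩ : ∃ g : (stabilizer (Perm (Finset ℕ)) (tri 0)).comap
    (fsp.comp (perm n)), g.1 = σ n 1 := ⟨⟨_, m1⟩, rfl⟩
  obtain ⟨g3, h3⟩ : ∃ g : (stabilizer (Perm (Finset ℕ)) (tri 0)).comap
    (fsp.comp (perm n)), g.1 = σ n 3 := ⟨⟨_, m3⟩, rfl⟩
  obtain ⟨g2, h2⟩ : ∃ g : (stabilizer (Perm (Finset ℕ)) (tri 0)).comap
    (fsp.comp (perm n)), g.1 = σ n 2 ^ 2 := ⟨⟨_, fsp_perm_sq (by omega) _⟩, rfl⟩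
  have hbr : g0 * g1 * g0 = g1 * g0 * g1 := Subtype.ext (by
    simp only [coe_mul, h0, h1]; exact σ_braid)
  have c03 : Commute g0 g3 := Subtype.ext (by
    simp only [coe_mul, h0, h3]; exact σ_comm)
  have c13 : Commute g1 g3 := Subtype.ext (by
    simp only [coe_mul, h1, h3]; exact σ_comm)
  have c02 : Commute g0 g2 := Subtype.ext (by
    simp only [coe_mul, h0, h2]; exact (σ_comm).pow_right 2)
  have cc : Commute (g3 * g2 * g3⁻¹) (g1 * g2 * g1⁻¹) := Subtype.ext (by
    simp only [coe_mul, Subgroup.coe_inv, h1, h2, h3]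
    have e1 : σ n 1 * σ n 2 ^ 2 * (σ n 1)⁻¹ = (σ n 2)⁻¹ * σ n 1 ^ 2 * σ n 2 := σ_sq_conj (by omega)
    have e2 : σ n 3 * σ n 2 ^ 2 * (σ n 3)⁻¹ = (σ n 2)⁻¹ * σ n 3 ^ 2 * σ n 2 := by
      have hb : σ n 2 * σ n 3 * σ n 2 = σ n 3 * σ n 2 * σ n 3 := σ_braid
      have e : σ n 2 * σ n 3 * σ n 2 = σ n 3 * (σ n 2 * σ n 3) := by rw [hb, mul_assoc]
      have e' : σ n 3 * σ n 2 * σ n 3 = σ n 2 * (σ n 3 * σ n 2) := by rw [← hb, mul_assoc]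
      rw [mul_inv_eq_iff_eq_mul, mul_assoc, mul_assoc, eq_inv_mul_iff_mul_eq]
      calc σ n 2 * (σ n 3 * σ n 2 ^ 2) = σ n 2 * σ n 3 * σ n 2 * σ n 2 := by
            simp only [pow_two, mul_assoc]
        _ = σ n 3 * (σ n 2 * σ n 3) * σ n 2 := by rw [e]
        _ = σ n 3 * (σ n 2 * σ n 3 * σ n 2) := by simp only [mul_assoc]
        _ = _ := by rw [hb]; simp only [pow_two, mul_assoc]
    rw [e1, e2]
    have := (σ_comm (m := n) (i := 1) (j := 3)).symm.pow_pow 2 2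
    have h4 := (SemiconjBy.conj_iff (a := σ n 3 ^ 2) (x := σ n 1 ^ 2) (y := σ n 1 ^ 2)
      (b := (σ n 2)⁻¹)).2 this
    rw [inv_inv] at h4
    exact h4)
  obtain ⟨f, hf⟩ : ∃ f, f = tripleHom φ hφ := ⟨_, rfl⟩
  have hne : f g0 ≠ f g1 := fun h => by
    have h5 : perm 3 (C n (tri 0) (φ (σ n 0))) = perm 3 (C n (tri 0) (φ (σ n 1))) :=
      perm_eq_of_SL fun i j => by
        have : SL (C n (tri 0) (φ (σ n 0))) = SL (C n (tri 0) (φ (σ n 1))) := by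
          rw [← h0, ← h1]; rw [hf] at h; exact h
        rw [this]
    have h6 := congrArg (fun g => g 0) h5
    rw [perm_C_tri (by rw [hφ, m0]) (by omega), perm_C_tri (by rw [hφ, m1]) (by omega), hφ, hφ,
      perm_σ, perm_σ, swap_apply_left,
      swap_apply_of_ne_of_ne (by omega) (by omega)] at h6
    omega
  have hb' : f g0 * f g1 * f g0 = f g1 * f g0 * f g1 := by
    rw [← map_mul, ← map_mul, hbr, map_mul, map_mul]
  have hg3 : f g3 = 1 ∨ f g3 = -1 := SLZ.central_of_commute hb' hne (c03.map f) (by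
    rw [(c13.map f).eq, mul_inv_cancel_right])
  have hg2 : f g2 = 1 ∨ f g2 = -1 := SLZ.central_of_commute hb' hne (c02.map f) (by
    have := cc.map f
    simp only [map_mul, map_inv] at this
    have e : f g3 * f g2 * (f g3)⁻¹ = f g2 := by
      have : Commute (f g3) (f g2) := by
        rcases hg3 with h | h <;> rw [h]
        · exact Commute.one_left _
        · exact (SLZ.commute_neg_one _).symm
      rw [this.eq, mul_inv_cancel_right]
    rwa [e] at this)
  rw [hf] at hg2
  rw [← h2]
  exact hg2

end

lemma SL_ker {b : Br 3} (h : SL b = 1) : ∃ c : ℤ, b = ζ 3 ^ (2 * c) := by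
  have hp : perm 3 b = 1 := by
    rw [← map_one (perm 3)]
    exact perm_eq_of_SL fun i j => by rw [h, map_one]
  have hb : ι 2 (fg 2 b) = b := ι_fg (by rw [hp]; rfl)
  obtain ⟨j, hj⟩ := mem_zpowers_iff.1 <|
    center 2 (fg 2 b).right (by rw [← perm_ι, hb, hp]) fun c =>
    (Br.commute_of_gens (MonoidHom.id _) _ (fun i hi => by
      refine (Br.commute_of_gens (MonoidHom.id _) _ (fun k hk => ?_) c).symm
      obtain rfl : i = 0 := by omega
      obtain rfl : k = 0 := by omega
      exact Commute.refl _) _)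
  obtain ⟨u, hu⟩ : ∃ u, u = (fg 2 b).left * (z 2 ^ j)⁻¹ := ⟨_, rfl⟩
  have hbu : b = ι 2 (fr u) * ζ 3 ^ j := by
    rw [← ι_Δ (m := 2), ← map_zpow, ← map_mul, ← hb]
    congr 1
    have hc : Commute (fr (z 2)) (br (ζ 2)) := by
      rw [Commute, SemiconjBy, br_mul_fr, act_z]
    rw [AG.fr_right 2 (fg 2 b), ← hj, hu, Δ, hc.mul_zpow]
    simp [mul_assoc]
  have h2 : SL (ι 2 (fr u)) * (-1) ^ j = 1 := by
    rw [← SL_ζ, ← map_zpow, ← map_mul, ← hbu, h]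
  have h3 : u ^ 2 = 1 := SL_fr_injective (by
    simp only [map_pow, map_one]
    rw [eq_inv_of_mul_eq_one_left h2, inv_pow, ← zpow_natCast, ← zpow_mul, mul_comm, zpow_mul]
    simp)
  have h4 : u = 1 := by simpa using h3
  rw [h4, map_one, map_one, one_mul] at hbu
  rw [h4, map_one, map_one, map_one, one_mul] at h2
  obtain ⟨c, hc | hc⟩ := Int.even_or_odd' j
  · exact ⟨c, by rw [hbu, hc]⟩
  · exfalso
    rw [hc, zpow_add, zpow_mul, zpow_one] at h2
    simp at h2
    have := (SLZ.ext_iff'.1 h2).1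
    simp at this

lemma SL_eq_one {b : Br 3} (h : SL b = 1) (he : expo 3 b = 1) : b = 1 := by
  obtain ⟨c, rfl⟩ := SL_ker h
  rw [map_zpow, expo_ζ] at he
  have h5 := congrArg toAdd he
  simp at h5
  rw [h5, mul_zero, zpow_zero]

lemma SL_surjective : Function.Surjective SL := by
  rw [← MonoidHom.range_eq_top, ← top_le_iff,
    ← SpecialLinearGroup.SL2Z_generators, Subgroup.closure_le]
  rintro A (rfl | rfl)
  · refine ⟨σ 3 0 * σ 3 1 * σ 3 0, ?_⟩
    rw [map_mul, map_mul, SL_σ0, SL_σ1, SLZ.ext_iff']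
    simp [SLZ.mul_entry, sm0_entries, sm1_entries, ModularGroup.S]
  · refine ⟨(σ 3 0)⁻¹, ?_⟩
    rw [map_inv, SL_σ0, inv_eq_iff_mul_eq_one, SLZ.ext_iff']
    simp only [SLZ.mul_entry]
    simp [sm0_entries, ModularGroup.T]

/-- A nonzero integral matrix conjugating the standard generators into the modular group is, up to
a scalar and a reflection, unimodular. -/
lemma unimodular_of_conj {a b c d : ℤ} {P Q : SLZ} (ha : Odd a) (hb : Even b) (hc : Even c)
    (hd : Odd d)
    (p1 : P.1 0 0 * a + P.1 0 1 * c = a) (p2 : P.1 0 0 * b + P.1 0 1 * d = b - a)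
    (p3 : P.1 1 0 * a + P.1 1 1 * c = c) (p4 : P.1 1 0 * b + P.1 1 1 * d = d - c)
    (q1 : Q.1 0 0 * a + Q.1 0 1 * c = a + b) (q2 : Q.1 0 0 * b + Q.1 0 1 * d = b)
    (q3 : Q.1 1 0 * a + Q.1 1 1 * c = c + d) (q4 : Q.1 1 0 * b + Q.1 1 1 * d = d) :
    ∃ N : SLZ, (Odd (N.1 0 0) ∧ Even (N.1 0 1) ∧ Even (N.1 1 0) ∧ Odd (N.1 1 1)) ∧
      (P * N = N * sm0 ∧ Q * N = N * sm1 ∨ P * N = N * sm0⁻¹ ∧ Q * N = N * sm1⁻¹) := by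
  obtain ⟨g, hg⟩ : ∃ g : ℤ, g = GCDMonoid.gcd (GCDMonoid.gcd a b) (GCDMonoid.gcd c d) := ⟨_, rfl⟩
  have hg0 : g ≠ 0 := fun h => by
    rw [h] at hg
    have := (gcd_eq_zero_iff _ _).1 hg.symm
    have := ((gcd_eq_zero_iff _ _).1 this.1).1
    subst this
    simp at ha
  have ga : g ∣ a := hg ▸ (gcd_dvd_left _ _).trans (gcd_dvd_left _ _)
  have gb : g ∣ b := hg ▸ (gcd_dvd_left _ _).trans (gcd_dvd_right _ _)
  have gc : g ∣ c := hg ▸ (gcd_dvd_right _ _).trans (gcd_dvd_left _ _)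
  have gd : g ∣ d := hg ▸ (gcd_dvd_right _ _).trans (gcd_dvd_right _ _)
  obtain ⟨a', rfl⟩ := ga
  obtain ⟨b', rfl⟩ := gb
  obtain ⟨c', rfl⟩ := gc
  obtain ⟨d', rfl⟩ := gd
  have hprim : ∀ p : ℤ, Prime p → p ∣ a' → p ∣ b' → p ∣ c' → p ∣ d' → False := by
    intro p hp h1 h2 h3 h4
    have : g * p ∣ g := by
      conv_rhs => rw [hg]
      exact dvd_gcd (dvd_gcd (mul_dvd_mul_left _ h1) (mul_dvd_mul_left _ h2))
        (dvd_gcd (mul_dvd_mul_left _ h3) (mul_dvd_mul_left _ h4))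
    obtain ⟨e, he⟩ := this
    have : p * e = 1 := by
      have : g * (p * e) = g * 1 := by rw [mul_one, ← mul_assoc]; exact he.symm
      exact mul_left_cancel₀ hg0 this
    exact hp.not_isUnit (IsUnit.of_mul_eq_one _ this)
  rw [Int.odd_mul] at ha hd
  have hgo : ¬ Even g := Int.not_even_iff_odd.2 ha.1
  have hb' : Even b' := (Int.even_mul.1 hb).resolve_left hgo
  have hc' : Even c' := (Int.even_mul.1 hc).resolve_left hgo
  have ha' := ha.2
  have hd' := hd.2
  clear hg ha hb hc hd hgo
  have cancel : ∀ {x y : ℤ}, g * x = g * y → x = y := fun h => mul_left_cancel₀ hg0 h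
  replace p1 := cancel (x := P.1 0 0 * a' + P.1 0 1 * c') (y := a') (by linear_combination p1)
  replace p2 := cancel (x := P.1 0 0 * b' + P.1 0 1 * d') (y := b' - a') (by linear_combination p2)
  replace p3 := cancel (x := P.1 1 0 * a' + P.1 1 1 * c') (y := c') (by linear_combination p3)
  replace p4 := cancel (x := P.1 1 0 * b' + P.1 1 1 * d') (y := d' - c') (by linear_combination p4)
  replace q1 := cancel (x := Q.1 0 0 * a' + Q.1 0 1 * c') (y := a' + b') (by linear_combination q1)
  replace q2 := cancel (x := Q.1 0 0 * b' + Q.1 0 1 * d') (y := b') (by linear_combination q2)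
  replace q3 := cancel (x := Q.1 1 0 * a' + Q.1 1 1 * c') (y := c' + d') (by linear_combination q3)
  replace q4 := cancel (x := Q.1 1 0 * b' + Q.1 1 1 * d') (y := d') (by linear_combination q4)
  obtain ⟨D, hD⟩ : ∃ D, D = a' * d' - b' * c' := ⟨_, rfl⟩
  have da : D ∣ a' ^ 2 := ⟨-P.1 0 1, by rw [hD]; linear_combination a' * p2 - b' * p1⟩
  have dc : D ∣ c' ^ 2 := ⟨P.1 1 0, by rw [hD]; linear_combination c' * p4 - d' * p3⟩
  have db : D ∣ b' ^ 2 := ⟨-Q.1 0 1, by rw [hD]; linear_combination a' * q2 - b' * q1⟩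
  have dd : D ∣ d' ^ 2 := ⟨Q.1 1 0, by rw [hD]; linear_combination c' * q4 - d' * q3⟩
  have hD1 : D = 1 ∨ D = -1 := by
    rw [← Int.isUnit_iff, Int.isUnit_iff_natAbs_eq]
    by_contra h
    obtain ⟨p, hp, hpd⟩ := Nat.exists_prime_and_dvd h
    have hp' : Prime (p : ℤ) := Nat.prime_iff_prime_int.1 hp
    have hpD : (p : ℤ) ∣ D := Int.natCast_dvd.2 hpd
    exact hprim p hp' (hp'.dvd_of_dvd_pow (hpD.trans da)) (hp'.dvd_of_dvd_pow (hpD.trans db))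
      (hp'.dvd_of_dvd_pow (hpD.trans dc)) (hp'.dvd_of_dvd_pow (hpD.trans dd))
  rcases hD1 with h | h
  · obtain ⟨N, hN⟩ : ∃ N : SLZ, N.1 = !![a', b'; c', d'] :=
      ⟨⟨_, by rw [Matrix.det_fin_two_of, ← hD, h]⟩, rfl⟩
    refine ⟨N, ⟨by simpa [hN], by simpa [hN], by simpa [hN], by simpa [hN]⟩, Or.inl ⟨?_, ?_⟩⟩
    · rw [SLZ.mul_ext_iff]
      simp [sm0_entries, hN]
      exact ⟨p1, by linarith, p3, by linarith⟩
    · rw [SLZ.mul_ext_iff]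
      simp [sm1_entries, hN]
      exact ⟨q1, q2, q3, q4⟩
  · obtain ⟨N, hN⟩ : ∃ N : SLZ, N.1 = !![a', -b'; c', -d'] :=
      ⟨⟨_, by rw [Matrix.det_fin_two_of]; linarith⟩, rfl⟩
    refine ⟨N, ⟨by simpa [hN], by simpa [hN] using hb', by simpa [hN],
      by simpa [hN] using hd'⟩, Or.inr ⟨?_, ?_⟩⟩
    · rw [eq_mul_inv_iff_mul_eq, SLZ.ext_iff']
      simp [SLZ.mul_entry, sm0_entries, hN]
      refine ⟨p1, by linarith, p3, by linarith⟩
    · rw [eq_mul_inv_iff_mul_eq, SLZ.ext_iff']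
      simp [SLZ.mul_entry, sm1_entries, hN]
      refine ⟨by linarith, by linarith, by linarith, by linarith⟩

section

open _root_.Braid.FP Equiv

section lift
variable {G : Type*} [Group G]

/-- The homomorphism on the free group `W` given by the images of `X` and `t`. -/
def wlift (a c : G) : W →* G := lift (zpowersHom G a) c

@[simp] lemma wlift_X (a c : G) : wlift a c X = a := by
  rw [wlift, X, lift_inc]; simp

@[simp] lemma wlift_t (a c : G) : wlift a c (t _) = c := lift_t _ _

/-- An automorphism of `W` given by mutually inverse substitutions. -/
def waut (a c a' c' : W) (h1 : wlift a' c' a = X) (h2 : wlift a' c' c = t _)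
    (h3 : wlift a c a' = X) (h4 : wlift a c c' = t _) : MulAut W :=
  MonoidHom.toMulEquiv (wlift a c) (wlift a' c') (W_hom_ext (by simpa using h2) (by simpa using h1))
    (W_hom_ext (by simpa using h4) (by simpa using h3))

lemma W_aut_ext {f g : MulAut W} (h1 : f (t _) = g (t _)) (h2 : f X = g X) : f = g := by
  have := W_hom_ext (f := f.toMonoidHom) (g := g.toMonoidHom) h1 h2
  ext u
  exact congr_fun this u

end lift

def aut0 : MulAut W := waut X (X⁻¹ * t (Multiplicative ℤ)) X (X * t (Multiplicative ℤ)) (by simp) (by simp) (by simp) (by simp)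
def aut1 : MulAut W := waut (X * t (Multiplicative ℤ)) (t (Multiplicative ℤ)) (X * (t (Multiplicative ℤ))⁻¹) (t (Multiplicative ℤ)) (by simp) (by simp) (by simp)
  (by simp)

@[simp] lemma aut0_X : aut0 X = X := wlift_X X (X⁻¹ * t (Multiplicative ℤ))
@[simp] lemma aut0_t : aut0 (t (Multiplicative ℤ)) = X⁻¹ * t _ := wlift_t X (X⁻¹ * t (Multiplicative ℤ))
@[simp] lemma aut1_X : aut1 X = X * t _ := wlift_X (X * t (Multiplicative ℤ)) (t (Multiplicative ℤ))
@[simp] lemma aut1_t : aut1 (t (Multiplicative ℤ)) = t _ := wlift_t (X * t (Multiplicative ℤ)) (t (Multiplicative ℤ))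

/-- The action of the braid group on three strands on the free group of rank two. -/
def actW : Br 3 →* MulAut W :=
  Br.lift (fun i => if i = 0 then aut0 else aut1)
    (fun i hi => by
      obtain rfl : i = 0 := by omega
      change aut0 * aut1 * aut0 = aut1 * aut0 * aut1
      apply W_aut_ext <;> simp [MulAut.mul_apply, mul_assoc])
    (fun i j h hj => by omega)

lemma actW_σ0 : actW (σ 3 0) = aut0 := Br.lift_σ _ _ _
lemma actW_σ1 : actW (σ 3 1) = aut1 := Br.lift_σ _ _ _

/-- The semidirect product isomorphic to the braid group on four strands. -/
abbrev S4 := W ⋊[actW] Br 3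

namespace S4

abbrev inW : W →* S4 := SemidirectProduct.inl
abbrev inR : Br 3 →* S4 := SemidirectProduct.inr

lemma inR_mul_inW (b : Br 3) (u : W) : inR b * inW u = inW (actW b u) * inR b := by
  rw [SemidirectProduct.inl_aut]; simp

lemma eq_mul (g : S4) : g = inW g.left * inR g.right :=
  (inl_left_mul_inr_right g).symm

end S4

open S4

/-- The splitting of the braid group on four strands. -/
def J : Br 4 →* S4 :=
  Br.lift (fun i => if i = 0 then inR (σ 3 0) else if i = 1 then inR (σ 3 1) else
      inW X * inR (σ 3 0))
    (fun i hi => by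
      have hb : σ 3 0 * σ 3 1 * σ 3 0 = σ 3 1 * σ 3 0 * σ 3 1 := σ_braid
      obtain rfl | rfl : i = 0 ∨ i = 1 := by omega
      · simp only [if_true, zero_add, one_ne_zero, if_false, ← map_mul, hb]
      · simp only [one_ne_zero, if_true, if_false, Nat.reduceAdd, OfNat.ofNat_ne_zero,
          OfNat.ofNat_ne_one]
        calc inR (σ 3 1) * (inW X * inR (σ 3 0)) * inR (σ 3 1)
            = inR (σ 3 1) * inW X * inR (σ 3 0 * σ 3 1) := by simp only [map_mul, mul_assoc]
          _ = inW (X * t _) * inR (σ 3 1 * σ 3 0 * σ 3 1) := by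
              rw [inR_mul_inW, actW_σ1, aut1_X]; simp only [map_mul, mul_assoc]
          _ = inW X * (inR (σ 3 0) * inW (X * t _)) * inR (σ 3 1 * σ 3 0) := by
              rw [inR_mul_inW, actW_σ0, map_mul aut0, aut0_X, aut0_t, mul_inv_cancel_left,
                map_mul, ← hb]
              simp only [map_mul, mul_assoc]
          _ = inW X * inR (σ 3 0) * (inR (σ 3 1) * inW X) * inR (σ 3 0) := by
              rw [inR_mul_inW (σ 3 1), actW_σ1, aut1_X]; simp only [map_mul, mul_assoc]
          _ = _ := by simp only [mul_assoc])
    (fun i j h hj => by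
      obtain rfl : i = 0 := by omega
      obtain rfl : j = 2 := by omega
      simp only [if_true, if_false, OfNat.ofNat_ne_zero, OfNat.ofNat_ne_one]
      rw [← mul_assoc, inR_mul_inW, actW_σ0, aut0_X])

lemma J_σ0 : J (σ 4 0) = inR (σ 3 0) := Br.lift_σ _ _ _
lemma J_σ1 : J (σ 4 1) = inR (σ 3 1) := Br.lift_σ _ _ _
lemma J_σ2 : J (σ 4 2) = inW X * inR (σ 3 0) := Br.lift_σ _ _ _

def αB : Br 4 := σ 4 2 * (σ 4 0)⁻¹
def γB : Br 4 := αB⁻¹ * (σ 4 1 * αB * (σ 4 1)⁻¹)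

lemma conj_αB0 : σ 4 0 * αB * (σ 4 0)⁻¹ = αB := by
  have h : σ 4 0 * σ 4 2 = σ 4 2 * σ 4 0 := σ_comm
  rw [αB, ← mul_assoc, h, mul_inv_cancel_right]

lemma conj_αB1 : σ 4 1 * αB * (σ 4 1)⁻¹ = αB * γB := by
  rw [γB, mul_inv_cancel_left]

lemma conj_γB0 : σ 4 0 * γB * (σ 4 0)⁻¹ = αB⁻¹ * γB := by
  have h : σ 4 0 * σ 4 2 = σ 4 2 * σ 4 0 := σ_comm
  have h1 : σ 4 0 * σ 4 1 * σ 4 0 = σ 4 1 * σ 4 0 * σ 4 1 := σ_braid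
  have h2 : σ 4 1 * σ 4 2 * σ 4 1 = σ 4 2 * σ 4 1 * σ 4 2 := σ_braid
  rw [γB, αB]
  generalize σ 4 0 = a at *
  generalize σ 4 1 = b at *
  generalize σ 4 2 = c at *
  have k1 : a⁻¹ * b⁻¹ * a⁻¹ = b⁻¹ * a⁻¹ * b⁻¹ := by
    simpa [mul_assoc] using congrArg (·⁻¹) h1
  have k2 : b * c * b⁻¹ = c⁻¹ * b * c := by
    rw [mul_inv_eq_iff_eq_mul, mul_assoc, mul_assoc, eq_inv_mul_iff_mul_eq, ← mul_assoc, ← mul_assoc,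
      h2]
  have k3 : c⁻¹ * a = a * c⁻¹ := by
    rw [inv_mul_eq_iff_eq_mul, ← mul_assoc, ← h, mul_inv_cancel_right]
  calc a * ((c * a⁻¹)⁻¹ * (b * (c * a⁻¹) * b⁻¹)) * a⁻¹
      = a * a * c⁻¹ * b * c * (a⁻¹ * b⁻¹ * a⁻¹) := by simp [mul_assoc]
    _ = a * a * c⁻¹ * (b * c * b⁻¹) * a⁻¹ * b⁻¹ := by rw [k1]; simp [mul_assoc]
    _ = a * (a * c⁻¹) * c⁻¹ * b * c * a⁻¹ * b⁻¹ := by rw [k2]; simp [mul_assoc]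
    _ = _ := by rw [← k3]; simp [mul_assoc]

lemma conj_γB1 : σ 4 1 * γB * (σ 4 1)⁻¹ = γB := by
  have h : σ 4 0 * σ 4 2 = σ 4 2 * σ 4 0 := σ_comm
  have h1 : σ 4 0 * σ 4 1 * σ 4 0 = σ 4 1 * σ 4 0 * σ 4 1 := σ_braid
  have h2 : σ 4 1 * σ 4 2 * σ 4 1 = σ 4 2 * σ 4 1 * σ 4 2 := σ_braid
  rw [γB, αB]
  generalize σ 4 0 = a at *
  generalize σ 4 1 = b at *
  generalize σ 4 2 = c at *
  have k2 : b * c⁻¹ * b⁻¹ = c⁻¹ * b⁻¹ * c := by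
    rw [mul_inv_eq_iff_eq_mul, mul_assoc, mul_assoc, eq_inv_mul_iff_mul_eq, ← mul_assoc,
      mul_inv_eq_iff_eq_mul, mul_assoc, mul_assoc, eq_inv_mul_iff_mul_eq, ← mul_assoc, ← mul_assoc,
      h2]
  have k3 : c⁻¹ * a = a * c⁻¹ := by
    rw [inv_mul_eq_iff_eq_mul, ← mul_assoc, ← h, mul_inv_cancel_right]
  have k4 : a * b * a⁻¹ = b⁻¹ * a * b := by
    rw [mul_inv_eq_iff_eq_mul, mul_assoc, mul_assoc, eq_inv_mul_iff_mul_eq, ← mul_assoc, ← mul_assoc,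
      h1]
  have k5 : c * a⁻¹ = a⁻¹ * c := by
    rw [eq_inv_mul_iff_mul_eq, ← mul_assoc, h, mul_inv_cancel_right]
  have hD : a * c⁻¹ * b * c * a⁻¹ = c⁻¹ * b⁻¹ * a * b * c := by
    calc a * c⁻¹ * b * c * a⁻¹ = (a * c⁻¹) * b * (c * a⁻¹) := by simp only [mul_assoc]
      _ = c⁻¹ * (a * b * a⁻¹) * c := by rw [← k3, k5]; simp only [mul_assoc]
      _ = _ := by rw [k4]; simp only [mul_assoc]
  have hc : b * (a * c⁻¹ * b * c * a⁻¹) = (a * c⁻¹ * b * c * a⁻¹) * b := by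
    rw [hD]
    calc b * (c⁻¹ * b⁻¹ * a * b * c) = (b * c⁻¹ * b⁻¹) * a * b * c := by simp only [mul_assoc]
      _ = c⁻¹ * b⁻¹ * (c * a) * b * c := by rw [k2]; simp only [mul_assoc]
      _ = c⁻¹ * b⁻¹ * a * (c * b * c) := by rw [← h]; simp only [mul_assoc]
      _ = _ := by rw [← h2]; simp only [mul_assoc]
  calc b * ((c * a⁻¹)⁻¹ * (b * (c * a⁻¹) * b⁻¹)) * b⁻¹
      = b * (a * c⁻¹ * b * c * a⁻¹) * b⁻¹ * b⁻¹ := by simp [mul_assoc]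
    _ = _ := by rw [hc]; simp [mul_assoc]

lemma inB_σ0 : inB 3 (σ 3 0) = σ 4 0 := inB_σ
lemma inB_σ1 : inB 3 (σ 3 1) = σ 4 1 := inB_σ

lemma wlift_actW (b : Br 3) (u : W) :
    wlift αB γB (actW b u) = inB 3 b * wlift αB γB u * (inB 3 b)⁻¹ := by
  refine Br.aut_equivariant actW (fun b v => inB 3 b * v * (inB 3 b)⁻¹) (wlift αB γB) (fun i hi u => ?_) b u
  have key : ∀ (f : MulAut W) (g : Br 4), wlift αB γB (f X) = g * αB * g⁻¹ →
      wlift αB γB (f (t _)) = g * γB * g⁻¹ →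
      wlift αB γB (f u) = g * wlift αB γB u * g⁻¹ := fun f g h1 h2 => by
    have := W_hom_ext (f := (wlift αB γB).comp f.toMonoidHom)
      (g := (MulAut.conj g).toMonoidHom.comp (wlift αB γB)) (by simpa using h2) (by simpa using h1)
    exact congr_fun this u
  obtain rfl | rfl : i = 0 ∨ i = 1 := by omega
  · rw [actW_σ0, inB_σ0]
    exact key _ _ (by simp [conj_αB0]) (by simp [conj_γB0])
  · rw [actW_σ1, inB_σ1]
    exact key _ _ (by simp [conj_αB1]) (by simp [conj_γB1])

/-- The inverse of the splitting. -/
def K : S4 →* Br 4 := SemidirectProduct.lift (wlift αB γB) (inB 3) fun b =>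
  MonoidHom.ext fun u => wlift_actW b u

lemma K_inW (u : W) : K (inW u) = wlift αB γB u := SemidirectProduct.lift_inl ..
lemma K_inR (b : Br 3) : K (inR b) = inB 3 b := SemidirectProduct.lift_inr ..

lemma J_inB (b : Br 3) : J (inB 3 b) = inR b := by
  have : J.comp (inB 3) = inR := Br.hom_ext fun i hi => by
    rw [comp_apply, inB_σ hi]
    obtain rfl | rfl : i = 0 ∨ i = 1 := by omega
    · exact J_σ0
    · exact J_σ1
  exact congr_fun this b

lemma K_J (b : Br 4) : K (J b) = b := by
  have : K.comp J = MonoidHom.id _ := Br.hom_ext fun i hi => by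
    rw [comp_apply, id_apply]
    obtain rfl | rfl | rfl : i = 0 ∨ i = 1 ∨ i = 2 := by omega
    · rw [J_σ0, K_inR, inB_σ0]
    · rw [J_σ1, K_inR, inB_σ1]
    · rw [J_σ2, map_mul, K_inR, K_inW, inB_σ0, wlift_X, αB, inv_mul_cancel_right]
  exact congr_fun this b

lemma J_αB : J αB = inW X := by
  rw [αB, map_mul, map_inv, J_σ0, J_σ2, mul_inv_cancel_right]

lemma J_γB : J γB = inW (t _) := by
  rw [γB, map_mul, map_mul, map_mul, map_inv, map_inv, J_αB, J_σ1, inR_mul_inW, actW_σ1, aut1_X,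
    mul_inv_cancel_right, map_mul, inv_mul_cancel_left]

lemma J_wlift (u : W) : J (wlift αB γB u) = inW u := by
  have : J.comp (wlift αB γB) = inW := W_hom_ext (by simp [J_γB]) (by simp [J_αB])
  exact congr_fun this u

lemma J_injective : Injective J := Function.LeftInverse.injective K_J

/-- The resolvent map. -/
def qB : Br 4 →* Br 3 := rightHom.comp J

lemma qB_inB (b : Br 3) : qB (inB 3 b) = b := by
  rw [qB, comp_apply, J_inB]; rfl

lemma eq_wlift_of_qB {b : Br 4} (h : qB b = 1) : b = wlift αB γB (J b).left := by
  apply J_injective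
  rw [J_wlift]
  conv_lhs => rw [eq_mul (J b)]
  rw [show (J b).right = 1 from h, map_one, mul_one]

end

section

open _root_.Braid.FP Equiv S4

/-! ### Permutations -/

/-- The three fixed point free involutions on four points. -/
def vv (i : ℕ) : Perm ℕ :=
  if i = 0 then swap 0 3 * swap 1 2 else if i = 1 then swap 0 2 * swap 1 3
  else swap 0 1 * swap 2 3

lemma qB_σ : qB (σ 4 0) = σ 3 0 ∧ qB (σ 4 1) = σ 3 1 ∧ qB (σ 4 2) = σ 3 0 := by
  refine ⟨?_, ?_, ?_⟩ <;> rw [qB, comp_apply]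
  · rw [J_σ0]; rfl
  · rw [J_σ1]; rfl
  · rw [J_σ2, map_mul]; simp

lemma swap_comm' {a b c d : ℕ} (h1 : a ≠ c) (h2 : a ≠ d) (h3 : b ≠ c) (h4 : b ≠ d) :
    swap a b * swap c d = swap c d * swap a b := by
  ext k
  simp only [mul_apply, swap_apply_def]
  grind

lemma vv_conj (b : Br 4) {i : ℕ} (hi : i < 3 := by omega) :
    perm 4 b * vv i * (perm 4 b)⁻¹ = vv (perm 3 (qB b) i) := by
  refine (Br.equivariant ((perm 3).comp qB) (fun b v => perm 4 b * v * (perm 4 b)⁻¹) vv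
    (p := (· < 3)) (fun b _ h => perm_lt h _) (fun j hj i hi => .symm ?_) b hi).symm
  rw [perm_σ hj, mul_inv_eq_iff_eq_mul]
  ext k
  have : j < 3 := by omega
  interval_cases j <;> simp only [comp_apply, qB_σ] <;> rw [perm_σ] <;> interval_cases i <;>
    simp [vv, swap_apply_def] <;> grind

lemma vv_injOn {i j : ℕ} (hi : i < 3) (hj : j < 3) (h : vv i = vv j) : i = j := by
  have h1 : ∀ i < 3, vv i 0 = 3 - i := fun i hi => by interval_cases i <;> rfl
  have h2 := h1 i hi
  have h3 := h1 j hj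
  rw [h] at h2
  omega

lemma perm_qB {b c : Br 4} (h : perm 4 b = perm 4 c) : perm 3 (qB b) = perm 3 (qB c) := by
  ext i
  by_cases hi : i < 3
  · refine vv_injOn (perm_lt hi _) (perm_lt hi _) ?_
    rw [← vv_conj b hi, ← vv_conj c hi, h]
  · rw [perm_of_le (by omega), perm_of_le (by omega)]

/-! ### The abelianization -/

def abX : W →* Multiplicative ℤ := wlift (ofAdd 1) 1
def abT : W →* Multiplicative ℤ := wlift 1 (ofAdd 1)

@[simp] lemma abX_X : abX X = ofAdd 1 := wlift_X _ _
@[simp] lemma abX_t : abX (t _) = 1 := wlift_t _ _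
@[simp] lemma abT_X : abT X = 1 := wlift_X _ _
@[simp] lemma abT_t : abT (t _) = ofAdd 1 := wlift_t _ _

open Matrix in
/-- The exponent vector of an element of `W`. -/
def ab (u : W) : Fin 2 → ℤ := ![(abX u).toAdd, (abT u).toAdd]

lemma ab_mul (u v : W) : ab (u * v) = ab u + ab v := by
  simp [ab]

lemma ab_inv (u : W) : ab u⁻¹ = -ab u := by
  simp [ab]

lemma ab_X : ab X = ![1, 0] := by simp [ab]
lemma ab_t : ab (t _) = ![0, 1] := by simp [ab]

/-- The exponent homomorphism to the additive group of vectors. -/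
def abHom : W →* Multiplicative (Fin 2 → ℤ) where
  toFun u := ofAdd (ab u)
  map_one' := by simp [ab]
  map_mul' u v := by rw [ab_mul]; rfl

open Matrix in
lemma ab_actW (b : Br 3) (u : W) : ab (actW b u) = (SL b).1 *ᵥ ab u := by
  refine Br.aut_equivariant actW (fun b v => (SL b).1 *ᵥ v) ab (fun i hi u => ?_) b u (by simp)
    fun a b u => by rw [mulVec_mulVec, map_mul]; rfl
  have key : ∀ (f : MulAut W) (A : SLZ), ab (f X) = A.1 *ᵥ ab X → ab (f (t _)) = A.1 *ᵥ ab (t _) →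
      ab (f u) = A.1 *ᵥ ab u := fun f A h1 h2 => by
    have := W_hom_ext (f := abHom.comp f.toMonoidHom)
      (g := (AddMonoidHom.toMultiplicative
        (Matrix.mulVecLin A.1).toAddMonoidHom).comp abHom)
      (congrArg ofAdd h2) (congrArg ofAdd h1)
    exact congrArg toAdd (congr_fun this u)
  obtain rfl | rfl : i = 0 ∨ i = 1 := by omega
  · rw [actW_σ0, SL_σ0]
    apply key
    · rw [aut0_X, ab_X]; decide
    · rw [aut0_t, ab_mul, ab_inv, ab_X, ab_t]; decide
  · rw [actW_σ1, SL_σ1]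
    apply key
    · rw [aut1_X, ab_mul, ab_X, ab_t]; decide
    · rw [aut1_t, ab_t]; decide

lemma vv_sq (i : ℕ) : vv i * vv i = 1 := by
  ext k
  unfold vv
  split_ifs <;> simp only [mul_apply, swap_apply_def, one_apply] <;> grind

lemma perm_αB : perm 4 αB = vv 2 := by
  rw [αB, map_mul, map_inv, perm_σ, perm_σ, swap_inv]
  exact swap_comm' (by simp) (by simp) (by simp) (by simp)

lemma perm_γB : perm 4 γB = vv 0 := by
  have h : vv 2 * vv 1 = vv 0 := by
    change swap 0 1 * swap 2 3 * (swap 0 2 * swap 1 3) = swap 0 3 * swap 1 2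
    ext i
    simp only [mul_apply, swap_apply_def]
    grind
  have h2 := vv_conj (σ 4 1) (i := 2)
  rw [qB_σ.2.1, perm_σ, perm_σ] at h2
  rw [γB, map_mul, map_mul, map_mul, map_inv, map_inv, perm_αB, perm_σ, h2,
    inv_eq_of_mul_eq_one_left (vv_sq 2)]
  exact h

lemma vv_comm : Commute (vv 2) (vv 0) := by
  rw [commute_iff_eq]
  ext k
  simp [vv, swap_apply_def]
  grind

lemma perm_wlift (u : W) :
    perm 4 (wlift αB γB u) = vv 2 ^ (abX u).toAdd * vv 0 ^ (abT u).toAdd := by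
  have := W_hom_ext (f := (perm 4).comp (wlift αB γB))
    (g := ((zpowersHom (Perm ℕ) (vv 2)).noncommCoprod (zpowersHom (Perm ℕ) (vv 0)) fun a b => by
      simp only [zpowersHom_apply]; exact vv_comm.zpow_zpow _ _).comp (abX.prod abT))
    (by simp [perm_γB]) (by simp [perm_αB])
  exact congr_fun this u

lemma perm_wlift_apply_zero (u : W) : perm 4 (wlift αB γB u) 0 =
    (if Even (abX u).toAdd then (if Even (abT u).toAdd then 0 else 3)
    else (if Even (abT u).toAdd then 1 else 2)) := by
  have key : ∀ i (k : ℤ), vv i ^ k = if Even k then 1 else vv i := fun i k => by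
    obtain ⟨c, rfl | rfl⟩ := Int.even_or_odd' k
    · rw [if_pos (even_two_mul c), zpow_mul, zpow_two, vv_sq, one_zpow]
    · rw [if_neg (by simp), zpow_add, zpow_mul, zpow_two, vv_sq, one_zpow, one_mul,
        zpow_one]
  rw [perm_wlift, key, key]
  split_ifs <;> rfl

lemma perm_wlift_eq_one {u : W} (h1 : Even (abX u).toAdd) (h2 : Even (abT u).toAdd) :
    perm 4 (wlift αB γB u) = 1 := by
  obtain ⟨a, ha⟩ := h1
  obtain ⟨b, hb⟩ := h2
  rw [perm_wlift, ha, hb, ← mul_two, ← mul_two, mul_comm a, mul_comm b, zpow_mul, zpow_mul, zpow_two,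
    zpow_two, vv_sq, vv_sq, one_zpow, one_zpow, one_mul]

end

section

open _root_.Braid.FP Equiv S4

/-! ### Generic modifications of homomorphisms -/

/-- The mirror involution. -/
def mirror (m : ℕ) : Br m →* Br m :=
  Br.lift (fun i => (σ m i)⁻¹)
    (fun i h => by
      have := congrArg (fun g => g⁻¹) (σ_braid h)
      simpa [mul_assoc] using this)
    (fun i j h _ => ((σ_comm (m := m) h).inv_inv).eq)

lemma mirror_σ {m i : ℕ} (h : i + 1 < m := by omega) : mirror m (σ m i) = (σ m i)⁻¹ := Br.lift_σ _ _ _ h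

lemma perm_mirror {m : ℕ} (b : Br m) : perm m (mirror m b) = perm m b := by
  have : (perm m).comp (mirror m) = perm m := Br.hom_ext fun i h => by
    rw [comp_apply, mirror_σ h, map_inv, perm_σ h, swap_inv]
  exact congr_fun this b

/-- The transvection of a homomorphism by a central element. -/
def transv {m : ℕ} {G : Type*} [Group G] (f : Br m →* G) (c : G) (hc : ∀ g, Commute c g) :
    Br m →* G where
  toFun b := f b * c ^ (expo m b).toAdd
  map_one' := by simp
  map_mul' a b := by
    rw [map_mul, map_mul, toAdd_mul, zpow_add, mul_assoc, mul_assoc, ← mul_assoc (f b),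
      ← ((hc (f b)).zpow_left _).eq, mul_assoc]

lemma transv_apply {m : ℕ} {G : Type*} [Group G] (f : Br m →* G) (c : G)
    (hc : ∀ g, Commute c g) (b : Br m) : transv f c hc b = f b * c ^ (expo m b).toAdd := rfl

/-- The endomorphisms of braid groups that are inner up to inversion and transvection. -/
def Std (m : ℕ) (ψ : Br m →* Br m) : Prop :=
  ∃ (g : Br m) (ε p : ℤ), (ε = 1 ∨ ε = -1) ∧
    ∀ i, i + 1 < m → ψ (σ m i) = g * σ m i ^ ε * g⁻¹ * ζ m ^ p

lemma Std.of_mirror {m : ℕ} {ψ : Br m →* Br m} (h : Std m (ψ.comp (mirror m))) : Std m ψ := by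
  obtain ⟨g, ε, p, hε, h⟩ := h
  refine ⟨g, -ε, -p, by omega, fun i hi => ?_⟩
  have := h i hi
  rw [comp_apply, mirror_σ hi, map_inv, inv_eq_iff_eq_inv] at this
  rw [this, ← ((ζ_commute m _).zpow_left p).eq]
  group

/-- Forgetting the last strand. -/
def forget {k m : ℕ} (f : Br k →* Br (m + 1)) (h : ∀ b, perm (m + 1) (f b) m = m) :
    Br k →* Br m where
  toFun b := (fg m (f b)).right
  map_one' := by
    rw [map_one, ← map_one (ι m), fg_ι]; rfl
  map_mul' a b := by
    rw [map_mul, fg_mul _ (h b)]; rfl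

lemma forget_apply {k m : ℕ} (f : Br k →* Br (m + 1)) (h : ∀ b, perm (m + 1) (f b) m = m)
    (b : Br k) : forget f h b = (fg m (f b)).right := rfl

lemma perm_forget {k m : ℕ} (f : Br k →* Br (m + 1)) (h : ∀ b, perm (m + 1) (f b) m = m)
    (b : Br k) : perm m (forget f h b) = perm (m + 1) (f b) := by
  rw [forget_apply, ← perm_ι, ι_fg (h b)]

lemma perm_inB {k : ℕ} (b : Br k) : perm (k + 1) (inB k b) = perm k b := by
  rw [inB, comp_apply, perm_ι]; rfl

/-! ### Endomorphisms of the braid group on four strands -/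

lemma SL_qB_eq {φ : Br 4 →* Br 4} (hφ : ∀ b, perm 4 (φ b) = perm 4 b) :
    SL (qB (φ (σ 4 2))) = SL (qB (φ (σ 4 0))) := by
  have h1 : σ 4 0 * σ 4 1 * σ 4 0 = σ 4 1 * σ 4 0 * σ 4 1 := σ_braid
  have h2 : σ 4 1 * σ 4 2 * σ 4 1 = σ 4 2 * σ 4 1 * σ 4 2 := σ_braid
  have h3 : Commute (σ 4 0) (σ 4 2) := σ_comm
  refine SLZ.eq_of_braid (R := SL (qB (φ (σ 4 1)))) ?_ ?_ ?_ fun h => ?_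
  · simp only [← map_mul, h1]
  · simp only [← map_mul, h2]
  · exact ((h3.map φ).map qB).map SL
  · have e := perm_eq_of_SL (b := qB (φ (σ 4 0))) (b' := qB (φ (σ 4 1))) fun i j => by rw [h]
    rw [perm_qB (hφ _), perm_qB (hφ _), qB_σ.1, qB_σ.2.1, perm_σ,
      perm_σ] at e
    have := congrArg (fun g : Perm ℕ => g 0) e
    simp [swap_apply_def] at this

lemma qB_map_αB {φ : Br 4 →* Br 4} (hφ : ∀ b, perm 4 (φ b) = perm 4 b) :
    qB (φ αB) = 1 := by
  refine SL_eq_one ?_ ?_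
  · rw [αB, map_mul, map_mul, map_mul, SL_qB_eq hφ, map_inv, map_inv, map_inv, mul_inv_cancel]
  · have := σ_eq_image (((expo 3).comp qB).comp φ) αB
    rw [comp_apply, comp_apply] at this
    rw [this, αB, map_mul, map_inv, expo_σ, expo_σ, mul_inv_cancel]
    simp

lemma exists_θ {φ : Br 4 →* Br 4} (hφ : ∀ b, perm 4 (φ b) = perm 4 b) :
    ∃ θ : W →* W, ∀ u, φ (wlift αB γB u) = wlift αB γB (θ u) := by
  have hα := qB_map_αB hφ
  have hγ : qB (φ γB) = 1 := by
    rw [γB]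
    simp only [map_mul, map_inv, hα]
    group
  refine ⟨wlift (J (φ αB)).left (J (φ γB)).left, fun u => ?_⟩
  have := W_hom_ext (f := φ.comp (wlift αB γB))
    (g := (wlift αB γB).comp (wlift (J (φ αB)).left (J (φ γB)).left))
    (by simpa using eq_wlift_of_qB hγ) (by simpa using eq_wlift_of_qB hα)
  exact congr_fun this u

lemma ab_conj (u v : W) : ab (u * v * u⁻¹) = ab v := by
  rw [ab_mul, ab_mul, ab_inv]; abel

lemma conj_wlift (g : Br 4) (v : W) : g * wlift αB γB v * g⁻¹ =
    wlift αB γB ((J g).left * actW (qB g) v * ((J g).left)⁻¹) := by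
  apply J_injective
  have : J g = inW (J g).left * inR (qB g) := eq_mul _
  rw [J_wlift, map_mul, map_mul, J_wlift, map_inv, map_mul, map_mul]
  conv_lhs => rw [this, mul_assoc (inW _), inR_mul_inW]
  rw [map_inv]; group

lemma wlift_injective : Injective (wlift αB γB) := fun u v h => by
  have := congrArg J h
  rw [J_wlift, J_wlift] at this
  exact inl_injective this

open Matrix in
lemma exists_normal_SL {φ : Br 4 →* Br 4} (hφ : ∀ b, perm 4 (φ b) = perm 4 b) :
    ∃ (b : Br 3) (ε : ℤ), perm 3 b = 1 ∧ (ε = 1 ∨ ε = -1) ∧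
    ∀ i, i + 1 < 3 → SL (qB (φ (σ 4 i))) = SL (b * σ 3 i ^ ε * b⁻¹) := by
  obtain ⟨θ, hθ⟩ := exists_θ hφ
  have key : ∀ (b : Br 3) u, ab (θ (actW b u)) = (SL (qB (φ (inB 3 b)))).1 *ᵥ ab (θ u) := by
    intro b u
    have h1 := hθ (actW b u)
    rw [wlift_actW, map_mul, map_mul, map_inv φ, hθ, conj_wlift] at h1
    rw [← wlift_injective h1, ab_conj, ab_actW]
  have par : ∀ u, perm 4 (wlift αB γB (θ u)) 0 = perm 4 (wlift αB γB u) 0 := fun u => by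
    rw [← hθ, hφ]
  obtain ⟨X', hX⟩ : ∃ v, v = θ X := ⟨_, rfl⟩
  obtain ⟨t', ht⟩ : ∃ v, v = θ (t _) := ⟨_, rfl⟩
  have pX := par X
  have pt := par (t _)
  have k0X := key (σ 3 0) X
  have k0t := key (σ 3 0) (t _)
  have k1X := key (σ 3 1) X
  have k1t := key (σ 3 1) (t _)
  rw [← hX] at pX k0X k1X
  rw [← ht] at pt k0t k1t
  rw [inB_σ0] at k0X k0t
  rw [inB_σ1] at k1X k1t
  rw [actW_σ0, aut0_X, ← hX] at k0X
  rw [actW_σ0, aut0_t, map_mul, map_inv θ, ← ht, ← hX, ab_mul, ab_inv] at k0t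
  rw [actW_σ1, aut1_X, map_mul, ← ht, ← hX, ab_mul] at k1X
  rw [actW_σ1, aut1_t, ← ht] at k1t
  obtain ⟨a, ha⟩ : ∃ a, a = (abX X').toAdd := ⟨_, rfl⟩
  obtain ⟨c, hc⟩ : ∃ a, a = (abT X').toAdd := ⟨_, rfl⟩
  obtain ⟨b, hb⟩ : ∃ a, a = (abX t').toAdd := ⟨_, rfl⟩
  obtain ⟨d, hd⟩ : ∃ a, a = (abT t').toAdd := ⟨_, rfl⟩
  have eX : ab X' = ![a, c] := by rw [ab, ha, hc]
  have et : ab t' = ![b, d] := by rw [ab, hb, hd]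
  rw [perm_wlift_apply_zero, perm_wlift_apply_zero, ← ha, ← hc] at pX
  rw [perm_wlift_apply_zero, perm_wlift_apply_zero, ← hb, ← hd] at pt
  rw [eX] at k0X
  rw [eX, et] at k0t k1X
  rw [et] at k1t
  have e1 : Odd a ∧ Even c := by
    have h : ¬ Even (1 : ℤ) := by decide
    have h' : Even (0 : ℤ) := by decide
    simp only [abX_X, abT_X, toAdd_ofAdd, toAdd_one, if_neg h, if_pos h'] at pX
    rw [← Int.not_even_iff_odd]
    by_cases u1 : Even a <;> by_cases u2 : Even c <;> simp [u1, u2] at pX ⊢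
  have e2 : Even b ∧ Odd d := by
    have h : ¬ Even (1 : ℤ) := by decide
    have h' : Even (0 : ℤ) := by decide
    simp only [abX_t, abT_t, toAdd_ofAdd, toAdd_one, if_neg h, if_pos h'] at pt
    rw [← Int.not_even_iff_odd]
    by_cases u1 : Even b <;> by_cases u2 : Even d <;> simp [u1, u2] at pt ⊢
  have f := fun (A : Matrix (Fin 2) (Fin 2) ℤ) (v w : Fin 2 → ℤ) (h : v = A *ᵥ w) =>
    And.intro (congrFun h 0) (congrFun h 1)
  obtain ⟨p1, p3⟩ := f _ _ _ k0X
  obtain ⟨p2, p4⟩ := f _ _ _ k0t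
  obtain ⟨q1, q3⟩ := f _ _ _ k1X
  obtain ⟨q2, q4⟩ := f _ _ _ k1t
  simp [Matrix.mulVec, dotProduct, Fin.sum_univ_two] at p1 p2 p3 p4 q1 q2 q3 q4
  obtain ⟨N, hN, h⟩ := unimodular_of_conj (P := SL (qB (φ (σ 4 0)))) (Q := SL (qB (φ (σ 4 1))))
    e1.1 e2.1 e1.2 e2.2 (by linarith) (by linarith) (by linarith) (by linarith)
    (by linarith) (by linarith) (by linarith) (by linarith)
  obtain ⟨β, rfl⟩ := SL_surjective N
  have hβ : perm 3 β = 1 := by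
    rw [← map_one (perm 3)]
    refine perm_eq_of_SL fun i j => ?_
    rw [map_one]
    have ev : ∀ k : ℤ, Even k → ((k : ℤ) : ZMod 2) = 0 := fun k hk => by
      obtain ⟨c, rfl⟩ := hk.two_dvd; push_cast; rw [show (2 : ZMod 2) = 0 from rfl, zero_mul]
    have od : ∀ k : ℤ, Odd k → ((k : ℤ) : ZMod 2) = 1 := fun k hk => by
      obtain ⟨c, rfl⟩ := hk; push_cast; rw [show (2 : ZMod 2) = 0 from rfl, zero_mul, zero_add]
    fin_cases i <;> fin_cases j
    · simpa using od _ hN.1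
    · simpa using ev _ hN.2.1
    · simpa using ev _ hN.2.2.1
    · simpa using od _ hN.2.2.2
  rcases h with ⟨h0, h1⟩ | ⟨h0, h1⟩
  · refine ⟨β, 1, hβ, Or.inl rfl, fun i hi => ?_⟩
    obtain rfl | rfl : i = 0 ∨ i = 1 := by omega
    · rw [map_mul, map_mul, map_inv, zpow_one, SL_σ0, ← h0, mul_inv_cancel_right]
    · rw [map_mul, map_mul, map_inv, zpow_one, SL_σ1, ← h1, mul_inv_cancel_right]
  · refine ⟨β, -1, hβ, Or.inr rfl, fun i hi => ?_⟩
    obtain rfl | rfl : i = 0 ∨ i = 1 := by omega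
    · rw [map_mul, map_mul, map_inv, _root_.zpow_neg_one, map_inv SL (σ 3 0), SL_σ0, ← h0,
        mul_inv_cancel_right]
    · rw [map_mul, map_mul, map_inv, _root_.zpow_neg_one, map_inv SL (σ 3 1), SL_σ1, ← h1,
        mul_inv_cancel_right]

end

section

open _root_.Braid.FP Equiv S4

lemma δ_four : δ 4 = σ 4 0 * σ 4 1 * σ 4 2 := by simp [δ, dl]

lemma ζ_three : ζ 3 = σ 3 0 * σ 3 1 * σ 3 0 * (σ 3 0 * σ 3 1 * σ 3 0) := by
  have h : ζ 3 = (σ 3 0 * σ 3 1) ^ 3 := by simp [ζ, δ, dl]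
  have hb : σ 3 0 * σ 3 1 * σ 3 0 = σ 3 1 * σ 3 0 * σ 3 1 := σ_braid
  rw [h]
  calc (σ 3 0 * σ 3 1) ^ 3 = σ 3 0 * σ 3 1 * σ 3 0 * (σ 3 1 * σ 3 0 * σ 3 1) := by
        simp only [pow_succ, pow_zero, one_mul, mul_assoc]
    _ = _ := by rw [← hb]

lemma qB_ζ : qB (ζ 4) = ζ 3 ^ 2 := by
  rw [ζ, map_pow, δ_four, map_mul, map_mul, qB_σ.1, qB_σ.2.1, qB_σ.2.2, ζ_three, ← pow_two, ← pow_mul]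

/-- The commutator generating the fixed points of the braid action. -/
def κ : W := X * (t (Multiplicative ℤ))⁻¹ * X⁻¹ * t _

lemma actW_κ (b : Br 3) : actW b κ = κ := by
  let S : Subgroup (Br 3) := (stabilizer (MulAut W) κ).comap actW
  refine Br.mem_of_gens S (fun i hi => ?_) b
  rw [mem_comap, MulAction.mem_stabilizer_iff, MulAut.smul_def]
  obtain rfl | rfl : i = 0 ∨ i = 1 := by omega
  · rw [actW_σ0, κ]; simp only [map_mul, map_inv aut0, aut0_X, aut0_t]; group
  · rw [actW_σ1, κ]; simp only [map_mul, map_inv aut1, aut1_X, aut1_t]; group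

lemma ab_κ : ab κ = 0 := by
  simp only [κ, ab_mul, ab_inv]; abel

lemma ab_zpow (u : W) (k : ℤ) : ab (u ^ k) = k • ab u := by
  have := map_zpow abHom u k
  exact congrArg toAdd this

/-- A conjugacy class of the free group fixed by both generators of the braid action consists of
conjugates of a power of `κ`. -/
lemma exists_conj_κ {u : W} (h0 : IsConj (aut0 u) u) (h1 : IsConj (aut1 u) u) :
    ∃ (v : W) (k : ℤ), u = v * κ ^ k * v⁻¹ := by
  have e1 : T' u = aut1 u := congr_fun
    (W_hom_ext (f := T') (g := aut1.toMonoidHom) (by simp) (by simp)) u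
  have e0 : aut0 (X * T u * X⁻¹) = u := congr_fun
    (W_hom_ext (f := aut0.toMonoidHom.comp ((MulAut.conj X).toMonoidHom.comp T))
      (g := MonoidHom.id _) (by simp [mul_assoc]) (by simp)) u
  have h0' : IsConj (T u) u := by
    have h2 : IsConj (aut0 (X * T u * X⁻¹)) (aut0 u) := e0.symm ▸ h0.symm
    have h3 : IsConj (X * T u * X⁻¹) u := by
      obtain ⟨c, hc⟩ := isConj_iff.1 h2
      refine isConj_iff.2 ⟨aut0.symm c, aut0.injective ?_⟩
      rw [← hc]; simp
    exact (isConj_iff.2 ⟨X, rfl⟩ : IsConj (T u) _).trans h3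
  obtain ⟨k, hk⟩ := classification h0' (e1.symm ▸ h1)
  obtain ⟨c, hc⟩ := isConj_iff.1 hk.symm
  refine ⟨c * t _, k, ?_⟩
  rw [← hc]
  have : t _ * X * (t _)⁻¹ * X⁻¹ = t _ * κ * (t (Multiplicative ℤ))⁻¹ := by
    rw [κ]; group
  rw [this, conj_zpow]
  group

/-- The centralizer of a nontrivial power of `κ` is generated by an element fixed by the braid
action. -/
lemma exists_root_κ {k : ℤ} (hk : κ ^ k ≠ 1) : ∃ r : W, (∀ g, Commute g (κ ^ k) →
    g ∈ zpowers r) ∧ (∀ b, actW b r = r) ∧ ab r = 0 := by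
  let f : F 2 →* W := F.lift 2 (fun i => if i = 0 then X else t _)
  have f0 : f (x 2 0) = X := F.lift_x _
  have f1 : f (x 2 1) = t _ := F.lift_x _
  let g : W →* F 2 := wlift (x 2 0) (x 2 1)
  have fg : ∀ u, f (g u) = u := fun u => congr_fun
    (W_hom_ext (f := f.comp g) (g := MonoidHom.id _) (by simp [g, f1]) (by simp [g, f0])) u
  have ginj : Injective g := Function.LeftInverse.injective fg
  have hne : g (κ ^ k) ≠ 1 := fun h => hk (ginj (by rw [h, map_one]))
  obtain ⟨r', hr'⟩ := FreeGroup.centralizer_cyclic hne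
  have hr : ∀ u, Commute u (κ ^ k) → u ∈ zpowers (f r') := fun u hu => by
    obtain ⟨j, hj⟩ := mem_zpowers_iff.1 (hr' _ (hu.map g))
    exact mem_zpowers_iff.2 ⟨j, by rw [← map_zpow, hj, fg]⟩
  obtain ⟨j, hj⟩ := mem_zpowers_iff.1 (hr _ (Commute.refl _))
  have hj0 : j ≠ 0 := fun h => hk (by rw [← hj, h, zpow_zero])
  have tf : ∀ s : ℤ, f r' ^ s = 1 → s = 0 := fun s hs => by
    by_contra h0
    have : (g (f r')) ^ s = 1 := by rw [← map_zpow, hs, map_one]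
    have h2 : g (f r') = 1 := by
      by_contra h3
      exact h0 ((IsMulTorsionFree.zpow_eq_one_iff_right h3).1 this)
    exact hk (by rw [← hj, show f r' = 1 from ginj (by rw [h2, map_one]), one_zpow])
  refine ⟨f r', hr, fun b => ?_, ?_⟩
  · have hc : Commute (f r') (κ ^ k) := hj ▸ (Commute.refl _).zpow_right j
    have h1 := hc.map (actW b)
    rw [map_zpow, actW_κ] at h1
    obtain ⟨s, hs⟩ := mem_zpowers_iff.1 (hr _ h1)
    have h2 : f r' ^ (s * j) = f r' ^ j := by
      rw [zpow_mul, hs, ← map_zpow, hj, map_zpow, actW_κ]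
    have h3 := tf (s * j - j) (by rw [zpow_sub, h2, mul_inv_cancel])
    have : s = 1 := by
      have : (s - 1) * j = 0 := by linarith
      rcases mul_eq_zero.1 this with h | h
      · omega
      · exact absurd h hj0
    rw [← hs, this, zpow_one]
  · have h1 := ab_zpow (f r') j
    rw [hj, ab_zpow, ab_κ, smul_zero] at h1
    exact (smul_eq_zero.1 h1.symm).resolve_left hj0

end

section

open _root_.Braid.FP Equiv S4

lemma perm_comp_inB {φ : Br 4 →* Br 4} (hφ : ∀ b, perm 4 (φ b) = perm 4 b) (b : Br 3) :
    perm 4 (φ.comp (inB 3) b) 3 = 3 := by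
  rw [comp_apply, hφ, perm_inB, perm_of_le le_rfl]

lemma std_of_qB_eq {φ : Br 4 →* Br 4} (hφ : ∀ b, perm 4 (φ b) = perm 4 b)
    (h : ∀ i, i + 1 < 3 → qB (φ (σ 4 i)) = σ 3 i) :
    Std 3 (forget (φ.comp (inB 3)) (perm_comp_inB hφ)) := by
  have hq : ∀ b, qB (φ (inB 3 b)) = b := fun b => by
    have : qB.comp (φ.comp (inB 3)) = MonoidHom.id _ := Br.hom_ext fun i hi => by
      rw [comp_apply, comp_apply, inB_σ hi]; exact h i hi
    exact congr_fun this b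
  have hJ : ∀ b, J (φ (inB 3 b)) = inW (J (φ (inB 3 b))).left * inR b := fun b => by
    conv_lhs => rw [eq_mul (J (φ (inB 3 b)))]
    rw [show (J (φ (inB 3 b))).right = b from hq b]
  -- the element measuring the image of the square of the full twist
  obtain ⟨u, hu⟩ : ∃ u, inW u = J (φ (inB 3 (ζ 3 ^ 2))) * (J (ζ 4))⁻¹ := by
    refine ⟨(J (φ (inB 3 (ζ 3 ^ 2))) * (J (ζ 4))⁻¹).left, ?_⟩
    conv_rhs => rw [eq_mul (J (φ (inB 3 (ζ 3 ^ 2))) * (J (ζ 4))⁻¹)]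
    have : (J (φ (inB 3 (ζ 3 ^ 2))) * (J (ζ 4))⁻¹).right = 1 := by
      rw [mul_right, inv_right]
      change qB (φ (inB 3 (ζ 3 ^ 2))) * (qB (ζ 4))⁻¹ = 1
      rw [hq, qB_ζ, mul_inv_cancel]
    rw [this, map_one, mul_one]
  have hc : ∀ b, u = (J (φ (inB 3 b))).left * actW b u * ((J (φ (inB 3 b))).left)⁻¹ := by
    intro b
    have h1 : Commute (inW u) (J (φ (inB 3 b))) := by
      rw [hu]
      refine Commute.mul_left ?_ (((ζ_commute 4 _).map J).inv_left)
      exact ((((ζ_commute 3 b).pow_left 2).map (inB 3)).map φ).map J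
    have h2 := mul_inv_eq_of_eq_mul h1.eq.symm
    rw [hJ, mul_assoc (inW _), inR_mul_inW] at h2
    apply inl_injective (φ := actW)
    rw [map_mul, map_mul, map_inv]
    conv_lhs => rw [← h2]
    group
  have hu1 : u ≠ 1 := fun h1 => by
    rw [h1, map_one, eq_comm, mul_inv_eq_one] at hu
    have h2 := J_injective hu
    have h3 : forget (φ.comp (inB 3)) (perm_comp_inB hφ) (ζ 3 ^ 2) = ζ 3 := by
      rw [forget_apply, comp_apply, h2, ← ι_Δ, fg_ι]; simp [Δ]
    have h4 := σ_eq_image ((expo 3).comp (forget (φ.comp (inB 3)) (perm_comp_inB hφ))) (ζ 3 ^ 2)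
    rw [comp_apply, h3, map_pow, expo_ζ] at h4
    have h5 := congrArg toAdd h4
    simp only [toAdd_zpow, toAdd_ofAdd, toAdd_pow, smul_eq_mul, nsmul_eq_mul] at h5
    push_cast at h5
    omega
  obtain ⟨v, k, hv⟩ := exists_conj_κ (u := u)
    (by rw [← actW_σ0]; exact isConj_iff.2 ⟨_, (hc (σ 3 0)).symm⟩)
    (by rw [← actW_σ1]; exact isConj_iff.2 ⟨_, (hc (σ 3 1)).symm⟩)
  obtain ⟨r, hr, hr1, hr2⟩ := exists_root_κ (k := k) fun h1 => hu1 (by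
    rw [hv, h1, mul_one, mul_inv_cancel])
  have key : ∀ b, ∃ s : ℤ, φ (inB 3 b) = wlift αB γB v * wlift αB γB r ^ s * inB 3 b *
      (wlift αB γB v)⁻¹ := by
    intro b
    have h1 := hc b
    obtain ⟨c, hcd⟩ : ∃ c, c = (J (φ (inB 3 b))).left := ⟨_, rfl⟩
    have h2 := hJ b
    rw [← hcd] at h1 h2
    have h3 : Commute (v⁻¹ * c * actW b v) (κ ^ k) := by
      have h4 : c * (actW b v * κ ^ k * (actW b v)⁻¹) * c⁻¹ = v * κ ^ k * v⁻¹ := by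
        rw [← hv]
        conv_rhs => rw [h1, hv, map_mul, map_mul, map_inv, map_zpow, actW_κ]
      have h5 : κ ^ k = v⁻¹ * (v * κ ^ k * v⁻¹) * v := by group
      change _ = _
      conv_rhs => rw [h5, ← h4]
      group
    obtain ⟨s, hs⟩ := mem_zpowers_iff.1 (hr _ h3)
    refine ⟨s, J_injective ?_⟩
    rw [h2, map_mul, map_mul, map_mul, map_inv, map_zpow, J_wlift, J_wlift, J_inB, mul_assoc,
      ← map_inv, inR_mul_inW, ← map_zpow, ← map_mul, ← mul_assoc, ← map_mul, hs, map_inv]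
    congr 2
    group
  have hR : perm 4 (wlift αB γB r) = 1 := by
    have h0 := congrFun hr2 0
    have h1 := congrFun hr2 1
    simp only [ab, Matrix.cons_val_zero, Matrix.cons_val_one, Pi.zero_apply] at h0 h1
    exact perm_wlift_eq_one (by rw [h0]; decide) (by rw [h1]; decide)
  have hV : perm 4 (wlift αB γB v) = 1 := by
    have h1 : ∀ i, i + 1 < 3 → swap i (i + 1) =
        swap (perm 4 (wlift αB γB v) i) (perm 4 (wlift αB γB v) (i + 1)) := fun i hi => by
      obtain ⟨s, hs⟩ := key (σ 3 i)
      have h2 := hφ (inB 3 (σ 3 i))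
      rw [hs, perm_inB, map_mul, map_mul, map_mul, map_zpow, hR, one_zpow, mul_one, map_inv,
        perm_inB, perm_σ hi, ← swap_apply_apply] at h2
      exact h2.symm
    have h01 := h1 0 (by omega)
    have h12 := h1 1 (by omega)
    have h0 : perm 4 (wlift αB γB v) 0 = 0 := by
      have e1 := congrArg (fun g : Perm ℕ => g 0) h01
      have e2 := congrArg (fun g : Perm ℕ => g 0) h12
      simp only [swap_apply_left] at e1
      rw [swap_apply_of_ne_of_ne (by omega) (by omega)] at e2
      simp only [swap_apply_def] at e1 e2
      have n1 : perm 4 (wlift αB γB v) 0 ≠ perm 4 (wlift αB γB v) 1 := fun h =>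
        absurd ((perm 4 (wlift αB γB v)).injective h) (by omega)
      have n2 : perm 4 (wlift αB γB v) 1 ≠ perm 4 (wlift αB γB v) 2 := fun h =>
        absurd ((perm 4 (wlift αB γB v)).injective h) (by omega)
      simp only [zero_add, Nat.reduceAdd] at e1 e2
      generalize perm 4 (wlift αB γB v) 0 = y0 at *
      generalize perm 4 (wlift αB γB v) 1 = y1 at *
      generalize perm 4 (wlift αB γB v) 2 = y2 at *
      grind
    rw [perm_wlift_apply_zero] at h0
    split_ifs at h0 with h2 h3
    exact perm_wlift_eq_one h2 h3
  obtain ⟨G, hG⟩ : ∃ G, ι 3 G = wlift αB γB v := ⟨_, ι_fg (by rw [hV]; rfl)⟩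
  obtain ⟨R, hR'⟩ : ∃ R, ι 3 R = wlift αB γB r := ⟨_, ι_fg (by rw [hR]; rfl)⟩
  have hRz : R.right ∈ zpowers (ζ 3) := by
    refine center 3 _ (by rw [← perm_ι, hR', hR]) fun c => ?_
    have h1 := wlift_actW c r
    rw [hr1, ← hR', eq_mul_inv_iff_mul_eq] at h1
    have h2 : R * br c = br c * R := ι_injective 3 (by rw [map_mul, map_mul]; exact h1)
    exact congrArg SemidirectProduct.right h2
  obtain ⟨w, hw⟩ := mem_zpowers_iff.1 hRz
  have fin : ∀ b, ∃ s : ℤ, forget (φ.comp (inB 3)) (perm_comp_inB hφ) b =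
      G.right * b * G.right⁻¹ * ζ 3 ^ s := fun b => by
    obtain ⟨s, hs⟩ := key b
    refine ⟨w * s, ?_⟩
    have h1 : φ (inB 3 b) = ι 3 (G * R ^ s * br b * G⁻¹) := by
      rw [hs, ← hG, ← hR']; simp only [map_mul, map_zpow, map_inv]; rfl
    rw [forget_apply, comp_apply, h1, fg_ι]
    have h2 : (G * R ^ s * br b * G⁻¹).right = G.right * (R.right) ^ s * b * G.right⁻¹ := by
      simp only [mul_right, inv_right]
      rw [← rightHom_eq_right, map_zpow]; rfl
    rw [h2, ← hw, ← zpow_mul, mul_assoc _ (ζ 3 ^ _) b, ((ζ_commute 3 _).zpow_left _).eq,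
      mul_assoc _ _ (G.right)⁻¹, mul_assoc b, ((ζ_commute 3 _).zpow_left _).eq]
    simp only [mul_assoc]
  obtain ⟨s0, hs0⟩ := fin (σ 3 0)
  obtain ⟨s1, hs1⟩ := fin (σ 3 1)
  have hs : s0 = s1 := by
    have h1 := σ_eq_image ((expo 3).comp (forget (φ.comp (inB 3)) (perm_comp_inB hφ))) (σ 3 1)
    rw [expo_σ, toAdd_ofAdd, zpow_one, comp_apply, comp_apply,
      hs0, hs1] at h1
    have h2 := congrArg toAdd h1
    simp only [map_mul, map_inv, map_zpow, expo_σ, expo_ζ, toAdd_mul, toAdd_zpow, toAdd_ofAdd,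
      smul_eq_mul, toAdd_inv] at h2
    rw [expo_σ, expo_σ, expo_ζ] at h2
    simp only [toAdd_ofAdd] at h2
    push_cast at h2
    omega
  subst hs
  refine ⟨G.right, 1, s0, Or.inl rfl, fun i hi => ?_⟩
  rw [zpow_one]
  obtain rfl | rfl : i = 0 ∨ i = 1 := by omega
  · exact hs0
  · exact hs1

end

section

open _root_.Braid.FP Equiv S4

lemma Std.of_conj {m : ℕ} {ψ ψ' : Br m →* Br m} (h : Std m ψ') (g : Br m) (c : ℤ)
    (hψ : ∀ i, i + 1 < m → ψ (σ m i) = g * ψ' (σ m i) * g⁻¹ * ζ m ^ c) : Std m ψ := by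
  obtain ⟨a, ε, p, hε, h⟩ := h
  refine ⟨g * a, ε, p + c, hε, fun i hi => ?_⟩
  rw [hψ i hi, h i hi, ← mul_assoc g, mul_assoc _ (ζ m ^ p), ((ζ_commute m g⁻¹).zpow_left p).eq,
    zpow_add, mul_inv_rev]
  simp only [mul_assoc]

lemma inB_mirror {m : ℕ} (b : Br m) : inB m (mirror m b) = mirror (m + 1) (inB m b) := by
  have : (inB m).comp (mirror m) = (mirror (m + 1)).comp (inB m) := Br.hom_ext fun i hi => by
    change inB m (mirror m (σ m i)) = mirror (m + 1) (inB m (σ m i))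
    rw [mirror_σ hi, map_inv, inB_σ hi, mirror_σ]
  exact congr_fun this b

lemma std_of_SL_eq {φ : Br 4 →* Br 4} (hφ : ∀ b, perm 4 (φ b) = perm 4 b) {b : Br 3}
    (hb : perm 3 b = 1) (h : ∀ i, i + 1 < 3 → SL (qB (φ (σ 4 i))) = SL (b * σ 3 i * b⁻¹)) :
    Std 3 (forget (φ.comp (inB 3)) (perm_comp_inB hφ)) := by
  have hk : ∀ i, i + 1 < 3 → ∃ c : ℤ, qB (φ (σ 4 i)) = b * σ 3 i * b⁻¹ * ζ 3 ^ (2 * c) :=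
    fun i hi => by
      obtain ⟨c, hc⟩ := SL_ker (b := (b * σ 3 i * b⁻¹)⁻¹ * qB (φ (σ 4 i)))
        (by rw [map_mul, h i hi, ← map_mul, inv_mul_cancel, map_one])
      exact ⟨c, by rw [← hc, mul_inv_cancel_left]⟩
  obtain ⟨c, hc⟩ := hk 0 (by omega)
  obtain ⟨d, hd⟩ := hk 1 (by omega)
  have hcd : c = d := by
    have h1 := σ_eq_image ((expo 3).comp (qB.comp φ)) (σ 4 1)
    rw [expo_σ, toAdd_ofAdd, zpow_one, comp_apply, comp_apply,
      comp_apply, comp_apply, hc, hd] at h1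
    have h2 := congrArg toAdd h1
    simp only [map_mul, map_inv, map_zpow, toAdd_mul, toAdd_zpow, toAdd_ofAdd,
      smul_eq_mul, toAdd_inv] at h2
    rw [expo_σ, expo_σ, expo_ζ] at h2
    simp only [toAdd_ofAdd] at h2
    push_cast at h2
    omega
  subst hcd
  have hz : ∀ g, Commute (ζ 4 ^ (-c)) g := fun g => (ζ_commute 4 g).zpow_left _
  let φ' : Br 4 →* Br 4 :=
    transv ((MulAut.conj (inB 3 b)⁻¹).toMonoidHom.comp φ) (ζ 4 ^ (-c)) hz
  have e : ∀ y, φ' y = (inB 3 b)⁻¹ * φ y * inB 3 b * (ζ 4 ^ (-c)) ^ (expo 4 y).toAdd := fun y => by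
    change (MulAut.conj (inB 3 b)⁻¹ (φ y)) * _ = _
    rw [MulAut.conj_apply, inv_inv]
  have hφ' : ∀ y, perm 4 (φ' y) = perm 4 y := fun y => by
    rw [e, map_mul, map_mul, map_mul, map_inv, perm_inB, hb, map_zpow, map_zpow,
      perm_ζ, hφ]
    simp
  have h' : ∀ i, i + 1 < 3 → qB (φ' (σ 4 i)) = σ 3 i := fun i hi => by
    have : qB (φ (σ 4 i)) = b * σ 3 i * b⁻¹ * ζ 3 ^ (2 * c) := by
      obtain rfl | rfl : i = 0 ∨ i = 1 := by omega
      · exact hc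
      · exact hd
    rw [e, expo_σ, toAdd_ofAdd, zpow_one, map_mul, map_mul, map_mul, map_inv, qB_inB,
      this, map_zpow, qB_ζ, mul_assoc b⁻¹, mul_assoc _ _ b, ((ζ_commute 3 b).zpow_left _).eq]
    have : (ζ 3 ^ 2) ^ (-c) = (ζ 3 ^ (2 * c))⁻¹ := by
      rw [← zpow_natCast, ← zpow_mul, ← zpow_neg]; congr 1; push_cast; ring
    rw [this]
    group
  refine (std_of_qB_eq hφ' h').of_conj b c fun i hi => ?_
  have e1 := e (σ 4 i)
  rw [expo_σ, toAdd_ofAdd, zpow_one] at e1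
  have e2 : φ (σ 4 i) = inB 3 b * φ' (σ 4 i) * (inB 3 b)⁻¹ * ζ 4 ^ c := by
    rw [e1, mul_assoc (inB 3 b), mul_assoc, mul_assoc _ (ζ 4 ^ (-c)), (hz _).eq]
    group
  obtain ⟨y, hy⟩ : ∃ y, ι 3 y = φ' (σ 4 i) := ⟨_, ι_fg (by
    rw [hφ', perm_σ]; exact swap_apply_of_ne_of_ne (by omega) (by omega))⟩
  have e3 : φ (σ 4 i) = ι 3 (br b * y * (br b)⁻¹ * Δ 3 ^ c) := by
    rw [e2, ← hy, ← ι_Δ]; simp only [map_mul, map_zpow, map_inv]; rfl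
  change (fg 3 (φ (inB 3 (σ 3 i)))).right = b * (fg 3 (φ' (inB 3 (σ 3 i)))).right * b⁻¹ * ζ 3 ^ c
  rw [inB_σ hi, ← hy, e3, fg_ι, fg_ι]
  simp only [mul_right, inv_right]
  have : (Δ 3 ^ c).right = ζ 3 ^ c := by
    rw [← rightHom_eq_right, map_zpow]; simp [Δ]
  rw [this]; rfl

/-- Forgetting a strand turns an endomorphism of the four strand braid group over the identity
permutation into a standard one. -/
lemma std_forget_four {φ : Br 4 →* Br 4} (hφ : ∀ b, perm 4 (φ b) = perm 4 b) :
    Std 3 (forget (φ.comp (inB 3)) (perm_comp_inB hφ)) := by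
  obtain ⟨b, ε, hb, rfl | rfl, h⟩ := exists_normal_SL hφ
  · exact std_of_SL_eq hφ hb fun i hi => by rw [h i hi, zpow_one]
  · have hφ' : ∀ y, perm 4 ((φ.comp (mirror 4)) y) = perm 4 y := fun y => by
      rw [comp_apply, hφ, perm_mirror]
    refine Std.of_mirror ?_
    have := std_of_SL_eq hφ' hb fun i hi => by
      rw [comp_apply, mirror_σ, map_inv, map_inv, map_inv, h i hi,
        ← map_inv]
      congr 1; group
    convert this using 1
    refine MonoidHom.ext fun y => ?_
    change (fg 3 (φ (inB 3 (mirror 3 y)))).right = (fg 3 (φ (mirror 4 (inB 3 y)))).right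
    rw [inB_mirror]

end

section

open Equiv

/-! ### Endomorphisms of braid groups over the identity permutation -/

lemma fr_z_commute_br (m : ℕ) (b : Br m) : Commute (fr (z m)) (br b) := by
  rw [Commute, SemiconjBy, br_mul_fr, act_z]

lemma Δ_zpow (m : ℕ) (b : ℤ) : Δ m ^ b = fr (z m ^ b) * br (ζ m ^ b) := by
  rw [Δ, (fr_z_commute_br m _).mul_zpow, map_zpow, map_zpow]

lemma eq_fr_mul_Δ {m : ℕ} {g : AG m} {b : ℤ} (h : g.right = ζ m ^ b) :
    g = fr (g.left * (z m ^ b)⁻¹) * Δ m ^ b := by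
  rw [Δ_zpow, ← mul_assoc, ← map_mul, inv_mul_cancel_right, ← h]
  exact AG.fr_right m g

lemma chi_act {m : ℕ} (b : Br m) (v : F m) : chi m (act m b v) = chi m v := by
  have h := congrArg (chiAG m) (br_mul_fr b v)
  rw [map_mul, map_mul, chiAG_fr, chiAG_fr, mul_comm] at h
  exact (mul_right_cancel h).symm

lemma exists_eq_ι_two {b : Br 3} (hp : perm 3 b = 1) :
    ∃ (u : F 2) (c : ℤ), b = ι 2 (fr u) * ζ 3 ^ c := by
  have hb : ι 2 (fg 2 b) = b := ι_fg (by rw [hp]; rfl)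
  obtain ⟨j, hj⟩ := mem_zpowers_iff.1 <|
    center 2 (fg 2 b).right (by rw [← perm_ι, hb, hp]) fun c =>
    (Br.commute_of_gens (MonoidHom.id _) _ (fun i hi => by
      refine (Br.commute_of_gens (MonoidHom.id _) _ (fun k hk => ?_) c).symm
      obtain rfl : i = 0 := by omega
      obtain rfl : k = 0 := by omega
      exact Commute.refl _) _)
  refine ⟨(fg 2 b).left * (z 2 ^ j)⁻¹, j, ?_⟩
  rw [← ι_Δ (m := 2), ← map_zpow, ← map_mul, ← eq_fr_mul_Δ hj.symm, hb]

section
variable {n : ℕ} {φ : Br n →* Br n}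

lemma C_tri_map_conj (hφ : ∀ b, perm n (φ b) = perm n b) {k : ℕ} (hk : k + 2 < n) {b : Br n}
    (hb : fsp (perm n b) (tri 0) = tri 0) :
    C n (tri k) (φ (δ n ^ k * b * (δ n ^ k)⁻¹)) =
      C n (tri 0) (φ (δ n ^ k)) * C n (tri 0) (φ b) * (C n (tri 0) (φ (δ n ^ k)))⁻¹ := by
  rw [map_mul, map_mul, map_inv φ, ← C_conj _ _ _ (by rw [hφ]; exact hb), hφ, fsp_δ_pow hk]

lemma perm_C_tri_δ_pow (hφ : ∀ b, perm n (φ b) = perm n b) {k : ℕ} (hk : k + 2 < n) :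
    perm 3 (C n (tri 0) (φ (δ n ^ k))) = 1 := by
  ext i
  rcases Nat.lt_or_ge i 3 with hi | hi
  · have h := C_perm (card_tri 0) (φ (δ n ^ k)) i (mem_tri.2 (by omega))
    have h1 := cnt_tri k
    rw [cnt_tri_zero hi, hφ, fsp_δ_pow hk, perm_δ_pow] at h
    rw [h, one_apply]
    obtain rfl | rfl | rfl : i = 0 ∨ i = 1 ∨ i = 2 := by omega
    · rw [zero_add]; exact h1.1
    · rw [add_comm]; exact h1.2.1
    · rw [add_comm]; exact h1.2.2
  · rw [perm_of_le hi]; rfl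

end

lemma eq_zero_of_C_tri_scalar {q : ℕ} {a b : ℤ}
    (h : SL (C (q + 3) (tri q) (ι (q + 2) (fr (z (q + 2) ^ a)) * ζ (q + 3) ^ b)) = 1 ∨
      SL (C (q + 3) (tri q) (ι (q + 2) (fr (z (q + 2) ^ a)) * ζ (q + 3) ^ b)) = -1) : a = 0 := by
  have h1 : C (q + 3) (tri q) (ι (q + 2) (fr (z (q + 2) ^ a)) * ζ (q + 3) ^ b) =
      ι 2 (fr (z 2 ^ a)) * ζ 3 ^ b := by
    have hz : fsp (perm (q + 3) (ζ (q + 3))) (tri q) = tri q := by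
      rw [perm_ζ]; simp
    have hz' : fsp (perm (q + 3) (ζ (q + 3) ^ b)) (tri q) = tri q := by
      rw [map_zpow, perm_ζ]; simp
    rw [C_mul_of_fix hz', C_zpow hz, C_tri_ζ (by omega)]
    congr 1
    rw [CF_apply, map_zpow, CF_z, map_zpow, map_zpow]
  have h2 : SL (ι 2 (fr (z 2 ^ a))) ^ 2 = 1 := by
    have h3 : (SL (ι 2 (fr (z 2 ^ a))) * (-1) ^ b) ^ 2 = 1 := by
      rw [← SL_ζ, ← map_zpow, ← map_mul, ← h1]
      rcases h with h | h <;> rw [h] <;> simp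
    have h4 : ((-1 : SLZ) ^ b) ^ 2 = 1 := by
      rw [← zpow_natCast, ← zpow_mul, mul_comm, zpow_mul]; simp
    rwa [((SLZ.commute_neg_one _).zpow_right b).mul_pow, h4, mul_one] at h3
  have h3 : (z 2 ^ a) ^ 2 = 1 := SL_fr_injective (by simpa only [map_pow, map_one] using h2)
  have h4 : z 2 ^ a = 1 := by simpa using h3
  have h5 := congrArg (fun v => (chi 2 v).toAdd) h4
  simp only [map_zpow, chi_z, map_one, toAdd_zpow, toAdd_ofAdd, smul_eq_mul, toAdd_one] at h5
  push_cast at h5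
  omega

lemma exists_CF (q : ℕ) : ∃ κ : F (q + 3) →* F 2,
    (∀ v, CF (q + 3) (tri (q + 1)) v = ι 2 (fr (κ v))) ∧ κ (x (q + 3) (q + 2)) = x 2 1 ∧
      κ (zl (q + 3) (q + 2)) = x 2 0 := by
  obtain ⟨κ, hκ⟩ : ∃ κ : F (q + 3) →* F 2, κ = F.lift (q + 3) fun i =>
    if i = q + 2 then x 2 1 else if i = q + 1 then x 2 0 else 1 := ⟨_, rfl⟩
  have h1 : ∀ v, CF (q + 3) (tri (q + 1)) v = ι 2 (fr (κ v)) := fun v => by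
    have : CF (q + 3) (tri (q + 1)) = ((ι 2).comp fr).comp κ := F.hom_ext fun i hi => by
      rw [comp_apply, comp_apply, hκ, F.lift_x _ hi]
      split_ifs with h1 h2
      · subst h1; exact CF_x_last
      · subst h2; exact CF_x_prev
      · rw [CF_x_of_not_mem hi (by rw [mem_tri]; omega), map_one, map_one]
    exact congr_fun this v
  refine ⟨κ, h1, ?_, ?_⟩
  · rw [hκ, F.lift_x _, if_pos rfl]
  · exact inl_injective (ι_injective 2 ((h1 _).symm.trans CF_p))

lemma section_data {q : ℕ} {φ : Br (q + 4) →* Br (q + 4)}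
    (hφ : ∀ b, perm (q + 4) (φ b) = perm (q + 4) b) {k : ℤ}
    (h : ∀ i, i + 1 < q + 3 →
      φ (σ (q + 4) i) = ι (q + 3) (fr (z (q + 3) ^ k) * br (σ (q + 3) i)))
    {f : F (q + 3)} {b : ℤ}
    (hX : φ (σ (q + 4) (q + 2)) ^ 2 = ι (q + 3) (fr f) * ζ (q + 4) ^ b) :
    k = 0 ∧ b = 0 ∧ ∃ j : ℤ, CF (q + 3) (tri (q + 1)) f =
      ι 2 (fr (z 2 ^ j * x 2 1 * (z 2 ^ j)⁻¹)) := by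
  have m0 : fsp (perm (q + 4) (σ (q + 4) 0)) (tri 0) = tri 0 := by
    rw [perm_σ, fsp_swap_of_mem (mem_tri.2 (by omega)) (mem_tri.2 (by omega))]
  have t0 : C (q + 4) (tri 0) (φ (σ (q + 4) 0)) = σ 3 0 := by
    rw [h 0 (by omega), C_ι (by rw [mem_tri]; omega)]
    simp only [mul_right, right_inl, one_mul,
      right_inr]
    have := C_tri_mul (n := q + 3) (k := 0) (i := 0) (by omega) (mem_tri.2 (by omega))
      (mem_tri.2 (by omega)) 1
    rwa [one_mul, C_one, one_mul, csv_tri_0] at this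
  have m1 : fsp (perm (q + 4) (φ (σ (q + 4) 1))) (tri 0) = tri 0 := by
    rw [hφ, perm_σ, fsp_swap_of_mem (mem_tri.2 (by omega)) (mem_tri.2 (by omega))]
  have t1 : C (q + 4) (tri 0) (φ (σ (q + 4) 1 ^ 2)) = σ 3 1 ^ 2 := by
    rw [map_pow, C_pow m1]
    congr 1
    rw [h 1 (by omega), C_ι (by rw [mem_tri]; omega)]
    simp only [mul_right, right_inl, one_mul,
      right_inr]
    have := C_tri_mul (n := q + 3) (k := 0) (i := 1) (by omega) (mem_tri.2 (by omega))
      (mem_tri.2 (by omega)) 1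
    rwa [one_mul, C_one, one_mul, csv_tri_1 0] at this
  obtain ⟨g, hg⟩ : ∃ g, g = C (q + 4) (tri 0) (φ (δ (q + 4) ^ (q + 1))) := ⟨_, rfl⟩
  have hgp : perm 3 g = 1 := hg ▸ perm_C_tri_δ_pow hφ (by omega)
  obtain ⟨u, c, hu⟩ := exists_eq_ι_two hgp
  have hgc : ∀ y, g * y * g⁻¹ = ι 2 (fr u) * y * (ι 2 (fr u))⁻¹ := fun y => by
    rw [hu, mul_assoc (ι 2 (fr u)), ((ζ_commute 3 y).zpow_left c).eq]; group
  have hCF : CF (q + 3) (tri (q + 1)) (z (q + 3) ^ k) = ι 2 (fr (z 2 ^ k)) := by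
    rw [map_zpow, map_zpow, map_zpow]
    exact congrArg (· ^ k) CF_z
  have s0 : ι 2 (fr (z 2 ^ k) * br (σ 2 0)) = g * σ 3 0 * g⁻¹ := by
    have := C_tri_map_conj hφ (k := q + 1) (by omega) m0
    rw [δ_pow_conj, t0, ← hg, h _ (by omega), map_mul] at this
    rw [← this, map_mul, ι_br_σ, ι_br_σ, C_tri_mul (by omega) (mem_tri.2 (by omega))
      (mem_tri.2 (by omega)), zero_add, csv_tri_0, CF_apply, hCF]
  rw [hgc, ← ι_br_σ (m := 2), ← map_mul, ← map_inv, ← map_mul] at s0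
  have s0' := congrArg SemidirectProduct.left (ι_injective 2 s0)
  simp only [SemidirectProduct.mul_left, SemidirectProduct.left_inl, SemidirectProduct.left_inr,
    right_inl, right_inr, map_one, mul_one,
    mul_right, one_mul, ← map_inv fr, MulAut.one_apply] at s0'
  have hk : k = 0 := by
    have h5 := congrArg (fun v => (chi 2 v).toAdd) s0'
    simp only [map_mul, chi_act] at h5
    simp only [map_inv, map_zpow, chi_z, toAdd_zpow, toAdd_ofAdd, smul_eq_mul, toAdd_mul,
      toAdd_inv] at h5
    push_cast at h5
    omega
  have hfix : act 2 (σ 2 0) u = u := by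
    rw [hk, zpow_zero, map_inv, eq_comm, mul_inv_eq_one] at s0'
    exact s0'.symm
  obtain ⟨j, hj⟩ := mem_zpowers_iff.1 <| act_fixed <| act_eq_of_gens u (fun i hi => by
    obtain rfl : i = 0 := by omega
    exact hfix) (ζ 2)
  obtain ⟨κ, hκ, -⟩ := exists_CF q
  have hz : fsp (perm (q + 4) (ζ (q + 4))) (tri (q + 1)) = tri (q + 1) := by
    rw [perm_ζ]; simp
  have hz' : fsp (perm (q + 4) (ζ (q + 4) ^ b)) (tri (q + 1)) = tri (q + 1) := by
    rw [map_zpow, perm_ζ]; simp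
  have s1 : ι 2 (fr (κ f)) * ζ 3 ^ b = g * σ 3 1 ^ 2 * g⁻¹ := by
    have := C_tri_map_conj hφ (k := q + 1) (by omega) (b := σ (q + 4) 1 ^ 2)
      (fsp_perm_sq (by omega) _)
    rw [← conj_pow, δ_pow_conj, t1, ← hg, map_pow, add_comm 1 (q + 1), hX,
      C_mul_of_fix hz', C_zpow hz, C_tri_ζ (by omega), CF_apply, hκ] at this
    exact this
  rw [hgc, ← ι_x_last (m := 2), ← ι_Δ, ← map_zpow, ← map_mul, ← map_mul,
    ← map_inv, ← map_mul, ← map_mul fr, ← map_inv fr, ← map_mul fr] at s1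
  have s1' := ι_injective 2 s1
  have hb : b = 0 := by
    have h5 := congrArg SemidirectProduct.right s1'
    rw [Δ_zpow] at h5
    simp only [mul_right, right_inl, one_mul,
      right_inr] at h5
    have h6 := congrArg (fun v => (expo 2 v).toAdd) h5
    simp only [map_zpow, expo_ζ one_le_two, toAdd_zpow, toAdd_ofAdd, smul_eq_mul, map_one,
      toAdd_one] at h6
    push_cast at h6
    omega
  refine ⟨hk, hb, j, ?_⟩
  rw [hκ, hj]
  rw [hb, zpow_zero, mul_one] at s1'
  rw [s1']

end

section

open Equiv

lemma mem_closure_of_fixed {k : ℕ} (hk : 1 ≤ k) {f : F (k + 1)}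
    (h : ∀ i, i + 1 < k → act (k + 1) (σ (k + 1) i) f = f) :
    f ∈ Subgroup.closure {x (k + 1) k, zl (k + 1) k} := by
  have h0 : ∀ b : Br k, act (k + 1) (inB k b) f = f := fun b =>
    Br.mem_of_gens ((stabilizer (MulAut (F (k + 1))) f).comap
      ((act (k + 1)).comp (inB k))) (fun i hi => by
        change act (k + 1) (inB k (σ k i)) f = f
        rw [inB_σ hi]
        exact h i hi) b
  have h1 := fpA_act_inB_ζ k f
  rw [h0] at h1
  have h2 := FP.fixed_mem h1.symm fun v hv => by
    rw [Subgroup.zpowers_inv]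
    exact commute_z_pow (l := 1) hk one_ne_zero (by rw [zpow_one]; simpa using hv)
  rw [← fpA'_fpA k f]
  have h3 := Subgroup.mem_map_of_mem (fpA' k) h2
  rw [MonoidHom.map_closure] at h3
  refine (Subgroup.closure_le _).2 ?_ h3
  rintro _ ⟨y, rfl | rfl, rfl⟩
  · rw [← fpA_last, fpA'_fpA]
    exact Subgroup.subset_closure (by simp)
  · rw [map_inv, ← fpA_inF, map_inv, fpA'_fpA, z, inF_zl le_rfl]
    exact inv_mem (Subgroup.subset_closure (by simp))

lemma eq_zero_of_z_commute {k : ℕ} (hk : 2 ≤ k) {a : ℤ} (h1 : Commute (z k ^ a) (x k (k - 1))) :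
    a = 0 := by
  obtain ⟨n, hn⟩ := mem_zpowers_of_commute (N := 1) (h := z k ^ a)
    (w := x k (k - 1)) (chij k (k - 1)) (by rw [chij_self]; simp) one_ne_zero
    (by rwa [zpow_one])
  have h3 := congrArg toAdd (congrArg (chij k 0) hn)
  simp only [map_zpow] at h3
  rw [chij_z, chij_ne, one_zpow, toAdd_zpow] at h3
  simpa using h3.symm

lemma eq_ζ_zpow_of_commute {q : ℕ} {d : Br (q + 4)} (hp : perm (q + 4) d = 1)
    (h1 : ∀ i, i + 1 < q + 2 → Commute d (σ (q + 4) i))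
    (h2 : Commute d (σ (q + 4) (q + 1) ^ 2)) (h3 : Commute d (σ (q + 4) (q + 2) ^ 2)) :
    ∃ b : ℤ, d = ζ (q + 4) ^ b := by
  obtain ⟨D, hD⟩ : ∃ D, ι (q + 3) D = d := ⟨_, ι_fg (by rw [hp]; rfl)⟩
  have c1 : ∀ i, i + 1 < q + 2 → Commute D (br (σ (q + 3) i)) := fun i hi =>
    Commute.of_map (ι_injective _) (by rw [hD, ι_br_σ]; exact h1 i hi)
  have c2 : Commute D (br (σ (q + 3) (q + 1) ^ 2)) :=
    Commute.of_map (ι_injective _) (by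
      rw [hD, map_pow, map_pow, ι_br_σ]; exact h2)
  have c3 : Commute D (fr (x (q + 3) (q + 2))) :=
    Commute.of_map (ι_injective _) (by rw [hD]; exact (ι_x_last (m := q + 3)) ▸ h3)
  have e1 : ∀ i, i + 1 < q + 2 → Commute D.right (σ (q + 3) i) := fun i hi => (commute_inl (c1 i hi)).1
  obtain ⟨a, b, hab⟩ := centralizer_inB (k := q + 2) (Y := D.right)
    (by rw [← perm_ι, hD, hp]) e1
  have e2 : Commute D.right (ι (q + 2) (fr (x (q + 2) (q + 1)))) := by
    rw [show ι (q + 2) (fr (x (q + 2) (q + 1))) = σ (q + 3) (q + 1) ^ 2 from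
      ι_x_last (m := q + 2)]
    exact (commute_inl c2).1
  have e3 : Commute (z (q + 2) ^ a) (x (q + 2) (q + 1)) := by
    refine Commute.of_map (f := (ι (q + 2)).comp fr) ((ι_injective _).comp
      inl_injective) ?_
    have h2 : ι (q + 2) (fr (z (q + 2) ^ a)) = D.right * (ζ (q + 3) ^ b)⁻¹ := by rw [hab]; group
    rw [comp_apply, h2]
    exact e2.mul_left ((ζ_commute _ _).zpow_left b).inv_left
  have ha : a = 0 := eq_zero_of_z_commute (by omega) e3
  rw [ha, zpow_zero, map_one, map_one, one_mul] at hab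
  have hDv := eq_fr_mul_Δ hab
  obtain ⟨v, hv⟩ : ∃ v, v = D.left * (z (q + 3) ^ b)⁻¹ := ⟨_, rfl⟩
  rw [← hv] at hDv
  have cv : ∀ y, Commute D y → Commute (fr v) y := fun y hy => by
    have : fr v = D * (Δ (q + 3) ^ b)⁻¹ := by rw [hDv]; group
    rw [this]
    exact hy.mul_left ((Δ_commute _ _).zpow_left b).inv_left
  obtain ⟨c, hc⟩ := mem_zpowers_of_commute (N := 1) (h := v)
    (w := x (q + 3) (q + 2)) (chij (q + 3) (q + 2)) (by rw [chij_self]; simp)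
    one_ne_zero (by
      rw [zpow_one]
      exact Commute.of_map (f := fr) inl_injective (cv _ c3))
  have e4 := (commute_inl (cv _ c2)).2
  rw [show (fr v).left = v from rfl, ← hc] at e4
  simp only [map_zpow] at e4
  rw [show act (q + 3) (σ (q + 3) (q + 1) ^ 2) (x (q + 3) (q + 2)) = _ from
    act_σ_sq_succ (by omega)] at e4
  obtain ⟨w, hw⟩ : ∃ w, w = x (q + 3) (q + 1 + 1) * x (q + 3) (q + 1) := ⟨_, rfl⟩
  rw [← hw] at e4
  have e5 : w⁻¹ * x (q + 3) (q + 2) ^ c * w = x (q + 3) (q + 2) ^ c := by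
    refine Eq.trans ?_ e4
    have := (conj_zpow (i := c) (a := w⁻¹) (b := x (q + 3) (q + 2))).symm
    rwa [inv_inv] at this
  have e6 : Commute w (x (q + 3) (q + 2) ^ c) := by
    have h : w * (w⁻¹ * x (q + 3) (q + 2) ^ c * w) = x (q + 3) (q + 2) ^ c * w := by group
    rwa [e5] at h
  have hc0 : c = 0 := by
    by_contra hne
    obtain ⟨n, hn⟩ := mem_zpowers_of_commute (chij (q + 3) (q + 2))
      (by rw [chij_self]; simp) hne e6
    have h3 := congrArg toAdd (congrArg (chij (q + 3) (q + 1)) hn)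
    simp only [map_zpow] at h3
    rw [hw, map_mul, chij_self] at h3
    rw [chij_ne] at h3
    simp at h3
  refine ⟨b, ?_⟩
  have hv1 : v = 1 := by rw [← hc, hc0]; exact zpow_zero _
  rw [← hD, hDv, hv1, map_one, one_mul, map_zpow, ι_Δ]

lemma std_of_section {q : ℕ} {φ : Br (q + 4) →* Br (q + 4)}
    (hφ : ∀ b, perm (q + 4) (φ b) = perm (q + 4) b)
    (hT : SL (C (q + 4) (tri 0) (φ (σ (q + 4) 2 ^ 2))) = 1 ∨
      SL (C (q + 4) (tri 0) (φ (σ (q + 4) 2 ^ 2))) = -1) {k : ℤ}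
    (h : ∀ i, i + 1 < q + 3 →
      φ (σ (q + 4) i) = ι (q + 3) (fr (z (q + 3) ^ k) * br (σ (q + 3) i))) :
    ∃ g, ∀ i, i + 1 < q + 4 → φ (σ (q + 4) i) = g * σ (q + 4) i * g⁻¹ := by
  obtain ⟨X, hX⟩ : ∃ X, X = φ (σ (q + 4) (q + 2) ^ 2) := ⟨_, rfl⟩
  have pX : perm (q + 4) X = 1 := by rw [hX, hφ, perm_sq_eq_one]
  obtain ⟨g, hg⟩ : ∃ g, ι (q + 3) g = X := ⟨_, ι_fg (by rw [pX]; rfl)⟩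
  have cX : ∀ i, i + 1 < q + 2 → Commute X (φ (σ (q + 4) i)) := fun i hi => by
    rw [hX]
    exact (((σ_comm (m := q + 4) (i := i) (j := q + 2)).pow_right 2).symm).map φ
  have cg : ∀ i, i + 1 < q + 2 → Commute g (fr (z (q + 3) ^ k) * br (σ (q + 3) i)) := fun i hi =>
    Commute.of_map (ι_injective _) (by rw [hg, ← h i (by omega)]; exact cX i hi)
  have cr : ∀ i, i + 1 < q + 2 → Commute g.right (σ (q + 3) i) := fun i hi => by
    have := (cg i hi).map rightHom
    simpa only [rightHom_eq_right, mul_right,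
      right_inl, right_inr, one_mul] using this
  obtain ⟨a, b, hab⟩ := centralizer_inB (k := q + 2) (by rw [← perm_ι, hg, pX]) cr
  have hC : C (q + 4) (tri q) X =
      C (q + 3) (tri q) (ι (q + 2) (fr (z (q + 2) ^ a)) * ζ (q + 3) ^ b) := by
    rw [← hg, C_ι (by rw [mem_tri]; omega), hab]
  have ha : a = 0 := by
    apply eq_zero_of_C_tri_scalar (q := q) (b := b)
    have := C_tri_map_conj hφ (k := q) (by omega) (b := σ (q + 4) 2 ^ 2) (fsp_perm_sq (by omega) _)
    rw [← conj_pow, δ_pow_conj, add_comm 2, ← hX, hC] at this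
    rw [this, map_mul, map_mul, map_inv]
    rcases hT with h | h <;> rw [h]
    · left; group
    · right; rw [(SLZ.commute_neg_one _).eq]; group
  rw [ha, zpow_zero, map_one, map_one, one_mul] at hab
  obtain ⟨f, hf⟩ : ∃ f, f = g.left * (z (q + 3) ^ b)⁻¹ := ⟨_, rfl⟩
  have hgf := eq_fr_mul_Δ hab
  rw [← hf] at hgf
  obtain ⟨hk, hb, j, hj⟩ := section_data (f := f) (b := b) hφ h (by
    rw [← map_pow, ← hX, ← hg, hgf, map_mul, map_zpow, ι_Δ])
  rw [hb, zpow_zero, mul_one] at hgf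
  have hff : f ∈ Subgroup.closure {x (q + 3) (q + 2), zl (q + 3) (q + 2)} :=
    mem_closure_of_fixed (by omega) fun i hi => by
      have := cg i hi
      rw [hk, zpow_zero, map_one, one_mul, hgf] at this
      exact (commute_inl this).2
  obtain ⟨κ, hκ, hκx, hκz⟩ := exists_CF q
  rw [hκ] at hj
  have hj' := inl_injective (ι_injective 2 hj)
  obtain ⟨r, hr⟩ : ∃ r : F 2 →* F (q + 3), r = F.lift 2 fun i =>
    if i = 1 then x (q + 3) (q + 2) else zl (q + 3) (q + 2) := ⟨_, rfl⟩
  have hr0 : r (x 2 0) = zl (q + 3) (q + 2) := by rw [hr, F.lift_x _]; rfl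
  have hr1 : r (x 2 1) = x (q + 3) (q + 2) := by rw [hr, F.lift_x _]; rfl
  have hrκ : r (κ f) = f := by
    have : Set.EqOn (r.comp κ) (MonoidHom.id _) {x (q + 3) (q + 2), zl (q + 3) (q + 2)} := by
      rintro _ (rfl | rfl)
      · rw [comp_apply, hκx, hr1]; rfl
      · rw [comp_apply, hκz, hr0]; rfl
    exact MonoidHom.eqOn_closure this hff
  have hrz : r (z 2) = z (q + 3) := by
    change r (x 2 1 * (x 2 0 * 1)) = x (q + 3) (q + 2) * zl (q + 3) (q + 2)
    rw [mul_one, map_mul, hr0, hr1]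
  rw [hj', map_mul, map_mul, map_inv, map_zpow, hrz, hr1] at hrκ
  obtain ⟨G, hG⟩ : ∃ G, G = ι (q + 3) (fr (z (q + 3) ^ j)) := ⟨_, rfl⟩
  have hGσ : ∀ i, i + 1 < q + 3 → Commute G (σ (q + 4) i) := fun i hi => by
    rw [hG, map_zpow, ← ι_br_σ (m := q + 3) hi]
    exact (((fr_z_commute_br _ _).zpow_left j).map (ι (q + 3)))
  have hGp : perm (q + 4) G = 1 := hG ▸ perm_ι_fr _ _
  have h0 : ∀ i, i + 1 < q + 3 → φ (σ (q + 4) i) = σ (q + 4) i := fun i hi => by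
    rw [h i hi, hk, zpow_zero, map_one, one_mul, ι_br_σ hi]
  have hXG : G⁻¹ * X * G = σ (q + 4) (q + 2) ^ 2 := by
    rw [← hg, hgf, ← hrκ, hG, show σ (q + 4) (q + 2) ^ 2 = ι (q + 3) (fr (x (q + 3) (q + 2))) from
      (ι_x_last (m := q + 3)).symm]
    simp only [map_mul, map_inv]
    group
  obtain ⟨s, hs⟩ : ∃ s, s = G⁻¹ * φ (σ (q + 4) (q + 2)) * G := ⟨_, rfl⟩
  have hs2 : s ^ 2 = σ (q + 4) (q + 2) ^ 2 := by
    rw [← hXG, hX, map_pow, hs, pow_two, pow_two]; group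
  obtain ⟨y, hy⟩ : ∃ y, y = σ (q + 4) (q + 2) := ⟨_, rfl⟩
  obtain ⟨w, hw⟩ : ∃ w, w = σ (q + 4) (q + 1) := ⟨_, rfl⟩
  have hwy : w * y * w = y * w * y := by rw [hw, hy]; exact σ_braid
  have hws : w * s * w = s * w * s := by
    have h1 := congrArg φ hwy
    rw [hy, hw, map_mul, map_mul, map_mul, map_mul, h0 _ (by omega), ← hw] at h1
    have hGw : Commute G w := hw ▸ hGσ _ (by omega)
    have hws : w = G⁻¹ * w * G := by rw [mul_assoc, ← hGw.eq]; group
    rw [hs]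
    calc w * (G⁻¹ * φ (σ (q + 4) (q + 2)) * G) * w
        = (G⁻¹ * w * G) * (G⁻¹ * φ (σ (q + 4) (q + 2)) * G) * (G⁻¹ * w * G) := by rw [← hws]
      _ = G⁻¹ * (w * φ (σ (q + 4) (q + 2)) * w) * G := by group
      _ = (G⁻¹ * φ (σ (q + 4) (q + 2)) * G) * (G⁻¹ * w * G) *
          (G⁻¹ * φ (σ (q + 4) (q + 2)) * G) := by rw [h1]; group
      _ = _ := by rw [← hws]
  rw [← hy] at hs2
  have hconj : ∀ u : Br (q + 4), w * u * w = u * w * u → u * w ^ 2 * u⁻¹ = w⁻¹ * u ^ 2 * w := by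
    intro u hu
    have h1 : u * w * u⁻¹ = w⁻¹ * u * w := by
      rw [mul_inv_eq_iff_eq_mul, mul_assoc, mul_assoc, eq_inv_mul_iff_mul_eq, ← mul_assoc, hu, mul_assoc]
    have h2 : w⁻¹ * u ^ 2 * w = (w⁻¹ * u * w) ^ 2 := by rw [pow_two, pow_two]; group
    rw [h2, ← h1, conj_pow]
  have hd : ∃ b : ℤ, s⁻¹ * y = ζ (q + 4) ^ b := by
    apply eq_ζ_zpow_of_commute
    · rw [map_mul, map_inv, hs, map_mul, map_mul, map_inv, hGp, hφ, hy]; simp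
    · intro i hi
      refine Commute.mul_left (Commute.inv_left ?_) (hy ▸ (σ_comm).symm)
      rw [hs]
      have h1 := (σ_comm (m := q + 4) (i := i) (j := q + 2)).symm.map φ
      rw [h0 i (by omega)] at h1
      exact ((hGσ i (by omega)).inv_left.mul_left h1).mul_left (hGσ i (by omega))
    · rw [← hw]
      have h1 := hconj y hwy
      have h2 := hconj s hws
      rw [hs2, ← h1] at h2
      change s⁻¹ * y * w ^ 2 = w ^ 2 * (s⁻¹ * y)
      calc s⁻¹ * y * w ^ 2 = s⁻¹ * (y * w ^ 2 * y⁻¹) * y := by group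
        _ = _ := by rw [← h2]; group
    · rw [← hy]
      refine Commute.mul_left (Commute.inv_left ?_) (Commute.self_pow _ _)
      rw [← hs2]; exact Commute.self_pow _ _
  obtain ⟨b, hb⟩ := hd
  have hb0 : b = 0 := by
    have h5 := congrArg (fun v => (expo (q + 4) v).toAdd) hb
    have h6 := congrArg (fun v => (expo (q + 4) v).toAdd) hs2
    simp only [map_mul, map_inv, map_pow, map_zpow, toAdd_mul, toAdd_zpow, toAdd_pow, toAdd_inv,
      smul_eq_mul] at h5 h6
    rw [expo_ζ] at h5
    simp only [toAdd_ofAdd] at h5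
    have h7 : (expo (q + 4) s).toAdd = (expo (q + 4) y).toAdd := by simpa using h6
    rw [h7, neg_add_cancel] at h5
    push_cast at h5
    have h8 : ((q : ℤ) + 4) * (q + 4 - 1) ≠ 0 :=
      mul_ne_zero (by omega) (by omega)
    simpa [h8] using h5.symm
  rw [hb0, zpow_zero, inv_mul_eq_one] at hb
  refine ⟨G, fun i hi => ?_⟩
  by_cases h1 : i + 1 < q + 3
  · rw [h0 i h1, (hGσ i h1).eq]; group
  · obtain rfl : i = q + 2 := by omega
    have h3 : σ (q + 4) (q + 2) = s := hy ▸ hb.symm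
    have h4 : φ (σ (q + 4) (q + 2)) = G * s * G⁻¹ := by rw [hs]; group
    rw [h4, h3]

end

section

open Equiv
/-! ### Endomorphisms compatible with the permutation representation -/

/-- The composition of `φ` with an inner automorphism and a transvection by a central power. -/
def normalize {m : ℕ} (φ : Br m →* Br m) (A : Br m) (p : ℤ) : Br m →* Br m :=
  transv ((MulAut.conj A⁻¹).toMonoidHom.comp φ) (ζ m ^ (-p)) fun g => (ζ_commute m g).zpow_left _

lemma normalize_apply {m : ℕ} (φ : Br m →* Br m) (A : Br m) (p : ℤ) (b : Br m) :
    normalize φ A p b = A⁻¹ * φ b * A * (ζ m ^ (-p)) ^ (expo m b).toAdd := by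
  change A⁻¹ * φ b * (A⁻¹)⁻¹ * _ = _
  rw [inv_inv]

lemma normalize_σ {m i : ℕ} (hi : i + 1 < m) (φ : Br m →* Br m) (A : Br m) (p : ℤ) :
    normalize φ A p (σ m i) = A⁻¹ * φ (σ m i) * A * ζ m ^ (-p) := by
  rw [normalize_apply, expo_σ hi]; simp

lemma perm_normalize {m : ℕ} (hm : 3 ≤ m) {φ : Br m →* Br m}
    (hφ : ∀ b, perm m (φ b) = perm m b) {A : Br m} (hA : perm m A = 1) (p : ℤ) (b : Br m) :
    perm m (normalize φ A p b) = perm m b := by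
  rw [normalize_apply, map_mul, map_mul, map_mul, map_inv, map_zpow, map_zpow, hA, perm_ζ hm, hφ]
  simp

/-- The triple `{0, 1, 2}` sees the square of `φ (σ 2)` as a scalar matrix. -/
def IsScalarAt (m : ℕ) (φ : Br m →* Br m) : Prop :=
  SL (C m (tri 0) (φ (σ m 2 ^ 2))) = 1 ∨ SL (C m (tri 0) (φ (σ m 2 ^ 2))) = -1

lemma IsScalarAt.normalize {m : ℕ} (hm : 4 ≤ m) {φ : Br m →* Br m}
    (hφ : ∀ b, perm m (φ b) = perm m b) (h : IsScalarAt m φ) {A : Br m} (hA : perm m A = 1)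
    (p : ℤ) : IsScalarAt m (normalize φ A p) := by
  have fix : ∀ {b}, perm m b = 1 → fsp (perm m b) (tri 0) = tri 0 := fun h => by
    rw [h, map_one]; rfl
  have pX : perm m (φ (σ m 2 ^ 2)) = 1 := by rw [hφ, perm_sq_eq_one]
  have pζ : perm m ((ζ m ^ (-p)) ^ (expo m (σ m 2 ^ 2)).toAdd) = 1 := by
    rw [map_zpow, map_zpow, perm_ζ, one_zpow, one_zpow]
  have e : SL (C m (tri 0) (Braid.normalize φ A p (σ m 2 ^ 2))) =
      SL (C m (tri 0) A)⁻¹ * SL (C m (tri 0) (φ (σ m 2 ^ 2))) * SL (C m (tri 0) A) := by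
    have hs : expo m (σ m 2 ^ 2) = ofAdd (2 : ℤ) := by
      rw [map_pow, expo_σ]; rfl
    rw [normalize_apply, C_mul_of_fix (fix pζ), C_mul_of_fix (fix hA), C_mul_of_fix (fix pX),
      C_inv_of_fix (fix hA), ← zpow_mul, C_zpow (fix (perm_ζ)), C_ζ (by omega),
      map_mul, map_mul, map_mul, map_zpow, SL_ζ, hs, toAdd_ofAdd, mul_comm (-p), zpow_mul]
    simp
  rcases h with h | h
  · left; rw [e, h]; simp
  · right; rw [e, h, ← (SLZ.commute_neg_one _).symm.eq, mul_assoc, ← map_mul]; simp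

lemma IsScalarAt.mirror {m : ℕ} (hm : 4 ≤ m) {φ : Br m →* Br m}
    (hφ : ∀ b, perm m (φ b) = perm m b) (h : IsScalarAt m φ) :
    IsScalarAt m (φ.comp (mirror m)) := by
  have pX : perm m (φ (σ m 2 ^ 2)) = 1 := by rw [hφ, perm_sq_eq_one]
  have e : SL (C m (tri 0) (φ.comp (Braid.mirror m) (σ m 2 ^ 2))) =
      (SL (C m (tri 0) (φ (σ m 2 ^ 2))))⁻¹ := by
    rw [comp_apply, map_pow, mirror_σ, inv_pow, map_inv,
      C_inv_of_fix (by rw [pX, map_one]; rfl), map_inv]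
  rcases h with h | h
  · left; rw [e, h, inv_one]
  · right; rw [e, h]; exact inv_eq_of_mul_eq_one_left (by simp)

lemma std_of_forget_pos {q : ℕ} {φ : Br (q + 4) →* Br (q + 4)}
    (hφ : ∀ b, perm (q + 4) (φ b) = perm (q + 4) b) (hT : IsScalarAt (q + 4) φ)
    {g : Br (q + 3)} {p : ℤ} (h : ∀ i, i + 1 < q + 3 →
      (fg (q + 3) (φ (σ (q + 4) i))).right = g * σ (q + 3) i * g⁻¹ * ζ (q + 3) ^ p) :
    Std (q + 4) φ := by
  have hfix : ∀ i, i + 1 < q + 3 → perm (q + 4) (φ (σ (q + 4) i)) (q + 3) = q + 3 := fun i hi => by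
    rw [hφ, perm_σ, swap_apply_of_ne_of_ne (by omega) (by omega)]
  have pg : perm (q + 3) g = 1 := by
    refine perm_eq_one_of_commute (k := q + 3) (by omega) (fun i hi => perm_of_le hi _) fun i hi => ?_
    have h1 := congrArg (perm (q + 3)) (h i hi)
    rw [← perm_ι, ι_fg (hfix i hi), hφ, perm_σ, map_mul, map_mul, map_mul, map_inv,
      map_zpow, perm_ζ, one_zpow, mul_one, perm_σ hi, eq_mul_inv_iff_mul_eq] at h1
    exact h1.symm
  obtain ⟨G, hG⟩ : ∃ G, G = ι (q + 3) (br g) := ⟨_, rfl⟩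
  have pG : perm (q + 4) G = 1 := by rw [hG, perm_ι]; exact pg
  obtain ⟨φ', hφ'⟩ : ∃ φ', φ' = normalize φ G p := ⟨_, rfl⟩
  have hp' : ∀ b, perm (q + 4) (φ' b) = perm (q + 4) b := fun b => by
    rw [hφ']; exact perm_normalize (by omega) hφ pG p b
  have hT' : IsScalarAt (q + 4) φ' := hφ' ▸ hT.normalize (by omega) hφ pG p
  have hr : ∀ i, i + 1 < q + 3 → (fg (q + 3) (φ' (σ (q + 4) i))).right = σ (q + 3) i :=
    fun i hi => by
      have h1 : φ' (σ (q + 4) i) = ι (q + 3) ((br g)⁻¹ * fg (q + 3) (φ (σ (q + 4) i)) * br g *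
          Δ (q + 3) ^ (-p)) := by
        rw [hφ', normalize_σ (by omega), map_mul, map_mul, map_mul, map_inv, ← hG,
          ι_fg (hfix i hi), map_zpow, ι_Δ]
      have h2 : (Δ (q + 3) ^ (-p)).right = ζ (q + 3) ^ (-p) := by
        rw [← rightHom_eq_right, map_zpow]; simp [Δ]
      rw [h1, fg_ι]
      simp only [mul_right, inv_right,
        right_inr]
      rw [h i hi, h2, mul_assoc g⁻¹, mul_assoc _ _ g, ((ζ_commute (q + 3) g).zpow_left p).eq]
      group
  have hf0 : ∀ b, perm (q + 4) (φ' (inB (q + 3) b)) (q + 3) = q + 3 := fun b => by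
    rw [hp', perm_inB, perm_of_le le_rfl]
  obtain ⟨f, hf⟩ : ∃ f : Br (q + 3) →* AG (q + 3), ∀ b, f b = fg (q + 3) (φ' (inB (q + 3) b)) :=
    ⟨{ toFun := fun b => fg (q + 3) (φ' (inB (q + 3) b))
       map_one' := by rw [map_one, map_one, ← map_one (ι (q + 3)), fg_ι]
       map_mul' := fun a b => by rw [map_mul, map_mul, fg_mul _ (hf0 b)] }, fun b => rfl⟩
  have hfr : ∀ b, (f b).right = b := fun b => by
    have : rightHom.comp f = MonoidHom.id _ := Br.hom_ext fun i hi => by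
      rw [comp_apply, hf, inB_σ hi]; exact hr i hi
    exact congr_fun this b
  obtain ⟨v, k, hv⟩ := section_classification (by omega) f hfr
  obtain ⟨V, hV⟩ : ∃ V, V = ι (q + 3) (fr v) := ⟨_, rfl⟩
  have pV : perm (q + 4) V = 1 := by rw [hV]; exact perm_ι_fr _ _
  obtain ⟨g', hg'⟩ := std_of_section (φ := normalize φ' V 0) (k := k)
    (perm_normalize (by omega) hp' pV 0) (hT'.normalize (by omega) hp' pV 0) fun i hi => by
      have h1 := congrArg (ι (q + 3)) (hv i hi)
      rw [hf, ι_fg (hf0 _), inB_σ hi, map_mul, map_mul, map_inv, ← hV] at h1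
      rw [normalize_σ (by omega), h1]
      group
  refine ⟨G * V * g', 1, p, Or.inl rfl, fun i hi => ?_⟩
  have h1 := hg' i hi
  rw [normalize_σ hi, hφ', normalize_σ hi] at h1
  have hc := ((ζ_commute (q + 4) V).zpow_left (-p)).eq
  have h2 : V⁻¹ * (G⁻¹ * φ (σ (q + 4) i) * G * ζ (q + 4) ^ (-p)) * V =
      V⁻¹ * (G⁻¹ * φ (σ (q + 4) i) * G) * V * ζ (q + 4) ^ (-p) := by
    simp only [mul_assoc]; rw [hc]
  rw [neg_zero, zpow_zero, mul_one, h2] at h1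
  rw [zpow_one, show G * V * g' * σ (q + 4) i * (G * V * g')⁻¹ =
    G * V * (g' * σ (q + 4) i * g'⁻¹) * (V⁻¹ * G⁻¹) by group, ← h1]
  have hc2 := ((ζ_commute (q + 4) (V⁻¹ * G⁻¹)).zpow_left (-p)).eq
  calc φ (σ (q + 4) i) = G * V * (V⁻¹ * (G⁻¹ * φ (σ (q + 4) i) * G) * V) * (V⁻¹ * G⁻¹) := by group
    _ = G * V * (V⁻¹ * (G⁻¹ * φ (σ (q + 4) i) * G) * V) * (V⁻¹ * G⁻¹ * ζ (q + 4) ^ (-p)) *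
        ζ (q + 4) ^ p := by group
    _ = _ := by rw [← hc2]; simp only [mul_assoc]

lemma std_of_forget {q : ℕ} {φ : Br (q + 4) →* Br (q + 4)}
    (hφ : ∀ b, perm (q + 4) (φ b) = perm (q + 4) b) (hT : IsScalarAt (q + 4) φ)
    (h' : ∀ b, perm (q + 4) (φ.comp (inB (q + 3)) b) (q + 3) = q + 3)
    (h : Std (q + 3) (forget (φ.comp (inB (q + 3))) h')) : Std (q + 4) φ := by
  obtain ⟨g, ε, p, rfl | rfl, h⟩ := h
  · refine std_of_forget_pos hφ hT (g := g) (p := p) fun i hi => ?_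
    rw [← inB_σ hi]
    refine (h i hi).trans ?_
    rw [zpow_one]
  · refine Std.of_mirror (std_of_forget_pos (fun b => by
      rw [comp_apply, hφ, perm_mirror]) (hT.mirror (by omega) hφ) (g := g) (p := -p)
      fun i hi => ?_)
    have h1 : fg (q + 3) (φ.comp (mirror (q + 4)) (σ (q + 4) i)) =
        fg (q + 3) (φ.comp (inB (q + 3)) (σ (q + 3) i)⁻¹) := by
      rw [comp_apply, mirror_σ, comp_apply, map_inv (inB _), inB_σ hi]
    have hc := (((ζ_commute (q + 3) g).zpow_left p).eq)
    rw [h1, ← forget_apply _ h', map_inv, h i hi, mul_inv_rev, ← zpow_neg,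
      ((ζ_commute (q + 3) _).zpow_left (-p)).eq]
    congr 1
    group

lemma std_of_scalar (q : ℕ) {φ : Br (q + 4) →* Br (q + 4)}
    (hφ : ∀ b, perm (q + 4) (φ b) = perm (q + 4) b) (hT : IsScalarAt (q + 4) φ) :
    Std (q + 4) φ := by
  induction q with
  | zero => exact std_of_forget (q := 0) hφ hT _ (std_forget_four hφ)
  | succ q ih =>
    have h' : ∀ b, perm (q + 5) (φ.comp (inB (q + 4)) b) (q + 4) = q + 4 := fun b => by
      rw [comp_apply, hφ, perm_inB, perm_of_le le_rfl]
    refine std_of_forget (q := q + 1) hφ hT h' (ih (fun b => ?_) ?_)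
    · rw [perm_forget]; rw [comp_apply, hφ, perm_inB]
    · have h1 : C (q + 4) (tri 0) (forget (φ.comp (inB (q + 4))) h' (σ (q + 4) 2 ^ 2)) =
          C (q + 5) (tri 0) (φ (σ (q + 5) 2 ^ 2)) := by
        rw [forget_apply, ← C_ι (by rw [mem_tri]; omega), ι_fg (h' _), comp_apply,
          map_pow (inB _), inB_σ]
      rw [IsScalarAt, h1]
      exact hT

lemma std_of_perm {n : ℕ} (hn : 5 ≤ n) {φ : Br n →* Br n}
    (hφ : ∀ b, perm n (φ b) = perm n b) : Std n φ := by
  obtain ⟨q, rfl⟩ : ∃ q, n = q + 4 := ⟨n - 4, by omega⟩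
  exact std_of_scalar q hφ (triple_scalar hn φ hφ)

end

/-! ### Perfectness of the commutator subgroup -/

lemma eq_of_commute_quotients {n : ℕ} (hn : 5 ≤ n) {G : Type*} [Group G] (f : Br n →* G)
    (h : Commute (f (σ n 0 * (σ n 1)⁻¹)) (f (σ n 3 * (σ n 0)⁻¹))) : f (σ n 0) = f (σ n 1) := by
  have h3 : Commute (f (σ n 0 * (σ n 1)⁻¹)) (f (σ n 3)) :=
    (((σ_comm (i := 0) (j := 3)).mul_left
      (σ_comm (i := 1) (j := 3)).inv_left)).map f
  have h0 : Commute (f (σ n 0 * (σ n 1)⁻¹)) (f (σ n 0)) := by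
    have := h.inv_right.mul_right h3
    rwa [map_mul f (σ n 3), map_inv f, mul_inv_rev, inv_inv, inv_mul_cancel_right] at this
  have h1 : Commute (f (σ n 1)) (f (σ n 0)) := by
    have := h0.inv_left.mul_left (Commute.refl (f (σ n 0)))
    rwa [map_mul, map_inv, mul_inv_rev, inv_inv, inv_mul_cancel_right] at this
  refine SLZ.eq_of_braid_of_commute ?_ h1.symm
  rw [← map_mul, ← map_mul, ← map_mul, ← map_mul, σ_braid]

lemma eq_σ_zero {n : ℕ} {G : Type*} [Group G] (f : Br n →* G) (h : f (σ n 0) = f (σ n 1)) :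
    ∀ i, i + 1 < n → f (σ n i) = f (σ n 0) := by
  have step : ∀ i, i + 2 < n → f (σ n (i + 1)) = f (σ n i) := fun i hi => by
    have h1 := δ_pow_conj (m := n) (i := 0) (j := i)
    have h2 := δ_pow_conj (m := n) (i := 1) (j := i)
    rw [zero_add] at h1
    rw [add_comm] at h2
    rw [← h1, ← h2, map_mul, map_mul, map_mul, map_mul, h]
  intro i hi
  induction i with
  | zero => rfl
  | succ i ih => rw [step i (by omega), ih (by omega)]

lemma commutator_perfect {n : ℕ} (hn : 5 ≤ n) :
    commutator (commutator (Br n)) = ⊤ := by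
  have key : commutator (Br n) ≤ ⁅commutator (Br n), commutator (Br n)⁆ := by
    have hmem : ∀ i j, i + 1 < n → j + 1 < n → σ n i * (σ n j)⁻¹ ∈ commutator (Br n) := by
      intro i j hi hj
      rw [← QuotientGroup.eq_one_iff (N := commutator (Br n)), QuotientGroup.mk_mul,
        QuotientGroup.mk_inv, mul_inv_eq_one]
      have h01 : Abelianization.of (σ n 0) = Abelianization.of (σ n 1) :=
        SLZ.eq_of_braid_of_commute (by
          rw [← map_mul, ← map_mul, ← map_mul, ← map_mul, σ_braid]) (mul_comm _ _)
      exact (eq_σ_zero _ h01 i hi).trans (eq_σ_zero _ h01 j hj).symm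
    let q := QuotientGroup.mk' ⁅commutator (Br n), commutator (Br n)⁆
    have h01 : q (σ n 0) = q (σ n 1) := by
      refine eq_of_commute_quotients hn q ?_
      rw [← commutatorElement_eq_one_iff_commute, ← map_commutatorElement]
      exact (QuotientGroup.eq_one_iff _).2 (Subgroup.commutator_mem_commutator
        (hmem 0 1 (by omega) (by omega)) (hmem 3 0 (by omega) (by omega)))
    have h1 : ∀ i b, i + 1 < n → Commute (q b) (q (σ n i)) := fun i b hi =>
      Br.commute_of_gens q _ (fun j hj => by
        rw [eq_σ_zero q h01 j hj, eq_σ_zero q h01 i hi]) b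
    have h2 : ∀ a b, Commute (q b) (q a) := fun a b =>
      (Br.commute_of_gens q _ (fun j hj => (h1 j b hj).symm) a).symm
    refine Subgroup.commutator_le.2 ?_
    intro a _ b _
    rw [← QuotientGroup.eq_one_iff (N := ⁅commutator (Br n), commutator (Br n)⁆)]
    change q (a * b * a⁻¹ * b⁻¹) = 1
    rw [map_mul, map_mul, map_mul, map_inv, map_inv, (h2 b a).eq, mul_inv_cancel_right,
      mul_inv_cancel]
  apply Subgroup.map_injective (commutator (Br n)).subtype_injective
  rw [Subgroup.map_subtype_commutator, ← MonoidHom.range_eq_map, Subgroup.range_subtype]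
  exact le_antisymm (Subgroup.commutator_le_left _ _) key

lemma hom_free_trivial {N : Type*} [Group N] (hN : commutator N = ⊤) {α : Type}
    (f : N →* FreeGroup α) (x : N) : f x = 1 := by
  let e := IsFreeGroup.toFreeGroup f.range
  let χ : FreeGroup (IsFreeGroup.Generators f.range) →* Multiplicative ℤ :=
    FreeGroup.lift fun _ => ofAdd 1
  have h1 : ∀ w, χ w = 1 := fun w => by
    obtain ⟨⟨_, y, rfl⟩, rfl⟩ := e.surjective w
    have : y ∈ ((χ.comp e.toMonoidHom).comp f.rangeRestrict).ker :=
      Abelianization.commutator_subset_ker _ (hN ▸ Subgroup.mem_top y)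
    exact this
  have : IsEmpty (IsFreeGroup.Generators f.range) := ⟨fun y => by
    have := h1 (FreeGroup.of y)
    simp [χ] at this⟩
  have h2 : (⟨f x, x, rfl⟩ : f.range) = 1 := e.injective (Subsingleton.elim _ _)
  exact congrArg Subtype.val h2

lemma hom_pure_trivial {N : Type*} [Group N] (hN : commutator N = ⊤) (m : ℕ)
    (f : N →* Br m) (hf : ∀ x, perm m (f x) = 1) (x : N) : f x = 1 := by
  induction m generalizing x with
  | zero => exact Br.eq_one_of_le (by omega) _
  | succ m ih =>
    have h0 : ∀ y, perm (m + 1) (f y) m = m := fun y => by rw [hf]; rfl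
    let F1 : N →* AG m :=
      { toFun := fun y => fg m (f y)
        map_one' := by rw [map_one, ← map_one (ι m), fg_ι]
        map_mul' := fun a b => by rw [map_mul, fg_mul _ (h0 b)] }
    have h1 : ∀ y, (F1 y).right = 1 := fun y =>
      ih (rightHom.comp F1) (fun y => by
        change perm m (fg m (f y)).right = 1
        rw [← perm_ι, ι_fg (h0 y), hf]) y
    let F2 : N →* F m :=
      { toFun := fun y => (F1 y).left
        map_one' := by rw [map_one]; rfl
        map_mul' := fun a b => by rw [map_mul, SemidirectProduct.mul_left, h1, map_one]; rfl }
    have h2 : F1 x = 1 := SemidirectProduct.ext (hom_free_trivial hN F2 x) (h1 x)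
    rw [← ι_fg (h0 x)]
    exact (congrArg _ h2).trans (map_one _)

lemma eq_of_perm_eq {n m : ℕ} (hn : 5 ≤ n) (f : Br n →* Br m)
    (h : perm m (f (σ n 0)) = perm m (f (σ n 1))) : f (σ n 0) = f (σ n 1) := by
  have hc : ∀ i, i + 1 < n → (perm m).comp f (σ n i) = (perm m).comp f (σ n 0) :=
    eq_σ_zero ((perm m).comp f) h
  have h2 : ∀ a b, Commute ((perm m).comp f b) ((perm m).comp f a) := fun a b =>
    (Br.commute_of_gens _ _ (fun j hj => (Br.commute_of_gens _ _ (fun k hk => by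
      rw [hc j hj, hc k hk]; exact Commute.refl _) b).symm) a).symm
  have hab : ∀ x ∈ commutator (Br n), perm m (f x) = 1 := by
    intro x hx
    have : commutator (Br n) ≤ ((perm m).comp f).ker := by
      rw [_root_.commutator_def, Subgroup.commutator_le]
      intro a _ b _
      rw [MonoidHom.mem_ker, map_commutatorElement, commutatorElement_eq_one_iff_commute]
      exact h2 b a
    exact this hx
  have hx : ∀ x ∈ commutator (Br n), f x = 1 := fun x hx =>
    hom_pure_trivial (commutator_perfect hn) m (f.comp (commutator (Br n)).subtype)
      (fun y => hab _ y.2) ⟨x, hx⟩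
  refine SLZ.eq_of_braid_of_commute (by
    rw [← map_mul, ← map_mul, ← map_mul, ← map_mul, σ_braid]) ?_
  rw [← commutatorElement_eq_one_iff_commute, ← map_commutatorElement]
  exact hx _ (Subgroup.commutator_mem_commutator (Subgroup.mem_top _) (Subgroup.mem_top _))

/-! ### Braid pairs in the symmetric group of degree six -/

section SymSix

open Equiv Equiv.Perm

/-- The pairs of elements of the centralizer of `s` satisfying the braid relation, the first one
having trivial cube if `s` does, are constant. -/
def NoBraid (s : Perm (Fin 6)) : Prop :=
  ∀ a : Perm (Fin 6), s * a = a * s → (s * s * s = 1 → a * a * a = 1) →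
    ∀ b : Perm (Fin 6), s * b = b * s → a * b * a = b * a * b → a = b

instance : DecidablePred NoBraid := fun s => by unfold NoBraid; infer_instance

lemma NoBraid.of_isConj {s s' : Perm (Fin 6)} (h : IsConj s s') (hs : NoBraid s) :
    NoBraid s' := by
  obtain ⟨g, hg⟩ := isConj_iff.1 h
  intro a ha h3 b hb hab
  have key : ∀ u v : Perm (Fin 6), g⁻¹ * (u * v) * g = (g⁻¹ * u * g) * (g⁻¹ * v * g) := by
    intro u v; group
  have hgs : g⁻¹ * s' * g = s := by rw [← hg]; group
  have ha' := congrArg (fun u => g⁻¹ * u * g) ha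
  have hb' := congrArg (fun u => g⁻¹ * u * g) hb
  have hab' := congrArg (fun u => g⁻¹ * u * g) hab
  simp only [key, hgs] at ha' hb' hab'
  have := hs _ ha' (fun h => by
    rw [← key, ← key, h3 (by
      have : s' * s' * s' = g * (s * s * s) * g⁻¹ := by rw [← hg]; group
      rw [this, h]; group)]
    group) _ hb' hab'
  simpa using this

set_option maxRecDepth 100000 in
lemma noBraid_reps : ∀ s ∈ ([swap 0 1 * swap 2 3, c[0, 1, 2], c[0, 1, 2] * c[3, 4, 5],
    c[0, 1, 2] * c[3, 4], c[0, 1, 2, 3], c[0, 1, 2, 3] * c[4, 5], c[0, 1, 2, 3, 4],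
    c[0, 1, 2, 3, 4, 5]] : List (Perm (Fin 6))), NoBraid s := by
  decide +kernel

set_option maxRecDepth 100000 in
lemma cycleType_reps : ([swap 0 1 * swap 2 3, c[0, 1, 2], c[0, 1, 2] * c[3, 4, 5],
    c[0, 1, 2] * c[3, 4], c[0, 1, 2, 3], c[0, 1, 2, 3] * c[4, 5], c[0, 1, 2, 3, 4],
    c[0, 1, 2, 3, 4, 5]] : List (Perm (Fin 6))).map cycleType =
    [{2, 2}, {3}, {3, 3}, {3, 2}, {4}, {4, 2}, {5}, {6}] := by
  decide +kernel

lemma multiset_cases {m : Multiset ℕ} (h2 : ∀ i ∈ m, 2 ≤ i) (hm : m.sum ≤ 6) :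
    m = 0 ∨ m = {2} ∨ m = {2, 2, 2} ∨
      m ∈ ([{2, 2}, {3}, {3, 3}, {3, 2}, {4}, {4, 2}, {5}, {6}] : List (Multiset ℕ)) := by
  induction m using Multiset.induction with
  | empty => simp
  | cons a m ih => 
  right
  clear ih
  induction m using Multiset.induction with
  | empty =>
    have := h2 a (by simp)
    simp only [Multiset.sum_cons, Multiset.sum_zero] at hm
    obtain rfl | rfl | rfl | rfl | rfl : a = 2 ∨ a = 3 ∨ a = 4 ∨ a = 5 ∨ a = 6 := by omega
    all_goals decide
  | cons b m ih =>
  clear ih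
  have ha := h2 a (by simp)
  have hb := h2 b (by simp)
  induction m using Multiset.induction with
  | empty =>
    simp only [Multiset.sum_cons, Multiset.sum_zero] at hm
    have ha' : a ≤ 4 := by omega
    have hb' : b ≤ 4 := by omega
    interval_cases a <;> interval_cases b <;> first | omega | decide
  | cons c m ih =>
  clear ih
  have hc := h2 c (by simp)
  have hm0 : m = 0 := by
    induction m using Multiset.induction with
    | empty => rfl
    | cons d m ih =>
      have hd := h2 d (by simp)
      simp only [Multiset.sum_cons] at hm
      omega
  subst hm0
  simp only [Multiset.sum_cons, Multiset.sum_zero] at hm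
  obtain rfl : a = 2 := by omega
  obtain rfl : b = 2 := by omega
  obtain rfl : c = 2 := by omega
  exact Or.inr (Or.inl rfl)

lemma cycleType_of_braid {s a b : Perm (Fin 6)} (h1 : s ≠ 1) (ha : Commute s a)
    (hb : Commute s b) (h3 : s * s * s = 1 → a * a * a = 1) (hab : a * b * a = b * a * b)
    (hne : a ≠ b) : s.cycleType = {2} ∨ s.cycleType = {2, 2, 2} := by
  have hs : s.cycleType.sum ≤ 6 := by
    rw [sum_cycleType]; exact s.support.card_le_univ
  rcases multiset_cases (fun i hi => two_le_of_mem_cycleType hi) hs with h | h | h | h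
  · exact absurd (cycleType_eq_zero.1 h) h1
  · exact Or.inl h
  · exact Or.inr h
  · rw [← cycleType_reps, List.mem_map] at h
    obtain ⟨r, hr, hrs⟩ := h
    exact absurd (((noBraid_reps r hr).of_isConj (isConj_of_cycleType_eq hrs)) a ha.eq h3 b hb.eq hab)
      hne

end SymSix

/-! ### Representations by transpositions -/

section Transpositions

open Equiv Equiv.Perm

variable {Ω : Type} [DecidableEq Ω]

lemma ne_of_commute_swap {a b c d : Ω} (hab : a ≠ b) (hcd : c ≠ d)
    (h : Commute (swap a b) (swap c d)) (hne : swap a b ≠ swap c d) :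
    a ≠ c ∧ a ≠ d ∧ b ≠ c ∧ b ≠ d := by
  have key : ∀ {a b d : Ω}, a ≠ b → a ≠ d → Commute (swap a b) (swap a d) → b = d := by
    intro a b d hab had h
    have := Equiv.congr_fun h.eq a
    simp only [mul_apply, swap_apply_left] at this
    by_contra hbd
    rw [swap_apply_of_ne_of_ne had.symm (Ne.symm hbd), swap_apply_of_ne_of_ne hab.symm hbd] at this
    exact hbd this.symm
  refine ⟨?_, ?_, ?_, ?_⟩
  · rintro rfl
    exact hne (by rw [key hab hcd h])
  · rintro rfl
    rw [swap_comm c a] at h hne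
    exact hne (by rw [key hab hcd.symm h])
  · rintro rfl
    rw [swap_comm a b] at h hne
    exact hne (by rw [key hab.symm hcd h])
  · rintro rfl
    rw [swap_comm c b, swap_comm a b] at h hne
    exact hne (by rw [key hab.symm hcd.symm h])

lemma eq_of_not_commute_swap {a b c d : Ω} (h : ¬ Commute (swap a b) (swap c d)) :
    a = c ∨ a = d ∨ b = c ∨ b = d := by
  by_contra! hne
  refine h (Perm.Disjoint.commute fun x => ?_)
  rw [swap_apply_def, swap_apply_def]
  grind

lemma isConj_map_σ {n : ℕ} {G : Type*} [Group G] (f : Br n →* G) {i : ℕ} (hi : i + 1 < n) :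
    ∃ g, f (σ n i) = g * f (σ n 0) * g⁻¹ := by
  refine ⟨f (δ n ^ i), ?_⟩
  have h1 := δ_pow_conj (m := n) (i := 0) (j := i)
  rw [zero_add] at h1
  rw [← h1, map_mul, map_mul, map_inv]

lemma not_commute_succ {n : ℕ} {G : Type*} [Group G] (f : Br n →* G)
    (hf : f (σ n 0) ≠ f (σ n 1)) {i : ℕ} (hi : i + 2 < n) :
    ¬ Commute (f (σ n i)) (f (σ n (i + 1))) := by
  intro h
  have h2 := SLZ.eq_of_braid_of_commute (by
    rw [← map_mul, ← map_mul, ← map_mul, ← map_mul, σ_braid hi]) h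
  have h1 := δ_pow_conj (m := n) (i := 0) (j := i)
  have h3 := δ_pow_conj (m := n) (i := 1) (j := i)
  rw [zero_add] at h1
  rw [add_comm] at h3
  rw [← h1, ← h3, map_mul, map_mul, map_mul, map_mul] at h2
  exact hf (mul_left_cancel (mul_right_cancel h2))

lemma map_σ_ne {n : ℕ} (hn : 5 ≤ n) {G : Type*} [Group G] (f : Br n →* G)
    (hf : f (σ n 0) ≠ f (σ n 1)) {i j : ℕ} (hij : i + 2 ≤ j) (hj : j + 1 < n) :
    f (σ n i) ≠ f (σ n j) := by
  intro h
  rcases Nat.lt_or_ge (i + 2) j with h1 | h1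
  · refine not_commute_succ f hf (i := i) (by omega) ?_
    rw [h]
    exact ((σ_comm).map f).symm
  obtain rfl : j = i + 2 := by omega
  rcases Nat.lt_or_ge (i + 4) n with h2 | h2
  · refine not_commute_succ f hf (i := i + 2) (by omega) ?_
    rw [← h]
    exact (σ_comm).map f
  · obtain ⟨i, rfl⟩ : ∃ k, i = k + 1 := ⟨i - 1, by omega⟩
    refine not_commute_succ f hf (i := i) (by omega) ?_
    rw [h]
    exact (σ_comm).map f

lemma exists_chain {n : ℕ} (hn : 5 ≤ n) (f : Br n →* Perm Ω) (hf : f (σ n 0) ≠ f (σ n 1))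
    (hs : (f (σ n 0)).IsSwap) :
    ∃ p : ℕ → Ω, Set.InjOn p (Set.Iio n) ∧
      ∀ i, i + 1 < n → f (σ n i) = swap (p i) (p (i + 1)) := by
  have hsw : ∀ i, i + 1 < n → ∃ a b, a ≠ b ∧ f (σ n i) = swap a b := fun i hi => by
    obtain ⟨g, hg⟩ := isConj_map_σ f hi
    obtain ⟨a, b, hab, h⟩ := hs
    refine ⟨g a, g b, g.injective.ne hab, ?_⟩
    rw [hg, h, swap_apply_apply]
  suffices H : ∀ k, k + 3 ≤ n → ∃ p : ℕ → Ω, Set.InjOn p (Set.Iio (k + 3)) ∧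
      ∀ i, i + 1 < k + 3 → f (σ n i) = swap (p i) (p (i + 1)) by
    have := H (n - 3) (by omega)
    rwa [show n - 3 + 3 = n by omega] at this
  intro k hk
  induction k with
  | zero =>
    obtain ⟨a, b, hab, h0⟩ := hsw 0 (by omega)
    obtain ⟨c, d, hcd, h1⟩ := hsw 1 (by omega)
    have hc := not_commute_succ f hf (i := 0) (by omega)
    have hne := hf
    rw [h0, zero_add, h1] at hc
    rw [h0, h1] at hne
    have main : ∃ u v w, u ≠ v ∧ v ≠ w ∧ u ≠ w ∧ swap a b = swap u v ∧ swap c d = swap v w := by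
      rcases eq_of_not_commute_swap hc with rfl | rfl | rfl | rfl
      · exact ⟨b, a, d, hab.symm, hcd, fun h => hne (by rw [h]), swap_comm _ _, rfl⟩
      · exact ⟨b, a, c, hab.symm, hcd.symm, fun h => hne (by rw [h, swap_comm]), swap_comm _ _,
          swap_comm _ _⟩
      · exact ⟨a, b, d, hab, hcd, fun h => hne (by rw [h, swap_comm]), rfl, rfl⟩
      · exact ⟨a, b, c, hab, hcd.symm, fun h => hne (by rw [h]), rfl, swap_comm _ _⟩
    obtain ⟨u, v, w, huv, hvw, huw, e1, e2⟩ := main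
    refine ⟨fun i => if i = 0 then u else if i = 1 then v else w, ?_, ?_⟩
    · intro i hi j hj h
      simp only [Set.mem_Iio] at hi hj
      interval_cases i <;> interval_cases j <;> simp_all
    · intro i hi
      have : i = 0 ∨ i = 1 := by omega
      rcases this with rfl | rfl
      · simp [h0, e1]
      · simp [h1, e2]
  | succ k ih =>
    obtain ⟨p, hp, hsp⟩ := ih (by omega)
    obtain ⟨a, b, hab, h0⟩ := hsw (k + 2) (by omega)
    have hdis : ∀ i, i ≤ k + 1 → p i ≠ a ∧ p i ≠ b := fun i hi => by
      have key : ∀ j, j ≤ k → p j ≠ a ∧ p j ≠ b ∧ p (j + 1) ≠ a ∧ p (j + 1) ≠ b := fun j hj => by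
        refine ne_of_commute_swap ?_ hab ?_ ?_
        · intro h
          have := hp (by simp; omega) (by simp; omega) h
          omega
        · rw [← hsp j (by omega), ← h0]
          exact (σ_comm).map f
        · rw [← hsp j (by omega), ← h0]
          exact map_σ_ne hn f hf (by omega) (by omega)
      rcases Nat.lt_or_ge k i with h | h
      · obtain rfl : i = k + 1 := by omega
        exact (key k le_rfl).2.2
      · exact ⟨(key i h).1, (key i h).2.1⟩
    have hc := not_commute_succ f hf (i := k + 1) (by omega)
    rw [hsp (k + 1) (by omega), h0] at hc
    have main : ∃ w, p (k + 2) ≠ w ∧ (∀ i, i ≤ k + 1 → p i ≠ w) ∧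
        swap a b = swap (p (k + 2)) w := by
      have h1 := hdis (k + 1) le_rfl
      rcases eq_of_not_commute_swap hc with h | h | h | h
      · exact absurd h h1.1
      · exact absurd h h1.2
      · exact ⟨b, by rw [h]; exact hab, fun i hi => (hdis i hi).2, by rw [h]⟩
      · exact ⟨a, by rw [h]; exact hab.symm, fun i hi => (hdis i hi).1, by rw [h, swap_comm]⟩
    obtain ⟨w, hw1, hw2, hw3⟩ := main
    have hw : ∀ i, i < k + 3 → p i ≠ w := fun i hi => by
      rcases Nat.lt_or_ge (k + 1) i with h | h
      · obtain rfl : i = k + 2 := by omega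
        exact hw1
      · exact hw2 i h
    refine ⟨fun i => if i = k + 3 then w else p i, ?_, ?_⟩
    · intro i hi j hj h
      simp only [Set.mem_Iio] at hi hj
      dsimp only at h
      split_ifs at h with h1 h2 h2
      · omega
      · exact absurd h.symm (hw j (by omega))
      · exact absurd h (hw i (by omega))
      · exact hp (by simp; omega) (by simp; omega) h
    · intro i hi
      dsimp only
      rcases Nat.lt_or_ge (i + 1) (k + 3) with h | h
      · rw [if_neg (by omega), if_neg (by omega), hsp i h]
      · obtain rfl : i = k + 2 := by omega
        rw [if_neg (by omega), if_pos (by omega), h0, hw3]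

end Transpositions

/-! ### Braid group actions on small sets -/

section SmallActions

open Equiv Equiv.Perm

/-- The action on an invariant subset. -/
def restrictHom {G X : Type*} [Group G] (f : G →* Perm X) (p : X → Prop)
    (h : ∀ g x, p (f g x) ↔ p x) : G →* Perm {x // p x} where
  toFun g := (f g).subtypePerm (h g)
  map_one' := by ext; simp
  map_mul' a b := by
    ext x
    exact Equiv.congr_fun (map_mul f a b) x

/-- Actions of the braid group on `k` strands on fewer than `k` points are cyclic. -/
def SmallCyclic (k : ℕ) : Prop :=
  ∀ (Ω : Type) [Fintype Ω] [DecidableEq Ω] (f : Br k →* Perm Ω), Fintype.card Ω < k →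
    f (σ k 0) = f (σ k 1)

lemma SmallCyclic.apply_eq {k : ℕ} (hk : SmallCyclic k) {X : Type} [DecidableEq X]
    (f : Br k →* Perm X) (S : Finset X) (hS : ∀ g x, f g x ∈ S ↔ x ∈ S) (hc : S.card < k)
    {x : X} (hx : x ∈ S) {i : ℕ} (hi : i + 1 < k) : f (σ k i) x = f (σ k 0) x := by
  have h := eq_σ_zero _ (hk _ (restrictHom f (· ∈ S) hS) (by simpa using hc)) i hi
  exact congrArg Subtype.val (Equiv.congr_fun h ⟨x, hx⟩)

lemma cycleType_of_smallCyclic {k : ℕ} (h5 : 5 ≤ k) (hk : SmallCyclic k) {Ω : Type} [Fintype Ω]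
    [DecidableEq Ω] (f : Br (k + 2) →* Perm Ω) (hΩ : Fintype.card Ω ≤ k + 2)
    (hf : f (σ (k + 2) 0) ≠ f (σ (k + 2) 1)) : (f (σ (k + 2) 0)).cycleType = {2} := by
  obtain ⟨g, hg⟩ := isConj_map_σ f (i := k) (by omega)
  have hct : (f (σ (k + 2) 0)).cycleType = (f (σ (k + 2) k)).cycleType := by
    rw [hg, cycleType_conj]
  rw [hct]
  obtain ⟨s, hs⟩ : ∃ s, s = f (σ (k + 2) k) := ⟨_, rfl⟩
  rw [← hs]
  have hs1 : s ≠ 1 := by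
    rintro rfl
    have h0 : f (σ (k + 2) 0) = 1 := cycleType_eq_zero.1 (by rw [hct, ← hs, cycleType_one])
    obtain ⟨g, hg⟩ := isConj_map_σ f (i := 1) (by omega)
    exact hf (by rw [hg, h0]; group)
  let e : Br k →* Br (k + 2) := (inB (k + 1)).comp (inB k)
  have he : ∀ i, i + 1 < k → e (σ k i) = σ (k + 2) i := fun i hi => by
    change inB (k + 1) (inB k (σ k i)) = _
    rw [inB_σ, inB_σ]
    all_goals omega
  let f' : Br k →* Perm Ω := f.comp e
  have hf' : ∀ i, i + 1 < k → f' (σ k i) = f (σ (k + 2) i) := fun i hi => by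
    change f (e _) = _; rw [he i hi]
  have hc : ∀ b, Commute (f' b) s := fun b => Br.commute_of_gens f' s (fun i hi => by
    rw [hf' i hi, hs]
    exact (σ_comm).map f) b
  have hfix : k ≤ Fintype.card Ω - s.support.card := by
    by_contra! hlt
    have hinv : ∀ g x, f' g x ∈ s.supportᶜ ↔ x ∈ s.supportᶜ := fun g x => by
      rw [Finset.mem_compl, Finset.mem_compl, notMem_support, notMem_support,
        ← mul_apply, ← (hc g).eq, mul_apply, (f' g).injective.eq_iff]
    have h1 : ∀ x, x ∈ s.supportᶜ → ∀ i, i + 1 < k → f' (σ k i) x = f' (σ k 0) x := by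
      intro x hx i hi
      refine hk.apply_eq f' s.supportᶜ hinv (by rwa [Finset.card_compl]) hx hi
    let f2 : Br k →* Perm (Perm Ω) := 
      { toFun := fun g => (MulAut.conj (f' g)).toEquiv
        map_one' := by ext; simp
        map_mul' := fun a b => by ext; simp }
    have hcard : s.cycleFactorsFinset.card < k := by
      have h2 : s.cycleFactorsFinset.card * 2 ≤ s.support.card := by
        have h3 := Multiset.card_nsmul_le_sum (s := s.cycleType) (a := 2)
          fun i hi => two_le_of_mem_cycleType hi
        rwa [sum_cycleType, cycleType_def, Multiset.card_map] at h3
      have := s.support.card_le_univ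
      omega
    have hinv2 : ∀ g c, f2 g c ∈ s.cycleFactorsFinset ↔ c ∈ s.cycleFactorsFinset := fun g c => by
      have hgs : f' g * s * (f' g)⁻¹ = s := by rw [(hc g).eq, mul_inv_cancel_right]
      have := mem_cycleFactorsFinset_conj s (f' g) c
      rwa [hgs] at this
    have h2 : ∀ c ∈ s.cycleFactorsFinset, ∀ i, i + 1 < k → f2 (σ k i) c = f2 (σ k 0) c := by
      intro c hcs i hi
      exact hk.apply_eq f2 _ hinv2 hcard hcs hi
    have h3 : ∀ i j, i + 1 < k → j + 1 < k → ∀ x, x ∈ s.supportᶜ →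
        f' (σ k i * (σ k j)⁻¹) x = x := fun i j hi hj x hx => by
      have hy := (hinv (σ k j)⁻¹ x).2 hx
      rw [map_mul, mul_apply, h1 _ hy i hi, ← h1 _ hy j hj, ← mul_apply, ← map_mul,
        mul_inv_cancel, map_one, one_apply]
    have h4 : ∀ i j, i + 1 < k → j + 1 < k → ∀ x, x ∈ s.support →
        ∃ m : ℤ, f' (σ k i * (σ k j)⁻¹) x = (s ^ m) x := fun i j hi hj x hx => by
      have hcx := cycleOf_mem_cycleFactorsFinset_iff.2 hx
      have hcy := (hinv2 (σ k j)⁻¹ _).2 hcx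
      have h5 : f2 (σ k i * (σ k j)⁻¹) (s.cycleOf x) = s.cycleOf x := by
        rw [map_mul, mul_apply, h2 _ hcy i hi, ← h2 _ hcy j hj, ← mul_apply, ← map_mul,
          mul_inv_cancel, map_one, one_apply]
      obtain ⟨d, hd⟩ : ∃ d, d = f' (σ k i * (σ k j)⁻¹) := ⟨_, rfl⟩
      change f' (σ k i * (σ k j)⁻¹) * s.cycleOf x * (f' (σ k i * (σ k j)⁻¹))⁻¹ = _ at h5
      rw [← hd] at h5 ⊢
      have h6 : d x ∈ (s.cycleOf x).support := by
        rw [← h5, mem_support, mul_apply, mul_apply, show d⁻¹ (d x) = x from d.symm_apply_apply x,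
          d.injective.ne_iff, ← mem_support]
        exact mem_support_cycleOf_iff.2 ⟨SameCycle.refl _ _, hx⟩
      obtain ⟨m, hm⟩ := (mem_support_cycleOf_iff.1 h6).1
      exact ⟨m, hm.symm⟩
    have h5 : Commute (f' (σ k 0 * (σ k 1)⁻¹)) (f' (σ k 3 * (σ k 0)⁻¹)) := by
      ext x
      rw [mul_apply, mul_apply]
      by_cases hx : x ∈ s.support
      · obtain ⟨m, hm⟩ := h4 0 1 (by omega) (by omega) x hx
        obtain ⟨l, hl⟩ := h4 3 0 (by omega) (by omega) x hx
        rw [hm, hl, ← mul_apply, ← mul_apply, ((hc _).zpow_right _).eq,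
          ((hc _).zpow_right _).eq, mul_apply, mul_apply, hm, hl, ← mul_apply,
          ← mul_apply, ← zpow_add, ← zpow_add, add_comm]
      · rw [← Finset.mem_compl] at hx
        rw [h3 _ _ (by omega) (by omega) x hx, h3 _ _ (by omega) (by omega) x hx,
          h3 _ _ (by omega) (by omega) x hx]
    have := eq_of_commute_quotients (by omega) f' h5
    rw [hf' 0 (by omega), hf' 1 (by omega)] at this
    exact hf this
  have h2 : s.support.card = 2 := by
    have h1 : s.support.card ≠ 0 := by rwa [Ne, Finset.card_eq_zero, support_eq_empty_iff]
    have h1' := s.card_support_ne_one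
    omega
  exact isSwap_iff_cycleType.1 (card_support_eq_two.1 h2)

end SmallActions

section SmallActions

open Equiv Equiv.Perm

lemma cycleType_of_card_le_six {n : ℕ} (hn : 5 ≤ n) {Ω : Type} [Fintype Ω] [DecidableEq Ω]
    (f : Br n →* Perm Ω) (hΩ : Fintype.card Ω ≤ 6) (hf : f (σ n 0) ≠ f (σ n 1)) :
    (f (σ n 0)).cycleType = {2} ∨ (f (σ n 0)).cycleType = {2, 2, 2} := by
  classical
  obtain ⟨e⟩ : Nonempty (Ω ↪ Fin 6) := Function.Embedding.nonempty_of_card_le (by simpa using hΩ)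
  let f' : Br n →* Perm (Fin 6) := (viaEmbeddingHom e).comp f
  have hct : ∀ b, (f' b).cycleType = (f b).cycleType := fun b => by
    rw [← cycleType_extendDomain (Equiv.ofInjective e.1 e.2) (g := f b)]
    refine congrArg cycleType ?_
    change (f b).viaEmbedding e = _
    rw [viaEmbedding]
    congr!
  have hne : f' (σ n 0) ≠ f' (σ n 1) := fun h => hf (viaEmbeddingHom_injective e h)
  obtain ⟨g, hg⟩ := isConj_map_σ f' (i := 3) (by omega)
  have h3 : (f' (σ n 3)).cycleType = (f' (σ n 0)).cycleType := by rw [hg, cycleType_conj]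
  rw [← hct, ← h3]
  refine cycleType_of_braid (a := f' (σ n 0)) (b := f' (σ n 1)) ?_ ?_ ?_ ?_ ?_ hne
  · intro h1
    have h0 : f' (σ n 0) = 1 := cycleType_eq_zero.1 (by rw [← h3, h1, cycleType_one])
    obtain ⟨g, hg⟩ := isConj_map_σ f' (i := 1) (by omega)
    exact hne (by rw [hg, h0]; group)
  · exact ((σ_comm).map f').symm
  · exact ((σ_comm).map f').symm
  · intro h
    rw [hg] at h
    have : f' (σ n 0) * f' (σ n 0) * f' (σ n 0) = g⁻¹ * (g * f' (σ n 0) * g⁻¹ *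
      (g * f' (σ n 0) * g⁻¹) * (g * f' (σ n 0) * g⁻¹)) * g := by group
    rw [this, h]; group
  · rw [← map_mul, ← map_mul, ← map_mul, ← map_mul, σ_braid]

lemma smallCyclic {k : ℕ} (hk : 5 ≤ k) : SmallCyclic k := by
  induction k using Nat.strong_induction_on with
  | _ k ih =>
  intro Ω _ _ f hΩ
  by_contra hf
  have hct : (f (σ k 0)).cycleType = {2} := by
    rcases Nat.lt_or_ge k 7 with h7 | h7
    · rcases cycleType_of_card_le_six hk f (by omega) hf with h | h
      · exact h
      · have := sum_cycleType_le (f (σ k 0))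
        rw [h, show ({2, 2, 2} : Multiset ℕ).sum = 6 from rfl] at this
        omega
    · obtain ⟨k, rfl⟩ : ∃ l, k = l + 2 := ⟨k - 2, by omega⟩
      exact cycleType_of_smallCyclic (by omega) (ih k (by omega) (by omega)) f (by omega) hf
  obtain ⟨p, hp, -⟩ := exists_chain hk f hf (isSwap_iff_cycleType.2 hct)
  have : Fintype.card (Fin k) ≤ Fintype.card Ω :=
    Fintype.card_le_of_injective (fun i : Fin k => p i) fun i j h =>
      Fin.ext (hp (Set.mem_Iio.2 i.2) (Set.mem_Iio.2 j.2) h)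
  rw [Fintype.card_fin] at this
  omega

lemma cycleType_of_ne {n : ℕ} (hn : 5 ≤ n) {Ω : Type} [Fintype Ω] [DecidableEq Ω]
    (f : Br n →* Perm Ω) (hΩ : Fintype.card Ω ≤ n) (hf : f (σ n 0) ≠ f (σ n 1)) :
    (f (σ n 0)).cycleType = {2} ∨ n = 6 ∧ (f (σ n 0)).cycleType = {2, 2, 2} := by
  rcases Nat.lt_or_ge n 7 with h7 | h7
  · rcases cycleType_of_card_le_six hn f (by omega) hf with h | h
    · exact Or.inl h
    · have := sum_cycleType_le (f (σ n 0))
      rw [h, show ({2, 2, 2} : Multiset ℕ).sum = 6 from rfl] at this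
      exact Or.inr ⟨by omega, h⟩
  · obtain ⟨k, rfl⟩ : ∃ l, n = l + 2 := ⟨n - 2, by omega⟩
    exact Or.inl (cycleType_of_smallCyclic (by omega) (smallCyclic (by omega)) f (by omega) hf)

/-! ### Standard permutation representations -/

/-- The permutation of the strands. -/
def permFin (n : ℕ) : Br n →* Perm (Fin n) where
  toFun b := 
    { toFun := fun i => ⟨perm n b i, perm_lt i.2 _⟩
      invFun := fun i => ⟨perm n b⁻¹ i, perm_lt i.2 _⟩
      left_inv := fun i => Fin.ext (by simp)
      right_inv := fun i => Fin.ext (by simp) }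
  map_one' := by ext; simp
  map_mul' a b := by ext; simp

lemma permFin_val {n : ℕ} (b : Br n) (i : Fin n) : (permFin n b i : ℕ) = perm n b i := rfl

lemma perm_eq_of_permFin {n : ℕ} {a b : Br n} (h : permFin n a = permFin n b) :
    perm n a = perm n b := by
  ext p
  rcases Nat.lt_or_ge p n with hp | hp
  · exact congrArg Fin.val (Equiv.congr_fun h ⟨p, hp⟩)
  · rw [perm_of_le hp, perm_of_le hp]

lemma permFin_σ {n i : ℕ} (h : i + 1 < n) :
    permFin n (σ n i) = swap ⟨i, by omega⟩ ⟨i + 1, h⟩ := by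
  ext x
  rw [permFin_val, perm_σ h, swap_apply_def, swap_apply_def]
  simp only [Fin.ext_iff]
  split_ifs <;> rfl

lemma permFin_surjective (n : ℕ) : Function.Surjective (permFin n) := by
  obtain _ | n := n
  · exact fun g => ⟨1, Subsingleton.elim _ _⟩
  rw [← MonoidHom.mrange_eq_top, eq_top_iff, ← mclosure_swap_castSucc_succ, Submonoid.closure_le]
  rintro _ ⟨i, rfl⟩
  exact ⟨σ (n + 1) i, permFin_σ (by omega)⟩

lemma exists_perm_conj {n : ℕ} (hn : 5 ≤ n) (φ : Br n →* Br n)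
    (hf : permFin n (φ (σ n 0)) ≠ permFin n (φ (σ n 1)))
    (hs : (permFin n (φ (σ n 0))).IsSwap) :
    ∃ g : Br n, ∀ b, perm n (g * φ b * g⁻¹) = perm n b := by
  obtain ⟨p, hp, hsp⟩ := exists_chain hn ((permFin n).comp φ) hf hs
  let P : Perm (Fin n) := Equiv.ofBijective (fun i : Fin n => p i)
    (Finite.injective_iff_bijective.1 fun i j h => 
      Fin.ext (hp (Set.mem_Iio.2 i.2) (Set.mem_Iio.2 j.2) h))
  obtain ⟨c, hc⟩ := permFin_surjective n P
  refine ⟨c⁻¹, fun b => ?_⟩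
  have : (((permFin n).comp (MulAut.conj c⁻¹).toMonoidHom).comp φ) = permFin n := by
    refine Br.hom_ext fun i hi => ?_
    have h1 := hsp i hi
    change permFin n (c⁻¹ * φ (σ n i) * c⁻¹⁻¹) = _
    change permFin n (φ (σ n i)) = _ at h1
    rw [map_mul, map_mul, inv_inv, map_inv, hc, h1]
    rw [permFin_σ hi, show p i = P ⟨i, by omega⟩ from rfl, show p (i + 1) = P ⟨i + 1, hi⟩ from rfl,
      swap_apply_apply]
    group
  have h1 := congr_fun this b
  change permFin n (c⁻¹ * φ b * c⁻¹⁻¹) = _ at h1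
  exact perm_eq_of_permFin h1

end SmallActions

/-! ### Exclusion of the exotic representation in degree six -/

section Exotic

open Equiv Equiv.Perm

/-- The product of three disjoint transpositions. -/
def tripleSwap : Perm (Fin 6) := swap 0 1 * swap 2 3 * swap 4 5

/-- The braid relation between distinct elements. -/
def BraidPair (a b : Perm (Fin 6)) : Prop := a * b * a = b * a * b ∧ a ≠ b

/-- Fixed-point-free involutions. -/
def FreeInvolution (a : Perm (Fin 6)) : Prop := a * a = 1 ∧ ∀ x, a x ≠ x

/-- The block `S` and the point `x` of it moved by `c * d` and by the commutator of `a` and `b`. -/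
def InvariantBlock (a b c d : Perm (Fin 6)) (S : Finset (Fin 6)) (x : Fin 6) : Prop :=
  S.card = 3 ∧ S.image (a * b) = S ∧ S.image (c * d) = S ∧ S.image (a * c) = S ∧ x ∈ S ∧
    c (d x) ≠ x ∧ a (b x) ≠ b (a x)

instance : DecidableRel BraidPair := fun a b => by unfold BraidPair; infer_instance

instance : DecidablePred FreeInvolution := fun a => by unfold FreeInvolution; infer_instance

instance (a b c d : Perm (Fin 6)) (S : Finset (Fin 6)) (x : Fin 6) :
    Decidable (InvariantBlock a b c d S x) := by unfold InvariantBlock; infer_instance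

set_option maxRecDepth 100000 in
lemma invariantBlock_of_braidPair : ∀ b, FreeInvolution b → BraidPair tripleSwap b →
    ∀ c, FreeInvolution c → tripleSwap * c = c * tripleSwap → b * c = c * b →
    ∀ d, FreeInvolution d → tripleSwap * d = d * tripleSwap → b * d = d * b → BraidPair c d →
    InvariantBlock tripleSwap b c d {0, tripleSwap (b 0), b (tripleSwap 0)} 0 := by
  decide +kernel

lemma cnt_injOn (S : Finset ℕ) : Set.InjOn (cnt S) S := by
  have key : StrictMonoOn (cnt S) S := fun i hi j _ hij => by
    have h1 := cnt_mono S (show i + 1 ≤ j from hij)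
    rw [cnt_succ, if_pos (Finset.mem_coe.1 hi)] at h1
    omega
  exact key.injOn

lemma perm_eq_of_SL_C {m : ℕ} {S : Finset ℕ} (hS : S.card = 3) {a b : Br m}
    (ha : fsp (perm m a) S = S) (hb : fsp (perm m b) S = S)
    (h : ∀ i j, ((SL (C m S a)).1 i j : ZMod 2) = ((SL (C m S b)).1 i j : ZMod 2)) {x : ℕ}
    (hx : x ∈ S) : perm m a x = perm m b x := by
  have h1 := perm_eq_of_SL h
  have h2 := C_perm hS a x hx
  have h3 := C_perm hS b x hx
  rw [ha] at h2
  rw [hb, ← h1, h2] at h3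
  exact cnt_injOn S (ha.subset (apply_mem_fsp.2 hx)) (hb.subset (apply_mem_fsp.2 hx)) h3

lemma braid_cube_commute {G : Type*} [Group G] {a b : G} (h : a * b * a = b * a * b) :
    Commute a (a * b * (a * b) * (a * b)) := by
  have h1 : SemiconjBy (a * b * a) a b := by rw [SemiconjBy, ← mul_assoc, ← mul_assoc, ← h]
  have h2 : SemiconjBy (a * b * a) b a := by rw [SemiconjBy, h, ← mul_assoc, ← mul_assoc, h]
  rw [show a * b * (a * b) * (a * b) = a * b * a * (a * b * a) by
    nth_rewrite 2 [h]; simp only [mul_assoc]]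
  exact (h2.mul_left h1).symm

lemma false_of_triple {n m : ℕ} (hn : 5 ≤ n) (f : Br n →* Br m) {S : Finset ℕ} (hS : S.card = 3)
    (h01 : fsp (perm m (f (σ n 0 * σ n 1))) S = S) (h34 : fsp (perm m (f (σ n 3 * σ n 4))) S = S)
    (h03 : fsp (perm m (f (σ n 0 * σ n 3))) S = S) (h00 : fsp (perm m (f (σ n 0 * σ n 0))) S = S)
    (h33 : fsp (perm m (f (σ n 3 * σ n 3))) S = S) {x : ℕ} (hx : x ∈ S)
    (h1 : perm m (f (σ n 3 * σ n 4)) x ≠ x)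
    (h2 : perm m (f (σ n 0 * σ n 1)) x ≠ perm m (f (σ n 0 * (σ n 0 * σ n 1) * (σ n 0)⁻¹)) x) :
    False := by
  let K : Subgroup (Br n) := ((stabilizer (Perm (Finset ℕ)) S).comap
    (fsp.comp (perm m))).comap f
  let Θ : K →* SLZ := (SL.comp (CH m S)).comp (f.subgroupComap _)
  have hΘ : ∀ b : K, Θ b = SL (C m S (f b)) := fun b => rfl
  have hK : ∀ b : K, fsp (perm m (f b)) S = S := fun b => b.2
  let u : K := ⟨σ n 0 * σ n 1, h01⟩
  let v : K := ⟨σ n 3 * σ n 4, h34⟩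
  let t : K := ⟨σ n 0 * σ n 3, h03⟩
  let p : K := ⟨σ n 0 * σ n 0, h00⟩
  let q : K := ⟨σ n 3 * σ n 3, h33⟩
  have c03 : Commute (σ n 0) (σ n 3) := σ_comm
  have c04 : Commute (σ n 0) (σ n 4) := σ_comm
  have c13 : Commute (σ n 1) (σ n 3) := σ_comm
  have c14 : Commute (σ n 1) (σ n 4) := σ_comm
  have hu' : ((t * u * t⁻¹ : K) : Br n) = σ n 0 * (σ n 0 * σ n 1) * (σ n 0)⁻¹ := by
    change σ n 0 * σ n 3 * (σ n 0 * σ n 1) * (σ n 0 * σ n 3)⁻¹ = _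
    rw [mul_assoc (σ n 0) (σ n 3), ← (c03.mul_left c13).eq]
    group
  have ne : ∀ A : SLZ, (∀ i j, (A.1 i j : ZMod 2) = ((1 : SLZ).1 i j : ZMod 2)) → Θ v ≠ A :=
    fun A hA h => h1 <| by
      have := perm_eq_of_SL_C (m := m) (a := f (σ n 3 * σ n 4)) (b := f (1 : K)) hS h34 (hK 1)
        (fun i j => by rw [← hΘ, ← hΘ v, h, map_one, hA]) hx
      simpa using this
  have ne1 := ne 1 fun _ _ => rfl
  have ne2 := ne (-1) fun i j => by fin_cases i <;> fin_cases j <;> simp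
  have huv : Commute u v := Subtype.ext ((c03.mul_right c04).mul_left (c13.mul_right c14)).eq
  have htv : Commute (t * u * t⁻¹) v := by
    refine Subtype.ext ?_
    change ((t * u * t⁻¹ : K) : Br n) * _ = _ * ((t * u * t⁻¹ : K) : Br n)
    rw [hu']
    have c0 := c03.mul_right c04
    exact ((c0.mul_left (c0.mul_left (c13.mul_right c14))).mul_left c0.inv_left).eq
  have hpv : Commute p v := Subtype.ext ((c03.mul_right c04).mul_left (c03.mul_right c04)).eq
  have c3 := c03.symm.mul_right c13.symm
  have hqu : Commute q u := Subtype.ext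
    (c3.mul_left c3).eq
  have huu : Commute (Θ u) (Θ (t * u * t⁻¹)) :=
    SLZ.commute_trans ne1 ne2 (huv.map Θ) (htv.map Θ)
  have hpu : Commute (Θ p) (Θ u) := SLZ.commute_trans ne1 ne2 (hpv.map Θ) (huv.map Θ)
  have hcube : Commute t (u * u * u) := Subtype.ext
    ((braid_cube_commute σ_braid).mul_left ((c3.mul_right c3).mul_right c3)).eq
  have htt : Θ (t * t * u) = Θ (u * t * t) := by
    have : t * t = p * q := by
      refine Subtype.ext ?_
      change σ n 0 * σ n 3 * (σ n 0 * σ n 3) = σ n 0 * σ n 0 * (σ n 3 * σ n 3)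
      rw [mul_assoc, ← mul_assoc (σ n 3), ← c03.eq]
      group
    rw [mul_assoc u, this, map_mul, map_mul Θ u, map_mul Θ p, mul_assoc, (hqu.map Θ).eq,
      ← mul_assoc, hpu.eq, mul_assoc]
  refine SLZ.not_inverted (ω := Θ u * (Θ (t * u * t⁻¹))⁻¹) (τ := Θ t) ?_ ?_ ?_
  · rw [← pow_three', huu.inv_right.mul_pow, inv_pow, ← map_pow, ← map_pow, mul_inv_eq_one,
      conj_pow, pow_three', hcube.eq, mul_inv_cancel_right]
  · refine fun h => h2 ?_
    rw [mul_inv_eq_one] at h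
    have := perm_eq_of_SL_C (m := m) (a := f u) (b := f (t * u * t⁻¹ : K)) hS (hK u) (hK _)
      (fun i j => congrArg (fun A : SLZ => (A.1 i j : ZMod 2)) h) hx
    rwa [hu'] at this
  · have e1 : Θ t * Θ u = Θ (t * u * t⁻¹) * Θ t := by
      rw [← map_mul, ← map_mul, inv_mul_cancel_right]
    have e2 : Θ t * Θ (t * u * t⁻¹) = Θ u * Θ t := by
      rw [← mul_left_inj (Θ t), ← map_mul, ← map_mul, ← map_mul, ← map_mul, ← htt]
      congr 1
      group
    have e3 : Θ t * (Θ (t * u * t⁻¹))⁻¹ = (Θ u)⁻¹ * Θ t := by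
      rw [mul_inv_eq_iff_eq_mul, mul_assoc, e2, inv_mul_cancel_left]
    rw [← mul_assoc, e1, mul_assoc, e3, mul_inv_rev, inv_inv]
    exact (mul_assoc _ _ _).symm

lemma freeInvolution_of_cycleType {s : Perm (Fin 6)} (h : s.cycleType = {2, 2, 2}) :
    FreeInvolution s := by
  constructor
  · rw [← pow_two, ← orderOf_dvd_iff_pow_eq_one, ← lcm_cycleType, h]
    decide
  · have h1 : s.support = Finset.univ := by
      rw [← Finset.card_eq_iff_eq_univ, ← sum_cycleType, h]
      rfl
    intro x
    rw [← mem_support, h1]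
    exact Finset.mem_univ x

lemma cycleType_tripleSwap : tripleSwap.cycleType = {2, 2, 2} := by
  decide +kernel

lemma not_exotic (φ : Br 6 →* Br 6) (hf : permFin 6 (φ (σ 6 0)) ≠ permFin 6 (φ (σ 6 1)))
    (h : (permFin 6 (φ (σ 6 0))).cycleType = {2, 2, 2}) : False := by
  obtain ⟨g, hg⟩ := isConj_iff.1 (isConj_of_cycleType_eq (h.trans cycleType_tripleSwap.symm))
  obtain ⟨c, rfl⟩ := permFin_surjective 6 g
  let φ' : Br 6 →* Br 6 := (MulAut.conj c).toMonoidHom.comp φ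
  let f : Br 6 →* Perm (Fin 6) := (permFin 6).comp φ'
  have hf' : ∀ b, f b = permFin 6 c * permFin 6 (φ b) * (permFin 6 c)⁻¹ := fun b => by
    change permFin 6 (c * φ b * c⁻¹) = _
    rw [map_mul, map_mul, map_inv]
  have h0 : f (σ 6 0) = tripleSwap := by rw [hf', hg]
  have hne : f (σ 6 0) ≠ f (σ 6 1) := by
    rw [hf', hf']
    exact fun h => hf (mul_left_cancel (mul_right_cancel h))
  have hfree : ∀ i, i + 1 < 6 → FreeInvolution (f (σ 6 i)) := fun i hi => by
    obtain ⟨g, hg⟩ := isConj_map_σ f hi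
    apply freeInvolution_of_cycleType
    rw [hg, cycleType_conj, h0, cycleType_tripleSwap]
  have hcomm : ∀ i j, i + 2 ≤ j → f (σ 6 i) * f (σ 6 j) = f (σ 6 j) * f (σ 6 i) := fun i j hij =>
    ((σ_comm hij).map f).eq
  have hbr : ∀ i, i + 2 < 6 → BraidPair (f (σ 6 i)) (f (σ 6 (i + 1))) := fun i hi => by
    refine ⟨by rw [← map_mul, ← map_mul, ← map_mul, ← map_mul, σ_braid hi], fun h => ?_⟩
    exact not_commute_succ f hne hi (h ▸ Commute.refl _)
  have key := invariantBlock_of_braidPair _ (hfree 1 (by omega)) (h0 ▸ hbr 0 (by omega)) _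
    (hfree 3 (by omega)) (h0 ▸ hcomm 0 3 (by omega)) (hcomm 1 3 (by omega)) _
    (hfree 4 (by omega)) (h0 ▸ hcomm 0 4 (by omega)) (hcomm 1 4 (by omega)) (hbr 3 (by omega))
  rw [← h0] at key
  obtain ⟨S, x, k1, k2, k3, k4, k5, k6, k7⟩ : ∃ S x,
    InvariantBlock (f (σ 6 0)) (f (σ 6 1)) (f (σ 6 3)) (f (σ 6 4)) S x := ⟨_, _, key⟩
  have hfix : ∀ b, S.image (f b) = S → fsp (perm 6 (φ' b)) (S.image Fin.val) = S.image Fin.val :=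
    fun b hb => by
      conv_rhs => rw [← hb]
      rw [fsp_eq, Finset.image_image, Finset.image_image]
      rfl
  have hsq : ∀ i, i + 1 < 6 → S.image (f (σ 6 i * σ 6 i)) = S := fun i hi => by
    rw [map_mul, (hfree i hi).1]
    exact Finset.image_id
  refine false_of_triple (by omega) φ' (S := S.image Fin.val)
    (by rw [Finset.card_image_of_injective _ Fin.val_injective, k1])
    (hfix _ (by rw [map_mul]; exact k2)) (hfix _ (by rw [map_mul]; exact k3))
    (hfix _ (by rw [map_mul]; exact k4)) (hfix _ (hsq 0 (by omega))) (hfix _ (hsq 3 (by omega)))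
    (x := x) (Finset.mem_image_of_mem _ k5) (fun h => k6 ?_) (fun h => k7 ?_)
  · rw [← mul_apply, ← map_mul]
    exact Fin.ext h
  · have h1 : f (σ 6 0 * σ 6 1) x = f (σ 6 0 * (σ 6 0 * σ 6 1) * (σ 6 0)⁻¹) x := Fin.ext h
    have h2 : (f (σ 6 0))⁻¹ = f (σ 6 0) := inv_eq_of_mul_eq_one_left (hfree 0 (by omega)).1
    rw [← mul_assoc, map_mul, map_mul, map_mul, map_mul, (hfree 0 (by omega)).1, map_inv, h2] at h1
    exact h1

/-- Every endomorphism of the braid group is cyclic or standard. -/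
lemma eq_or_std {n : ℕ} (hn : 5 ≤ n) (φ : Br n →* Br n) :
    φ (σ n 0) = φ (σ n 1) ∨ Std n φ := by
  by_cases hf : permFin n (φ (σ n 0)) = permFin n (φ (σ n 1))
  · exact Or.inl (eq_of_perm_eq hn φ (perm_eq_of_permFin hf))
  right
  rcases cycleType_of_ne hn ((permFin n).comp φ) (by simp) hf with h | ⟨rfl, h⟩
  · obtain ⟨g, hg⟩ := exists_perm_conj hn φ hf (isSwap_iff_cycleType.2 h)
    have h1 := std_of_perm hn (φ := (MulAut.conj g).toMonoidHom.comp φ) hg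
    refine h1.of_conj g⁻¹ 0 fun i hi => ?_
    change φ (σ n i) = g⁻¹ * (g * φ (σ n i) * g⁻¹) * g⁻¹⁻¹ * ζ n ^ (0 : ℤ)
    group
  · exact (not_exotic φ hf h).elim

end Exotic

section

open Equiv

/-! ### The half twist -/

/-- The half twist. -/
def gar : (m : ℕ) → Br m
  | 0 => 1
  | k + 1 => δ (k + 1) * inB k (gar k)

/-- The product `σ (k - 1) * ⋯ * σ 0`. -/
def rl (m : ℕ) : ℕ → Br m
  | 0 => 1
  | k + 1 => σ m k * rl m k

lemma mirror_dl {m k : ℕ} (h : k < m) : mirror m (dl m k) = (rl m k)⁻¹ := by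
  induction k with
  | zero => simp [dl, rl]
  | succ k ih => rw [dl, rl, map_mul, ih (by omega), mirror_σ h, mul_inv_rev]

lemma inB_dl {m k : ℕ} (h : k < m := by omega) : inB m (dl m k) = dl (m + 1) k := ι_br_dl h

lemma expo_inB (m : ℕ) (b : Br m) : expo (m + 1) (inB m b) = expo m b := by
  have := Br.hom_ext (f := (expo (m + 1)).comp (inB m)) (g := expo m) fun i hi => by
    change expo (m + 1) (inB m (σ m i)) = _
    rw [inB_σ hi, expo_σ, expo_σ hi]
  exact congr_fun this b

lemma expo_gar (m : ℕ) : 2 * (expo m (gar m)).toAdd = m * (m - 1) := by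
  induction m with
  | zero => simp [gar]
  | succ m ih =>
    rw [gar, map_mul, expo_inB, δ, expo_dl (by omega), toAdd_mul, toAdd_ofAdd, mul_add, ih]
    push_cast
    ring_nf

lemma gar_σ {m : ℕ} : ∀ {i : ℕ}, i + 2 ≤ m → gar m * σ m i = σ m (m - 2 - i) * gar m := by
  induction m with
  | zero => intro i h; omega
  | succ k ih =>
    intro i h
    by_cases hi : i + 2 ≤ k
    · have h1 := congrArg (inB k) (ih hi)
      rw [map_mul, map_mul, inB_σ, inB_σ] at h1
      rw [gar, mul_assoc, h1, ← mul_assoc, δ_σ, mul_assoc]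
      congr 2
      omega
    · obtain ⟨q, rfl⟩ : ∃ q, k = q + 1 := ⟨k - 1, by omega⟩
      obtain rfl : i = q := by omega
      have hc : Commute (inB (i + 1) (inB i (gar i))) (σ (i + 2) i) :=
        Br.commute_of_gens ((inB (i + 1)).comp (inB i)) _ (fun j hj => by
          change Commute (inB (i + 1) (inB i (σ i j))) _
          rw [inB_σ hj, inB_σ]
          exact σ_comm) _
      have h1 := δ_dl (m := i + 2) (k := i) (by omega)
      have h2 : dl (i + 2) (i + 1) = δ (i + 2) := rfl
      rw [gar, gar, map_mul, show inB (i + 1) (δ (i + 1)) = dl (i + 2) i from inB_dl,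
        mul_assoc, mul_assoc, hc.eq, show i + 1 + 1 - 2 - i = 0 by omega,
        ← mul_assoc (dl _ i), show dl (i + 2) i * σ (i + 2) i = δ (i + 2) from rfl,
        ← mul_assoc (δ _) (δ _), ← mul_assoc (δ _) (dl _ i), ← mul_assoc (σ _ 0), h1, h2]

lemma gar_rl {m : ℕ} (hm : 1 ≤ m) : gar m * rl m (m - 1) = δ m * gar m := by
  have key : ∀ k, k < m → gar m * rl m k = ((dl m (m - 1 - k))⁻¹ * δ m) * gar m := by
    intro k hk
    induction k with
    | zero => simp [rl, δ]
    | succ k ih =>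
      obtain ⟨q, hq⟩ : ∃ q, m - 2 - k = q := ⟨_, rfl⟩
      have := ih (by omega)
      rw [show m - 1 - k = q + 1 by omega, dl] at this
      rw [rl, ← mul_assoc, gar_σ (by omega), mul_assoc, this, show m - 1 - (k + 1) = q by omega, hq]
      group
  have := key (m - 1) (by omega)
  rwa [show m - 1 - (m - 1) = 0 by omega, dl, inv_one, one_mul] at this

lemma gar_sq {m : ℕ} (hm : 3 ≤ m) : gar m ^ 2 = ζ m := by
  have hc : ∀ c, Commute (gar m ^ 2) c := fun c => (Br.commute_of_gens (MonoidHom.id _) _ (fun i hi => by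
    change σ m i * gar m ^ 2 = gar m ^ 2 * σ m i
    rw [pow_two, mul_assoc (gar m), gar_σ (by omega), ← mul_assoc (gar m), gar_σ (by omega),
      mul_assoc, show m - 2 - (m - 2 - i) = i by omega]) c).symm
  have hp : perm m (gar m ^ 2) = 1 :=
    perm_eq_one_of_commute hm (fun i hi => perm_of_le hi _) fun i hi => by
      rw [← perm_σ hi]
      exact (hc _).map (perm m)
  obtain ⟨c, hcz⟩ := center m _ hp hc
  have h1 := congrArg (fun b => (expo m b).toAdd) hcz
  have h2 := expo_gar m
  simp only [map_pow, map_zpow, toAdd_pow, toAdd_zpow, expo_ζ (show 1 ≤ m by omega), toAdd_ofAdd,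
    smul_eq_mul, nsmul_eq_mul] at h1
  push_cast at h1
  rw [h2] at h1
  have h3 : (m : ℤ) * (m - 1) ≠ 0 := mul_ne_zero (by omega) (by omega)
  have h4 : c = 1 := mul_right_cancel₀ h3 (by linarith)
  rw [← hcz, h4]
  exact zpow_one _

lemma ζ_eq {m : ℕ} (hm : 3 ≤ m) : ζ (m + 1) = rl (m + 1) m * δ (m + 1) * inB m (ζ m) := by
  have h1 := gar_rl (m := m + 1) (by omega)
  have h2 := gar_sq (m := m + 1) (by omega)
  have h3 : gar (m + 1) * (rl (m + 1) m * gar (m + 1)) = gar (m + 1) * (gar (m + 1) * δ (m + 1)) := by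
    rw [← mul_assoc, ← mul_assoc, show gar (m + 1) * rl (m + 1) m = _ from h1, mul_assoc, ← pow_two, h2,
      (ζ_commute _ _).eq]
  rw [← gar_sq hm, map_pow, ← h2, pow_two, pow_two]
  nth_rewrite 2 [gar]
  rw [← mul_assoc, ← mul_left_cancel h3, gar]
  simp only [mul_assoc]

lemma ι_z {m : ℕ} (hm : 3 ≤ m) : ι m (fr (z m)) = rl (m + 1) m * δ (m + 1) := by
  have h := ι_Δ (m := m)
  rw [Δ, map_mul, ζ_eq hm] at h
  exact mul_right_cancel h

lemma act_gar_last {m : ℕ} (hm : 1 ≤ m) : act m (gar m) (x m (m - 1)) = x m 0 := by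
  obtain ⟨k, rfl⟩ : ∃ k, m = k + 1 := ⟨m - 1, by omega⟩
  rw [gar, map_mul, MulAut.mul_apply, show k + 1 - 1 = k from rfl, act_inB_last]
  exact act_δ_last (by omega)

lemma act_rl_last {m : ℕ} : act (m + 2) (rl (m + 2) (m + 1)) (x (m + 2) (m + 1)) =
    x (m + 2) m := by
  have key : ∀ k ≤ m, act (m + 2) (rl (m + 2) k) (x (m + 2) (m + 1)) = x (m + 2) (m + 1) := by
    intro k hk
    induction k with
    | zero => simp [rl]
    | succ k ih =>
      rw [rl, map_mul, MulAut.mul_apply, ih (by omega), act_σ_of_ne]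
  rw [rl, map_mul, MulAut.mul_apply, key m le_rfl, act_σ_succ]

lemma act_δ_inv_last {m : ℕ} : (act (m + 2) (δ (m + 2)))⁻¹ (x (m + 2) (m + 1)) =
    x (m + 2) (m + 1) * x (m + 2) m * (x (m + 2) (m + 1))⁻¹ := by
  rw [MulAut.inv_apply, MulEquiv.symm_apply_eq, map_mul, map_mul, map_inv,
    show act (m + 2) (δ (m + 2)) (x (m + 2) (m + 1)) = _ from act_δ_last (by omega),
    act_δ (by omega)]
  group

/-! ### Elements inducing the shift -/

lemma smz_zpow (a : ℤ) : ∃ e : ℤ, e * e = 1 ∧ (smz ^ a).1 0 0 = e ∧ (smz ^ a).1 0 1 = 2 * a * e ∧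
    (smz ^ a).1 1 0 = 0 ∧ (smz ^ a).1 1 1 = e := by
  have key : ∀ n : ℕ, ∃ e : ℤ, e * e = 1 ∧ (smz ^ n).1 0 0 = e ∧ (smz ^ n).1 0 1 = 2 * n * e ∧
      (smz ^ n).1 1 0 = 0 ∧ (smz ^ n).1 1 1 = e := by
    intro n
    induction n with
    | zero => exact ⟨1, by simp⟩
    | succ n ih =>
      obtain ⟨e, he, h1, h2, h3, h4⟩ := ih
      refine ⟨-e, by linarith, ?_⟩
      simp only [pow_succ, SLZ.mul_entry, smz_entries, h1, h2, h3, h4]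
      push_cast
      refine ⟨?_, ?_, ?_, ?_⟩ <;> ring
  obtain ⟨n, rfl | rfl⟩ := a.eq_nat_or_neg
  · simpa using key n
  · obtain ⟨e, he, h1, h2, h3, h4⟩ := key n
    refine ⟨e, he, ?_⟩
    rw [_root_.zpow_neg, zpow_natCast, Matrix.SpecialLinearGroup.SL2_inv_expl]
    refine ⟨h4, ?_, ?_, h1⟩
    · change -(smz ^ n).1 0 1 = _
      rw [h2]; ring
    · change -(smz ^ n).1 1 0 = _
      rw [h3]; rfl

lemma shift_aux {m : ℕ} (hm : 3 ≤ m) {a b : ℤ}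
    (h : (δ (m + 1) * ι m (fr (z m ^ a)) * ζ (m + 1) ^ b) ^ 2 * σ (m + 1) (m - 1) =
      σ (m + 1) 0 * (δ (m + 1) * ι m (fr (z m ^ a)) * ζ (m + 1) ^ b) ^ 2) : a = 0 ∨ a = -1 := by
  obtain ⟨q, rfl⟩ : ∃ q, m = q + 2 := ⟨m - 2, by omega⟩
  obtain ⟨Z, hZ⟩ : ∃ Z, Z = ι (q + 2) (fr (z (q + 2) ^ a)) := ⟨_, rfl⟩
  have hzc : ∀ c, Commute (ζ (q + 3) ^ b) c := fun c => (ζ_commute _ c).zpow_left b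
  have hD : δ (q + 3) = inB (q + 2) (δ (q + 2)) * σ (q + 3) (q + 1) := by
    rw [show inB (q + 2) (δ (q + 2)) = dl (q + 3) (q + 1) from inB_dl]; rfl
  have hDZ : Commute (inB (q + 2) (δ (q + 2))) Z := by
    rw [hZ]
    change Commute (ι (q + 2) (br (δ (q + 2)))) _
    refine Commute.map (Commute.symm ?_) _
    rw [map_zpow]
    exact (fr_z_commute_br _ _).zpow_left a
  have h2 := δ_sq_σ_last (m := q + 3)
  obtain ⟨s, hs⟩ : ∃ s, s = σ (q + 3) (q + 1) := ⟨_, rfl⟩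
  obtain ⟨D, hD'⟩ : ∃ D, D = inB (q + 2) (δ (q + 2)) := ⟨_, rfl⟩
  rw [← hZ, (hzc _).symm.mul_pow, mul_assoc, ((hzc _).pow_left 2).eq, ← mul_assoc, ← mul_assoc] at h
  replace h := mul_right_cancel h
  change δ (q + 3) ^ 2 * σ (q + 3) (q + 1) = _ at h2
  change (δ (q + 3) * Z) ^ 2 * σ (q + 3) (q + 1) = σ (q + 3) 0 * (δ (q + 3) * Z) ^ 2 at h
  rw [← hs, ← hD'] at hD
  rw [← hD'] at hDZ
  rw [← hs] at h h2
  rw [eq_comm, ← eq_mul_inv_iff_mul_eq] at h2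
  rw [h2, hD] at h
  have key : s * Z * s * Z = Z * s * Z * s := by
    have h3 : D * s * (D * (s * Z * s * Z)) = D * s * (D * (Z * s * Z * s)) := by
      have e1 : (D * s * Z) ^ 2 * s = D * s * (D * (Z * s * Z * s)) := by
        rw [pow_two]
        calc _ = D * s * (Z * D) * s * Z * s := by group
          _ = _ := by rw [← hDZ.eq]; group
      have e2 : (D * s) ^ 2 * s * ((D * s) ^ 2)⁻¹ * (D * s * Z) ^ 2 =
          D * s * (D * (s * Z * s * Z)) := by
        rw [pow_two, pow_two]
        calc _ = D * s * D * s * D⁻¹ * (Z * D) * s * Z := by group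
          _ = _ := by rw [← hDZ.eq]; group
      rw [← e1, ← e2, h]
    exact mul_left_cancel (mul_left_cancel h3)
  have hsf : fsp (perm (q + 3) s) (tri q) = tri q := by
    rw [hs, perm_σ, fsp_swap_of_mem (mem_tri.2 (by omega)) (mem_tri.2 (by omega))]
  have hZf : fsp (perm (q + 3) Z) (tri q) = tri q := by
    rw [hZ, perm_ι_fr, map_one]; rfl
  have k1 := congrArg (fun b => SL (C (q + 3) (tri q) b)) key
  have hCs : SL (C (q + 3) (tri q) s) = sm1 := by
    rw [hs, C_σ (by omega), csv_tri_1, SL_σ1]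
  have hCZ : SL (C (q + 3) (tri q) Z) = smz ^ a := by
    rw [hZ, CF_apply, map_zpow, CF_z, map_zpow, SL_z']
  simp only [C_mul_of_fix hsf, C_mul_of_fix hZf, map_mul, hCs, hCZ] at k1
  obtain ⟨e, he, h1, h2, h3, h4⟩ := smz_zpow a
  rw [SLZ.ext_iff'] at k1
  simp only [SLZ.mul_entry, sm1_entries, h1, h2, h3, h4] at k1
  have k2 := k1.1
  have k3 : (e * e) * (a * (a + 1)) = 0 := by nlinarith
  rw [he, one_mul] at k3
  rcases mul_eq_zero.1 k3 with h | h
  · exact Or.inl h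
  · exact Or.inr (by omega)

end

section

open Equiv Braid.FP

/-! ### Elements inducing the shift on the braid group -/

lemma act_σ_top {k : ℕ} : act (k + 2) (σ (k + 2) k) (x (k + 2) (k + 1) * x (k + 2) k) =
    x (k + 2) (k + 1) * x (k + 2) k := by
  rw [map_mul, act_σ_succ, act_σ_self]
  group

lemma ρ_br_σ {m i : ℕ} (h : i + 2 < m) : ρ m * br (σ m i) = br (σ m (i + 1)) * ρ m := by
  rw [ρ_eq, ← mul_assoc, ← map_mul, ← δ_σ h, map_mul, mul_assoc, mul_assoc, br_mul_fr,
    act_σ_of_ne]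

lemma ρ_sq {k : ℕ} : ρ (k + 2) ^ 2 = br (δ (k + 2) ^ 2) * fr (x (k + 2) (k + 1) * x (k + 2) k) := by
  have h := br_mul_fr (δ (k + 2)) ((act (k + 2) (δ (k + 2)))⁻¹ (x (k + 2) (k + 1)))
  rw [MulAut.apply_inv_self, act_δ_inv_last] at h
  have e := ρ_eq (m := k + 2)
  change ρ (k + 2) = br (δ (k + 2)) * fr (x (k + 2) (k + 1)) at e
  rw [pow_two, e, ← mul_assoc, mul_assoc (br _) (fr _) (br _), ← h, pow_two, map_mul, mul_assoc,
    mul_assoc, mul_assoc, ← map_mul, inv_mul_cancel, map_one, mul_one, map_mul br (δ _), mul_assoc]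

lemma ρ_sq_br_σ {k : ℕ} : ρ (k + 2) ^ 2 * br (σ (k + 2) k) = br (σ (k + 2) 0) * ρ (k + 2) ^ 2 := by
  have h := δ_sq_σ_last (m := k + 2)
  have h2 := br_mul_fr (σ (k + 2) k) (x (k + 2) (k + 1) * x (k + 2) k)
  rw [act_σ_top] at h2
  rw [ρ_sq, mul_assoc, ← h2, ← mul_assoc, ← map_mul, show δ (k + 2) ^ 2 * σ (k + 2) k = _ from h,
    map_mul, mul_assoc]

lemma mirror_δ (m : ℕ) (hm : 1 ≤ m) : mirror m (δ m) = (rl m (m - 1))⁻¹ := mirror_dl (by omega)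

lemma mirror_δ_σ {m i : ℕ} (h : i + 2 < m) :
    mirror m (δ m) * σ m i = σ m (i + 1) * mirror m (δ m) := by
  have h1 := congrArg (mirror m) (δ_σ h)
  rw [map_mul, map_mul, mirror_σ, mirror_σ, eq_inv_mul_iff_mul_eq, ← mul_assoc,
    mul_inv_eq_iff_eq_mul] at h1
  exact h1.symm

lemma mirror_δ_sq_σ {k : ℕ} :
    mirror (k + 2) (δ (k + 2)) ^ 2 * σ (k + 2) k = σ (k + 2) 0 * mirror (k + 2) (δ (k + 2)) ^ 2 := by
  have h1 := congrArg (mirror (k + 2)) (δ_sq_σ_last (m := k + 2))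
  rw [show k + 2 - 2 = k from rfl, map_mul, map_mul, map_pow, mirror_σ,
    mirror_σ, eq_inv_mul_iff_mul_eq, ← mul_assoc,
    mul_inv_eq_iff_eq_mul] at h1
  exact h1.symm

lemma eq_δ_or_mirror {m : ℕ} (hm : 4 ≤ m) {R : Br m}
    (h1 : ∀ i, i + 2 < m → R * σ m i = σ m (i + 1) * R)
    (h2 : R ^ 2 * σ m (m - 2) = σ m 0 * R ^ 2) :
    ∃ b : ℤ, R = δ m * ζ m ^ b ∨ R = mirror m (δ m) * ζ m ^ b := by
  obtain ⟨k, rfl⟩ : ∃ k, m = k + 1 := ⟨m - 1, by omega⟩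
  obtain ⟨Y, hY⟩ : ∃ Y, Y = (δ (k + 1))⁻¹ * R := ⟨_, rfl⟩
  have hR : R = δ (k + 1) * Y := by rw [hY]; group
  have hc : ∀ i, i + 1 < k → Commute Y (σ (k + 1) i) := fun i hi => by
    rw [Commute, SemiconjBy, hY, mul_assoc, h1 i (by omega), inv_mul_eq_iff_eq_mul, ← mul_assoc,
      ← mul_assoc, δ_σ]
    group
  have hcp : ∀ i, i + 1 < k → Commute (perm (k + 1) Y) (swap i (i + 1)) := fun i hi => by
    rw [← perm_σ (m := k + 1)]
    exact (hc i hi).map _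
  have hk : perm (k + 1) Y k = k := by
    by_contra hne
    obtain ⟨j, hj⟩ : ∃ j, j = perm (k + 1) Y k := ⟨_, rfl⟩
    have hlt : j < k + 1 := hj ▸ perm_lt (by omega) Y
    have hs : ∀ i, i + 1 < k → swap i (i + 1) j = j := fun i hi => by
      have e := congrArg (fun g : Perm ℕ => g k) (hcp i hi).eq
      simp only [mul_apply, swap_apply_of_ne_of_ne (show k ≠ i by omega)
        (show k ≠ i + 1 by omega), ← hj] at e
      exact e.symm
    by_cases hj2 : j + 1 < k
    · have e := hs j hj2
      rw [swap_apply_left] at e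
      omega
    · have e := hs (j - 1) (by omega)
      rw [show j - 1 + 1 = j by omega, swap_apply_right] at e
      omega
  have hp : perm (k + 1) Y = 1 := perm_eq_one_of_commute (k := k) (by omega) (fun i hi => by
    rcases hi.eq_or_lt with rfl | hi
    · exact hk
    · exact perm_of_le hi Y) hcp
  obtain ⟨a, b, hab⟩ := centralizer_inB hp hc
  refine ⟨b, ?_⟩
  rw [hR, hab, ← mul_assoc] at h2
  rw [hR, hab, ← mul_assoc]
  rcases shift_aux (by omega) h2 with rfl | rfl
  · left; simp
  · right
    rw [_root_.zpow_neg_one, map_inv, map_inv, ι_z (by omega), mirror_δ _ (by omega), mul_inv_rev,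
      mul_inv_cancel_left, show k + 1 - 1 = k from rfl]

/-! ### Elements of the free group commuting with twisted generators -/

lemma fpB_injective (k : ℕ) : Injective (fpB k) :=
  Function.LeftInverse.injective (fpB'_fpB k)

lemma fpB_σ_sq_conj {k : ℕ} {v g : F (k + 2)} {g' : F (k + 1)}
    (hg : fpB k (x (k + 2) (k + 1) * x (k + 2) k * g) = inc g')
    (h : act (k + 2) (σ (k + 2) k ^ 2) v = g * v * g⁻¹) :
    cmap (x (k + 1) k) (fpB k v) = inc g' * fpB k v * (inc g')⁻¹ := by
  rw [← fpB_act_σ_sq, h, ← hg]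
  simp only [map_mul, map_inv]
  group

lemma mem_zpowers_of_commute_twist {k : ℕ} {v : F (k + 2)} {K : ℤ} (hk : 1 ≤ k) (hK : K ≠ 0)
    (h : Commute (fr v) (br (σ (k + 2) k) * fr (z (k + 2) ^ K))) :
    v ∈ zpowers (z (k + 2)) := by
  have h1 : act (k + 2) (σ (k + 2) k) v = (z (k + 2) ^ K)⁻¹ * v * z (k + 2) ^ K := by
    have hc : Commute (fr (z (k + 2) ^ K)) (br (σ (k + 2) k)) := by
      rw [map_zpow]; exact (fr_z_commute_br _ _).zpow_left K
    have e := h.eq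
    rw [← hc.eq, ← mul_assoc, ← map_mul, mul_assoc, br_mul_fr, ← mul_assoc, ← map_mul] at e
    have e2 := inl_injective (mul_right_cancel e)
    rw [mul_assoc, e2]
    group
  have h2 : act (k + 2) (σ (k + 2) k ^ 2) v =
      (z (k + 2) ^ (2 * K))⁻¹ * v * (z (k + 2) ^ (2 * K))⁻¹⁻¹ := by
    rw [pow_two, map_mul, MulAut.mul_apply, h1, map_mul, map_mul, map_inv, map_zpow, act_z, h1]
    group
  have h3 := fpB_σ_sq_conj (g' := x (k + 1) k * (z (k + 1) ^ (2 * K))⁻¹) (by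
    rw [map_mul, fpB_mul, map_inv, map_zpow, fpB_z, map_mul, map_inv, map_zpow]) h2
  rcases fixed h3 with ⟨u, hu, hw⟩ | ⟨u, l, hl, hu, hw⟩
  · have hcu : Commute u (z (k + 1) ^ (2 * K)) := by
      have e : u = (z (k + 1) ^ (2 * K))⁻¹ * u * z (k + 1) ^ (2 * K) := by
        have e1 := congrArg (fun y => (x (k + 1) k)⁻¹ * y * x (k + 1) k) hw
        calc u = (x (k + 1) k)⁻¹ * (x (k + 1) k * u * (x (k + 1) k)⁻¹) * x (k + 1) k := by group
          _ = _ := by rw [e1]; group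
      rw [mul_assoc, eq_inv_mul_iff_mul_eq] at e
      exact e.symm
    obtain ⟨j, hj⟩ := commute_z_pow (by omega) (by omega) hcu
    refine ⟨j, fpB_injective k ?_⟩
    change fpB k (z (k + 2) ^ j) = _
    rw [hu, map_zpow, fpB_z, ← map_zpow]
    exact congrArg inc hj
  · have e := congrArg (fun y => (chij (k + 1) 0 y).toAdd) hw
    simp only [map_mul, map_inv, map_zpow, toAdd_mul, toAdd_inv, toAdd_zpow, smul_eq_mul] at e
    rw [chij_z, chij_ne] at e
    simp at e
    omega

lemma map_zpowers_fixed {k : ℕ} {u : F (k + 2)} (h : act (k + 2) (σ (k + 2) k) u = u) :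
    ∃ g : F (k + 1), fpB k u = inc g := by
  have h2 : act (k + 2) (σ (k + 2) k ^ 2) u = 1 * u * 1⁻¹ := by
    rw [pow_two, map_mul, MulAut.mul_apply, h, h]; simp
  have h3 := fpB_σ_sq_conj (g' := x (k + 1) k) (by rw [mul_one, fpB_mul]) h2
  rcases fixed h3 with ⟨g, hg, -⟩ | ⟨g, l, -, -, hw⟩
  · exact ⟨g, hg⟩
  · have e := congrArg (fun y => (chij (k + 1) k y).toAdd) hw
    simp only [map_mul, map_inv, map_zpow, toAdd_mul, toAdd_inv, toAdd_zpow, smul_eq_mul] at e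
    rw [chij_self] at e
    simp at e

lemma flip_hyps {k : ℕ} (hk : 1 ≤ k) {ε : ℤ} (hε : ε = 1 ∨ ε = -1) :
    (∀ i j : ℤ, z (k + 1) ^ i * x (k + 1) k ^ ε * z (k + 1) ^ j ≠ 1) ∧
    ∀ i j : ℤ, (x (k + 1) k ^ ε)⁻¹ * z (k + 1) ^ i * x (k + 1) k ^ ε = z (k + 1) ^ j → i = 0 := by
  constructor
  · intro i j h
    have e1 := congrArg (fun y => (chij (k + 1) 0 y).toAdd) h
    have e2 := congrArg (fun y => (chij (k + 1) k y).toAdd) h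
    simp only [map_mul, map_inv, map_zpow, toAdd_mul, toAdd_inv, toAdd_zpow, smul_eq_mul] at e1 e2
    rw [chij_z, chij_ne] at e1
    rw [chij_z, chij_self] at e2
    simp at e1 e2
    omega
  · intro i j h
    have e1 := congrArg (fun y => (chij (k + 1) 0 y).toAdd) h
    simp only [map_mul, map_inv, map_zpow, toAdd_mul, toAdd_inv, toAdd_zpow, smul_eq_mul] at e1
    rw [chij_z, chij_ne] at e1
    simp at e1
    subst e1
    have hc : Commute (z (k + 1) ^ i) (x (k + 1) k ^ ε) := by
      rw [mul_assoc, inv_mul_eq_iff_eq_mul] at h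
      exact h
    refine eq_zero_of_z_commute (k := k + 1) (by omega) (a := i) ?_
    change Commute _ (x (k + 1) k)
    rcases hε with rfl | rfl
    · rwa [zpow_one] at hc
    · rw [_root_.zpow_neg_one] at hc
      exact Commute.inv_right_iff.1 hc

lemma closure_eq_range_jB {k : ℕ} {h : F (k + 2)}
    (hh : h ∈ Subgroup.closure {x (k + 2) (k + 1), zl (k + 2) (k + 1)}) :
    ∃ w : W, h = jB (k + 1) w := by
  have : Subgroup.closure {x (k + 2) (k + 1), zl (k + 2) (k + 1)} ≤ (jB (k + 1)).range := by
    rw [Subgroup.closure_le]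
    rintro y (rfl | rfl)
    · exact ⟨_, jB_t (k + 1)⟩
    · refine ⟨(t _)⁻¹ * X, ?_⟩
      rw [map_mul, map_inv, jB_t, jB_X, z]
      change _ * (x (k + 2) (k + 1) * zl (k + 2) (k + 1)) = _
      group
  obtain ⟨w, hw⟩ := this hh
  exact ⟨w, hw.symm⟩

end

section

open Equiv Braid.FP

/-! ### Elements of the free group inverted by the shift -/

/-- The automorphism of a free product with `ℤ` that inverts the generator of `ℤ`. -/
def FP.invT (H : Type*) [Group H] : FP H →* FP H := lift inc (t H)⁻¹

lemma FP.invT_t {H : Type*} [Group H] : invT H (t H) = (t H)⁻¹ := lift_t _ _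

lemma FP.invT_inc {H : Type*} [Group H] (h : H) : invT H (inc h) = inc h := lift_inc _ _ _

lemma FP.invT_X : invT _ X = X := invT_inc _

lemma FP.invT_invT {H : Type*} [Group H] (u : FP H) : invT H (invT H u) = u := by
  have := FP.hom_ext (f := (invT H).comp (invT H)) (g := MonoidHom.id _)
    (MonoidHom.ext fun v => by simp [invT]) (by simp [invT])
  exact congr_fun this u

lemma fpB_act_δ_inv {k : ℕ} (w : W) :
    fpB k ((act (k + 2) (δ (k + 2)))⁻¹ (jB (k + 1) w)) =
      FP.flip (z (k + 1)) (x (k + 1) k) w := by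
  have := W_hom_ext
    (f := (fpB k).comp (((act (k + 2) (δ (k + 2)))⁻¹ : MulAut _).toMonoidHom.comp (jB (k + 1))))
    (g := FP.flip (z (k + 1)) (x (k + 1) k))
    (by
      change fpB k ((act (k + 2) (δ (k + 2)))⁻¹ (jB (k + 1) (t _))) = _
      rw [jB_t, act_δ_inv_last, map_mul, fpB_mul, map_inv, fpB_last, FP.flip, lift_t])
    (by
      change fpB k ((act (k + 2) (δ (k + 2)))⁻¹ (jB (k + 1) X)) = _
      rw [jB_X, ← map_inv, act_z, fpB_z, FP.flip, X, lift_inc]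
      simp)
  exact congr_fun this w

lemma fpB_act_mirror_inv {k : ℕ} (w : W) :
    FP.invT _ (fpB k ((act (k + 2) (mirror (k + 2) (δ (k + 2))))⁻¹ (jB (k + 1) (FP.invT _ w)))) =
      FP.flip (z (k + 1)) (x (k + 1) k)⁻¹ w := by
  have := W_hom_ext
    (f := (FP.invT _).comp ((fpB k).comp
      (((act (k + 2) (mirror (k + 2) (δ (k + 2))))⁻¹ : MulAut _).toMonoidHom.comp
        ((jB (k + 1)).comp (FP.invT _)))))
    (g := FP.flip (z (k + 1)) (x (k + 1) k)⁻¹)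
    (by
      change FP.invT _ (fpB k ((act (k + 2) (mirror (k + 2) (δ (k + 2))))⁻¹
        (jB (k + 1) (FP.invT _ (t _))))) = _
      rw [FP.invT_t, map_inv, jB_t, mirror_δ _ (by omega), map_inv (act (k + 2)), inv_inv, map_inv,
        show k + 2 - 1 = k + 1 from rfl, act_rl_last, map_inv, fpB_mid, map_inv, map_mul,
        map_inv, FP.invT_t, FP.invT_inc, FP.flip, lift_t, map_inv, mul_inv_rev, inv_inv])
    (by
      change FP.invT _ (fpB k ((act (k + 2) (mirror (k + 2) (δ (k + 2))))⁻¹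
        (jB (k + 1) (FP.invT _ X)))) = _
      rw [FP.invT_X, jB_X, ← map_inv, act_z, fpB_z, FP.invT_inc, FP.flip, X, lift_inc]
      simp)
  exact congr_fun this w

lemma shift_δ_classification {k : ℕ} (hk : 1 ≤ k) {h : F (k + 2)}
    (h1 : ∀ i, i + 1 < k + 1 → act (k + 2) (σ (k + 2) i) h = h)
    (h2 : act (k + 2) (σ (k + 2) k) ((act (k + 2) (δ (k + 2)))⁻¹ h * h) =
      (act (k + 2) (δ (k + 2)))⁻¹ h * h) :
    ∃ i : ℤ, h = z (k + 2) ^ i ∨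
      h = z (k + 2) ^ i * x (k + 2) (k + 1) * (z (k + 2) ^ i)⁻¹ := by
  obtain ⟨w, rfl⟩ := closure_eq_range_jB (mem_closure_of_fixed (k := k + 1) (by omega) h1)
  obtain ⟨g, hg⟩ := map_zpowers_fixed h2
  rw [map_mul, fpB_act_δ_inv, fpB_jB] at hg
  have hf := flip_hyps hk (ε := 1) (Or.inl rfl)
  rw [zpow_one] at hf
  obtain ⟨i, rfl | rfl⟩ := flip_classification hf.1 hf.2 hg
  · exact ⟨i, Or.inl (by rw [map_zpow, jB_X])⟩
  · exact ⟨i, Or.inr (by rw [map_mul, map_mul, map_inv, map_zpow, jB_X, jB_t])⟩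

lemma shift_mirror_classification {k : ℕ} (hk : 1 ≤ k) {h : F (k + 2)}
    (h1 : ∀ i, i + 1 < k + 1 → act (k + 2) (σ (k + 2) i) h = h)
    (h2 : act (k + 2) (σ (k + 2) k) ((act (k + 2) (mirror (k + 2) (δ (k + 2))))⁻¹ h * h) =
      (act (k + 2) (mirror (k + 2) (δ (k + 2))))⁻¹ h * h) :
    ∃ i : ℤ, h = z (k + 2) ^ i ∨
      h = z (k + 2) ^ i * (x (k + 2) (k + 1))⁻¹ * (z (k + 2) ^ i)⁻¹ := by
  obtain ⟨w, rfl⟩ := closure_eq_range_jB (mem_closure_of_fixed (k := k + 1) (by omega) h1)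
  obtain ⟨g, hg⟩ := map_zpowers_fixed h2
  obtain ⟨v, rfl⟩ : ∃ v, w = FP.invT _ v := ⟨_, (FP.invT_invT w).symm⟩
  have hm : ∀ v : W, FP.invT _ (FP.map (zpowersHom _ (z (k + 1))) (FP.invT _ v)) =
      FP.map (zpowersHom _ (z (k + 1))) v := fun v => by
    have := FP.hom_ext (f := (FP.invT _).comp ((FP.map (zpowersHom _ (z (k + 1)))).comp (FP.invT _)))
      (g := FP.map (zpowersHom _ (z (k + 1))))
      (MonoidHom.ext fun v => by simp [FP.invT, FP.map]) (by simp [FP.invT, FP.map])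
    exact congr_fun this v
  have hg2 := congrArg (FP.invT _) hg
  rw [map_mul, map_mul, fpB_act_mirror_inv, fpB_jB, hm, FP.invT_inc] at hg2
  have hf := flip_hyps hk (ε := -1) (Or.inr rfl)
  rw [_root_.zpow_neg_one] at hf
  obtain ⟨i, rfl | rfl⟩ := flip_classification hf.1 hf.2 hg2
  · exact ⟨i, Or.inl (by rw [map_zpow, FP.invT_X, map_zpow, jB_X])⟩
  · refine ⟨i, Or.inr ?_⟩
    simp only [map_mul, map_inv, map_zpow, FP.invT_X, FP.invT_t, jB_X, jB_t]

end

section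

open Equiv Braid.FP

/-! ### Endomorphisms of `AG m` -/

/-- A signed generator twisted by a power of `z`. -/
def tw (m : ℕ) (ε K : ℤ) (i : ℕ) : AG m := br (σ m i) ^ ε * fr (z m ^ K)

lemma semiconjBy_zpow_iff {G : Type*} [Group G] {a b c : G} {ε : ℤ} (hε : ε = 1 ∨ ε = -1) :
    SemiconjBy a (b ^ ε) (c ^ ε) ↔ SemiconjBy a b c := by
  rcases hε with rfl | rfl
  · rw [zpow_one, zpow_one]
  · rw [_root_.zpow_neg_one, _root_.zpow_neg_one, SemiconjBy.inv_right_iff]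

lemma fr_z_zpow_commute_br (m : ℕ) (K : ℤ) (b : Br m) : Commute (fr (z m ^ K)) (br b) := by
  rw [map_zpow]; exact (fr_z_commute_br _ _).zpow_left K

lemma semiconjBy_tw {m i j : ℕ} {β : Br m} (ε K : ℤ) (h : SemiconjBy β (σ m i) (σ m j)) :
    SemiconjBy (br β) (tw m ε K i) (tw m ε K j) :=
  ((h.map br).zpow_right ε).mul_right (fr_z_zpow_commute_br m K β).symm

lemma semiconjBy_right {m i j : ℕ} {g : AG m} {ε K : ℤ} (hε : ε = 1 ∨ ε = -1)
    (h : SemiconjBy g (tw m ε K i) (tw m ε K j)) : SemiconjBy g.right (σ m i) (σ m j) := by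
  have e : ∀ l, (rightHom : AG m →* Br m) (tw m ε K l) = σ m l ^ ε := fun l => by
    rw [tw, map_mul, map_zpow, SemidirectProduct.rightHom_inr, SemidirectProduct.rightHom_inl, mul_one]
  have := h.map (rightHom : AG m →* Br m)
  rw [e, e] at this
  exact (semiconjBy_zpow_iff hε).1 this

lemma act_eq_of_commute_tw {m i : ℕ} {ε : ℤ} (hε : ε = 1 ∨ ε = -1) {v : F m}
    (h : Commute (fr v) (tw m ε 0 i)) : act m (σ m i) v = v := by
  rw [tw, zpow_zero, map_one, mul_one] at h
  exact (commute_inl ((semiconjBy_zpow_iff (a := (fr v : AG m)) hε).1 h)).2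

lemma mem_zpowers_of_commute_tw {k : ℕ} {v : F (k + 2)} {ε K : ℤ} (hε : ε = 1 ∨ ε = -1)
    (hk : 1 ≤ k) (hK : K ≠ 0) (h : Commute (fr v) (tw (k + 2) ε K k)) :
    v ∈ zpowers (z (k + 2)) := by
  rcases hε with rfl | rfl
  · rw [tw, zpow_one] at h
    exact mem_zpowers_of_commute_twist hk hK h
  · rw [tw, _root_.zpow_neg_one] at h
    have h2 := h.inv_right
    rw [mul_inv_rev, inv_inv, ← map_inv, ← _root_.zpow_neg, (fr_z_zpow_commute_br _ _ _).eq] at h2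
    exact mem_zpowers_of_commute_twist hk (neg_ne_zero.2 hK) h2

lemma exists_shift_form {k : ℕ} (hk : 2 ≤ k) {ε K : ℤ} (hε : ε = 1 ∨ ε = -1) {R : AG (k + 2)}
    (h1 : ∀ i, i + 2 < k + 2 → SemiconjBy R (tw (k + 2) ε K i) (tw (k + 2) ε K (i + 1)))
    (h2 : SemiconjBy (R ^ 2) (tw (k + 2) ε K k) (tw (k + 2) ε K 0)) :
    ∃ (β : Br (k + 2)) (h : F (k + 2)) (b : ℤ),
      (β = δ (k + 2) ∨ β = mirror (k + 2) (δ (k + 2))) ∧ R = br β * fr h * Δ (k + 2) ^ b ∧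
      (∀ i, i + 2 < k + 2 → Commute (fr h) (tw (k + 2) ε K i)) ∧
      Commute (fr ((act (k + 2) β)⁻¹ h * h)) (tw (k + 2) ε K k) := by
  obtain ⟨b, hb⟩ := eq_δ_or_mirror (m := k + 2) (by omega) (R := R.right)
    (fun i hi => (semiconjBy_right hε (h1 i hi)).eq) (by
      have e := semiconjBy_right hε h2
      rw [← rightHom_eq_right, map_pow] at e
      exact e.eq)
  obtain ⟨β, hβ, hR⟩ : ∃ β : Br (k + 2), (β = δ (k + 2) ∨ β = mirror (k + 2) (δ (k + 2))) ∧
      R.right = β * ζ (k + 2) ^ b := by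
    rcases hb with hb | hb
    · exact ⟨_, Or.inl rfl, hb⟩
    · exact ⟨_, Or.inr rfl, hb⟩
  have hβ1 : ∀ i, i + 2 < k + 2 → SemiconjBy β (σ (k + 2) i) (σ (k + 2) (i + 1)) := fun i hi => by
    rcases hβ with rfl | rfl
    · exact δ_σ hi
    · exact mirror_δ_σ hi
  have hβ2 : SemiconjBy (β ^ 2) (σ (k + 2) k) (σ (k + 2) 0) := by
    rcases hβ with rfl | rfl
    · exact δ_sq_σ_last (m := k + 2)
    · exact mirror_δ_sq_σ
  have hg : ((br β)⁻¹ * R).right = ζ (k + 2) ^ b := by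
    rw [mul_right, ← map_inv, right_inr, hR, inv_mul_cancel_left]
  obtain ⟨h, hh⟩ : ∃ h, (br β)⁻¹ * R = fr h * Δ (k + 2) ^ b := ⟨_, eq_fr_mul_Δ hg⟩
  have hRe : R = br β * fr h * Δ (k + 2) ^ b := by
    rw [mul_assoc, ← hh, mul_inv_cancel_left]
  have hB : br β * fr h = Δ (k + 2) ^ (-b) * R := by
    rw [hRe, _root_.zpow_neg, ← ((Δ_commute (k + 2) _).zpow_left b).eq, inv_mul_cancel_left]
  have hΔ : ∀ g, Commute (Δ (k + 2) ^ (-b)) g := fun g => (Δ_commute _ g).zpow_left _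
  refine ⟨β, h, b, hβ, hRe, fun i hi => ?_, ?_⟩
  · have e : fr h = (br β)⁻¹ * (Δ (k + 2) ^ (-b) * R) := by rw [← hB, inv_mul_cancel_left]
    rw [e]
    exact (semiconjBy_tw ε K (hβ1 i hi)).inv_symm_left.mul_left
      (SemiconjBy.mul_left (hΔ _) (h1 i hi))
  · have e : fr ((act (k + 2) β)⁻¹ h * h) = (br (β ^ 2))⁻¹ * ((Δ (k + 2) ^ (-b)) ^ 2 * R ^ 2) := by
      rw [← (hΔ R).mul_pow, ← hB, pow_two (_ * _), map_mul, ← map_inv (act (k + 2)), ← br_conj, map_pow,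
        map_inv]
      group
    rw [e]
    exact (semiconjBy_tw ε K hβ2).inv_symm_left.mul_left
      (SemiconjBy.mul_left ((hΔ _).pow_left 2) h2)

lemma shift_classification {k : ℕ} (hk : 1 ≤ k) {ε K : ℤ} (hε : ε = 1 ∨ ε = -1)
    {β : Br (k + 2)} {h : F (k + 2)} (hβ : β = δ (k + 2) ∨ β = mirror (k + 2) (δ (k + 2)))
    (h1 : ∀ i, i + 2 < k + 2 → Commute (fr h) (tw (k + 2) ε K i))
    (h2 : Commute (fr ((act (k + 2) β)⁻¹ h * h)) (tw (k + 2) ε K k)) :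
    (∃ i : ℤ, h = z (k + 2) ^ i) ∨
    (K = 0 ∧ β = δ (k + 2) ∧
      ∃ i : ℤ, h = z (k + 2) ^ i * x (k + 2) (k + 1) * (z (k + 2) ^ i)⁻¹) ∨
    (K = 0 ∧ β = mirror (k + 2) (δ (k + 2)) ∧
      ∃ i : ℤ, h = z (k + 2) ^ i * (x (k + 2) (k + 1))⁻¹ * (z (k + 2) ^ i)⁻¹) := by
  by_cases hK : K = 0
  · subst hK
    have h1' : ∀ i, i + 1 < k + 1 → act (k + 2) (σ (k + 2) i) h = h := fun i hi =>
      act_eq_of_commute_tw hε (h1 i (by omega))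
    rcases hβ with rfl | rfl
    · obtain ⟨i, hi | hi⟩ := shift_δ_classification hk h1' (act_eq_of_commute_tw hε h2)
      · exact Or.inl ⟨i, hi⟩
      · exact Or.inr (Or.inl ⟨rfl, rfl, i, hi⟩)
    · obtain ⟨i, hi | hi⟩ := shift_mirror_classification hk h1' (act_eq_of_commute_tw hε h2)
      · exact Or.inl ⟨i, hi⟩
      · exact Or.inr (Or.inr ⟨rfl, rfl, i, hi⟩)
  · left
    have hs : SemiconjBy (δ (k + 2) ^ k) (σ (k + 2) 0) (σ (k + 2) k) := by
      have e := δ_pow_conj (m := k + 2) (i := 0) (j := k)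
      rw [zero_add, mul_inv_eq_iff_eq_mul] at e
      exact e
    have hc : Commute (fr (act (k + 2) (δ (k + 2) ^ k) h)) (tw (k + 2) ε K k) := by
      have hb := semiconjBy_tw ε K hs
      rw [← br_conj]
      exact (hb.mul_left (h1 0 (by omega))).mul_left hb.inv_symm_left
    obtain ⟨i, hi⟩ := mem_zpowers_of_commute_tw hε hk hK hc
    refine ⟨i, (act (k + 2) (δ (k + 2) ^ k)).injective ?_⟩
    rw [map_zpow (act (k + 2) (δ (k + 2) ^ k)) (z (k + 2)), act_z]
    exact hi.symm

end

section

open Equiv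

/-- The noncyclic normal forms for the values of an endomorphism of `AG m` on generators. -/
def AG.Normal (m : ℕ) (S : ℕ → AG m) (R : AG m) : Prop :=
  (∃ ε p q : ℤ, (ε = 1 ∨ ε = -1) ∧ (∀ i, i + 1 < m → S i = br (σ m i) ^ ε * Δ m ^ p) ∧
    R = ρ m * Δ m ^ q) ∨
  (∃ ε p q : ℤ, (ε = 1 ∨ ε = -1) ∧ (∀ i, i + 1 < m → S i = br (σ m (m - 2 - i)) ^ ε * Δ m ^ p) ∧
    R = (ρ m)⁻¹ * Δ m ^ q) ∨
  ∃ (ε p q r s : ℤ) (β : Br m), (ε = 1 ∨ ε = -1) ∧ (β = δ m ∨ β = mirror m (δ m)) ∧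
    (∀ i, i + 1 < m → S i = br (σ m i) ^ ε * br (ζ m) ^ p * Δ m ^ q) ∧
    R = br β * br (ζ m) ^ r * Δ m ^ s

lemma fr_z_zpow (m : ℕ) (i : ℤ) : fr (z m ^ i) = br (ζ m) ^ (-i) * Δ m ^ i := by
  rw [Δ_zpow, (fr_z_zpow_commute_br m i _).eq, map_zpow br, zpow_neg, inv_mul_cancel_left]

lemma gar_mirror_δ {m : ℕ} (hm : 1 ≤ m) :
    gar m * mirror m (δ m) = (δ m)⁻¹ * gar m := by
  rw [mirror_δ m hm, mul_inv_eq_iff_eq_mul, mul_assoc, gar_rl hm, inv_mul_cancel_left]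

lemma AG.normal_of_shift {k : ℕ} (hk : 2 ≤ k) {S : ℕ → AG (k + 2)} {R : AG (k + 2)} {ε K p : ℤ}
    (hε : ε = 1 ∨ ε = -1) (hS : ∀ i, i + 1 < k + 2 → S i = tw (k + 2) ε K i * Δ (k + 2) ^ p)
    (h1 : ∀ i, i + 2 < k + 2 → SemiconjBy R (S i) (S (i + 1)))
    (h2 : SemiconjBy (R ^ 2) (S k) (S 0)) :
    ∃ g : AG (k + 2), AG.Normal (k + 2) (fun i => g * S i * g⁻¹) (g * R * g⁻¹) := by
  have hΔ : ∀ (g : AG (k + 2)) (c : ℤ), g * Δ (k + 2) ^ c = Δ (k + 2) ^ c * g := fun g c =>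
    ((Δ_commute _ g).zpow_left c).eq.symm
  have hT : ∀ {g : AG (k + 2)} {i j}, i + 1 < k + 2 → j + 1 < k + 2 → SemiconjBy g (S i) (S j) →
      SemiconjBy g (tw (k + 2) ε K i) (tw (k + 2) ε K j) := fun {g i j} hi hj h => by
    rw [hS i hi, hS j hj, SemiconjBy, ← mul_assoc, mul_assoc (tw _ _ _ j), ← hΔ g, ← mul_assoc] at h
    exact mul_right_cancel h
  obtain ⟨β, h, b, hβ, rfl, h3, h4⟩ := exists_shift_form hk hε
    (fun i hi => hT (by omega) (by omega) (h1 i hi)) (hT (by omega) (by omega) h2)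
  rcases shift_classification (by omega) hε hβ h3 h4 with ⟨i, rfl⟩ | ⟨rfl, rfl, i, rfl⟩ |
    ⟨rfl, rfl, i, rfl⟩
  · refine ⟨1, Or.inr (Or.inr ⟨ε, -K, K + p, -i, i + b, β, hε, hβ, fun j hj => ?_, ?_⟩)⟩
    · beta_reduce
      rw [one_mul, inv_one, mul_one, hS j hj, tw, fr_z_zpow, zpow_add, mul_assoc, mul_assoc, mul_assoc]
    · rw [one_mul, inv_one, mul_one, fr_z_zpow, zpow_add]
      simp only [mul_assoc]
  · refine ⟨(fr (z (k + 2) ^ i))⁻¹, Or.inl ⟨ε, p, b, hε, fun j hj => ?_, ?_⟩⟩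
    · have hc := (fr_z_zpow_commute_br (k + 2) i (σ (k + 2) j)).zpow_right ε
      beta_reduce
      rw [hS j hj, tw, zpow_zero, map_one, mul_one, inv_inv, mul_assoc, mul_assoc, ← hΔ,
        inv_mul_eq_iff_eq_mul, ← mul_assoc, ← mul_assoc, hc.eq]
    · have hc := fr_z_zpow_commute_br (k + 2) i (δ (k + 2))
      have e := ρ_eq (m := k + 2)
      change ρ (k + 2) = br (δ (k + 2)) * fr (x (k + 2) (k + 1)) at e
      rw [e, inv_inv, mul_assoc, mul_assoc, ← hΔ, inv_mul_eq_iff_eq_mul, map_mul, map_mul, map_inv,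
        ← mul_assoc, ← mul_assoc, ← mul_assoc, ← mul_assoc, ← hc.eq]
      group
  · refine ⟨br (gar (k + 2)) * (fr (z (k + 2) ^ i))⁻¹,
      Or.inr (Or.inl ⟨ε, p, b, hε, fun j hj => ?_, ?_⟩)⟩
    · have hc := (fr_z_zpow_commute_br (k + 2) i (σ (k + 2) j)).zpow_right ε
      have e : SemiconjBy (br (gar (k + 2))) (br (σ (k + 2) j) ^ ε)
          (br (σ (k + 2) (k + 2 - 2 - j)) ^ ε) :=
        (SemiconjBy.map (show SemiconjBy (gar (k + 2)) (σ (k + 2) j) (σ (k + 2) (k + 2 - 2 - j)) from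
          gar_σ (by omega)) br).zpow_right ε
      beta_reduce
      rw [hS j hj, tw, zpow_zero, map_one, mul_one, mul_inv_eq_iff_eq_mul,
        mul_assoc (br (σ (k + 2) _) ^ ε) (Δ _ ^ p), ← hΔ, ← mul_assoc, ← mul_assoc]
      congr 1
      rw [mul_assoc, ← hc.inv_left.eq.symm, ← mul_assoc, e.eq, mul_assoc]
    · have hc := (fr_z_zpow_commute_br (k + 2) i (mirror (k + 2) (δ (k + 2))))
      have e2 : fr (z (k + 2) ^ i * (x (k + 2) (k + 1))⁻¹ * (z (k + 2) ^ i)⁻¹) =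
          fr (z (k + 2) ^ i) * (fr (x (k + 2) (k + 1)))⁻¹ * (fr (z (k + 2) ^ i))⁻¹ := by
        rw [map_mul, map_mul, map_inv, map_inv]
      have e3 : br (gar (k + 2)) * br (mirror (k + 2) (δ (k + 2))) =
          (br (δ (k + 2)))⁻¹ * br (gar (k + 2)) := by
        rw [← map_mul, gar_mirror_δ (by omega), map_mul, map_inv]
      have e4 : br (gar (k + 2)) * (fr (x (k + 2) (k + 1)))⁻¹ =
          (fr (x (k + 2) 0))⁻¹ * br (gar (k + 2)) := by
        rw [← map_inv, br_mul_fr, map_inv, show act (k + 2) (gar (k + 2)) (x (k + 2) (k + 1)) = _ from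
          act_gar_last (by omega), map_inv]
      rw [mul_inv_eq_iff_eq_mul, ρ, mul_inv_rev, mul_assoc ((br (δ (k + 2)))⁻¹ * _) (Δ _ ^ b), ← hΔ,
        ← mul_assoc _ _ (Δ _ ^ b), ← mul_assoc _ _ (Δ _ ^ b)]
      congr 1
      rw [e2]
      obtain ⟨Z, hZ⟩ : ∃ Z, Z = fr (z (k + 2) ^ i) := ⟨_, rfl⟩
      rw [← hZ] at hc ⊢
      calc _ = br (gar (k + 2)) * (Z⁻¹ * br (mirror (k + 2) (δ (k + 2)))) * Z *
            (fr (x (k + 2) (k + 1)))⁻¹ * Z⁻¹ := by group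
        _ = (br (gar (k + 2)) * br (mirror (k + 2) (δ (k + 2)))) *
            (fr (x (k + 2) (k + 1)))⁻¹ * Z⁻¹ := by rw [hc.inv_left.eq]; group
        _ = (br (δ (k + 2)))⁻¹ * (br (gar (k + 2)) * (fr (x (k + 2) (k + 1)))⁻¹) * Z⁻¹ := by
          rw [e3]; group
        _ = _ := by rw [e4]; group

lemma tw_of_std {m : ℕ} (hm : 3 ≤ m) (f : Br m →* AG m)
    (h : Std m (rightHom.comp f)) :
    ∃ (g : AG m) (ε K p : ℤ), (ε = 1 ∨ ε = -1) ∧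
      ∀ i, i + 1 < m → g * f (σ m i) * g⁻¹ = tw m ε K i * Δ m ^ p := by
  obtain ⟨g, ε, p, hε, hg⟩ := h
  have hr : ∀ i, i + 1 < m → ((br g)⁻¹ * f (σ m i) * br g).right = σ m i ^ ε * ζ m ^ p := fun i hi => by
    have e : (f (σ m i)).right = _ := hg i hi
    rw [← map_inv, mul_right, mul_right,
      right_inr, right_inr, e, mul_assoc,
      mul_assoc _ (ζ m ^ p), ((ζ_commute m g).zpow_left p).eq]
    group
  have hΔr : ∀ c : ℤ, (Δ m ^ c).right = ζ m ^ c := fun c => by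
    rw [← rightHom_eq_right, map_zpow]; simp [Δ]
  have hΔ : ∀ g : AG m, Commute (Δ m) g := Δ_commute m
  obtain ⟨c, hc⟩ : ∃ c : Br m →* AG m, c = (MulAut.conj (br g)⁻¹).toMonoidHom.comp f := ⟨_, rfl⟩
  have hcb : ∀ b, c b = (br g)⁻¹ * f b * br g := fun b => by rw [hc]; simp
  rcases hε with rfl | rfl
  · obtain ⟨F1, hF1⟩ : ∃ F1, F1 = transv c (Δ m ^ (-p)) (fun g => (hΔ g).zpow_left _) := ⟨_, rfl⟩
    have hFσ : ∀ i, i + 1 < m → F1 (σ m i) = (br g)⁻¹ * f (σ m i) * br g * Δ m ^ (-p) := fun i hi => by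
      rw [hF1, transv_apply, expo_σ hi, hcb, toAdd_ofAdd, zpow_one]
    have hF : ∀ b, (F1 b).right = b := fun b => by
      have := Br.hom_ext (f := rightHom.comp F1) (g := MonoidHom.id _) fun i hi => by
        change (F1 (σ m i)).right = σ m i
        rw [hFσ i hi, mul_right, hr i hi, hΔr]
        group
      exact congr_fun this b
    obtain ⟨v, K, hv⟩ := section_classification hm F1 hF
    refine ⟨(fr v)⁻¹ * (br g)⁻¹, 1, K, p, Or.inl rfl, fun i hi => ?_⟩
    have e := hv i hi
    rw [hFσ i hi, _root_.zpow_neg, mul_inv_eq_iff_eq_mul] at e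
    calc _ = (fr v)⁻¹ * ((br g)⁻¹ * f (σ m i) * br g) * fr v := by group
      _ = (fr v)⁻¹ * (fr v * (fr (z m ^ K) * br (σ m i)) * (fr v)⁻¹) * (Δ m ^ p * fr v) := by
        rw [e]; simp only [mul_assoc]
      _ = _ := by
        rw [((hΔ (fr v)).zpow_left p).eq, tw, zpow_one, ← (fr_z_zpow_commute_br m K (σ m i)).eq]; group
  · obtain ⟨F1, hF1⟩ : ∃ F1, F1 = transv (c.comp (mirror m)) (Δ m ^ p)
      (fun g => (hΔ g).zpow_left _) := ⟨_, rfl⟩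
    have hFσ : ∀ i, i + 1 < m → F1 (σ m i) = ((br g)⁻¹ * f (σ m i) * br g)⁻¹ * Δ m ^ p :=
      fun i hi => by
        rw [hF1, transv_apply, expo_σ hi, comp_apply, mirror_σ hi, map_inv c, hcb,
          toAdd_ofAdd, zpow_one]
    have hF : ∀ b, (F1 b).right = b := fun b => by
      have := Br.hom_ext (f := rightHom.comp F1) (g := MonoidHom.id _) fun i hi => by
        change (F1 (σ m i)).right = σ m i
        rw [hFσ i hi, mul_right, ← rightHom_eq_right, map_inv,
          rightHom_eq_right, hr i hi, hΔr, mul_inv_rev,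
          ← ((ζ_commute m (σ m i ^ (-1 : ℤ))⁻¹).zpow_left p).inv_left.eq.symm]
        group
      exact congr_fun this b
    obtain ⟨v, K, hv⟩ := section_classification hm F1 hF
    refine ⟨(fr v)⁻¹ * (br g)⁻¹, -1, -K, p, Or.inr rfl, fun i hi => ?_⟩
    have e := hv i hi
    rw [hFσ i hi, ← eq_mul_inv_iff_mul_eq, inv_eq_iff_eq_inv] at e
    calc _ = (fr v)⁻¹ * ((br g)⁻¹ * f (σ m i) * br g) * fr v := by group
      _ = (fr v)⁻¹ * Δ m ^ p * fr v * (br (σ m i))⁻¹ * (fr (z m ^ K))⁻¹ := by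
        rw [e]; group
      _ = (br (σ m i))⁻¹ * (fr (z m ^ K))⁻¹ * Δ m ^ p := by
        rw [← ((hΔ _).zpow_left p).eq, inv_mul_cancel_right, mul_assoc, ((hΔ _).zpow_left p).eq]
      _ = _ := by
        rw [tw, _root_.zpow_neg_one, _root_.zpow_neg, map_inv]

/-- Classification of the endomorphisms of `AG m`. -/
lemma AG.classification {m : ℕ} (hm : 5 ≤ m) (Φ : AG m →* AG m) :
    (∃ u, Commute u (Φ (ρ m)) ∧ ∀ i, i + 1 < m → Φ (br (σ m i)) = u) ∨
    ∃ g : AG m, AG.Normal m (fun i => g * Φ (br (σ m i)) * g⁻¹) (g * Φ (ρ m) * g⁻¹) := by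
  have hρ : ∀ i, i + 2 < m → SemiconjBy (ρ m) (br (σ m i)) (br (σ m (i + 1))) := fun i hi => ρ_br_σ hi
  rcases eq_or_std hm (rightHom.comp (Φ.comp br)) with h | h
  · left
    have h1 := eq_of_perm_eq hm ((ι m).comp (Φ.comp br)) (by
      change perm (m + 1) (ι m _) = perm (m + 1) (ι m _)
      rw [perm_ι, perm_ι]
      exact congrArg (perm m) h)
    have h2 : (Φ.comp br) (σ m 0) = (Φ.comp br) (σ m 1) := ι_injective m h1
    have h3 := eq_σ_zero _ h2
    refine ⟨Φ (br (σ m 0)), ?_, fun i hi => h3 i hi⟩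
    have e := (hρ 0 (by omega)).map Φ
    rw [show Φ (br (σ m (0 + 1))) = Φ (br (σ m 0)) from h2.symm] at e
    exact Commute.symm e
  · right
    obtain ⟨k, rfl⟩ : ∃ k, m = k + 2 := ⟨m - 2, by omega⟩
    obtain ⟨g, ε, K, p, hε, hg⟩ := tw_of_std (by omega) (Φ.comp br) h
    obtain ⟨g', hg'⟩ := AG.normal_of_shift (S := fun i => g * Φ (br (σ (k + 2) i)) * g⁻¹)
      (R := g * Φ (ρ (k + 2)) * g⁻¹) (by omega) hε hg
      (fun i hi => ((hρ i hi).map Φ).map (MulAut.conj g)) (by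
        have e : SemiconjBy (ρ (k + 2) ^ 2) (br (σ (k + 2) k)) (br (σ (k + 2) 0)) := ρ_sq_br_σ
        have e2 := (e.map Φ).map (MulAut.conj g)
        rw [map_pow, map_pow] at e2
        exact e2)
    refine ⟨g' * g, ?_⟩
    have e : ∀ y, g' * g * y * (g' * g)⁻¹ = g' * (g * y * g⁻¹) * g'⁻¹ := fun y => by group
    simp only [e]
    exact hg'

end

end Braid

namespace Braid

/-! ### Transfer to the Artin group of type `B` -/

theorem rB_succ {n i : ℕ} (h : i < n) : rB n (i + 1) = PresentedGroup.of ⟨i, h⟩ := dif_pos h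

theorem rB_braid {n i : ℕ} (h : i + 2 < n) :
    rB n (i + 1) * rB n (i + 1 + 1) * rB n (i + 1) =
      rB n (i + 1 + 1) * rB n (i + 1) * rB n (i + 1 + 1) := by
  rw [rB_succ (i := i) (by omega), rB_succ (i := i + 1) (by omega)]
  exact PresentedGroup.mk_eq_mk_of_mul_inv_mem (Or.inl ⟨_, _, rfl, h, rfl⟩)

theorem rB_comm {n i j : ℕ} (h : i + 2 ≤ j) (hj : j < n) :
    rB n (i + 1) * rB n (j + 1) = rB n (j + 1) * rB n (i + 1) := by
  rw [rB_succ (i := i) (by omega), rB_succ hj]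
  exact PresentedGroup.mk_eq_mk_of_mul_inv_mem (Or.inr (Or.inr ⟨_, _, h, rfl⟩))

theorem rB_braid_four {k : ℕ} :
    rB (k + 2) (k + 1) * rB (k + 2) (k + 2) * rB (k + 2) (k + 1) * rB (k + 2) (k + 2) =
      rB (k + 2) (k + 2) * rB (k + 2) (k + 1) * rB (k + 2) (k + 2) * rB (k + 2) (k + 1) := by
  rw [rB_succ (i := k) (by omega), rB_succ (i := k + 1) (by omega)]
  exact PresentedGroup.mk_eq_mk_of_mul_inv_mem (Or.inr (Or.inl ⟨_, _, rfl, rfl, rfl⟩))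

/-- The canonical homomorphism from `AG n` to the Artin group of type `B`. -/
def toB (n : ℕ) : AG n →* ArtinB n :=
  AG.lift (s := fun i => rB n (i + 1)) (q := rB n n) (fun _ h => rB_braid h)
    (fun _ _ h hj => rB_comm h (by omega))
    (fun i h => by
      obtain ⟨k, rfl⟩ : ∃ k, n = k + 1 := ⟨n - 1, by omega⟩
      exact rB_comm (by omega) (by omega))
    (fun h => by
      obtain ⟨k, rfl⟩ : ∃ k, n = k + 2 := ⟨n - 2, by omega⟩
      exact rB_braid_four)

theorem toB_br_σ {n i : ℕ} (h : i + 1 < n) : toB n (br (σ n i)) = rB n (i + 1) :=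
  AG.lift_br _ _ _ _ h

theorem toB_fr_last {n : ℕ} (h : 0 < n) : toB n (fr (x n (n - 1))) = rB n n :=
  (AG.lift_fr _ _ _ _ (by omega)).trans (xImg_of_le n _ _)

/-- The canonical homomorphism from the Artin group of type `B` to `AG n`. -/
def ofB (n : ℕ) : ArtinB n →* AG n :=
  PresentedGroup.toGroup
    (f := fun i : Fin n => if (i : ℕ) + 1 < n then br (σ n i) else fr (x n (n - 1))) (by
    rintro w (⟨i, j, h1, h2, rfl⟩ | ⟨i, j, h1, h2, rfl⟩ | ⟨i, j, h, rfl⟩)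
    · simp only [map_mul, map_inv, FreeGroup.lift_apply_of, mul_inv_eq_one]
      rw [if_pos (by omega), if_pos h2, ← h1]
      simp only [← map_mul]
      rw [σ_braid]
    · simp only [map_mul, map_inv, FreeGroup.lift_apply_of, mul_inv_eq_one]
      rw [if_pos (by omega), if_neg (by omega)]
      obtain ⟨k, rfl⟩ : ∃ k, n = k + 2 := ⟨n - 2, by omega⟩
      obtain hi : (i : ℕ) = k := by omega
      rw [hi]
      have h := AG.conj_x (m := k + 2) (i := k) (by omega)
      have e : Commute (br (σ (k + 2) k)) (fr (x (k + 2) (k + 1) * x (k + 2) k)) := by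
        rw [Commute, SemiconjBy, br_mul_fr, act_σ_top]
      change br (σ (k + 2) k) * fr (x (k + 2) (k + 1)) * br (σ (k + 2) k) * fr (x (k + 2) (k + 1)) =
        fr (x (k + 2) (k + 1)) * br (σ (k + 2) k) * fr (x (k + 2) (k + 1)) * br (σ (k + 2) k)
      rw [map_mul, h] at e
      generalize br (σ (k + 2) k) = s at *
      generalize fr (x (k + 2) (k + 1)) = y at *
      have e2 := e.eq
      simp only [← mul_assoc, inv_mul_cancel_right] at e2
      rw [← e2]
      group
    · simp only [map_mul, map_inv, FreeGroup.lift_apply_of, mul_inv_eq_one]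
      rw [if_pos (by omega)]
      split_ifs
      · rw [← map_mul, (σ_comm h).eq, map_mul]
      · rw [br_mul_fr, act_σ_of_ne])

theorem toB_ofB {n : ℕ} (y : ArtinB n) : toB n (ofB n y) = y := by
  have : (toB n).comp (ofB n) = MonoidHom.id _ := PresentedGroup.ext fun i => by
    rw [MonoidHom.comp_apply, ofB, PresentedGroup.toGroup.of, MonoidHom.id_apply]
    split_ifs with h
    · rw [toB_br_σ h, rB_succ i.2]
    · rw [toB_fr_last (by omega)]
      have e := rB_succ (n := n) i.2
      rwa [show (i : ℕ) + 1 = n by omega] at e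
  exact DFunLike.congr_fun this y

theorem toB_dl {n k : ℕ} (h : k < n) :
    toB n (br (dl n k)) = ((List.range k).map fun i => rB n (i + 1)).prod := by
  induction k with
  | zero => simp [dl]
  | succ k ih =>
    rw [dl, map_mul, map_mul, ih (by omega), toB_br_σ h, List.range_succ, List.map_append,
      List.prod_append, List.map_singleton, List.prod_singleton]

theorem toB_mirror_dl {n k : ℕ} (h : k < n) :
    toB n (br (mirror n (dl n k))) = ((List.range k).map fun i => (rB n (i + 1))⁻¹).prod := by
  induction k with
  | zero => simp [dl]
  | succ k ih =>
    rw [dl, map_mul, map_mul, map_mul, ih (by omega), mirror_σ h, map_inv, map_inv, toB_br_σ h,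
      List.range_succ, List.map_append, List.prod_append, List.map_singleton, List.prod_singleton]

theorem gar_eq_prod (n : ℕ) : gar n = ((List.range (n - 1)).map fun k => dl n (n - 1 - k)).prod := by
  induction n with
  | zero => rfl
  | succ n ih =>
    rcases n with _ | n
    · simp [gar, δ, dl]
    · rw [gar, ih, map_list_prod, List.map_map, Nat.add_sub_cancel, Nat.add_sub_cancel,
        List.range_succ_eq_map, List.map_cons, List.prod_cons, List.map_map]
      congr 2
      refine List.map_congr_left fun k _ => ?_
      have h := inB_dl (m := n + 1) (k := n - k)
      simp only [Function.comp_apply, Nat.succ_eq_add_one, Nat.add_sub_add_right]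
      exact h

theorem toB_gar (n : ℕ) : toB n (br (gar n)) = ΔY n := by
  rw [gar_eq_prod, map_list_prod, map_list_prod, List.map_map, List.map_map, ΔY]
  congr 1
  refine List.map_congr_left fun k hk => ?_
  rw [List.mem_range] at hk
  exact toB_dl (by omega)

theorem toB_ζ {n : ℕ} (hn : 3 ≤ n) : toB n (br (ζ n)) = ΔY n ^ 2 := by
  rw [← gar_sq hn, map_pow, map_pow, toB_gar]

theorem toB_ρ {n : ℕ} (hn : 0 < n) : toB n (ρ n) = ρB n := by
  rw [ρ_eq hn, map_mul, toB_fr_last hn, δ, toB_dl (by omega), ρB]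
  obtain ⟨k, rfl⟩ : ∃ k, n = k + 1 := ⟨n - 1, by omega⟩
  rw [List.range_succ, List.map_append, List.prod_append, List.map_singleton, List.prod_singleton]
  rfl

theorem toB_Δ {n : ℕ} (hn : 0 < n) : toB n (Δ n) = ΔB n := by
  rw [← ρ_pow_self, map_pow, toB_ρ hn, ΔB]

theorem toB_ζ_zpow {n : ℕ} (hn : 3 ≤ n) (p : ℤ) : toB n (br (ζ n) ^ p) = ΔY n ^ (2 * p) := by
  rw [map_zpow, toB_ζ hn, zpow_mul, zpow_ofNat]

theorem tB_of_lt {n i : ℕ} (h : i + 1 < n) : tB n (i + 1) = rB n (i + 1) := by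
  rw [tB, Nat.mod_eq_of_lt h, if_neg (by omega)]

theorem tB_zero (n : ℕ) : tB n 0 = ρB n * rB n (n - 1) * (ρB n)⁻¹ := by
  rw [tB, Nat.zero_mod, if_pos rfl]

theorem tB_self (n : ℕ) : tB n n = tB n 0 := by
  rw [tB_zero, tB, Nat.mod_self, if_pos rfl]

theorem toB_conj_ρ {k : ℕ} :
    toB (k + 2) (ρ (k + 2) * br (σ (k + 2) k) * (ρ (k + 2))⁻¹) = tB (k + 2) 0 := by
  rw [tB_zero, map_mul, map_mul, map_inv, toB_ρ (by omega), toB_br_σ (by omega)]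
  rfl

theorem conj_mul_of_commute {G : Type*} [Group G] {w a b r s : G} (ε : ℤ) (hr : Commute r (a ^ ε * b))
    (hs : ∀ g, Commute s g) (hb : Commute w b) :
    (w * r * s) * (a ^ ε * b) * (w * r * s)⁻¹ = (w * a * w⁻¹) ^ ε * b := by
  have h1 : s * (a ^ ε * b) * s⁻¹ = a ^ ε * b := by rw [(hs _).eq, mul_inv_cancel_right]
  have h2 : r * (a ^ ε * b) * r⁻¹ = a ^ ε * b := by rw [hr.eq, mul_inv_cancel_right]
  calc _ = w * (r * (s * (a ^ ε * b) * s⁻¹) * r⁻¹) * w⁻¹ := by group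
    _ = w * a ^ ε * b * w⁻¹ := by rw [h1, h2, ← mul_assoc]
    _ = w * a ^ ε * w⁻¹ * b := by rw [mul_assoc _ b, ← hb.inv_left.eq, ← mul_assoc]
    _ = _ := by rw [conj_zpow]

theorem Δ_zpow_commute (m : ℕ) (c : ℤ) (g : AG m) : Commute (Δ m ^ c) g :=
  Commute.zpow_left (Δ_commute m g) c

theorem isType_of_normal {k : ℕ} (hk : 1 ≤ k) {ψ : ArtinB (k + 2) →* ArtinB (k + 2)} {S : ℕ → AG (k + 2)}
    {R : AG (k + 2)} (hS : ∀ i, i + 1 < k + 2 → ψ (rB (k + 2) (i + 1)) = toB (k + 2) (S i))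
    (hR : ψ (ρB (k + 2)) = toB (k + 2) R) (h : AG.Normal (k + 2) S R) :
    (∃ ε p q : ℤ, IsType2a (k + 2) ε p q ψ) ∨ (∃ ε p q : ℤ, IsType2b (k + 2) ε p q ψ) ∨
      ∃ (ε : ℤ) (j : ℕ) (p q r s : ℤ), IsType3 (k + 2) ε j p q r s ψ := by
  have hρ := toB_ρ (n := k + 2) (by omega)
  have hΔ := toB_Δ (n := k + 2) (by omega)
  have h0 : ψ (tB (k + 2) 0) = toB (k + 2) (R * S k * R⁻¹) := by
    rw [tB_zero, map_mul, map_mul, map_inv, hR]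
    change _ * ψ (rB (k + 2) (k + 1)) * _ = _
    rw [hS k (by omega), map_mul, map_mul, map_inv]
  have hi : ∀ i, i + 1 < k + 2 → ψ (tB (k + 2) (i + 1)) = toB (k + 2) (S i) := fun i hi => by
    rw [tB_of_lt hi, hS i hi]
  rcases h with ⟨ε, p, q, hε, h1, rfl⟩ | ⟨ε, p, q, hε, h1, rfl⟩ | ⟨ε, p, q, r, s, β, hε, hβ, h1, rfl⟩
  · refine Or.inl ⟨ε, p, q, hε, fun i hin => ?_, ?_⟩
    · rcases i with _ | i
      · have e := conj_mul_of_commute (w := ρ (k + 2)) (a := br (σ (k + 2) k)) (b := Δ (k + 2) ^ p)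
          (r := 1) (s := Δ (k + 2) ^ q) ε (Commute.one_left _) (Δ_zpow_commute _ q)
          (Δ_zpow_commute _ p _).symm
        rw [mul_one] at e
        rw [h0, h1 k (by omega), e, map_mul, map_zpow, toB_conj_ρ, map_zpow, hΔ]
      · rw [hi i hin, h1 i hin, map_mul, map_zpow, map_zpow, hΔ, toB_br_σ hin, tB_of_lt hin]
    · rw [hR, map_mul, map_zpow, hρ, hΔ]
  · refine Or.inr (Or.inl ⟨ε, p, q, hε, fun i hin => ?_, ?_⟩)
    · rcases i with _ | i
      · have e := conj_mul_of_commute (w := (ρ (k + 2))⁻¹) (a := br (σ (k + 2) 0)) (b := Δ (k + 2) ^ p)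
          (r := 1) (s := Δ (k + 2) ^ q) ε (Commute.one_left _) (Δ_zpow_commute _ q)
          (Δ_zpow_commute _ p _).symm
        have e2 : (ρ (k + 2))⁻¹ * br (σ (k + 2) 0) * (ρ (k + 2))⁻¹⁻¹ =
            ρ (k + 2) * br (σ (k + 2) k) * (ρ (k + 2))⁻¹ := by
          have e3 : ρ (k + 2) ^ 2 * br (σ (k + 2) k) = br (σ (k + 2) 0) * ρ (k + 2) ^ 2 := ρ_sq_br_σ
          rw [inv_inv, mul_assoc, inv_mul_eq_iff_eq_mul, ← mul_assoc, ← mul_assoc, ← pow_two, e3]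
          group
        rw [mul_one] at e
        rw [h0, h1 k (by omega), show k + 2 - 2 - k = 0 by omega, e, e2, map_mul, map_zpow, toB_conj_ρ,
          map_zpow, hΔ, Nat.sub_zero, tB_self]
      · rw [hi i hin, h1 i hin, map_mul, map_zpow, map_zpow, hΔ, toB_br_σ (by omega),
          show k + 2 - (i + 1) = k + 2 - 2 - i + 1 by omega, tB_of_lt (by omega)]
    · rw [hR, map_mul, map_zpow, map_inv, hρ, hΔ]
  · obtain ⟨j, hj, hρj⟩ : ∃ j, (j = 0 ∨ j = 1) ∧ toB (k + 2) (br β) = ρkB (k + 2) j := by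
      rcases hβ with rfl | rfl
      · refine ⟨0, Or.inl rfl, ?_⟩
        rw [δ, toB_dl (by omega)]
        rfl
      · refine ⟨1, Or.inr rfl, ?_⟩
        rw [δ, toB_mirror_dl (by omega)]
        rfl
    refine Or.inr (Or.inr ⟨ε, j, p, q, r, s, hε, hj, fun i hi1 hin => ?_, ?_, ?_⟩)
    · obtain ⟨i, rfl⟩ : ∃ l, i = l + 1 := ⟨i - 1, by omega⟩
      rw [hi i (by omega), h1 i (by omega), map_mul, map_mul, toB_ζ_zpow (by omega), map_zpow, map_zpow,
        hΔ, toB_br_σ (by omega), tB_of_lt (by omega)]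
    · have hζ : ∀ (c : ℤ) (b : Br (k + 2)), Commute (br (ζ (k + 2)) ^ c) (br b) := fun c b =>
        Commute.zpow_left ((ζ_commute (k + 2) b).map br) c
      have e := conj_mul_of_commute (w := br β) (a := br (σ (k + 2) k))
        (b := br (ζ (k + 2)) ^ p * Δ (k + 2) ^ q) (r := br (ζ (k + 2)) ^ r) (s := Δ (k + 2) ^ s) ε
        (((hζ r _).zpow_right ε).mul_right
          (((Commute.refl _).zpow_zpow r p).mul_right (Δ_zpow_commute _ q _).symm))
        (Δ_zpow_commute _ s) ((hζ p β).symm.mul_right (Δ_zpow_commute _ q _).symm)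
      rw [h0, h1 k (by omega), mul_assoc _ (br _ ^ p), e, map_mul, map_mul, toB_ζ_zpow (by omega),
        map_zpow, map_zpow, hΔ, map_mul, map_mul, map_inv, hρj, toB_br_σ (by omega), ← mul_assoc]
      rfl
    · rw [hR, map_mul, map_mul, toB_ζ_zpow (by omega), map_zpow, hΔ, hρj]

end Braid

/-- classification of endomorphisms of `A[Bₙ]`, `n ≥ 5`, up to conjugation. -/
theorem endomorphism_classification (n : ℕ) (hn : 5 ≤ n) (φ : ArtinB n →* ArtinB n) :
    ∃ x : ArtinB n,
      IsType1 n (conjComp x φ) ∨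
      (∃ ε p q : ℤ, IsType2a n ε p q (conjComp x φ)) ∨
      (∃ ε p q : ℤ, IsType2b n ε p q (conjComp x φ)) ∨
      (∃ (ε : ℤ) (k : ℕ) (p q r s : ℤ), IsType3 n ε k p q r s (conjComp x φ)) := by
  obtain ⟨Φ, hΦ⟩ : ∃ Φ, Φ = (Braid.ofB n).comp (φ.comp (Braid.toB n)) := ⟨_, rfl⟩
  have hb : ∀ g, Braid.toB n (Φ g) = φ (Braid.toB n g) := fun g => by
    rw [hΦ, MonoidHom.comp_apply, Braid.toB_ofB, MonoidHom.comp_apply]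
  have hρ := Braid.toB_ρ (n := n) (by omega)
  obtain ⟨k, rfl⟩ : ∃ k, n = k + 2 := ⟨n - 2, by omega⟩
  rcases Braid.AG.classification hn Φ with ⟨u, hu, h⟩ | ⟨g, hg⟩
  · have hc : ∀ y, conjComp 1 φ y = φ y := fun y => by simp [conjComp]
    have h1 : ∀ i, i + 1 < k + 2 → φ (rB (k + 2) (i + 1)) = Braid.toB (k + 2) u := fun i hi => by
      rw [← Braid.toB_br_σ hi, ← hb, h i hi]
    have h2 : Commute (Braid.toB (k + 2) u) (φ (ρB (k + 2))) := by
      rw [← hρ, ← hb]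
      exact hu.map _
    refine ⟨1, Or.inl ⟨Braid.toB (k + 2) u, φ (ρB (k + 2)), h2, fun i hi => ?_, hc _⟩⟩
    rw [hc]
    rcases i with _ | i
    · rw [Braid.tB_zero, map_mul, map_mul, map_inv, show k + 2 - 1 = k + 1 from rfl, h1 k (by omega),
        ← h2.eq, mul_inv_cancel_right]
    · rw [Braid.tB_of_lt hi, h1 i hi]
  · refine ⟨Braid.toB (k + 2) g, Or.inr (Braid.isType_of_normal (by omega) (fun i hi => ?_) ?_ hg)⟩
    · rw [← Braid.toB_br_σ hi, map_mul, map_mul, map_inv, hb]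
      rfl
    · rw [← hρ, map_mul, map_mul, map_inv, hb]
      rfl
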